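/- Let ℓ, ℓ' ∈ ℕ, let (X, μ) be a probability space, and let (T_n)_{n∈ℕ} be a measure preserving action of (ℕ, ×) on (X, μ), i.e. each T_n : X → X is an invertible measure preserving transformation, T_1 = id, and T_{mn} = T_m ∘ T_n for all m, n ∈ ℕ. Let A ⊆ X be measurable with μ(A) > 0. Then: (1) there exist m, n ∈ ℕ with m > n such that ℓ·(m² − n²) and ℓ'·m·n are distinct and μ( T_{ℓ(m²−n²)}⁻¹A ∩ T_{ℓ'mn}⁻¹A ) > 0; and (2) there exist m, n ∈ ℕ such that ℓ·(m² + n²) and ℓ'·m·n are distinct and μ( T_{ℓ(m²+n²)}⁻¹A ∩ T_{ℓ'mn}⁻¹A ) > 0. -/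

import Mathlib

section
open Finset
open scoped ComplexConjugate InnerProductSpace

noncomputable def cntN {ι : Type} [Fintype ι] [DecidableEq ι] (M : ℕ) (k l : ι → ℕ) : ℕ :=
  ∑ e ∈ Fintype.piFinset (fun _ : ι => range M), ∑ e' ∈ Fintype.piFinset (fun _ : ι => range M),
    if e + k = e' + l then 1 else 0

theorem cntN_eq {ι : Type} [Fintype ι] [DecidableEq ι] (M : ℕ) (k l : ι → ℕ) :
    cntN M k l = ∏ p, ((range M).filter (fun x => l p ≤ x + k p ∧ x + k p < l p + M)).card := by
  unfold cntN
  rw [← Fintype.card_piFinset, card_eq_sum_ones]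
  have : Fintype.piFinset (fun p : ι => (range M).filter (fun x => l p ≤ x + k p ∧ x + k p < l p + M)) =
      (Fintype.piFinset (fun _ : ι => range M)).filter (fun e => ∀ p, l p ≤ e p + k p ∧ e p + k p < l p + M) := by
    ext e; simp only [Fintype.mem_piFinset, mem_filter, mem_range]; grind
  rw [this, sum_filter]
  apply sum_congr rfl
  intro e he
  split_ifs with h
  · rw [sum_eq_single (fun p => e p + k p - l p)]
    · rw [if_pos]; ext p; simp; have := h p; omega
    · intro b hb hne
      rw [if_neg]; intro hh; apply hne; ext p; have := congrFun hh p; simp at this; omega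
    · intro hh; exfalso; apply hh; simp; intro p; have := h p; omega
  · apply sum_eq_zero
    intro b hb
    rw [if_neg]; intro hh; apply h; intro p; have := congrFun hh p; simp at this hb; have := hb p; omega

theorem cntN_self {ι : Type} [Fintype ι] [DecidableEq ι] (M : ℕ) :
    cntN M (0 : ι → ℕ) 0 = M ^ Fintype.card ι := by
  rw [cntN_eq]
  have : (range M).filter (fun x => x < M) = range M := by ext x; simp
  simp [this]

theorem cntN_tendsto {ι : Type} [Fintype ι] [DecidableEq ι] (k l : ι → ℕ) :
    Filter.Tendsto (fun M : ℕ => (cntN M k l : ℝ) / (M : ℝ) ^ Fintype.card ι) Filter.atTop (nhds 1) := by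
  have h1 : ∀ p : ι, Filter.Tendsto (fun M : ℕ =>
      ((((range M).filter (fun x => l p ≤ x + k p ∧ x + k p < l p + M)).card : ℕ) : ℝ) / (M : ℝ))
      Filter.atTop (nhds 1) := by
    intro p
    have hlow : Filter.Tendsto (fun M : ℕ => 1 - ((k p + l p : ℕ) : ℝ) / (M : ℝ)) Filter.atTop (nhds 1) := by
      have := (tendsto_const_div_atTop_nhds_zero_nat ((k p + l p : ℕ) : ℝ)).const_sub 1
      simpa using this
    refine tendsto_of_tendsto_of_tendsto_of_le_of_le' hlow tendsto_const_nhds ?_ ?_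
    · filter_upwards [Filter.eventually_gt_atTop 0] with M hM
      have hM' : (0 : ℝ) < M := by exact_mod_cast hM
      rw [le_div_iff₀ hM', sub_mul, div_mul_cancel₀ _ hM'.ne', one_mul, sub_le_iff_le_add]
      have : (Finset.Ico (l p) (M - k p)).card ≤
        ((range M).filter (fun x => l p ≤ x + k p ∧ x + k p < l p + M)).card := by
        apply card_le_card
        intro x; simp; omega
      rw [Nat.card_Ico] at this
      exact_mod_cast (by omega : M ≤ _ + (k p + l p))
    · filter_upwards [Filter.eventually_gt_atTop 0] with M hM
      have hM' : (0 : ℝ) < M := by exact_mod_cast hM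
      rw [div_le_one hM']
      exact_mod_cast (card_filter_le _ _).trans (by simp)
  have := tendsto_finsetProd (Finset.univ : Finset ι) (fun p _ => h1 p)
  simp only [prod_const_one] at this
  refine this.congr ?_
  intro M
  rw [cntN_eq, prod_div_distrib]
  simp

theorem spec_id {ι : Type} [Fintype ι] [DecidableEq ι] {H : Type*} [NormedAddCommGroup H]
    [InnerProductSpace ℂ H] (V : (ι → ℕ) → H →ₗᵢ[ℂ] H)
    (hV : ∀ e e' x, V (e + e') x = V e (V e' x)) (g : H) (M Q : ℕ) [NeZero Q] (k l : ι → ℕ)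
    (hQ : ∀ p, M + k p + l p < Q) :
    ∑ ψ : AddChar (ι → ZMod Q) ℂ, ((‖∑ e ∈ Fintype.piFinset (fun _ : ι => range M),
      conj (ψ (fun p => (e p : ZMod Q))) • V e g‖ ^ 2 : ℝ) : ℂ) *
        (ψ (fun p => (k p : ZMod Q)) * conj (ψ (fun p => (l p : ZMod Q)))) =
    (Q : ℂ) ^ Fintype.card ι * cntN M k l * ⟪V l g, V k g⟫_ℂ := by
  have h1 : ∀ ψ : AddChar (ι → ZMod Q) ℂ, ((‖∑ e ∈ Fintype.piFinset (fun _ : ι => range M),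
      conj (ψ (fun p => (e p : ZMod Q))) • V e g‖ ^ 2 : ℝ) : ℂ) *
        (ψ (fun p => (k p : ZMod Q)) * conj (ψ (fun p => (l p : ZMod Q)))) =
      ∑ e ∈ Fintype.piFinset (fun _ : ι => range M), ∑ e' ∈ Fintype.piFinset (fun _ : ι => range M),
        ψ ((fun p => (e p : ZMod Q)) + (fun p => (k p : ZMod Q)) - (fun p => (e' p : ZMod Q)) -
          (fun p => (l p : ZMod Q))) * ⟪V e g, V e' g⟫_ℂ := by
    intro ψ
    have := inner_self_eq_norm_sq_to_K (𝕜 := ℂ) (∑ e ∈ Fintype.piFinset (fun _ : ι => range M),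
      conj (ψ (fun p => (e p : ZMod Q))) • V e g)
    rw [Complex.ofReal_pow]
    erw [← this]
    rw [sum_inner, sum_mul]
    apply sum_congr rfl; intro e _
    rw [inner_sum, sum_mul]
    apply sum_congr rfl; intro e' _
    rw [inner_smul_left, inner_smul_right, sub_eq_add_neg, sub_eq_add_neg, AddChar.map_add_eq_mul, AddChar.map_add_eq_mul, AddChar.map_add_eq_mul,
      AddChar.map_neg_eq_conj, AddChar.map_neg_eq_conj, Complex.conj_conj]
    ring
  simp_rw [h1]
  rw [sum_comm]
  simp_rw [sum_comm (s := (univ : Finset (AddChar (ι → ZMod Q) ℂ))), ← sum_mul, AddChar.sum_apply_eq_ite]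
  unfold cntN
  push_cast
  rw [mul_sum, sum_mul]
  apply sum_congr rfl; intro e he
  rw [mul_sum, sum_mul]
  apply sum_congr rfl; intro e' he'
  simp only [Fintype.mem_piFinset, mem_range] at he he'
  have hiff : ((fun p => (e p : ZMod Q)) + (fun p => (k p : ZMod Q)) - (fun p => (e' p : ZMod Q)) -
          (fun p => (l p : ZMod Q)) = 0) ↔ e + k = e' + l := by
    rw [sub_sub, sub_eq_zero]
    constructor
    · intro h; ext p
      have := congrFun h p
      simp only [Pi.add_apply] at this
      rw [← Nat.cast_add, ← Nat.cast_add, ZMod.natCast_eq_natCast_iff'] at this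
      have a1 := hQ p; have a2 := he p; have a3 := he' p
      rw [Nat.mod_eq_of_lt (by omega), Nat.mod_eq_of_lt (by omega)] at this
      exact this
    · intro h; ext p
      have := congrFun h p
      simp only [Pi.add_apply] at this ⊢
      exact_mod_cast congrArg (Nat.cast (R := ZMod Q)) this
  by_cases h : e + k = e' + l
  · rw [if_pos (hiff.2 h), if_pos h]
    have : ⟪V e g, V e' g⟫_ℂ = ⟪V l g, V k g⟫_ℂ := by
      rw [← (V l).inner_map_map (V e g), ← (V e).inner_map_map (V l g), ← hV, ← hV, ← hV, ← hV, h,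
        add_comm l e, add_comm l e']
    rw [this]; simp [ZMod.card]
  · rw [if_neg (mt hiff.1 h), if_neg h]; simp

theorem transfer_add {ι : Type} [Fintype ι] [DecidableEq ι] {H : Type*} [NormedAddCommGroup H]
    [InnerProductSpace ℂ H] (V : (ι → ℕ) → H →ₗᵢ[ℂ] H) (hV0 : ∀ x, V 0 x = x)
    (hV : ∀ e e' x, V (e + e') x = V e (V e' x)) (g : H) {α β : Type} (I : Finset α) (c : α → ℂ)
    (k l : α → ι → ℕ) (Φ : Finset β) (ω : β → ℝ) (s : β → ι → ℕ) (η : ℝ)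
    (hyp : ∀ (Q : ℕ) [NeZero Q] (ψ : AddChar (ι → ZMod Q) ℂ),
      ‖∑ i ∈ I, c i * (ψ (fun p => (k i p : ZMod Q)) * conj (ψ (fun p => (l i p : ZMod Q))))‖ ≤
        η + ‖∑ j ∈ Φ, (ω j : ℂ) * ψ (fun p => (s j p : ZMod Q))‖) :
    ‖∑ i ∈ I, c i * ⟪V (l i) g, V (k i) g⟫_ℂ‖ ≤ η * ‖g‖ ^ 2 + ‖g‖ * ‖∑ j ∈ Φ, (ω j : ℂ) • V (s j) g‖ := by
  have key : ∀ M : ℕ, 0 < M →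
      ‖∑ i ∈ I, c i * (((cntN M (k i) (l i) : ℝ) / (M : ℝ) ^ Fintype.card ι : ℝ) : ℂ) * ⟪V (l i) g, V (k i) g⟫_ℂ‖ ≤
      η * ‖g‖ ^ 2 + ‖g‖ * √(∑ j ∈ Φ, ∑ j' ∈ Φ, (((ω j : ℂ) * ω j' *
        (((cntN M (s j) (s j') : ℝ) / (M : ℝ) ^ Fintype.card ι : ℝ) : ℂ) * ⟪V (s j') g, V (s j) g⟫_ℂ)).re) := by
    intro M hM
    obtain ⟨Q, hQ0, hQ1, hQ2⟩ : ∃ Q : ℕ, M < Q ∧ (∀ i ∈ I, ∀ p, M + k i p + l i p < Q) ∧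
        (∀ j ∈ Φ, ∀ j' ∈ Φ, ∀ p, M + s j p + s j' p < Q) := by
      refine ⟨M + ∑ i ∈ I, ∑ p, (k i p + l i p) + 2 * ∑ j ∈ Φ, ∑ p, s j p + 1, by omega, ?_, ?_⟩
      · intro i hi p
        have := single_le_sum (f := fun i => ∑ p, (k i p + l i p)) (fun _ _ => Nat.zero_le _) hi
        have h2 := single_le_sum (f := fun p => (k i p + l i p)) (fun _ _ => Nat.zero_le _) (mem_univ p)
        omega
      · intro i hi i' hi' p
        have := single_le_sum (f := fun i => ∑ p, (s i p)) (fun _ _ => Nat.zero_le _) hi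
        have h2 := single_le_sum (f := fun p => (s i p)) (fun _ _ => Nat.zero_le _) (mem_univ p)
        have h3 := single_le_sum (f := fun i => ∑ p, (s i p)) (fun _ _ => Nat.zero_le _) hi'
        have h4 := single_le_sum (f := fun p => (s i' p)) (fun _ _ => Nat.zero_le _) (mem_univ p)
        omega
    have : NeZero Q := ⟨by omega⟩
    set w : AddChar (ι → ZMod Q) ℂ → ℝ := fun ψ => ‖∑ e ∈ Fintype.piFinset (fun _ : ι => range M),
      conj (ψ (fun p => (e p : ZMod Q))) • V e g‖ ^ 2 with hw
    have hw0 : ∀ ψ, 0 ≤ w ψ := fun ψ => by positivity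
    have id1 : ∀ i ∈ I, ∑ ψ, (w ψ : ℂ) * (ψ (fun p => (k i p : ZMod Q)) * conj (ψ (fun p => (l i p : ZMod Q)))) =
      (Q : ℂ) ^ Fintype.card ι * cntN M (k i) (l i) * ⟪V (l i) g, V (k i) g⟫_ℂ :=
      fun i hi => spec_id V hV g M Q _ _ (hQ1 i hi)
    have id2 : ∀ j ∈ Φ, ∀ j' ∈ Φ, ∑ ψ, (w ψ : ℂ) * (ψ (fun p => (s j p : ZMod Q)) * conj (ψ (fun p => (s j' p : ZMod Q)))) =
      (Q : ℂ) ^ Fintype.card ι * cntN M (s j) (s j') * ⟪V (s j') g, V (s j) g⟫_ℂ :=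
      fun j hj j' hj' => spec_id V hV g M Q _ _ (hQ2 j hj j' hj')
    have id0 : ∑ ψ, w ψ = (Q : ℝ) ^ Fintype.card ι * (M : ℝ) ^ Fintype.card ι * ‖g‖ ^ 2 := by
      have hMQ : ∀ p : ι, M + (0 : ι → ℕ) p + (0 : ι → ℕ) p < Q := by
        intro p
        simpa using hQ0
      have := spec_id V hV g M Q 0 0 hMQ
      simp only [Pi.zero_apply, Nat.cast_zero] at this
      have h0 : ∀ ψ : AddChar (ι → ZMod Q) ℂ, ψ (fun p => 0) = 1 := fun ψ => ψ.map_zero_eq_one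
      simp only [h0, cntN_self, hV0, map_one, mul_one, inner_self_eq_norm_sq_to_K] at this
      apply Complex.ofReal_injective
      rw [Complex.ofReal_sum]
      push_cast at this ⊢
      simp only [hw]
      push_cast
      exact this
    set n := Fintype.card ι with hn
    have hQp : (0 : ℝ) < (Q : ℝ) ^ n := by
      have : 0 < Q := by omega
      positivity
    have hMp : (0 : ℝ) < (M : ℝ) ^ n := by positivity
    have hL : ‖∑ i ∈ I, c i * (((cntN M (k i) (l i) : ℝ) / (M : ℝ) ^ n : ℝ) : ℂ) * ⟪V (l i) g, V (k i) g⟫_ℂ‖ *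
        ((Q : ℝ) ^ n * (M : ℝ) ^ n) ≤ ∑ ψ, w ψ * (η + ‖∑ j ∈ Φ, (ω j : ℂ) * ψ (fun p => (s j p : ZMod Q))‖) := by
      have e1 : (∑ i ∈ I, c i * (((cntN M (k i) (l i) : ℝ) / (M : ℝ) ^ n : ℝ) : ℂ) * ⟪V (l i) g, V (k i) g⟫_ℂ) *
          (((Q : ℝ) ^ n * (M : ℝ) ^ n : ℝ) : ℂ) = ∑ ψ, (w ψ : ℂ) * ∑ i ∈ I, c i *
            (ψ (fun p => (k i p : ZMod Q)) * conj (ψ (fun p => (l i p : ZMod Q)))) := by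
        simp_rw [mul_sum]
        rw [sum_comm, sum_mul]
        apply sum_congr rfl; intro i hi
        have := id1 i hi
        calc _ = c i * ((Q : ℂ) ^ n * cntN M (k i) (l i) * ⟪V (l i) g, V (k i) g⟫_ℂ) := by
              have : (M : ℂ) ^ n ≠ 0 := by exact_mod_cast hMp.ne'
              push_cast; field_simp
          _ = _ := by
              rw [← this, mul_sum]; apply sum_congr rfl; intro ψ _; ring
      have e2 : ‖(((Q : ℝ) ^ n * (M : ℝ) ^ n : ℝ) : ℂ)‖ = (Q : ℝ) ^ n * (M : ℝ) ^ n := by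
        rw [Complex.norm_real, Real.norm_of_nonneg (by positivity)]
      rw [← e2, ← norm_mul, e1]
      refine (norm_sum_le _ _).trans (sum_le_sum fun ψ _ => ?_)
      rw [norm_mul, Complex.norm_real, Real.norm_of_nonneg (hw0 ψ)]
      exact mul_le_mul_of_nonneg_left (hyp Q ψ) (hw0 ψ)
    set R := ∑ j ∈ Φ, ∑ j' ∈ Φ, (((ω j : ℂ) * ω j' *
        (((cntN M (s j) (s j') : ℝ) / (M : ℝ) ^ n : ℝ) : ℂ) * ⟪V (s j') g, V (s j) g⟫_ℂ)).re with hR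
    have hR2 : ∑ ψ, w ψ * ‖∑ j ∈ Φ, (ω j : ℂ) * ψ (fun p => (s j p : ZMod Q))‖ ^ 2 = ((Q : ℝ) ^ n * (M : ℝ) ^ n) * R := by
      have e1 : ∑ ψ, ((w ψ * ‖∑ j ∈ Φ, (ω j : ℂ) * ψ (fun p => (s j p : ZMod Q))‖ ^ 2 : ℝ) : ℂ) =
          ∑ j ∈ Φ, ∑ j' ∈ Φ, (((Q : ℝ) ^ n * (M : ℝ) ^ n : ℝ) : ℂ) * (((ω j : ℂ) * ω j' *
        (((cntN M (s j) (s j') : ℝ) / (M : ℝ) ^ n : ℝ) : ℂ) * ⟪V (s j') g, V (s j) g⟫_ℂ)) := by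
        have e3 : ∀ ψ : AddChar (ι → ZMod Q) ℂ, ((w ψ * ‖∑ j ∈ Φ, (ω j : ℂ) * ψ (fun p => (s j p : ZMod Q))‖ ^ 2 : ℝ) : ℂ) =
          ∑ j ∈ Φ, ∑ j' ∈ Φ, (ω j : ℂ) * ω j' * ((w ψ : ℂ) * (ψ (fun p => (s j p : ZMod Q)) * conj (ψ (fun p => (s j' p : ZMod Q))))) := by
          intro ψ
          push_cast
          rw [← Complex.mul_conj', map_sum, sum_mul_sum, mul_sum]
          apply sum_congr rfl; intro j _
          rw [mul_sum]
          apply sum_congr rfl; intro j' _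
          rw [map_mul, Complex.conj_ofReal]; ring
        simp_rw [e3]
        rw [sum_comm]
        apply sum_congr rfl; intro j hj
        rw [sum_comm]
        apply sum_congr rfl; intro j' hj'
        rw [← mul_sum, id2 j hj j' hj']
        have : (M : ℂ) ^ n ≠ 0 := by exact_mod_cast hMp.ne'
        push_cast; field_simp
      have e2 := congrArg Complex.re e1
      rw [← Complex.ofReal_sum, Complex.ofReal_re] at e2
      rw [e2, hR, mul_sum, Complex.re_sum]
      apply sum_congr rfl; intro j _
      rw [mul_sum, Complex.re_sum]
      apply sum_congr rfl; intro j' _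
      rw [Complex.re_ofReal_mul]
    have hR0 : 0 ≤ R := by
      have : 0 ≤ ((Q : ℝ) ^ n * (M : ℝ) ^ n) * R := by
        rw [← hR2]; exact sum_nonneg fun ψ _ => mul_nonneg (hw0 ψ) (by positivity)
      exact nonneg_of_mul_nonneg_right this (by positivity)
    have hCS : ∑ ψ, w ψ * ‖∑ j ∈ Φ, (ω j : ℂ) * ψ (fun p => (s j p : ZMod Q))‖ ≤
        ((Q : ℝ) ^ n * (M : ℝ) ^ n) * (‖g‖ * √R) := by
      apply le_of_sq_le_sq _ (by positivity)
      refine (sum_sq_le_sum_mul_sum_of_sq_le_mul univ (fun ψ _ => hw0 ψ) (g := fun ψ => w ψ * ‖∑ j ∈ Φ, (ω j : ℂ) * ψ (fun p => (s j p : ZMod Q))‖ ^ 2)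
        (fun ψ _ => mul_nonneg (hw0 ψ) (by positivity)) (fun ψ _ => le_of_eq (by ring))).trans ?_
      rw [hR2, id0]
      apply le_of_eq
      rw [mul_pow, mul_pow ‖g‖, Real.sq_sqrt hR0]; ring
    simp_rw [mul_add] at hL
    rw [sum_add_distrib, ← sum_mul, id0] at hL
    have hpos : 0 < (Q : ℝ) ^ n * (M : ℝ) ^ n := by positivity
    refine le_of_mul_le_mul_right (hL.trans ?_) hpos
    linarith
  have hone : ∀ (k l : ι → ℕ), Filter.Tendsto (fun M : ℕ => (((cntN M k l : ℝ) / (M : ℝ) ^ Fintype.card ι : ℝ) : ℂ)) Filter.atTop (nhds 1) := by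
    intro k l
    have := (Complex.continuous_ofReal.tendsto _).comp (cntN_tendsto k l)
    rw [Complex.ofReal_one] at this
    exact this
  have tL : Filter.Tendsto (fun M : ℕ => ‖∑ i ∈ I, c i * (((cntN M (k i) (l i) : ℝ) / (M : ℝ) ^ Fintype.card ι : ℝ) : ℂ) * ⟪V (l i) g, V (k i) g⟫_ℂ‖)
      Filter.atTop (nhds ‖∑ i ∈ I, c i * 1 * ⟪V (l i) g, V (k i) g⟫_ℂ‖) :=
    (tendsto_finsetSum _ fun i _ => ((hone _ _).const_mul _).mul_const _).norm
  have tR : Filter.Tendsto (fun M : ℕ => η * ‖g‖ ^ 2 + ‖g‖ * √(∑ j ∈ Φ, ∑ j' ∈ Φ, (((ω j : ℂ) * ω j' *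
        (((cntN M (s j) (s j') : ℝ) / (M : ℝ) ^ Fintype.card ι : ℝ) : ℂ) * ⟪V (s j') g, V (s j) g⟫_ℂ)).re))
      Filter.atTop (nhds (η * ‖g‖ ^ 2 + ‖g‖ * √(∑ j ∈ Φ, ∑ j' ∈ Φ, (((ω j : ℂ) * ω j' * 1 * ⟪V (s j') g, V (s j) g⟫_ℂ)).re))) := by
    refine Filter.Tendsto.const_add _ (Filter.Tendsto.const_mul _ (Filter.Tendsto.sqrt ?_))
    refine tendsto_finsetSum _ fun j _ => tendsto_finsetSum _ fun j' _ => ?_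
    exact (Complex.continuous_re.tendsto _).comp (((hone _ _).const_mul _).mul_const _)
  have fin := le_of_tendsto_of_tendsto tL tR (by
    filter_upwards [Filter.eventually_gt_atTop 0] with M hM using key M hM)
  simp only [mul_one] at fin
  have e4 : (∑ j ∈ Φ, ∑ j' ∈ Φ, (((ω j : ℂ) * ω j' * ⟪V (s j') g, V (s j) g⟫_ℂ)).re) = ‖∑ j ∈ Φ, (ω j : ℂ) • V (s j) g‖ ^ 2 := by
    have := inner_self_eq_norm_sq_to_K (𝕜 := ℂ) (∑ j ∈ Φ, (ω j : ℂ) • V (s j) g)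
    have e2 := congrArg Complex.re this
    have e3 : ((((‖∑ j ∈ Φ, (ω j : ℂ) • V (s j) g‖ : ℝ) : ℂ) ^ 2)).re = ‖∑ j ∈ Φ, (ω j : ℂ) • V (s j) g‖ ^ 2 := by
      rw [← Complex.ofReal_pow, Complex.ofReal_re]
    erw [e3] at e2
    rw [← e2, sum_inner, Complex.re_sum]
    simp_rw [inner_sum, Complex.re_sum, inner_smul_left, inner_smul_right, Complex.conj_ofReal]
    rw [sum_comm]
    apply sum_congr rfl; intro j _; apply sum_congr rfl; intro j' _
    congr 1; ring
  rw [e4, Real.sqrt_sq (norm_nonneg _)] at fin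
  exact fin

theorem transfer_mul {H : Type*} [NormedAddCommGroup H]
    [InnerProductSpace ℂ H] (U : ℕ → H →ₗᵢ[ℂ] H) (hU1 : ∀ x, U 1 x = x)
    (hU : ∀ m n x, 0 < m → 0 < n → U (m * n) x = U m (U n x)) (g : H) {α : Type} (I : Finset α) (c : α → ℂ)
    (k l : α → ℕ) (hk : ∀ i ∈ I, 0 < k i) (hl : ∀ i ∈ I, 0 < l i) (Φ : Finset ℕ) (hΦ : ∀ s ∈ Φ, 0 < s)
    (ω : ℕ → ℝ) (η : ℝ)
    (hyp : ∀ f : ℕ →*₀ ℂ, (∀ n, n ≠ 0 → ‖f n‖ = 1) →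
      ‖∑ i ∈ I, c i * (f (k i) * conj (f (l i)))‖ ≤ η + ‖∑ s ∈ Φ, (ω s : ℂ) * f s‖) :
    ‖∑ i ∈ I, c i * ⟪U (l i) g, U (k i) g⟫_ℂ‖ ≤ η * ‖g‖ ^ 2 + ‖g‖ * ‖∑ s ∈ Φ, (ω s : ℂ) • U s g‖ := by
  obtain ⟨B, hB1, hB2, hB3⟩ : ∃ B : ℕ, (∀ i ∈ I, k i < B) ∧ (∀ i ∈ I, l i < B) ∧ (∀ s ∈ Φ, s < B) := by
    refine ⟨∑ i ∈ I, k i + ∑ i ∈ I, l i + ∑ s ∈ Φ, s + 1, ?_, ?_, ?_⟩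
    · intro i hi; have := single_le_sum (f := k) (fun _ _ => Nat.zero_le _) hi; omega
    · intro i hi; have := single_le_sum (f := l) (fun _ _ => Nat.zero_le _) hi; omega
    · intro i hi; have := single_le_sum (f := fun s : ℕ => s) (fun _ _ => Nat.zero_le _) hi; omega
  let vec : ℕ → ({p // p ∈ Nat.primesBelow B} → ℕ) := fun n p => n.factorization p
  let r : ({p // p ∈ Nat.primesBelow B} → ℕ) → ℕ := fun e => ∏ p : {p // p ∈ Nat.primesBelow B}, (p : ℕ) ^ e p
  have hr0 : ∀ e, 0 < r e := fun e => prod_pos fun p _ => pow_pos (Nat.prime_of_mem_primesBelow p.2).pos _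
  have hrv : ∀ n, 0 < n → n < B → r (vec n) = n := by
    intro n hn hnB
    have h1 := Nat.prod_factorization_pow_eq_self hn.ne'
    rw [Finsupp.prod_of_support_subset (s := Nat.primesBelow B)] at h1
    · change ∏ p : {p // p ∈ Nat.primesBelow B}, (p : ℕ) ^ n.factorization p = n
      rw [Finset.prod_coe_sort (Nat.primesBelow B) (fun p => p ^ n.factorization p)]
      exact h1
    · intro p hp
      rw [Nat.support_factorization] at hp
      rw [Nat.mem_primesBelow]
      exact ⟨(Nat.le_of_mem_primeFactors hp).trans_lt hnB, Nat.prime_of_mem_primeFactors hp⟩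
    · simp
  have := transfer_add (fun e => U (r e)) (by intro x; simp [r, hU1]) (by
      intro e e' x
      rw [← hU _ _ _ (hr0 _) (hr0 _)]
      congr 2
      simp [r, pow_add, prod_mul_distrib]) g I c (fun i => vec (k i)) (fun i => vec (l i)) Φ ω vec η (by
      intro Q _ ψ
      let f : ℕ →*₀ ℂ :=
        { toFun := fun n => if n = 0 then 0 else ψ (fun p => (vec n p : ZMod Q))
          map_zero' := by simp
          map_one' := by
            simp only [one_ne_zero, if_false, vec, Nat.factorization_one, Finsupp.coe_zero, Pi.zero_apply, Nat.cast_zero]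
            exact ψ.map_zero_eq_one
          map_mul' := by
            intro m n
            by_cases hm : m = 0
            · simp [hm]
            by_cases hn : n = 0
            · simp [hn]
            simp only [hm, hn, mul_eq_zero, or_self, if_false]
            rw [← AddChar.map_add_eq_mul]
            congr 1; ext p
            simp [vec, Nat.factorization_mul hm hn] }
      have hf : ∀ n, n ≠ 0 → f n = ψ (fun p => (vec n p : ZMod Q)) := by
        intro n hn; change (if n = 0 then 0 else _) = _; rw [if_neg hn]
      have h2 := hyp f (by intro n hn; rw [hf n hn]; exact ψ.norm_apply _)
      rw [sum_congr rfl (fun i hi => by rw [hf _ (hk i hi).ne', hf _ (hl i hi).ne']),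
        sum_congr (s₁ := Φ) rfl (fun i hi => by rw [hf _ (hΦ i hi).ne'])] at h2
      exact h2)
  rw [sum_congr rfl (fun i hi => by rw [hrv _ (hk i hi) (hB1 i hi), hrv _ (hl i hi) (hB2 i hi)]),
    sum_congr (s₁ := Φ) rfl (fun i hi => by rw [hrv _ (hΦ i hi) (hB3 i hi)])] at this
  exact this

def KPset (P : Set (ℕ × ℕ)) : Prop :=
  ∀ (Φ : Finset ℕ) (ω : ℕ → ℝ) (η : ℝ), (∀ s ∈ Φ, 0 < s) → (∀ s, 0 ≤ ω s) → ∑ s ∈ Φ, ω s = 1 → 0 < η →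
    ∃ (I : Finset (ℕ × ℕ)) (c : ℕ × ℕ → ℝ), (∀ p ∈ I, p ∈ P) ∧ ∑ p ∈ I, c p = 1 ∧
      ∀ f : ℕ →*₀ ℂ, (∀ n, n ≠ 0 → ‖f n‖ = 1) →
        ‖∑ p ∈ I, (c p : ℂ) * (f p.1 * conj (f p.2))‖ ≤ η + ‖∑ s ∈ Φ, (ω s : ℂ) * f s‖

theorem hilbert_part {H : Type*} [NormedAddCommGroup H]
    [InnerProductSpace ℂ H] [CompleteSpace H] (U : ℕ → H →ₗᵢ[ℂ] H) (hU1 : ∀ x, U 1 x = x)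
    (hU : ∀ m n x, 0 < m → 0 < n → U (m * n) x = U m (U n x)) (x u : H) (hu : ∀ n, 0 < n → U n u = u)
    (hux : ⟪u, x⟫_ℂ ≠ 0) (P : Set (ℕ × ℕ)) (hP : ∀ p ∈ P, 0 < p.1 ∧ 0 < p.2) (hKP : KPset P) :
    ∃ p ∈ P, ⟪U p.2 x, U p.1 x⟫_ℂ ≠ 0 := by
  let _ : InnerProductSpace ℝ H := InnerProductSpace.rclikeToReal ℂ H
  set S : Set H := {y | ∃ s, 0 < s ∧ y = U s x} with hS
  set K : Set H := closure (convexHull ℝ S) with hK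
  have hKc : Convex ℝ K := (convex_convexHull ℝ S).closure
  have hxS : x ∈ S := ⟨1, one_pos, (hU1 x).symm⟩
  have hxK : x ∈ K := subset_closure (subset_convexHull ℝ S hxS)
  obtain ⟨v, hvK, hv⟩ := exists_norm_eq_iInf_of_complete_convex ⟨x, hxK⟩ isClosed_closure.isComplete hKc (0 : H)
  have hv2 := (norm_eq_iInf_iff_real_inner_le_zero hKc hvK).1 hv
  have hv3 : ∀ w ∈ K, ‖v‖ ^ 2 ≤ (⟪v, w⟫_ℂ).re := by
    intro w hw
    have h1 := hv2 w hw
    rw [zero_sub, inner_neg_left, inner_sub_right, real_inner_self_eq_norm_sq, real_inner_eq_re_inner ℂ] at h1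
    simp only [RCLike.re_to_complex] at h1
    linarith
  have hUK : ∀ n, 0 < n → ∀ w ∈ K, U n w ∈ K := by
    intro n hn
    have h1 : Set.MapsTo (U n) (convexHull ℝ S) (convexHull ℝ S) := by
      intro w hw
      have : U n w ∈ (((U n).toLinearMap.restrictScalars ℝ) : H →ₗ[ℝ] H) '' (convexHull ℝ S) := ⟨w, hw, rfl⟩
      rw [LinearMap.image_convexHull] at this
      refine convexHull_mono ?_ this
      rintro _ ⟨y, ⟨s, hs, rfl⟩, rfl⟩
      exact ⟨n * s, by positivity, (hU n s x hn hs).symm⟩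
    intro w hw
    exact h1.closure (U n).continuous hw
  have hUv : ∀ n, 0 < n → U n v = v := by
    intro n hn
    have h1 := hv3 _ (hUK n hn v hvK)
    have h2 := @norm_sub_sq ℂ H _ _ _ v (U n v)
    rw [(U n).norm_map] at h2
    simp only [RCLike.re_to_complex] at h2
    have h3 : ‖v - U n v‖ ^ 2 ≤ 0 := by linarith
    have h4 : ‖v - U n v‖ = 0 := by nlinarith [norm_nonneg (v - U n v)]
    rw [norm_eq_zero, sub_eq_zero] at h4
    exact h4.symm
  have hinv : ∀ z : H, (∀ n, 0 < n → U n z = z) → ∀ w ∈ K, ⟪z, w⟫_ℂ = ⟪z, x⟫_ℂ := by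
    intro z hz
    have hcl : IsClosed {w : H | ⟪z, w⟫_ℂ = ⟪z, x⟫_ℂ} :=
      isClosed_eq (continuous_const.inner continuous_id) continuous_const
    have hconv : Convex ℝ {w : H | ⟪z, w⟫_ℂ = ⟪z, x⟫_ℂ} := by
      intro a ha b hb t t' ht ht' htt
      simp only [Set.mem_ofPred_eq] at ha hb ⊢
      rw [inner_add_right]
      have e1 : ∀ (t : ℝ) (a : H), ⟪z, t • a⟫_ℂ = (t : ℂ) * ⟪z, a⟫_ℂ := by
        intro t a
        rw [← Complex.coe_smul, inner_smul_right]
      rw [e1, e1, ha, hb, ← add_mul, ← Complex.ofReal_add, htt]; simp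
    have : K ⊆ {w : H | ⟪z, w⟫_ℂ = ⟪z, x⟫_ℂ} := by
      apply closure_minimal _ hcl
      apply convexHull_min _ hconv
      rintro _ ⟨s, hs, rfl⟩
      simp only [Set.mem_ofPred_eq]
      conv_lhs => rw [← hz s hs]
      exact (U s).inner_map_map _ _
    exact fun w hw => this hw
  have hvx : ⟪v, x⟫_ℂ = (‖v‖ ^ 2 : ℝ) := by
    rw [← hinv v hUv v hvK, inner_self_eq_norm_sq_to_K]; simp
  have hv0 : 0 < ‖v‖ := by
    rw [norm_pos_iff]; rintro rfl
    apply hux; rw [← hinv u hu 0 hvK]; simp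
  set g := x - v with hg
  have hvg : ⟪v, g⟫_ℂ = 0 := by
    rw [hg, inner_sub_right, hvx, inner_self_eq_norm_sq_to_K]; simp
  have hgv : ⟪g, v⟫_ℂ = 0 := by rw [← inner_conj_symm, hvg]; simp
  set δ := ‖v‖ ^ 2 / (4 * (‖g‖ + 1)) with hδ
  have hδ0 : 0 < δ := by positivity
  obtain ⟨w, hw, hwv⟩ := Metric.mem_closure_iff.1 hvK δ hδ0
  obtain ⟨Φ, ω, hΦ, hω0, hω1, hωw⟩ : ∃ (Φ : Finset ℕ) (ω : ℕ → ℝ), (∀ s ∈ Φ, 0 < s) ∧ (∀ s, 0 ≤ ω s) ∧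
      ∑ s ∈ Φ, ω s = 1 ∧ ∑ s ∈ Φ, (ω s : ℂ) • U s x = w := by
    have hconv : Convex ℝ {w : H | ∃ (Φ : Finset ℕ) (ω : ℕ → ℝ), (∀ s ∈ Φ, 0 < s) ∧ (∀ s, 0 ≤ ω s) ∧
      ∑ s ∈ Φ, ω s = 1 ∧ ∑ s ∈ Φ, (ω s : ℂ) • U s x = w} := by
      rintro a ⟨Φ, ω, h1, h2, h3, rfl⟩ b ⟨Φ', ω', h1', h2', h3', rfl⟩ t t' ht ht' htt
      classical
      refine ⟨Φ ∪ Φ', fun s => t * (if s ∈ Φ then ω s else 0) + t' * (if s ∈ Φ' then ω' s else 0), ?_, ?_, ?_, ?_⟩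
      · intro s hs; rcases mem_union.1 hs with h | h
        · exact h1 s h
        · exact h1' s h
      · intro s
        have a1 := h2 s; have a2 := h2' s
        beta_reduce; split_ifs <;> positivity
      · rw [sum_add_distrib, ← mul_sum, ← mul_sum, sum_ite_mem, sum_ite_mem, union_inter_cancel_left,
          union_inter_cancel_right, h3, h3']; linarith
      · push_cast
        simp_rw [add_smul, mul_smul]
        rw [sum_add_distrib, ← smul_sum, ← smul_sum, Complex.coe_smul, Complex.coe_smul]
        simp only [apply_ite (fun r : ℝ => (r : ℂ)), Complex.ofReal_zero, ite_smul, zero_smul]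
        rw [sum_ite_mem, sum_ite_mem, union_inter_cancel_left, union_inter_cancel_right]
    refine convexHull_min ?_ hconv hw
    rintro _ ⟨s, hs, rfl⟩
    exact ⟨{s}, fun _ => 1, by simpa using hs, by simp, by simp, by simp⟩
  set η := ‖v‖ ^ 2 / (4 * (‖g‖ ^ 2 + 1)) with hη
  have hη0 : 0 < η := by positivity
  obtain ⟨I, c, hI, hc1, hf⟩ := hKP Φ ω η hΦ hω0 hω1 hη0
  have ht := transfer_mul U hU1 hU g I (fun p => (c p : ℂ)) (fun p => p.1) (fun p => p.2)
    (fun p hp => (hP p (hI p hp)).1) (fun p hp => (hP p (hI p hp)).2) Φ hΦ ω η hf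
  by_contra hcon
  push Not at hcon
  have h5 : ∑ p ∈ I, (c p : ℂ) * ⟪U p.2 g, U p.1 g⟫_ℂ = -((‖v‖ ^ 2 : ℝ) : ℂ) := by
    have : ∀ p ∈ I, (c p : ℂ) * ⟪U p.2 g, U p.1 g⟫_ℂ = (c p : ℂ) * -((‖v‖ ^ 2 : ℝ) : ℂ) := by
      intro p hp
      congr 1
      have p1 := (hP p (hI p hp)).1
      have p2 := (hP p (hI p hp)).2
      have h6 := hcon p (hI p hp)
      have hx : x = v + g := by rw [hg]; abel
      rw [hx, map_add, map_add, inner_add_left, inner_add_right, inner_add_right] at h6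
      have a1 : ⟪U p.2 v, U p.1 g⟫_ℂ = 0 := by
        rw [hUv _ p2, ← hUv _ p1, (U p.1).inner_map_map, hvg]
      have a2 : ⟪U p.2 g, U p.1 v⟫_ℂ = 0 := by
        rw [hUv _ p1]
        conv_lhs => rw [← hUv _ p2]
        rw [(U p.2).inner_map_map, hgv]
      rw [a1, a2, hUv _ p1, hUv _ p2, inner_self_eq_norm_sq_to_K] at h6
      simp only [Complex.coe_algebraMap, add_zero, zero_add] at h6
      push_cast
      exact eq_neg_of_add_eq_zero_right h6
    rw [sum_congr rfl this, ← sum_mul, ← Complex.ofReal_sum, hc1]; simp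
  have h7 : ∑ s ∈ Φ, (ω s : ℂ) • U s g = w - v := by
    rw [hg]; simp_rw [map_sub, smul_sub]
    rw [sum_sub_distrib, hωw, sum_congr rfl (fun s hs => by rw [hUv s (hΦ s hs)]), ← sum_smul, ← Complex.ofReal_sum, hω1]
    simp
  rw [h5, h7, norm_neg, Complex.norm_real, Real.norm_of_nonneg (by positivity)] at ht
  rw [dist_eq_norm, norm_sub_rev] at hwv
  have h8 : η * ‖g‖ ^ 2 ≤ ‖v‖ ^ 2 / 4 := by
    rw [hη, div_mul_eq_mul_div, div_le_div_iff₀ (by positivity) (by positivity)]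
    nlinarith [sq_nonneg ‖v‖]
  have h9 : ‖g‖ * ‖w - v‖ ≤ ‖v‖ ^ 2 / 4 := by
    calc ‖g‖ * ‖w - v‖ ≤ ‖g‖ * δ := by gcongr
      _ ≤ _ := by
        rw [hδ, mul_div_assoc', div_le_div_iff₀ (by positivity) (by positivity)]
        nlinarith [sq_nonneg ‖v‖]
  nlinarith [pow_pos hv0 2]

end

section
open Finset MeasureTheory
open scoped ComplexConjugate InnerProductSpace

def Pset (l l' : ℕ) (e : ℤ) : Set (ℕ × ℕ) :=
  {p | ∃ m n : ℕ, 0 < n ∧ (l' + 1) * n ≤ m ∧ p.1 = l * ((m : ℤ) ^ 2 - e * (n : ℤ) ^ 2).natAbs ∧ p.2 = l' * (m * n)}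

theorem ergodic_part {X : Type*} [MeasurableSpace X] (μ : Measure X) [IsProbabilityMeasure μ]
    (T : ℕ → X → X)
    (hmp : ∀ n, 0 < n → MeasurePreserving (T n) μ μ)
    (hid : T 1 = id)
    (hmul : ∀ m n, 0 < m → 0 < n → T (m * n) = T m ∘ T n)
    (A : Set X) (hA : MeasurableSet A) (hApos : 0 < μ A) (P : Set (ℕ × ℕ)) (hP : ∀ p ∈ P, 0 < p.1 ∧ 0 < p.2)
    (hKP : KPset P) : ∃ p ∈ P, 0 < μ (T p.1 ⁻¹' A ∩ T p.2 ⁻¹' A) := by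
  let U : ℕ → Lp ℂ 2 μ →ₗᵢ[ℂ] Lp ℂ 2 μ := fun n =>
    if h : 0 < n then Lp.compMeasurePreservingₗᵢ ℂ (T n) (hmp n h) else LinearIsometry.id
  have hUp : ∀ n (h : 0 < n) y, U n y = Lp.compMeasurePreserving (T n) (hmp n h) y := by
    intro n h y; simp only [U, dif_pos h]; rfl
  have hUi : ∀ n, 0 < n → ∀ (B : Set X) (hB : MeasurableSet B), ∃ hB' : MeasurableSet (T n ⁻¹' B),
      U n (indicatorConstLp 2 hB (measure_ne_top μ B) (1 : ℂ)) =
      indicatorConstLp 2 hB' (measure_ne_top μ _) (1 : ℂ) := by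
    intro n hn B hB
    refine ⟨(hmp n hn).measurable hB, ?_⟩
    rw [hUp n hn, Lp.indicatorConstLp_compMeasurePreserving]
  obtain ⟨p, hpP, hp⟩ := hilbert_part U (by
      intro x
      rw [hUp 1 one_pos]
      apply Lp.ext
      filter_upwards [Lp.coeFn_compMeasurePreserving x (hmp 1 one_pos)] with a ha
      rw [ha, hid]; rfl) (by
      intro m n x hm hn
      rw [hUp _ (Nat.mul_pos hm hn), hUp _ hm, hUp _ hn]
      apply Lp.ext
      have h1 := Lp.coeFn_compMeasurePreserving x (hmp (m * n) (Nat.mul_pos hm hn))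
      have h2 := Lp.coeFn_compMeasurePreserving (Lp.compMeasurePreserving (T n) (hmp n hn) x) (hmp m hm)
      have h3 := (hmp m hm).quasiMeasurePreserving.ae_eq_comp (Lp.coeFn_compMeasurePreserving x (hmp n hn))
      filter_upwards [h1, h2, h3] with a h1 h2 h3
      rw [h1, h2, h3, mul_comm, hmul n m hn hm]; rfl)
    (indicatorConstLp 2 hA (measure_ne_top μ A) (1 : ℂ))
    (indicatorConstLp 2 MeasurableSet.univ (measure_ne_top μ _) (1 : ℂ)) (by
      intro n hn
      obtain ⟨h, h2⟩ := hUi n hn _ MeasurableSet.univ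
      rw [h2]; rfl) (by
      rw [L2.inner_indicatorConstLp_one]
      rw [setIntegral_congr_ae (g := A.indicator (fun _ => (1:ℂ))) MeasurableSet.univ (by
        filter_upwards [indicatorConstLp_coeFn (p := 2) (hs := hA) (hμs := measure_ne_top μ A) (c := (1:ℂ))] with a ha _
        exact ha)]
      rw [setIntegral_univ, integral_indicator hA]
      simp [Measure.real, ENNReal.toReal_eq_zero_iff, hApos.ne'])
    P hP hKP
  refine ⟨p, hpP, ?_⟩
  obtain ⟨p1, p2⟩ := hP p hpP
  obtain ⟨h1, h1'⟩ := hUi _ p1 _ hA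
  obtain ⟨h2, h2'⟩ := hUi _ p2 _ hA
  rw [h1', h2', L2.inner_indicatorConstLp_one] at hp
  rw [pos_iff_ne_zero]
  intro h0
  apply hp
  rw [setIntegral_congr_ae (g := (T p.1 ⁻¹' A).indicator (fun _ => (1:ℂ))) h2 (by
        filter_upwards [indicatorConstLp_coeFn (p := 2) (hs := h1) (hμs := measure_ne_top μ _) (c := (1:ℂ))] with a ha _
        exact ha)]
  rw [setIntegral_indicator h1]
  rw [Set.inter_comm] at h0
  rw [Measure.restrict_eq_zero.2 h0]; simp

theorem main_of_KP (hKP : ∀ e : ℤ, e = 1 ∨ e = -1 → ∀ l l' : ℕ, 0 < l → 0 < l' → KPset (Pset l l' e))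
    {X : Type*} [MeasurableSpace X] (μ : Measure X) [IsProbabilityMeasure μ]
    (T : ℕ → X → X)
    (hmp : ∀ n, 0 < n → MeasurePreserving (T n) μ μ)
    (hid : T 1 = id)
    (hmul : ∀ m n, 0 < m → 0 < n → T (m * n) = T m ∘ T n)
    (ℓ ℓ' : ℕ) (hℓ : 0 < ℓ) (hℓ' : 0 < ℓ')
    (A : Set X) (hA : MeasurableSet A) (hApos : 0 < μ A) :
    (∃ m n : ℕ, 0 < n ∧ n < m ∧ ℓ * (m ^ 2 - n ^ 2) ≠ ℓ' * (m * n) ∧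
      0 < μ (T (ℓ * (m ^ 2 - n ^ 2)) ⁻¹' A ∩ T (ℓ' * (m * n)) ⁻¹' A)) ∧
    (∃ m n : ℕ, 0 < m ∧ 0 < n ∧ ℓ * (m ^ 2 + n ^ 2) ≠ ℓ' * (m * n) ∧
      0 < μ (T (ℓ * (m ^ 2 + n ^ 2)) ⁻¹' A ∩ T (ℓ' * (m * n)) ⁻¹' A)) := by
  have aux : ∀ m n : ℕ, 0 < n → (ℓ' + 1) * n ≤ m → n < m ∧ n ^ 2 < m ^ 2 ∧ ℓ' * (m * n) < m ^ 2 - n ^ 2 := by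
    intro m n hn hm
    have h1 : n < m := by nlinarith
    have h2 : n ^ 2 < m ^ 2 := by nlinarith
    refine ⟨h1, h2, ?_⟩
    have h3 : ℓ' * (m * n) + n ^ 2 < m ^ 2 := by nlinarith
    omega
  constructor
  · have hn1 : ∀ m n : ℕ, n ^ 2 < m ^ 2 → ((m : ℤ) ^ 2 - 1 * (n : ℤ) ^ 2).natAbs = m ^ 2 - n ^ 2 := by
      intro m n h; zify [h.le]; rw [one_mul, abs_of_pos]; have : (n:ℤ)^2 < m ^ 2 := by exact_mod_cast h
      linarith
    obtain ⟨⟨k, l⟩, ⟨m, n, hn, hm, hk, hl⟩, h⟩ := ergodic_part μ T hmp hid hmul A hA hApos (Pset ℓ ℓ' 1) (by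
      rintro ⟨k, l⟩ ⟨m, n, hn, hm, hk, hl⟩
      simp only at hk hl
      obtain ⟨h1, h2, h3⟩ := aux m n hn hm
      rw [hn1 m n h2] at hk
      subst hk hl
      exact ⟨Nat.mul_pos hℓ (by omega), Nat.mul_pos hℓ' (Nat.mul_pos (by omega) hn)⟩) (hKP 1 (Or.inl rfl) _ _ hℓ hℓ')
    simp only at hk hl
    obtain ⟨h1, h2, h3⟩ := aux m n hn hm
    rw [hn1 m n h2] at hk
    subst hk hl
    refine ⟨m, n, hn, h1, ?_, h⟩
    have : 1 * (m ^ 2 - n ^ 2) ≤ ℓ * (m ^ 2 - n ^ 2) := Nat.mul_le_mul_right _ hℓ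
    omega
  · have hn1 : ∀ m n : ℕ, ((m : ℤ) ^ 2 - (-1) * (n : ℤ) ^ 2).natAbs = m ^ 2 + n ^ 2 := by
      intro m n; zify; rw [abs_of_nonneg] <;> [ring; nlinarith [sq_nonneg (m:ℤ), sq_nonneg (n:ℤ)]]
    obtain ⟨⟨k, l⟩, ⟨m, n, hn, hm, hk, hl⟩, h⟩ := ergodic_part μ T hmp hid hmul A hA hApos (Pset ℓ ℓ' (-1)) (by
      rintro ⟨k, l⟩ ⟨m, n, hn, hm, hk, hl⟩
      simp only at hk hl
      obtain ⟨h1, h2, h3⟩ := aux m n hn hm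
      rw [hn1 m n] at hk
      subst hk hl
      exact ⟨Nat.mul_pos hℓ (by omega), Nat.mul_pos hℓ' (Nat.mul_pos (by omega) hn)⟩) (hKP (-1) (Or.inr rfl) _ _ hℓ hℓ')
    simp only at hk hl
    obtain ⟨h1, h2, h3⟩ := aux m n hn hm
    rw [hn1 m n] at hk
    subst hk hl
    refine ⟨m, n, by omega, hn, ?_, h⟩
    have : 1 * (m ^ 2 + n ^ 2) ≤ ℓ * (m ^ 2 + n ^ 2) := Nat.mul_le_mul_right _ hℓ
    omega

end

section
open Finset
open scoped ComplexConjugate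

def CM (f : ℕ →*₀ ℂ) : Prop := ∀ n, n ≠ 0 → ‖f n‖ = 1

theorem CM.le {f : ℕ →*₀ ℂ} (h : CM f) (n : ℕ) : ‖f n‖ ≤ 1 := by
  by_cases hn : n = 0
  · subst hn; simp
  · exact (h n hn).le

theorem cs_sum {ι : Type*} (s : Finset ι) (a b : ι → ℂ) :
    ‖∑ i ∈ s, a i * b i‖ ^ 2 ≤ (∑ i ∈ s, ‖a i‖ ^ 2) * ∑ i ∈ s, ‖b i‖ ^ 2 := by
  calc ‖∑ i ∈ s, a i * b i‖ ^ 2 ≤ (∑ i ∈ s, ‖a i‖ * ‖b i‖) ^ 2 := by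
        gcongr
        refine (norm_sum_le _ _).trans (le_of_eq ?_)
        simp
    _ ≤ _ := sum_mul_sq_le_sq_mul_sq s _ _

theorem cs_sum_one {ι : Type*} (s : Finset ι) (a b : ι → ℂ) (ha : ∀ i ∈ s, ‖a i‖ ≤ 1) :
    ‖∑ i ∈ s, a i * b i‖ ^ 2 ≤ (#s : ℝ) * ∑ i ∈ s, ‖b i‖ ^ 2 := by
  refine (cs_sum s a b).trans ?_
  gcongr
  calc ∑ i ∈ s, ‖a i‖ ^ 2 ≤ ∑ i ∈ s, (1 : ℝ) := sum_le_sum fun i hi => pow_le_one₀ (norm_nonneg _) (ha i hi)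
    _ = _ := by simp

theorem sqnorm_expand {ι : Type*} (s : Finset ι) (x : ι → ℂ) :
    ((‖∑ i ∈ s, x i‖ ^ 2 : ℝ) : ℂ) = ∑ i ∈ s, ∑ j ∈ s, x i * conj (x j) := by
  rw [Complex.ofReal_pow, ← Complex.mul_conj', map_sum, sum_mul_sum]

theorem sum_sqnorm_le {ι κ : Type*} (s : Finset ι) (t : Finset κ) (x : κ → ι → ℂ) :
    ∑ m ∈ t, ‖∑ i ∈ s, x m i‖ ^ 2 ≤ ∑ i ∈ s, ∑ j ∈ s, ‖∑ m ∈ t, x m i * conj (x m j)‖ := by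
  have h1 : ((∑ m ∈ t, ‖∑ i ∈ s, x m i‖ ^ 2 : ℝ) : ℂ) = ∑ i ∈ s, ∑ j ∈ s, ∑ m ∈ t, x m i * conj (x m j) := by
    rw [Complex.ofReal_sum]
    simp_rw [sqnorm_expand]
    rw [sum_comm]
    refine sum_congr rfl fun i _ => ?_
    rw [sum_comm]
  have h2 : (∑ m ∈ t, ‖∑ i ∈ s, x m i‖ ^ 2 : ℝ) = ‖((∑ m ∈ t, ‖∑ i ∈ s, x m i‖ ^ 2 : ℝ) : ℂ)‖ := by
    rw [Complex.norm_real, Real.norm_of_nonneg (sum_nonneg fun _ _ => by positivity)]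
  rw [h2, h1]
  refine (norm_sum_le _ _).trans (sum_le_sum fun i _ => norm_sum_le _ _)

theorem ordc_nat (s : Finset ℕ) (h : (s : Set ℕ).OrdConnected) : ∃ a b, a ≤ b ∧ s = Ico a b := by
  by_cases hs : s.Nonempty
  · refine ⟨s.min' hs, s.max' hs + 1, ?_, ?_⟩
    · exact (s.min'_le_max' hs).trans (Nat.le_succ _)
    · ext x
      simp only [mem_Ico, Nat.lt_succ_iff]
      constructor
      · intro hx; exact ⟨s.min'_le x hx, s.le_max' x hx⟩
      · intro hx
        exact h.out (s.min'_mem hs) (s.max'_mem hs) hx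
  · rw [not_nonempty_iff_eq_empty] at hs
    exact ⟨0, 0, le_rfl, by simp [hs]⟩

theorem ordc_int (s : Finset ℤ) (h : (s : Set ℤ).OrdConnected) : ∃ a b, a ≤ b ∧ s = Ico a b := by
  by_cases hs : s.Nonempty
  · refine ⟨s.min' hs, s.max' hs + 1, ?_, ?_⟩
    · have := s.min'_le_max' hs; omega
    · ext x
      simp only [mem_Ico, Int.lt_add_one_iff]
      constructor
      · intro hx; exact ⟨s.min'_le x hx, s.le_max' x hx⟩
      · intro hx
        exact h.out (s.min'_mem hs) (s.max'_mem hs) hx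
  · rw [not_nonempty_iff_eq_empty] at hs
    exact ⟨0, 0, le_rfl, by simp [hs]⟩

theorem geom_bound (s : Finset ℕ) (h : (s : Set ℕ).OrdConnected) (w : ℂ) (hw : ‖w‖ = 1) :
    ‖∑ m ∈ s, w ^ m‖ * ‖1 - w‖ ≤ 2 := by
  obtain ⟨a, b, hab, rfl⟩ := ordc_nat s h
  rw [← norm_mul]
  have : (∑ m ∈ Ico a b, w ^ m) * (1 - w) = w ^ a - w ^ b := by
    have := geom_sum_Ico_mul w hab
    linear_combination -this
  rw [this]
  refine (norm_sub_le _ _).trans ?_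
  simp [hw]; norm_num

theorem card_dvd_range (p N : ℕ) (hp : 0 < p) :
    (N : ℝ) / p ≤ #{n ∈ range N | p ∣ n} ∧ (#{n ∈ range N | p ∣ n} : ℝ) ≤ N / p + 1 := by
  have h : #{n ∈ range N | p ∣ n} = (N + p - 1) / p := by
    have : {n ∈ range N | p ∣ n} = (range ((N + p - 1) / p)).image (fun k => p * k) := by
      ext n
      simp only [mem_filter, mem_range, mem_image]
      constructor
      · rintro ⟨h1, k, rfl⟩
        refine ⟨k, ?_, rfl⟩
        rw [Nat.lt_iff_add_one_le, Nat.le_div_iff_mul_le hp]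
        have : (k + 1) * p = p * k + p := by ring
        omega
      · rintro ⟨k, h1, rfl⟩
        refine ⟨?_, Dvd.intro _ rfl⟩
        rw [Nat.lt_iff_add_one_le, Nat.le_div_iff_mul_le hp] at h1
        have : (k + 1) * p = p * k + p := by ring
        omega
    rw [this, card_image_of_injective, card_range]
    intro a b hab
    exact Nat.eq_of_mul_eq_mul_left hp hab
  rw [h]
  have hp' : (0 : ℝ) < p := by exact_mod_cast hp
  constructor
  · rw [div_le_iff₀ hp']
    have := Nat.lt_div_mul_add hp (a := N + p - 1)
    have h2 : N ≤ (N + p - 1) / p * p := by omega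
    exact_mod_cast h2
  · have h2 := Nat.div_mul_le_self (N + p - 1) p
    have h3 : (((N + p - 1) / p : ℕ) : ℝ) * p ≤ N + p := by
      have : (N + p - 1) / p * p ≤ N + p := by omega
      exact_mod_cast this
    have : (N : ℝ) / p + 1 = (N + p) / p := by field_simp
    rw [this, le_div_iff₀ hp']
    exact h3

theorem turan_kubilius (P : Finset ℕ) (hP : ∀ p ∈ P, p.Prime) (N : ℕ) :
    ∑ n ∈ range N, ((∑ p ∈ P, if p ∣ n then (1:ℝ) else 0) - ∑ p ∈ P, (1:ℝ) / p) ^ 2 ≤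
      N * (∑ p ∈ P, (1:ℝ) / p) + (#P : ℝ) ^ 2 := by
  set L := ∑ p ∈ P, (1:ℝ) / p with hL
  have hL0 : 0 ≤ L := sum_nonneg fun _ _ => by positivity
  have e1 : ∑ n ∈ range N, ∑ p ∈ P, (if p ∣ n then (1:ℝ) else 0) ≥ N * L := by
    rw [sum_comm, hL, mul_sum]
    refine sum_le_sum fun p hp => ?_
    rw [sum_boole]
    have := (card_dvd_range p N (hP p hp).pos).1
    rwa [mul_one_div]
  have e2 : ∑ n ∈ range N, (∑ p ∈ P, if p ∣ n then (1:ℝ) else 0) ^ 2 ≤ N * L ^ 2 + N * L + (#P : ℝ) ^ 2 := by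
    have : ∀ n ∈ range N, (∑ p ∈ P, if p ∣ n then (1:ℝ) else 0) ^ 2 =
        ∑ p ∈ P, ∑ q ∈ P, if p ∣ n ∧ q ∣ n then (1:ℝ) else 0 := by
      intro n _
      rw [sq, sum_mul_sum]
      refine sum_congr rfl fun p _ => sum_congr rfl fun q _ => ?_
      by_cases h1 : p ∣ n <;> by_cases h2 : q ∣ n <;> simp [h1, h2]
    rw [sum_congr rfl this, sum_comm]
    have h3 : ∀ p ∈ P, ∀ q ∈ P, ∑ n ∈ range N, (if p ∣ n ∧ q ∣ n then (1:ℝ) else 0) ≤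
        N * (1 / p * (1 / q)) + 1 + if p = q then (N : ℝ) / p else 0 := by
      intro p hp q hq
      rw [sum_boole]
      by_cases hpq : p = q
      · subst hpq
        simp only [and_self, if_true]
        have := (card_dvd_range p N (hP p hp).pos).2
        have h4 : 0 ≤ (N : ℝ) * (1 / p * (1 / p)) := by positivity
        linarith
      · have hc : Nat.Coprime p q := (Nat.coprime_primes (hP p hp) (hP q hq)).2 hpq
        have h5 : ∀ n, (p ∣ n ∧ q ∣ n) ↔ p * q ∣ n := fun n =>
          ⟨fun h => hc.mul_dvd_of_dvd_of_dvd h.1 h.2, fun h => ⟨(dvd_mul_right p q).trans h, (dvd_mul_left q p).trans h⟩⟩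
        simp only [h5, hpq, if_false, add_zero]
        have := (card_dvd_range (p * q) N (Nat.mul_pos (hP p hp).pos (hP q hq).pos)).2
        refine this.trans (le_of_eq ?_)
        push_cast
        field_simp
    calc _ ≤ ∑ p ∈ P, ∑ q ∈ P, ((N:ℝ) * (1 / p * (1 / q)) + 1 + if p = q then (N : ℝ) / p else 0) := by
          refine sum_le_sum fun p hp => ?_
          rw [sum_comm]
          exact sum_le_sum fun q hq => h3 p hp q hq
      _ = _ := by
          simp only [sum_add_distrib, sum_ite_eq, ← mul_sum, sum_const]
          rw [← sum_mul, ← hL]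
          have : ∑ p ∈ P, (if p ∈ P then (N:ℝ) / p else 0) = N * L := by
            rw [hL, mul_sum]
            refine sum_congr rfl fun p hp => ?_
            simp [hp]; ring
          rw [this]
          simp; ring
  have e3 : ∑ n ∈ range N, ((∑ p ∈ P, if p ∣ n then (1:ℝ) else 0) - L) ^ 2 =
      ∑ n ∈ range N, (∑ p ∈ P, if p ∣ n then (1:ℝ) else 0) ^ 2
      - 2 * L * ∑ n ∈ range N, (∑ p ∈ P, if p ∣ n then (1:ℝ) else 0) + N * L ^ 2 := by
    simp only [sub_sq, sum_add_distrib, sum_sub_distrib, sum_const, card_range, nsmul_eq_mul, mul_sum]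
    congr 2
    refine sum_congr rfl fun n _ => ?_
    rw [sum_mul]
    refine sum_congr rfl fun p _ => ?_
    ring
  rw [e3]
  nlinarith

theorem dab_core (P : Finset ℕ) (hP : ∀ p ∈ P, p.Prime) (Q0 : ℕ) (hQ : ∀ p ∈ P, p ≤ Q0) (N : ℕ)
    (f : ℕ →*₀ ℂ) (hf : CM f) (z : ℂ) (hz : ‖z‖ = 1) (A B : ℕ) (hB : B ≤ N) (κ : ℝ) (hκ : 0 < κ)
    (hd : ∀ d, 1 ≤ d → d ≤ Q0 → κ ≤ ‖1 - z ^ d‖) :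
    (∑ p ∈ P, (1:ℝ) / p) * ‖∑ n ∈ Ico A B, f n * z ^ n‖ ≤
      √(N * (N * (∑ p ∈ P, (1:ℝ) / p) + (#P : ℝ) ^ 2)) +
      √(N * (N * (∑ p ∈ P, (1:ℝ) / p) + #P + (#P : ℝ) ^ 2 * (2 / κ))) := by
  set L := ∑ p ∈ P, (1:ℝ) / p with hL
  have hL0 : 0 ≤ L := sum_nonneg fun _ _ => by positivity
  set om : ℕ → ℝ := fun n => ∑ p ∈ P, if p ∣ n then (1:ℝ) else 0 with hom
  have key : (L : ℂ) * ∑ n ∈ Ico A B, f n * z ^ n = ∑ n ∈ Ico A B, (f n * z ^ n) * ((L - om n : ℝ) : ℂ) +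
      ∑ n ∈ Ico A B, (om n : ℂ) * (f n * z ^ n) := by
    rw [mul_sum, ← sum_add_distrib]
    refine sum_congr rfl fun n _ => ?_
    push_cast; ring
  have hsub : Ico A B ⊆ range N := by
    intro n hn; simp only [mem_Ico, mem_range] at *; omega
  have b1 : ‖∑ n ∈ Ico A B, (f n * z ^ n) * ((L - om n : ℝ) : ℂ)‖ ≤ √(N * (N * L + (#P : ℝ) ^ 2)) := by
    refine Real.le_sqrt_of_sq_le ?_
    refine (cs_sum_one _ _ _ ?_).trans ?_
    · intro n _
      rw [norm_mul, norm_pow, hz]; simpa using hf.le n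
    · gcongr
      · have := card_le_card hsub
        rw [card_range] at this
        exact_mod_cast this
      · refine le_trans ?_ (turan_kubilius P hP N)
        refine le_trans (sum_le_sum_of_subset_of_nonneg hsub fun _ _ _ => by positivity) (le_of_eq ?_)
        refine sum_congr rfl fun n _ => ?_
        rw [Complex.norm_real, Real.norm_eq_abs, sq_abs]
        ring
  have b2 : ‖∑ n ∈ Ico A B, (om n : ℂ) * (f n * z ^ n)‖ ≤ √(N * (N * L + #P + (#P : ℝ) ^ 2 * (2 / κ))) := by
    have e : ∑ n ∈ Ico A B, (om n : ℂ) * (f n * z ^ n) =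
        ∑ m ∈ range N, f m * ∑ p ∈ P, if A ≤ p * m ∧ p * m < B then f p * z ^ (p * m) else 0 := by
      simp_rw [hom, mul_sum]
      push_cast
      simp_rw [sum_mul]
      rw [sum_comm, sum_comm (s := range N)]
      refine sum_congr rfl fun p hp => ?_
      have hp0 := (hP p hp).pos
      simp only [apply_ite Complex.ofReal, Complex.ofReal_one, Complex.ofReal_zero, ite_mul, one_mul, zero_mul, mul_ite, mul_zero]
      rw [← sum_filter, ← sum_filter]
      symm
      refine sum_bij (fun m _ => p * m) ?_ ?_ ?_ ?_
      · intro m hm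
        simp only [mem_filter, mem_range, mem_Ico] at hm ⊢
        exact ⟨hm.2, Dvd.intro _ rfl⟩
      · intro m _ m' _ h
        exact Nat.eq_of_mul_eq_mul_left hp0 h
      · intro n hn
        simp only [mem_filter, mem_Ico] at hn
        obtain ⟨⟨h1, h2⟩, k, rfl⟩ := hn
        refine ⟨k, ?_, rfl⟩
        simp only [mem_filter, mem_range]
        refine ⟨?_, h1, h2⟩
        have : k ≤ p * k := Nat.le_mul_of_pos_left k hp0
        omega
      · intro m _
        rw [map_mul]; ring
    rw [e]
    refine Real.le_sqrt_of_sq_le ?_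
    refine (cs_sum_one _ _ _ fun n _ => hf.le n).trans ?_
    rw [card_range]
    gcongr
    refine (sum_sqnorm_le _ _ _).trans ?_
    have h3 : ∀ p ∈ P, ∀ q ∈ P, ‖∑ m ∈ range N, (if A ≤ p * m ∧ p * m < B then f p * z ^ (p * m) else 0) *
        conj (if A ≤ q * m ∧ q * m < B then f q * z ^ (q * m) else 0)‖ ≤
        2 / κ + if p = q then (N : ℝ) / p + 1 else 0 := by
      intro p hp q hq
      have hp0 := (hP p hp).pos
      have e1 : ∑ m ∈ range N, (if A ≤ p * m ∧ p * m < B then f p * z ^ (p * m) else 0) *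
        conj (if A ≤ q * m ∧ q * m < B then f q * z ^ (q * m) else 0) =
        (f p * conj (f q)) * ∑ m ∈ range N with (A ≤ p * m ∧ p * m < B) ∧ (A ≤ q * m ∧ q * m < B),
          (z ^ p * conj (z ^ q)) ^ m := by
        rw [sum_filter, mul_sum]
        refine sum_congr rfl fun m _ => ?_
        by_cases h1 : A ≤ p * m ∧ p * m < B <;> by_cases h2 : A ≤ q * m ∧ q * m < B <;> simp [h1, h2]
        rw [pow_mul, pow_mul, mul_pow]; ring
      rw [e1, norm_mul]
      have hfpq : ‖f p * conj (f q)‖ ≤ 1 := by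
        rw [norm_mul, RCLike.norm_conj]
        exact mul_le_one₀ (hf.le p) (norm_nonneg _) (hf.le q)
      refine (mul_le_of_le_one_left (norm_nonneg _) hfpq).trans ?_
      by_cases hpq : p = q
      · subst hpq
        simp only [if_true, and_self]
        have hzz : z ^ p * conj (z ^ p) = 1 := by
          rw [Complex.mul_conj', norm_pow, hz]; simp
        rw [hzz]
        simp only [one_pow, sum_const, nsmul_eq_mul, mul_one]
        rw [Complex.norm_natCast]
        have h6 : (#{m ∈ range N | A ≤ p * m ∧ p * m < B} : ℝ) ≤ #{n ∈ range N | p ∣ n} := by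
          norm_cast
          refine card_le_card_of_injOn (fun m => p * m) ?_ ?_
          · intro m hm
            simp only [coe_filter, mem_range, Set.mem_ofPred_eq] at hm ⊢
            exact ⟨by omega, Dvd.intro _ rfl⟩
          · intro m _ m' _ h
            exact Nat.eq_of_mul_eq_mul_left hp0 h
        have := (card_dvd_range p N hp0).2
        have h7 : 0 ≤ 2 / κ := by positivity
        linarith
      · simp only [hpq, if_false, add_zero]
        have hw : ‖z ^ p * conj (z ^ q)‖ = 1 := by
          rw [norm_mul, RCLike.norm_conj, norm_pow, norm_pow, hz]; simp
        have hoc : (({m ∈ range N | (A ≤ p * m ∧ p * m < B) ∧ (A ≤ q * m ∧ q * m < B)} : Finset ℕ) : Set ℕ).OrdConnected := by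
          constructor
          intro x hx y hy w hw
          simp only [coe_filter, mem_range, Set.mem_ofPred_eq] at hx hy ⊢
          obtain ⟨hw1, hw2⟩ := hw
          have := Nat.mul_le_mul_left p hw1
          have := Nat.mul_le_mul_left p hw2
          have := Nat.mul_le_mul_left q hw1
          have := Nat.mul_le_mul_left q hw2
          omega
        have hg := geom_bound _ hoc _ hw
        have hlow : κ ≤ ‖1 - z ^ p * conj (z ^ q)‖ := by
          have hgen : ∀ a b : ℕ, a < b → b ≤ Q0 → κ ≤ ‖z ^ a - z ^ b‖ := by
            intro a b hab hb
            have : z ^ a - z ^ b = z ^ a * (1 - z ^ (b - a)) := by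
              rw [mul_sub, ← pow_add, Nat.add_sub_cancel' hab.le, mul_one]
            rw [this, norm_mul, norm_pow, hz, one_pow, one_mul]
            exact hd _ (by omega) (by omega)
          have e5 : ‖1 - z ^ p * conj (z ^ q)‖ = ‖z ^ q - z ^ p‖ := by
            have : z ^ q - z ^ p = z ^ q * (1 - z ^ p * conj (z ^ q)) := by
              have hzz : z ^ q * conj (z ^ q) = 1 := by
                rw [Complex.mul_conj', norm_pow, hz]; simp
              linear_combination z ^ p * hzz
            rw [this, norm_mul, norm_pow, hz]; simp
          rw [e5]
          rcases lt_or_gt_of_ne hpq with h | h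
          · rw [norm_sub_rev]; exact hgen p q h (hQ q hq)
          · exact hgen q p h (hQ p hp)
        rw [le_div_iff₀ hκ]
        refine le_trans ?_ hg
        gcongr
    calc _ ≤ ∑ p ∈ P, ∑ q ∈ P, (2 / κ + if p = q then (N : ℝ) / p + 1 else 0) :=
          sum_le_sum fun p hp => sum_le_sum fun q hq => h3 p hp q hq
      _ = _ := by
        simp only [sum_add_distrib, sum_ite_eq, sum_const]
        have : ∑ p ∈ P, (if p ∈ P then (N:ℝ) / p + 1 else 0) = N * L + #P := by
          rw [hL, mul_sum, card_eq_sum_ones]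
          push_cast
          rw [← sum_add_distrib]
          refine sum_congr rfl fun p hp => ?_
          simp [hp]; ring
        rw [this]
        simp; ring
  have : L * ‖∑ n ∈ Ico A B, f n * z ^ n‖ = ‖(L : ℂ) * ∑ n ∈ Ico A B, f n * z ^ n‖ := by
    rw [norm_mul, Complex.norm_real, Real.norm_of_nonneg hL0]
  rw [this, key]
  exact (norm_add_le _ _).trans (add_le_add b1 b2)

theorem primes_large (M : ℝ) : ∃ P : Finset ℕ, (∀ p ∈ P, p.Prime) ∧ M ≤ ∑ p ∈ P, (1:ℝ) / p := by
  by_contra hcon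
  push Not at hcon
  apply Nat.Primes.not_summable_one_div
  refine summable_of_sum_le (c := M) (fun _ => by positivity) ?_
  intro u
  have h := hcon (u.map ⟨fun p : Nat.Primes => (p : ℕ), Subtype.coe_injective⟩) (by
    intro p hp
    rw [mem_map] at hp
    obtain ⟨q, _, rfl⟩ := hp
    exact q.2)
  rw [sum_map] at h
  exact h.le

theorem daboussi (c : ℝ) (hc : 0 < c) : ∃ (Q0 : ℕ) (C0 : ℝ), 1 ≤ Q0 ∧ 0 < C0 ∧ ∀ f : ℕ →*₀ ℂ, CM f →
    ∀ z : ℂ, ‖z‖ = 1 → ∀ N : ℕ, 1 ≤ N → (∃ d, 1 ≤ d ∧ d ≤ Q0 ∧ ‖1 - z ^ d‖ ≤ C0 / N) ∨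
      ∀ A B : ℕ, B ≤ N → ‖∑ n ∈ Ico A B, f n * z ^ n‖ ≤ c * N := by
  obtain ⟨P, hP, hPL⟩ := primes_large (2 + 16 / c ^ 2)
  set L := ∑ p ∈ P, (1:ℝ) / p with hL
  have hc2 : 0 < 16 / c ^ 2 := by positivity
  have hL0 : 0 < L := by linarith
  have hPn : P.Nonempty := by
    by_contra h
    rw [not_nonempty_iff_eq_empty] at h
    rw [hL, h] at hL0; simp at hL0
  have hP1 : 1 ≤ #P := hPn.card_pos
  refine ⟨∑ p ∈ P, p + 1, 2 * (#P : ℝ) ^ 2, by omega, by positivity, ?_⟩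
  intro f hf z hz N hN
  have hN' : (1:ℝ) ≤ N := by exact_mod_cast hN
  by_cases hd : ∃ d, 1 ≤ d ∧ d ≤ ∑ p ∈ P, p + 1 ∧ ‖1 - z ^ d‖ ≤ 2 * (#P : ℝ) ^ 2 / N
  · exact Or.inl hd
  right
  push Not at hd
  intro A B hB
  have hbig : (#P : ℝ) ^ 2 < N := by
    have h1 := hd 1 le_rfl (by omega)
    have h2 : ‖1 - z ^ 1‖ ≤ 2 := by
      refine (norm_sub_le _ _).trans ?_
      simp [hz]; norm_num
    have h3 := h1.trans_le h2
    rw [div_lt_iff₀ (by linarith)] at h3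
    linarith
  have := dab_core P hP (∑ p ∈ P, p + 1) (fun p hp => by
    have := single_le_sum (f := fun s : ℕ => s) (fun _ _ => Nat.zero_le _) hp; omega) N f hf z hz A B hB
    (2 * (#P : ℝ) ^ 2 / N) (by positivity) (fun d h1 h2 => (hd d h1 h2).le)
  rw [← hL] at this
  have hs1 : √(N * (N * L + (#P : ℝ) ^ 2)) ≤ N * √(L + 2) := by
    rw [Real.sqrt_le_left (by positivity), mul_pow, Real.sq_sqrt (by positivity)]
    nlinarith
  have hs2 : √(N * (N * L + #P + (#P : ℝ) ^ 2 * (2 / (2 * (#P : ℝ) ^ 2 / N)))) ≤ N * √(L + 2) := by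
    rw [Real.sqrt_le_left (by positivity), mul_pow, Real.sq_sqrt (by positivity)]
    have : (#P : ℝ) ^ 2 * (2 / (2 * (#P : ℝ) ^ 2 / N)) = N := by field_simp
    rw [this]
    nlinarith
  have h3 : 2 * √(L + 2) ≤ c * L := by
    have h4 : √(L + 2) ≤ c * L / 2 := by
      rw [Real.sqrt_le_left (by positivity)]
      have : 16 ≤ (L - 2) * c ^ 2 := by
        have h5 : (2 + 16 / c ^ 2) * c ^ 2 = 2 * c ^ 2 + 16 := by field_simp
        nlinarith
      nlinarith
    linarith
  have h6 : L * ‖∑ n ∈ Ico A B, f n * z ^ n‖ ≤ L * (c * N) := by nlinarith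
  exact le_of_mul_le_mul_left h6 hL0

theorem one_sub_pow_le (z : ℂ) (hz : ‖z‖ = 1) (k : ℕ) : ‖1 - z ^ k‖ ≤ k * ‖1 - z‖ := by
  induction k with
  | zero => simp
  | succ k ih =>
    have : 1 - z ^ (k + 1) = (1 - z ^ k) + z ^ k * (1 - z) := by ring
    rw [this]
    refine (norm_add_le _ _).trans ?_
    rw [norm_mul, norm_pow, hz, one_pow]
    push_cast
    linarith

theorem norm_sum_le_card {ι : Type*} (s : Finset ι) (a : ι → ℂ) (ha : ∀ i ∈ s, ‖a i‖ ≤ 1) :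
    ‖∑ i ∈ s, a i‖ ≤ #s := by
  refine (norm_sum_le _ _).trans ((sum_le_sum ha).trans (by simp))

def FU (g : ℕ → ℂ) (c : ℝ) (N : ℕ) : Prop :=
  ∀ z : ℂ, ‖z‖ = 1 → ∀ A B : ℕ, 2 * B ≤ N → ‖∑ n ∈ Ico A B, g n * z ^ n‖ ≤ c * N

theorem unif (c σm : ℝ) (hc : 0 < c) (hσm : 0 < σm) (W1 : ℕ) (hW1 : 0 < W1) :
    ∃ (W : ℕ) (σ : ℝ) (N0 : ℕ), 0 < W ∧ W1 ∣ W ∧ 0 < σ ∧ σ ≤ σm ∧ ∀ N, N0 ≤ N →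
      ∀ f : ℕ →*₀ ℂ, CM f →
        FU (fun n => f n - (1 / (⌊σ * N / W⌋₊ : ℂ)) * ∑ k ∈ range ⌊σ * N / W⌋₊, f (n + W * k)) c N := by
  obtain ⟨Q0, C0, hQ0, hC0, hdab⟩ := daboussi (c / 2) (by positivity)
  set σ := min σm (min (1 / 2) (c / (C0 + 2))) with hσ
  have hσ0 : 0 < σ := by
    rw [hσ]; refine lt_min hσm (lt_min (by norm_num) (by positivity))
  have hσ1 : σ ≤ 1 / 2 := (min_le_right _ _).trans (min_le_left _ _)
  have hσ2 : σ * (C0 + 2) ≤ c := by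
    have : σ ≤ c / (C0 + 2) := (min_le_right _ _).trans (min_le_right _ _)
    rwa [le_div_iff₀ (by positivity)] at this
  set W := W1 * Q0.factorial with hW
  have hW0 : 0 < W := Nat.mul_pos hW1 (Nat.factorial_pos _)
  have hWr : (0:ℝ) < W := by exact_mod_cast hW0
  refine ⟨W, σ, ⌈W / σ⌉₊ + 1, hW0, dvd_mul_right _ _, hσ0, min_le_left _ _, ?_⟩
  intro N hN f hf z hz A B hB
  have hN1 : 1 ≤ N := by omega
  have hL1 : 1 ≤ ⌊σ * N / W⌋₊ := by
    rw [Nat.le_floor_iff (by positivity)]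
    rw [le_div_iff₀ hWr]
    have h1 : (W:ℝ) / σ ≤ N := (Nat.le_ceil _).trans (by exact_mod_cast (by omega : ⌈(W:ℝ) / σ⌉₊ ≤ N))
    rw [div_le_iff₀ hσ0] at h1
    push_cast; linarith
  set L := ⌊σ * N / W⌋₊ with hL
  have hLW : (L : ℝ) * W ≤ σ * N := by
    have := Nat.floor_le (a := σ * N / W) (by positivity)
    rwa [le_div_iff₀ hWr] at this
  have hLc : (L : ℂ) ≠ 0 := by
    have : L ≠ 0 := by omega
    exact_mod_cast this
  have hkey : ∀ k ∈ range L, ‖∑ n ∈ Ico A B, (f n - f (n + W * k)) * z ^ n‖ ≤ c * N := by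
    intro k hk
    rw [mem_range] at hk
    have hkW : ((W * k : ℕ) : ℝ) ≤ σ * N := by
      have h2 : ((W * k : ℕ) : ℝ) ≤ L * W := by
        push_cast
        rw [mul_comm]
        gcongr
      linarith
    have hshift : z ^ (W * k) * ∑ n ∈ Ico A B, f (n + W * k) * z ^ n = ∑ n ∈ Ico (A + W * k) (B + W * k), f n * z ^ n := by
      rw [← sum_Ico_add' (fun n => f n * z ^ n) A B (W * k), mul_sum]
      refine sum_congr rfl fun n _ => ?_
      rw [pow_add]; ring
    have hzWk : ‖z ^ (W * k)‖ = 1 := by rw [norm_pow, hz, one_pow]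
    have hBN : B + W * k ≤ N := by
      have h3 : ((W * k : ℕ) : ℝ) ≤ 1 / 2 * N := by nlinarith
      have h4 : (2:ℝ) * B ≤ N := by exact_mod_cast hB
      have : (((B + W * k : ℕ)) : ℝ) ≤ N := by push_cast at *; linarith
      exact_mod_cast this
    simp only [sub_mul, sum_sub_distrib]
    rcases hdab f hf z hz N hN1 with ⟨d, hd1, hd2, hd3⟩ | hsmall
    · have hdW : d ∣ W * k := (((Nat.dvd_factorial (by omega) hd2).trans (dvd_mul_left _ _)).trans (dvd_mul_right W k))
      obtain ⟨j, hj⟩ := hdW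
      have hz1 : ‖1 - z ^ (W * k)‖ ≤ σ * C0 := by
        rw [hj, pow_mul]
        refine (one_sub_pow_le _ (by rw [norm_pow, hz, one_pow]) _).trans ?_
        have hj2 : (j : ℝ) ≤ σ * N := by
          refine le_trans ?_ hkW
          rw [hj]
          exact_mod_cast Nat.le_mul_of_pos_left j (by omega)
        calc (j:ℝ) * ‖1 - z ^ d‖ ≤ (σ * N) * (C0 / N) := by gcongr
          _ = σ * C0 := by field_simp
      have hd : ‖∑ n ∈ Ico A B, f n * z ^ n - ∑ n ∈ Ico (A + W * k) (B + W * k), f n * z ^ n‖ ≤ 2 * (σ * N) := by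
        have e : ∑ n ∈ Ico A B, f n * z ^ n - ∑ n ∈ Ico (A + W * k) (B + W * k), f n * z ^ n =
            ∑ n ∈ Ico A B \ Ico (A + W * k) (B + W * k), f n * z ^ n -
            ∑ n ∈ Ico (A + W * k) (B + W * k) \ Ico A B, f n * z ^ n := by
          rw [sum_sdiff_sub_sum_sdiff]
        rw [e]
        refine (norm_sub_le _ _).trans ?_
        have h1 : ∀ s : Finset ℕ, #s ≤ W * k → ‖∑ n ∈ s, f n * z ^ n‖ ≤ σ * N := by
          intro s hs
          refine (norm_sum_le_card _ _ ?_).trans (le_trans (by exact_mod_cast hs) hkW)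
          intro n _
          rw [norm_mul, norm_pow, hz]; simpa using hf.le n
        have := h1 (Ico A B \ Ico (A + W * k) (B + W * k)) (by
          calc _ ≤ #(Ico A (A + W * k)) := card_le_card (by intro n; simp only [mem_sdiff, mem_Ico]; omega)
            _ ≤ _ := by simp)
        have := h1 (Ico (A + W * k) (B + W * k) \ Ico A B) (by
          calc _ ≤ #(Ico B (B + W * k)) := card_le_card (by intro n; simp only [mem_sdiff, mem_Ico]; omega)
            _ ≤ _ := by simp)
        linarith
      have e : ∑ n ∈ Ico A B, f n * z ^ n - ∑ n ∈ Ico A B, f (n + W * k) * z ^ n =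
          (∑ n ∈ Ico A B, f n * z ^ n - ∑ n ∈ Ico (A + W * k) (B + W * k), f n * z ^ n) -
          (1 - z ^ (W * k)) * ∑ n ∈ Ico A B, f (n + W * k) * z ^ n := by
        rw [← hshift]; ring
      rw [e]
      refine (norm_sub_le _ _).trans ?_
      rw [norm_mul]
      have h5 : ‖∑ n ∈ Ico A B, f (n + W * k) * z ^ n‖ ≤ N := by
        refine (norm_sum_le_card _ _ ?_).trans ?_
        · intro n _
          rw [norm_mul, norm_pow, hz]; simpa using hf.le _
        · simp only [Nat.card_Ico]
          exact_mod_cast (by omega : B - A ≤ N)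
      calc _ ≤ 2 * (σ * N) + (σ * C0) * N := by gcongr
        _ = (σ * (C0 + 2)) * N := by ring
        _ ≤ c * N := by gcongr
    · refine (norm_sub_le _ _).trans ?_
      have h1 := hsmall A B (by omega)
      have h2 := hsmall (A + W * k) (B + W * k) hBN
      rw [← hshift, norm_mul, hzWk, one_mul] at h2
      linarith
  have e : ∑ n ∈ Ico A B, (f n - (1 / (L : ℂ)) * ∑ k ∈ range L, f (n + W * k)) * z ^ n =
      (1 / (L : ℂ)) * ∑ k ∈ range L, ∑ n ∈ Ico A B, (f n - f (n + W * k)) * z ^ n := by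
    rw [sum_comm, mul_sum]
    refine sum_congr rfl fun n _ => ?_
    rw [← sum_mul, sum_sub_distrib, sum_const, card_range, nsmul_eq_mul]
    field_simp
  rw [e, norm_mul, norm_div, norm_one, Complex.norm_natCast]
  calc 1 / (L:ℝ) * ‖∑ k ∈ range L, ∑ n ∈ Ico A B, (f n - f (n + W * k)) * z ^ n‖
      ≤ 1 / (L:ℝ) * ∑ k ∈ range L, c * N := by
        gcongr
        exact (norm_sum_le _ _).trans (sum_le_sum hkey)
    _ = c * N := by
        rw [sum_const, card_range, nsmul_eq_mul]; field_simp

theorem FU_AP {g : ℕ → ℂ} {c : ℝ} {N : ℕ} (h : FU g c N) (l ρ : ℕ) (hl : 0 < l) (z : ℂ) (hz : ‖z‖ = 1)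
    (A B : ℕ) (hB : 2 * (ρ + l * B) ≤ N) : ‖∑ k ∈ Ico A B, g (ρ + l * k) * z ^ k‖ ≤ c * N := by
  obtain ⟨w, hw⟩ := IsAlgClosed.exists_pow_nat_eq z hl
  have hwn : ‖w‖ = 1 := by
    have : ‖w‖ ^ l = 1 := by rw [← norm_pow, hw, hz]
    exact (pow_eq_one_iff_of_nonneg (norm_nonneg _) hl.ne').1 this
  set ζ := Complex.exp (2 * Real.pi * Complex.I / l) with hζ
  have hprim : IsPrimitiveRoot ζ l := Complex.isPrimitiveRoot_exp l hl.ne'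
  have hζn : ‖ζ‖ = 1 := hprim.norm'_eq_one hl.ne'
  have hζ0 : ζ ≠ 0 := by intro h0; rw [h0] at hζn; simp at hζn
  have hind : ∀ j : ℕ, ∑ i ∈ range l, (ζ ^ i) ^ j = if l ∣ j then (l : ℂ) else 0 := by
    intro j
    have e1 : ∀ i ∈ range l, (ζ ^ i) ^ j = (ζ ^ j) ^ i := by intro i _; rw [← pow_mul, ← pow_mul, mul_comm]
    rw [sum_congr rfl e1]
    split_ifs with hd
    · rw [(hprim.pow_eq_one_iff_dvd j).2 hd]; simp
    · have h1 : ζ ^ j ≠ 1 := fun h1 => hd ((hprim.pow_eq_one_iff_dvd j).1 h1)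
      have h2 := geom_sum_mul (ζ ^ j) l
      rw [← pow_mul, mul_comm j l, pow_mul, hprim.pow_eq_one, one_pow, sub_self] at h2
      exact (mul_eq_zero.1 h2).resolve_right (sub_ne_zero.2 h1)
  have key : (l : ℂ) * (w ^ ρ * ∑ k ∈ Ico A B, g (ρ + l * k) * z ^ k) =
      ∑ i ∈ range l, ((ζ ^ i) ^ ρ)⁻¹ * ∑ n ∈ Ico (ρ + l * A) (ρ + l * B), g n * (w * ζ ^ i) ^ n := by
    simp_rw [mul_sum]
    rw [sum_comm]
    have e2 : ∀ n ∈ Ico (ρ + l * A) (ρ + l * B), ∑ i ∈ range l, ((ζ ^ i) ^ ρ)⁻¹ * (g n * (w * ζ ^ i) ^ n) =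
        if l ∣ n - ρ then (l : ℂ) * (g n * w ^ n) else 0 := by
      intro n hn
      rw [mem_Ico] at hn
      have hn1 : ρ ≤ n := by omega
      have : ∀ i ∈ range l, ((ζ ^ i) ^ ρ)⁻¹ * (g n * (w * ζ ^ i) ^ n) = (g n * w ^ n) * (ζ ^ i) ^ (n - ρ) := by
        intro i _
        have h3 : (ζ ^ i) ^ n = (ζ ^ i) ^ ρ * (ζ ^ i) ^ (n - ρ) := by rw [← pow_add, Nat.add_sub_cancel' hn1]
        rw [mul_pow, h3]
        field_simp
      rw [sum_congr rfl this, ← mul_sum, hind]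
      split_ifs <;> ring
    rw [sum_congr rfl e2, ← sum_filter]
    refine sum_bij (fun k _ => ρ + l * k) ?_ ?_ ?_ ?_
    · intro k hk
      simp only [mem_filter, mem_Ico] at hk ⊢
      refine ⟨⟨?_, ?_⟩, ?_⟩
      · have := Nat.mul_le_mul_left l hk.1; omega
      · have := Nat.mul_lt_mul_of_pos_left hk.2 hl; omega
      · simp
    · intro a _ b _ hab
      have : l * a = l * b := by omega
      exact Nat.eq_of_mul_eq_mul_left hl this
    · intro n hn
      simp only [mem_filter, mem_Ico] at hn
      obtain ⟨⟨h1, h2⟩, k, hk⟩ := hn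
      have hn' : n = ρ + l * k := by omega
      refine ⟨k, ?_, hn'.symm⟩
      rw [mem_Ico]
      subst hn'
      exact ⟨Nat.le_of_mul_le_mul_left (by omega : l * A ≤ l * k) hl, Nat.lt_of_mul_lt_mul_left (by omega : l * k < l * B)⟩
    · intro k _
      rw [pow_add, pow_mul, hw]; ring
  have hlr : (0:ℝ) < l := by exact_mod_cast hl
  have h6 : (l : ℝ) * ‖∑ k ∈ Ico A B, g (ρ + l * k) * z ^ k‖ ≤ l * (c * N) := by
    calc (l : ℝ) * ‖∑ k ∈ Ico A B, g (ρ + l * k) * z ^ k‖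
        = ‖(l : ℂ) * (w ^ ρ * ∑ k ∈ Ico A B, g (ρ + l * k) * z ^ k)‖ := by
          rw [norm_mul, norm_mul, norm_pow, hwn, Complex.norm_natCast]; simp
      _ ≤ ∑ i ∈ range l, c * N := by
          rw [key]
          refine (norm_sum_le _ _).trans (sum_le_sum fun i _ => ?_)
          rw [norm_mul, norm_inv, norm_pow, norm_pow, hζn]
          simp only [one_pow, inv_one, one_mul]
          exact h _ (by rw [norm_mul, norm_pow, hwn, hζn]; simp) _ _ hB
      _ = _ := by simp
  exact le_of_mul_le_mul_left h6 hlr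

section energy
set_option linter.unusedSectionVars false
variable {G : Type*} [AddCommGroup G] [Fintype G]

noncomputable def av (b : G) (L : ℕ) (φ : G → ℂ) (x : G) : ℂ := (1 / (L : ℂ)) * ∑ k ∈ range L, φ (x + k • b)
noncomputable def Hm (b : G) (L : ℕ) (φ : G → ℂ) (x : G) : ℂ := (1 / (L : ℂ)) * ∑ k ∈ range L, av b L φ (x - k • b)

theorem avg_norm_le (L : ℕ) (F : ℕ → ℂ) (B : ℝ) (hB : 0 ≤ B) (h : ∀ k, k < L → ‖F k‖ ≤ B) :
    ‖(1 / (L : ℂ)) * ∑ k ∈ range L, F k‖ ≤ B := by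
  rcases Nat.eq_zero_or_pos L with rfl | hL
  · simpa using hB
  · have hLr : (0:ℝ) < L := by exact_mod_cast hL
    rw [norm_mul, norm_div, norm_one, Complex.norm_natCast]
    calc 1 / (L:ℝ) * ‖∑ k ∈ range L, F k‖ ≤ 1 / (L:ℝ) * ∑ k ∈ range L, B := by
          gcongr
          exact (norm_sum_le _ _).trans (sum_le_sum fun k hk => h k (mem_range.1 hk))
      _ = B := by rw [sum_const, card_range, nsmul_eq_mul]; field_simp

theorem avg_sq_le (L : ℕ) (F : ℕ → G → ℂ) (B : ℝ) (hB : 0 ≤ B) (h : ∀ k, k < L → ∑ x, ‖F k x‖ ^ 2 ≤ B) :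
    ∑ x, ‖(1 / (L : ℂ)) * ∑ k ∈ range L, F k x‖ ^ 2 ≤ B := by
  rcases Nat.eq_zero_or_pos L with rfl | hL
  · simpa using hB
  · have hLr : (0:ℝ) < L := by exact_mod_cast hL
    have h1 : ∀ x, ‖(1 / (L : ℂ)) * ∑ k ∈ range L, F k x‖ ^ 2 ≤ (1 / (L:ℝ)) * ∑ k ∈ range L, ‖F k x‖ ^ 2 := by
      intro x
      have h2 := cs_sum_one (range L) (fun _ => 1) (fun k => F k x) (by simp)
      simp only [one_mul, card_range] at h2
      rw [norm_mul, norm_div, norm_one, Complex.norm_natCast, mul_pow]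
      calc (1 / (L:ℝ)) ^ 2 * ‖∑ k ∈ range L, F k x‖ ^ 2 ≤ (1 / (L:ℝ)) ^ 2 * (L * ∑ k ∈ range L, ‖F k x‖ ^ 2) := by gcongr
        _ = _ := by field_simp
    calc _ ≤ ∑ x, (1 / (L:ℝ)) * ∑ k ∈ range L, ‖F k x‖ ^ 2 := sum_le_sum fun x _ => h1 x
      _ = (1 / (L:ℝ)) * ∑ k ∈ range L, ∑ x, ‖F k x‖ ^ 2 := by rw [← mul_sum, sum_comm]
      _ ≤ (1 / (L:ℝ)) * ∑ k ∈ range L, B := by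
          gcongr with k hk
          exact h k (mem_range.1 hk)
      _ = B := by rw [sum_const, card_range, nsmul_eq_mul]; field_simp

theorem av_le (b : G) (L : ℕ) (φ : G → ℂ) (hφ : ∀ x, ‖φ x‖ ≤ 1) (x : G) : ‖av b L φ x‖ ≤ 1 :=
  avg_norm_le L _ 1 zero_le_one fun _ _ => hφ _

theorem Hm_le (b : G) (L : ℕ) (φ : G → ℂ) (hφ : ∀ x, ‖φ x‖ ≤ 1) (x : G) : ‖Hm b L φ x‖ ≤ 1 :=
  avg_norm_le L _ 1 zero_le_one fun _ _ => av_le b L φ hφ _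

theorem sum_shift (F : G → ℝ) (c : G) : ∑ x, F (x + c) = ∑ x, F x := Equiv.sum_comp (Equiv.addRight c) F

theorem av_sq_le (b : G) (L : ℕ) (φ : G → ℂ) : ∑ x, ‖av b L φ x‖ ^ 2 ≤ ∑ x, ‖φ x‖ ^ 2 := by
  refine avg_sq_le L (fun k x => φ (x + k • b)) _ (sum_nonneg fun _ _ => by positivity) fun k _ => le_of_eq ?_
  exact sum_shift (fun x => ‖φ x‖ ^ 2) _

theorem Hm_sq_le (b : G) (L : ℕ) (φ : G → ℂ) : ∑ x, ‖Hm b L φ x‖ ^ 2 ≤ ∑ x, ‖av b L φ x‖ ^ 2 := by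
  refine avg_sq_le L (fun k x => av b L φ (x - k • b)) _ (sum_nonneg fun _ _ => by positivity) fun k _ => le_of_eq ?_
  simp_rw [sub_eq_add_neg]
  exact sum_shift (fun x => ‖av b L φ x‖ ^ 2) _

theorem av_lip (b : G) (L : ℕ) (hL : 0 < L) (φ : G → ℂ) (hφ : ∀ x, ‖φ x‖ ≤ 1) (x : G) (k : ℕ) :
    ‖av b L φ (x + k • b) - av b L φ x‖ ≤ 2 * k / L := by
  have h1 : ∀ x, ‖av b L φ (x + b) - av b L φ x‖ ≤ 2 / L := by
    intro x
    have : av b L φ (x + b) - av b L φ x = (1 / (L : ℂ)) * (φ (x + L • b) - φ x) := by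
      unfold av
      rw [← mul_sub]
      congr 1
      have e1 := sum_range_succ (fun k => φ (x + k • b)) L
      have e2 := sum_range_succ' (fun k => φ (x + k • b)) L
      simp only [zero_smul, add_zero] at e2
      have e3 : ∀ k ∈ range L, φ (x + b + k • b) = φ (x + (k + 1) • b) := by
        intro k _; rw [add_smul, one_smul, add_assoc, add_comm b]
      rw [sum_congr rfl e3]
      linear_combination e1 - e2
    rw [this, norm_mul, norm_div, norm_one, Complex.norm_natCast]
    calc 1 / (L:ℝ) * ‖φ (x + L • b) - φ x‖ ≤ 1 / (L:ℝ) * (1 + 1) := by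
          gcongr
          exact (norm_sub_le _ _).trans (add_le_add (hφ _) (hφ _))
      _ = 2 / L := by ring
  induction k with
  | zero => simp
  | succ k ih =>
    have e : av b L φ (x + (k + 1) • b) - av b L φ x =
        (av b L φ (x + k • b + b) - av b L φ (x + k • b)) + (av b L φ (x + k • b) - av b L φ x) := by
      rw [add_smul, one_smul, ← add_assoc]; ring
    rw [e]
    refine (norm_add_le _ _).trans ((add_le_add (h1 _) ih).trans (le_of_eq ?_))
    push_cast; ring

theorem Hm_lip (b : G) (L : ℕ) (hL : 0 < L) (φ : G → ℂ) (hφ : ∀ x, ‖φ x‖ ≤ 1) (x : G) (k : ℕ) :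
    ‖Hm b L φ (x + k • b) - Hm b L φ x‖ ≤ 2 * k / L := by
  unfold Hm
  rw [← mul_sub, ← sum_sub_distrib]
  refine avg_norm_le L _ _ (by positivity) fun j _ => ?_
  have : x + k • b - j • b = (x - j • b) + k • b := by abel
  rw [this]
  exact av_lip b L hL φ hφ _ k

theorem Hm_lip_int (b : G) (L : ℕ) (hL : 0 < L) (φ : G → ℂ) (hφ : ∀ x, ‖φ x‖ ≤ 1) (x y : G) (k : ℤ)
    (h : y = x + k • b) : ‖Hm b L φ y - Hm b L φ x‖ ≤ 2 * |(k : ℝ)| / L := by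
  subst h
  obtain ⟨n, rfl | rfl⟩ := k.eq_nat_or_neg
  · have := Hm_lip b L hL φ hφ x n
    simpa using this
  · have := Hm_lip b L hL φ hφ (x + (-(n:ℤ)) • b) n
    rw [norm_sub_rev] at this
    simpa using this

theorem energy_i (b c o : G) (L T : ℕ) (hL : 0 < L) (hT : 0 < T) (φ : G → ℂ) (hφ : ∀ x, ‖φ x‖ ≤ 1)
    (ko kc : ℕ) (ho : o = ko • b) (hc : c = kc • b) :
    ∑ x, ‖av c T φ (x + o) - Hm b L φ x‖ ^ 2 ≤ ∑ x, ‖av c T φ x‖ ^ 2 - ∑ x, ‖av b L φ x‖ ^ 2 +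
      4 * (ko + kc * T) / L * Fintype.card G := by
  have hTc : (T:ℂ) ≠ 0 := by exact_mod_cast hT.ne'
  set ψ := fun x => av c T φ (x + o) with hψ
  have e1 : ∑ x, ‖ψ x - Hm b L φ x‖ ^ 2 = ∑ x, ‖ψ x‖ ^ 2 + ∑ x, ‖Hm b L φ x‖ ^ 2 -
      2 * (∑ x, ψ x * conj (Hm b L φ x)).re := by
    rw [Complex.re_sum, mul_sum, ← sum_add_distrib, ← sum_sub_distrib]
    refine sum_congr rfl fun x _ => ?_
    rw [← Complex.normSq_eq_norm_sq, ← Complex.normSq_eq_norm_sq, ← Complex.normSq_eq_norm_sq, Complex.normSq_sub]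
  have e2 : ∑ x, ‖ψ x‖ ^ 2 = ∑ x, ‖av c T φ x‖ ^ 2 := sum_shift (fun x => ‖av c T φ x‖ ^ 2) o
  have e3 : ∑ x, ψ x * conj (Hm b L φ x) = ∑ x, ((1 / (L:ℂ)) * ∑ k ∈ range L, ψ (x + k • b)) * conj (av b L φ x) := by
    unfold Hm
    simp_rw [map_mul, map_sum, mul_sum, sum_mul]
    rw [sum_comm, sum_comm (s := univ)]
    refine sum_congr rfl fun k _ => ?_
    rw [← Equiv.sum_comp (Equiv.addRight (k • b))]
    refine sum_congr rfl fun x _ => ?_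
    simp only [Equiv.coe_addRight, add_sub_cancel_right]
    simp; ring
  have e4 : ∀ x, (1 / (L:ℂ)) * ∑ k ∈ range L, ψ (x + k • b) = (1 / (T:ℂ)) * ∑ t ∈ range T, av b L φ (x + (ko + t * kc) • b) := by
    intro x
    simp_rw [hψ, av, mul_sum]
    rw [sum_comm]
    refine sum_congr rfl fun t _ => sum_congr rfl fun k _ => ?_
    rw [ho, hc, smul_smul, add_smul]
    have : x + k • b + ko • b + (t * kc) • b = x + (ko • b + (t * kc) • b) + k • b := by abel
    rw [this]; ring
  have e5 : ∀ x, ‖(1 / (L:ℂ)) * ∑ k ∈ range L, ψ (x + k • b) - av b L φ x‖ ≤ 2 * (ko + kc * T) / L := by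
    intro x
    rw [e4]
    have : (1 / (T:ℂ)) * ∑ t ∈ range T, av b L φ (x + (ko + t * kc) • b) - av b L φ x =
        (1 / (T:ℂ)) * ∑ t ∈ range T, (av b L φ (x + (ko + t * kc) • b) - av b L φ x) := by
      rw [sum_sub_distrib, sum_const, card_range, nsmul_eq_mul]
      field_simp
    rw [this]
    refine avg_norm_le T _ _ (by positivity) fun t ht => ?_
    refine (av_lip b L hL φ hφ x _).trans ?_
    gcongr
    push_cast
    have : (t:ℝ) ≤ T := by exact_mod_cast ht.le
    nlinarith [(Nat.cast_nonneg kc : (0:ℝ) ≤ kc)]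
  have e6 : ∑ x, ‖av b L φ x‖ ^ 2 - 2 * (ko + kc * T) / L * Fintype.card G ≤ (∑ x, ψ x * conj (Hm b L φ x)).re := by
    rw [e3, Complex.re_sum]
    have : (2 * (ko + kc * T) / L * Fintype.card G : ℝ) = ∑ x : G, (2 * (ko + kc * T) / L : ℝ) := by
      rw [sum_const, card_univ, nsmul_eq_mul]; ring
    rw [this, ← sum_sub_distrib]
    refine sum_le_sum fun x _ => ?_
    set u := (1 / (L:ℂ)) * ∑ k ∈ range L, ψ (x + k • b) with hu
    have h1 : u * conj (av b L φ x) = (u - av b L φ x) * conj (av b L φ x) + ((‖av b L φ x‖ ^ 2 : ℝ) : ℂ) := by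
      rw [Complex.ofReal_pow, ← Complex.mul_conj']; ring
    rw [h1, Complex.add_re, Complex.ofReal_re]
    have h2 : -‖(u - av b L φ x) * conj (av b L φ x)‖ ≤ ((u - av b L φ x) * conj (av b L φ x)).re :=
      (abs_le.1 (Complex.abs_re_le_norm _)).1
    have h3 : ‖(u - av b L φ x) * conj (av b L φ x)‖ ≤ 2 * (ko + kc * T) / L := by
      rw [norm_mul, RCLike.norm_conj]
      exact (mul_le_of_le_one_right (norm_nonneg _) (av_le b L φ hφ x)).trans (e5 x)
    linarith
  have e7 := Hm_sq_le b L φ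
  change ∑ x, ‖ψ x - Hm b L φ x‖ ^ 2 ≤ _
  rw [e1, e2]
  have e8 : (4 * (ko + kc * T) / L * Fintype.card G : ℝ) = 2 * (2 * (ko + kc * T) / L * Fintype.card G) := by ring
  linarith

theorem energy_ii (c : G) (L' T d : ℕ) (hT : 0 < T) (hL' : 0 < L') (φ : G → ℂ) (hφ : ∀ x, ‖φ x‖ ≤ 1) :
    ∑ x, ‖av c T φ x‖ ^ 2 ≤ ∑ x, ‖av (d • c) L' φ x‖ ^ 2 + 4 * (d * L') / T * Fintype.card G := by
  have hLc : (L':ℂ) ≠ 0 := by exact_mod_cast hL'.ne'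
  have hcomm : ∀ x, av (d • c) L' (av c T φ) x = av c T (av (d • c) L' φ) x := by
    intro x
    simp_rw [av, mul_sum]
    rw [sum_comm]
    refine sum_congr rfl fun t _ => sum_congr rfl fun k _ => ?_
    rw [add_right_comm]; ring
  have hd : ∀ x, ‖av c T φ x‖ ^ 2 ≤ ‖av c T (av (d • c) L' φ) x‖ ^ 2 + 4 * (d * L') / T := by
    intro x
    rw [← hcomm]
    have h1 : ‖av c T φ x - av (d • c) L' (av c T φ) x‖ ≤ 2 * (d * L') / T := by
      have : av c T φ x - av (d • c) L' (av c T φ) x = -((1 / (L':ℂ)) * ∑ k ∈ range L', (av c T φ (x + k • d • c) - av c T φ x)) := by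
        rw [sum_sub_distrib, sum_const, card_range, nsmul_eq_mul]
        simp only [av]
        field_simp
        ring
      rw [this, norm_neg]
      refine avg_norm_le L' _ _ (by positivity) fun k hk => ?_
      rw [smul_smul]
      refine (av_lip c T hT φ hφ x _).trans ?_
      gcongr
      push_cast
      have : (k:ℝ) ≤ L' := by exact_mod_cast hk.le
      nlinarith [(Nat.cast_nonneg d : (0:ℝ) ≤ d)]
    have h2 := av_le c T φ hφ x
    have h4 := norm_sub_norm_le (av c T φ x) (av (d • c) L' (av c T φ) x)
    have h5 : (4 * (d * L') / T : ℝ) = 2 * (2 * (d * L') / T) := by ring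
    rw [h5]
    have h6 : ‖av c T φ x‖ - ‖av (d • c) L' (av c T φ) x‖ ≤ 2 * (d * L') / T := h4.trans h1
    have h7 : (0:ℝ) ≤ 2 * (d * L') / T := by positivity
    have h8 := norm_nonneg (av c T φ x)
    have h9 := norm_nonneg (av (d • c) L' (av c T φ) x)
    generalize (2 * (d * L') / T : ℝ) = q at *
    nlinarith [mul_le_mul_of_nonneg_right h6 (add_nonneg h8 h9)]
  calc _ ≤ ∑ x, (‖av c T (av (d • c) L' φ) x‖ ^ 2 + 4 * (d * L') / T) := sum_le_sum fun x _ => hd x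
    _ = ∑ x, ‖av c T (av (d • c) L' φ) x‖ ^ 2 + 4 * (d * L') / T * Fintype.card G := by
        rw [sum_add_distrib, sum_const, card_univ, nsmul_eq_mul]; ring
    _ ≤ _ := by
        have := av_sq_le c T (av (d • c) L' φ)
        linarith

end energy

theorem FU.nonneg {g : ℕ → ℂ} {c : ℝ} {N : ℕ} (h : FU g c N) : 0 ≤ c * N := by
  have := h 1 (by simp) 0 0 (by omega)
  simpa using this

theorem FU_int {g : ℤ → ℂ} {c : ℝ} {N : ℕ} (h : FU (fun n : ℕ => g n) c N) (β l : ℤ) (hl0 : l ≠ 0) (hl : 4 * |l| ≤ N)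
    (s : Finset ℤ) (hs : (s : Set ℤ).OrdConnected) (hv : ∀ k ∈ s, 0 ≤ β + l * k ∧ 4 * (β + l * k) ≤ N) :
    ‖∑ k ∈ s, g (β + l * k)‖ ≤ c * N := by
  obtain ⟨a, b, hab, rfl⟩ := ordc_int s hs
  rcases hab.eq_or_lt with rfl | hab'
  · simpa using h.nonneg
  have ha := hv a (by simp; omega)
  have hb := hv (b - 1) (by simp; omega)
  rcases lt_or_gt_of_ne hl0 with hneg | hpos
  · rw [abs_of_neg hneg] at hl
    have e : ∑ k ∈ Ico a b, g (β + l * k) =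
        ∑ i ∈ Ico 0 (b - a).toNat, g (((β + l * (b - 1)).toNat + (-l).toNat * i : ℕ)) * 1 ^ i := by
      refine sum_bij' (fun k _ => (b - 1 - k).toNat) (fun i _ => b - 1 - i) ?_ ?_ ?_ ?_ ?_
      · intro k hk; simp only [mem_Ico] at hk ⊢; omega
      · intro k hk; simp only [mem_Ico] at hk ⊢; omega
      · intro k hk; simp only [mem_Ico] at hk ⊢; omega
      · intro k hk; simp only [mem_Ico] at hk ⊢; omega
      · intro k hk
        simp only [mem_Ico] at hk
        rw [one_pow, mul_one]
        congr 1
        push_cast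
        rw [Int.toNat_of_nonneg hb.1, Int.toNat_of_nonneg (by omega : 0 ≤ -l), Int.toNat_of_nonneg (by omega : 0 ≤ b - 1 - k)]
        ring
    rw [e]
    refine FU_AP h (-l).toNat _ (by omega) 1 (by simp) 0 _ ?_
    zify
    rw [Int.toNat_of_nonneg hb.1, Int.toNat_of_nonneg (by omega : 0 ≤ -l), Int.toNat_of_nonneg (by omega : 0 ≤ b - a)]
    have : 2 * (β + l * (b - 1) + -l * (b - a)) = 2 * (β + l * a) - 2 * l := by ring
    rw [this]
    omega
  · rw [abs_of_pos hpos] at hl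
    have e : ∑ k ∈ Ico a b, g (β + l * k) =
        ∑ i ∈ Ico 0 (b - a).toNat, g (((β + l * a).toNat + l.toNat * i : ℕ)) * 1 ^ i := by
      refine sum_bij' (fun k _ => (k - a).toNat) (fun i _ => a + i) ?_ ?_ ?_ ?_ ?_
      · intro k hk; simp only [mem_Ico] at hk ⊢; omega
      · intro k hk; simp only [mem_Ico] at hk ⊢; omega
      · intro k hk; simp only [mem_Ico] at hk ⊢; omega
      · intro k hk; simp only [mem_Ico] at hk ⊢; omega
      · intro k hk
        simp only [mem_Ico] at hk
        rw [one_pow, mul_one]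
        congr 1
        push_cast
        rw [Int.toNat_of_nonneg ha.1, Int.toNat_of_nonneg (by omega : 0 ≤ l), Int.toNat_of_nonneg (by omega : 0 ≤ k - a)]
        ring
    rw [e]
    refine FU_AP h l.toNat _ (by omega) 1 (by simp) 0 _ ?_
    zify
    rw [Int.toNat_of_nonneg ha.1, Int.toNat_of_nonneg (by omega : 0 ≤ l), Int.toNat_of_nonneg (by omega : 0 ≤ b - a)]
    have : 2 * (β + l * a + l * (b - a)) = 2 * (β + l * (b - 1)) + 2 * l := by ring
    rw [this]
    omega

theorem mslot_pair {g : ℤ → ℂ} {c : ℝ} {N : ℕ} (h : FU (fun n : ℕ => g n) c N) (hg : ∀ n, ‖g n‖ ≤ 2)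
    (X Y p q p' q' : ℤ) (hX : 0 ≤ X) (hY : 0 ≤ Y) (hp : 0 < p) (hq : 0 < q)
    (hne : p' * q - q' * p ≠ 0) (hstep : 4 * |p' * q - q' * p| ≤ N)
    (hv : ∀ x y, 0 ≤ x → x < X → Y ≤ y → y < 2 * Y → 0 ≤ p' * y - q' * x ∧ 4 * (p' * y - q' * x) ≤ N) :
    ‖∑ z ∈ Ico 0 X ×ˢ Ico Y (2 * Y), g (p * z.2 - q * z.1) * conj (g (p' * z.2 - q' * z.1))‖ ≤
      (p * Y + q * X + q * p : ℝ) * (2 * (c * N)) := by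
  set π : ℤ × ℤ → ℤ × ℤ := fun z => (z.1 % p, z.2 - q * (z.1 / p)) with hπ
  set Lset := Ico 0 p ×ˢ Ico (Y - q * (X / p + 1)) (2 * Y) with hLs
  have hmap : ∀ z ∈ Ico 0 X ×ˢ Ico Y (2 * Y), π z ∈ Lset := by
    rintro ⟨x, y⟩ hz
    simp only [mem_product, mem_Ico, hLs, hπ] at hz ⊢
    obtain ⟨⟨h1, h2⟩, h3, h4⟩ := hz
    have h5 : 0 ≤ x / p := Int.ediv_nonneg h1 hp.le
    have h6 : x / p ≤ X / p := Int.ediv_le_ediv hp (by omega)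
    refine ⟨⟨Int.emod_nonneg _ hp.ne', Int.emod_lt_of_pos _ hp⟩, ?_, ?_⟩
    · nlinarith
    · nlinarith
  rw [← sum_fiberwise_of_maps_to hmap]
  have hfib : ∀ l ∈ Lset, ‖∑ z ∈ Ico 0 X ×ˢ Ico Y (2 * Y) with π z = l,
      g (p * z.2 - q * z.1) * conj (g (p' * z.2 - q' * z.1))‖ ≤ 2 * (c * N) := by
    rintro ⟨x0, y0⟩ hl
    simp only [mem_product, mem_Ico, hLs] at hl
    set s := {k ∈ Ico 0 (X + 1) | (0 ≤ x0 + p * k ∧ x0 + p * k < X) ∧ (Y ≤ y0 + q * k ∧ y0 + q * k < 2 * Y)} with hs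
    have hsm : ∀ k, k ∈ s ↔ (0 ≤ k ∧ k < X + 1) ∧ (0 ≤ x0 + p * k ∧ x0 + p * k < X) ∧ (Y ≤ y0 + q * k ∧ y0 + q * k < 2 * Y) := by
      intro k; simp only [hs, mem_filter, mem_Ico]
    have e : ∑ z ∈ Ico 0 X ×ˢ Ico Y (2 * Y) with π z = (x0, y0), g (p * z.2 - q * z.1) * conj (g (p' * z.2 - q' * z.1)) =
        g (p * y0 - q * x0) * conj (∑ k ∈ s, g ((p' * y0 - q' * x0) + (p' * q - q' * p) * k)) := by
      rw [map_sum, mul_sum]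
      refine sum_bij' (fun z _ => z.1 / p) (fun k _ => (x0 + p * k, y0 + q * k)) ?_ ?_ ?_ ?_ ?_
      · rintro ⟨x, y⟩ hz
        simp only [mem_filter, mem_product, mem_Ico, hπ, Prod.mk.injEq] at hz
        obtain ⟨⟨⟨h1, h2⟩, h3, h4⟩, h5, h6⟩ := hz
        have h7 := Int.emod_add_mul_ediv x p
        have h8 : 0 ≤ x / p := Int.ediv_nonneg h1 hp.le
        have h9 : x / p ≤ x := Int.ediv_le_self _ h1
        rw [hsm]
        refine ⟨⟨h8, by show x / p < X + 1; omega⟩, ⟨?_, ?_⟩, ?_, ?_⟩ <;> simp only <;> omega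
      · intro k hk
        rw [hsm] at hk
        obtain ⟨⟨h0, _⟩, ⟨h1, h2⟩, h3, h4⟩ := hk
        simp only [mem_filter, mem_product, mem_Ico, hπ, Prod.mk.injEq]
        have hx : (x0 + p * k) / p = k := by
          rw [Int.add_mul_ediv_left _ _ hp.ne', Int.ediv_eq_zero_of_lt hl.1.1 hl.1.2]; ring
        refine ⟨⟨⟨h1, h2⟩, h3, h4⟩, ?_, ?_⟩
        · rw [Int.add_mul_emod_self_left, Int.emod_eq_of_lt hl.1.1 hl.1.2]
        · rw [hx]; ring
      · rintro ⟨x, y⟩ hz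
        simp only [mem_filter, mem_product, mem_Ico, hπ, Prod.mk.injEq] at hz ⊢
        obtain ⟨⟨⟨h1, h2⟩, h3, h4⟩, h5, h6⟩ := hz
        have h7 := Int.emod_add_mul_ediv x p
        constructor
        · omega
        · omega
      · intro k hk
        simp only
        rw [Int.add_mul_ediv_left _ _ hp.ne', Int.ediv_eq_zero_of_lt hl.1.1 hl.1.2]; ring
      · rintro ⟨x, y⟩ hz
        simp only [mem_filter, mem_product, mem_Ico, hπ, Prod.mk.injEq] at hz ⊢
        obtain ⟨⟨⟨h1, h2⟩, h3, h4⟩, h5, h6⟩ := hz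
        have h7 := Int.emod_add_mul_ediv x p
        have hx : x = x0 + p * (x / p) := by omega
        have hy : y = y0 + q * (x / p) := by omega
        congr 2
        · generalize x / p = k at *
          rw [hx, hy]; ring
        · generalize x / p = k at *
          rw [hx, hy]; ring_nf
    rw [e, norm_mul, RCLike.norm_conj]
    have hoc : (s : Set ℤ).OrdConnected := by
      constructor
      intro x hx y hy w hw
      rw [mem_coe, hsm] at *
      obtain ⟨hw1, hw2⟩ := hw
      have := mul_le_mul_of_nonneg_left hw1 hp.le
      have := mul_le_mul_of_nonneg_left hw2 hp.le
      have := mul_le_mul_of_nonneg_left hw1 hq.le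
      have := mul_le_mul_of_nonneg_left hw2 hq.le
      omega
    have h1 := FU_int h (p' * y0 - q' * x0) _ hne hstep s hoc (by
      intro k hk
      rw [hsm] at hk
      have := hv (x0 + p * k) (y0 + q * k) hk.2.1.1 hk.2.1.2 hk.2.2.1 hk.2.2.2
      have e2 : p' * y0 - q' * x0 + (p' * q - q' * p) * k = p' * (y0 + q * k) - q' * (x0 + p * k) := by ring
      rw [e2]; exact this)
    have := hg (p * y0 - q * x0)
    gcongr
  have hcard : (#Lset : ℝ) ≤ p * Y + q * X + q * p := by
    rw [hLs, card_product, Int.card_Ico, Int.card_Ico]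
    have h1 : X / p * p ≤ X := Int.ediv_mul_le _ hp.ne'
    have h2 : 0 ≤ X / p := Int.ediv_nonneg hX hp.le
    have h3 : ((((p - 0).toNat * (2 * Y - (Y - q * (X / p + 1))).toNat : ℕ)) : ℤ) ≤ p * Y + q * X + q * p := by
      push_cast
      rw [Int.toNat_of_nonneg (by omega), Int.toNat_of_nonneg (by nlinarith)]
      nlinarith
    exact_mod_cast h3
  refine (norm_sum_le _ _).trans ((sum_le_sum hfib).trans ?_)
  rw [sum_const, nsmul_eq_mul]
  have := h.nonneg
  gcongr

theorem cs_weight' {ι κ : Type*} (s s' : Finset ι) (hss : s ⊆ s') (t : Finset κ) (d : ι → ℂ) (hd : ∀ i ∈ s, ‖d i‖ ≤ 1)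
    (F : κ → ι → ℂ) :
    (∑ j ∈ t, ‖∑ i ∈ s, d i * F j i‖) ^ 2 ≤ #s * ∑ j ∈ t, ∑ j' ∈ t, ‖∑ i ∈ s', F j i * conj (F j' i)‖ := by
  have hθ : ∀ j, ∃ θ : ℂ, ‖θ‖ = 1 ∧ (‖∑ i ∈ s, d i * F j i‖ : ℂ) = θ * ∑ i ∈ s, d i * F j i := by
    intro j
    set w := ∑ i ∈ s, d i * F j i
    by_cases hw : w = 0
    · exact ⟨1, by simp, by simp [hw]⟩
    · have hn : (‖w‖ : ℂ) ≠ 0 := by exact_mod_cast norm_ne_zero_iff.2 hw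
      refine ⟨conj w / ‖w‖, ?_, ?_⟩
      · rw [norm_div, RCLike.norm_conj, Complex.norm_real, norm_norm, div_self]
        exact norm_ne_zero_iff.2 hw
      · have : conj w * w = (‖w‖ : ℂ) ^ 2 := by rw [mul_comm, Complex.mul_conj']
        field_simp
        linear_combination -this
  choose θ hθ1 hθ2 using hθ
  have e1 : ((∑ j ∈ t, ‖∑ i ∈ s, d i * F j i‖ : ℝ) : ℂ) = ∑ i ∈ s, d i * ∑ j ∈ t, θ j * F j i := by
    push_cast
    simp_rw [hθ2, mul_sum]
    rw [sum_comm]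
    refine sum_congr rfl fun i _ => sum_congr rfl fun j _ => ?_
    ring
  have e2 : (∑ j ∈ t, ‖∑ i ∈ s, d i * F j i‖) = ‖∑ i ∈ s, d i * ∑ j ∈ t, θ j * F j i‖ := by
    rw [← e1, Complex.norm_real, Real.norm_of_nonneg (sum_nonneg fun _ _ => norm_nonneg _)]
  rw [e2]
  refine (cs_sum_one s _ _ hd).trans ?_
  gcongr
  refine (sum_le_sum_of_subset_of_nonneg hss fun _ _ _ => sq_nonneg _).trans ?_
  refine (sum_sqnorm_le _ _ _).trans ?_
  refine sum_le_sum fun j _ => sum_le_sum fun j' _ => le_of_eq ?_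
  have : ∑ i ∈ s', θ j * F j i * conj (θ j' * F j' i) = (θ j * conj (θ j')) * ∑ i ∈ s', F j i * conj (F j' i) := by
    rw [mul_sum]
    refine sum_congr rfl fun i _ => ?_
    rw [map_mul]; ring
  rw [this, norm_mul, norm_mul, RCLike.norm_conj, hθ1, hθ1, one_mul, one_mul]

theorem cs_weight {ι κ : Type*} (s : Finset ι) (t : Finset κ) (d : ι → ℂ) (hd : ∀ i ∈ s, ‖d i‖ ≤ 1)
    (F : κ → ι → ℂ) :
    (∑ j ∈ t, ‖∑ i ∈ s, d i * F j i‖) ^ 2 ≤ #s * ∑ j ∈ t, ∑ j' ∈ t, ‖∑ i ∈ s, F j i * conj (F j' i)‖ :=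
  cs_weight' s s subset_rfl t d hd F

theorem mslot {g : ℤ → ℂ} {c : ℝ} {N : ℕ} (h : FU (fun n : ℕ => g n) c N) (hg : ∀ n, ‖g n‖ ≤ 2)
    (T : ℕ) (X Y : ℤ) (p q : ℕ → ℤ) (M : ℝ) (hX : 0 ≤ X) (hY : 0 ≤ Y) (hp : ∀ t < T, 0 < p t) (hq : ∀ t < T, 0 < q t)
    (hne : ∀ t < T, ∀ t' < T, t ≠ t' → p t' * q t - q t' * p t ≠ 0)
    (hstep : ∀ t < T, ∀ t' < T, 4 * |p t' * q t - q t' * p t| ≤ N)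
    (hM : ∀ t < T, (p t * Y + q t * X + q t * p t : ℝ) ≤ M)
    (hv : ∀ t < T, ∀ x y, 0 ≤ x → x < X → Y ≤ y → y < 2 * Y → 0 ≤ p t * y - q t * x ∧ 4 * (p t * y - q t * x) ≤ N)
    (d : ℤ × ℤ → ℂ) (hd : ∀ z, ‖d z‖ ≤ 1) :
    (∑ t ∈ range T, ‖∑ z ∈ Ico 0 X ×ˢ Ico Y (2 * Y), d z * g (p t * z.2 - q t * z.1)‖) ^ 2 ≤
      (X * Y : ℝ) * (4 * T * (X * Y) + T ^ 2 * (M * (2 * (c * N)))) := by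
  have hcard : (#(Ico 0 X ×ˢ Ico Y (2 * Y)) : ℝ) = X * Y := by
    rw [card_product, Int.card_Ico, Int.card_Ico]
    have : (((X - 0).toNat * (2 * Y - Y).toNat : ℕ) : ℤ) = X * Y := by
      push_cast
      rw [Int.toNat_of_nonneg (by omega), Int.toNat_of_nonneg (by omega)]; ring
    exact_mod_cast this
  have hc := h.nonneg
  refine (cs_weight _ _ d (fun i _ => hd i) (fun t z => g (p t * z.2 - q t * z.1))).trans ?_
  rw [hcard]
  gcongr
  have hpair : ∀ t ∈ range T, ∀ t' ∈ range T,
      ‖∑ z ∈ Ico 0 X ×ˢ Ico Y (2 * Y), g (p t * z.2 - q t * z.1) * conj (g (p t' * z.2 - q t' * z.1))‖ ≤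
      (if t = t' then 4 * (X * Y : ℝ) else 0) + M * (2 * (c * N)) := by
    intro t ht t' ht'
    rw [mem_range] at ht ht'
    have hM0 : 0 ≤ M := le_trans (by
      have h1 : (0:ℤ) ≤ p t * Y + q t * X + q t * p t := by
        have := hp t ht; have := hq t ht; positivity
      exact_mod_cast h1) (hM t ht)
    by_cases htt : t = t'
    · subst htt
      simp only [if_true]
      have : ‖∑ z ∈ Ico 0 X ×ˢ Ico Y (2 * Y), g (p t * z.2 - q t * z.1) * conj (g (p t * z.2 - q t * z.1))‖ ≤ 4 * (X * Y) := by
        refine (norm_sum_le _ _).trans ?_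
        rw [← hcard]
        calc _ ≤ ∑ z ∈ Ico 0 X ×ˢ Ico Y (2 * Y), (4:ℝ) := by
              refine sum_le_sum fun z _ => ?_
              rw [norm_mul, RCLike.norm_conj]
              have h1 := hg (p t * z.2 - q t * z.1)
              nlinarith [norm_nonneg (g (p t * z.2 - q t * z.1))]
          _ = _ := by rw [sum_const, nsmul_eq_mul]; ring
      have : 0 ≤ M * (2 * (c * N)) := by positivity
      linarith
    · simp only [htt, if_false, zero_add]
      refine (mslot_pair h hg X Y _ _ _ _ hX hY (hp t ht) (hq t ht) (hne t ht t' ht' htt) (hstep t ht t' ht') (hv t' ht')).trans ?_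
      gcongr
      exact hM t ht
  refine (sum_le_sum fun t ht => sum_le_sum fun t' ht' => hpair t ht t' ht').trans (le_of_eq ?_)
  simp only [sum_add_distrib, sum_ite_eq, sum_const, card_range, nsmul_eq_mul]
  have : ∑ t ∈ range T, (if t ∈ range T then 4 * (X * Y : ℝ) else 0) = T * (4 * (X * Y)) := by
    rw [sum_congr rfl (fun t ht => if_pos ht), sum_const, card_range, nsmul_eq_mul]
  rw [this]; ring

noncomputable def ch (Q : ℕ) [NeZero Q] (η : ZMod Q) (x : ℤ) : ℂ := ZMod.stdAddChar (η * (x : ZMod Q))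

section chs
variable {Q : ℕ} [NeZero Q]

theorem ch_norm (η : ZMod Q) (x : ℤ) : ‖ch Q η x‖ = 1 := AddChar.norm_apply _ _

theorem ch_add (η : ZMod Q) (x y : ℤ) : ch Q η (x + y) = ch Q η x * ch Q η y := by
  unfold ch; rw [← AddChar.map_add_eq_mul]; push_cast; ring_nf

theorem ch_neg (η : ZMod Q) (x : ℤ) : ch Q η (-x) = conj (ch Q η x) := by
  unfold ch; rw [← AddChar.map_neg_eq_conj]; push_cast; ring_nf

theorem ch_sub (η : ZMod Q) (x y : ℤ) : ch Q η (x - y) = ch Q η x * conj (ch Q η y) := by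
  rw [sub_eq_add_neg, ch_add, ch_neg]

theorem ch_nsmul (η : ZMod Q) (k : ℕ) (x : ℤ) : ch Q η (k * x) = ch Q η x ^ k := by
  unfold ch; rw [← AddChar.map_nsmul_eq_pow]; push_cast; congr 1; rw [nsmul_eq_mul]; ring

theorem ch_orth (x : ℤ) (hx : |x| < Q) : ∑ η : ZMod Q, ch Q η x = if x = 0 then (Q : ℂ) else 0 := by
  unfold ch
  rw [AddChar.sum_mulShift _ (ZMod.isPrimitive_stdAddChar Q)]
  have : ((x : ZMod Q) = 0) ↔ x = 0 := by
    rw [ZMod.intCast_zmod_eq_zero_iff_dvd]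
    constructor
    · intro h; exact Int.eq_zero_of_abs_lt_dvd h hx
    · rintro rfl; simp
  simp only [this, ZMod.card]
  split_ifs <;> simp

theorem parseval {ι : Type*} (P : Finset ι) (π : ι → ℤ) (a : ι → ℂ)
    (hπ : ∀ p ∈ P, ∀ p' ∈ P, |π p - π p'| < Q) :
    ((∑ η : ZMod Q, ‖∑ p ∈ P, a p * ch Q η (π p)‖ ^ 2 : ℝ) : ℂ) =
      Q * ∑ p ∈ P, ∑ p' ∈ P, if π p = π p' then a p * conj (a p') else 0 := by
  rw [Complex.ofReal_sum]
  simp_rw [sqnorm_expand]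
  rw [sum_comm, mul_sum]
  refine sum_congr rfl fun p hp => ?_
  rw [sum_comm, mul_sum]
  refine sum_congr rfl fun p' hp' => ?_
  calc ∑ η : ZMod Q, a p * ch Q η (π p) * conj (a p' * ch Q η (π p'))
      = a p * conj (a p') * ∑ η : ZMod Q, ch Q η (π p - π p') := by
        rw [mul_sum]; refine sum_congr rfl fun η _ => ?_
        rw [ch_sub, map_mul]; ring
    _ = _ := by
        rw [ch_orth _ (hπ p hp p' hp')]
        simp only [sub_eq_zero]
        split_ifs <;> ring

theorem fiber_pairs {ι : Type*} (P : Finset ι) (π : ι → ℤ) (a : ι → ℂ) (J : Finset ℤ) (hJ : ∀ p ∈ P, π p ∈ J) :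
    ((∑ x ∈ J, ‖∑ p ∈ P with π p = x, a p‖ ^ 2 : ℝ) : ℂ) =
      ∑ p ∈ P, ∑ p' ∈ P, if π p = π p' then a p * conj (a p') else 0 := by
  rw [Complex.ofReal_sum]
  simp_rw [sqnorm_expand]
  rw [← sum_fiberwise_of_maps_to hJ]
  refine sum_congr rfl fun x _ => sum_congr rfl fun p hp => ?_
  rw [sum_filter]
  refine sum_congr rfl fun p' _ => ?_
  rw [(mem_filter.1 hp).2]
  simp [eq_comm]

theorem fiber_mono {ι : Type*} (P : Finset ι) (π : ι → ℤ) (a : ι → ℂ) (J : Finset ℤ) :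
    ∑ x ∈ J, ‖∑ p ∈ P with π p = x, a p‖ ^ 2 ≤ ∑ x ∈ P.image π, ‖∑ p ∈ P with π p = x, a p‖ ^ 2 := by
  have : ∑ x ∈ J, ‖∑ p ∈ P with π p = x, a p‖ ^ 2 = ∑ x ∈ J with x ∈ P.image π, ‖∑ p ∈ P with π p = x, a p‖ ^ 2 := by
    rw [sum_filter]
    refine sum_congr rfl fun x _ => ?_
    split_ifs with h
    · rfl
    · have : {p ∈ P | π p = x} = ∅ := by
        apply filter_eq_empty_iff.2
        intro p hp hpx; exact h (mem_image.2 ⟨p, hp, hpx⟩)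
      simp [this]
  rw [this]
  exact sum_le_sum_of_subset_of_nonneg (fun x hx => (mem_filter.1 hx).2) fun _ _ _ => by positivity

theorem fiberCS {ι : Type*} (P : Finset ι) (π : ι → ℤ) (J : Finset ℤ) (Φ : ℤ → ℂ) (hΦ : ∀ x, ‖Φ x‖ ≤ 1)
    (hJ : ∀ x, x ∉ J → Φ x = 0) (w : ι → ℂ) :
    ‖∑ p ∈ P, Φ (π p) * w p‖ ^ 2 ≤ #J * ∑ x ∈ P.image π, ‖∑ p ∈ P with π p = x, w p‖ ^ 2 := by
  have h1 : ∑ p ∈ P, Φ (π p) * w p = ∑ x ∈ J, Φ x * ∑ p ∈ P with π p = x, w p := by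
    have : ∑ p ∈ P, Φ (π p) * w p = ∑ p ∈ P with π p ∈ J, Φ (π p) * w p := by
      rw [sum_filter]
      refine sum_congr rfl fun p _ => ?_
      split_ifs with h
      · rfl
      · rw [hJ _ h, zero_mul]
    rw [this, ← sum_fiberwise_of_maps_to (s := {p ∈ P | π p ∈ J}) (t := J) (g := π) (fun p hp => (mem_filter.1 hp).2)]
    refine sum_congr rfl fun x hx => ?_
    rw [mul_sum]
    have : {p ∈ {p ∈ P | π p ∈ J} | π p = x} = {p ∈ P | π p = x} := by
      ext p; simp only [mem_filter]; constructor
      · tauto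
      · rintro ⟨h1, h2⟩; exact ⟨⟨h1, h2 ▸ hx⟩, h2⟩
    rw [this]
    refine sum_congr rfl fun p hp => by rw [(mem_filter.1 hp).2]
  rw [h1]
  refine (cs_sum_one J _ _ fun x _ => hΦ x).trans ?_
  exact mul_le_mul_of_nonneg_left (fiber_mono P π w J) (by positivity)

theorem parseval_fiber {ι : Type*} (P : Finset ι) (π : ι → ℤ) (a : ι → ℂ)
    (hπ : ∀ p ∈ P, ∀ p' ∈ P, |π p - π p'| < Q) :
    ∑ η : ZMod Q, ‖∑ p ∈ P, a p * ch Q η (π p)‖ ^ 2 =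
      Q * ∑ x ∈ P.image π, ‖∑ p ∈ P with π p = x, a p‖ ^ 2 := by
  have h1 := parseval P π a hπ
  rw [← fiber_pairs P π a (P.image π) fun p hp => mem_image_of_mem _ hp] at h1
  exact_mod_cast h1

theorem parseval_inj {ι : Type*} (P : Finset ι) (π : ι → ℤ) (a : ι → ℂ)
    (hπ : ∀ p ∈ P, ∀ p' ∈ P, |π p - π p'| < Q) (hinj : Set.InjOn π P) :
    ∑ η : ZMod Q, ‖∑ p ∈ P, a p * ch Q η (π p)‖ ^ 2 = Q * ∑ p ∈ P, ‖a p‖ ^ 2 := by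
  rw [parseval_fiber P π a hπ, sum_image hinj]
  congr 1
  refine sum_congr rfl fun p hp => ?_
  have : {p' ∈ P | π p' = π p} = {p} := by
    ext p'; simp only [mem_filter, mem_singleton]
    constructor
    · rintro ⟨h1, h2⟩; exact hinj h1 hp h2
    · rintro rfl; exact ⟨hp, rfl⟩
  rw [this, sum_singleton]

end chs

theorem quasi_sum (F : ℤ → ℂ) (hF : ∀ w, ‖F w‖ ≤ 1) (M : ℕ) (z : ℂ) (hz : ∀ w, F (w + M) = z * F w) (a b : ℤ) :
    ‖∑ w ∈ Ico a b, F w‖ * ‖1 - z‖ ≤ 2 * M := by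
  rw [← norm_mul]
  have h1 : (∑ w ∈ Ico a b, F w) * (1 - z) = ∑ w ∈ Ico a b, F w - ∑ w ∈ Ico (a + M) (b + M), F w := by
    have : ∑ w ∈ Ico (a + M) (b + M), F w = ∑ w ∈ Ico a b, F (w + M) := by
      rw [← Finset.map_add_right_Ico, sum_map]; rfl
    rw [this, mul_sub, mul_one]
    congr 1
    rw [sum_mul]; refine sum_congr rfl fun w _ => by rw [hz]; ring
  rw [h1, ← sum_sdiff_sub_sum_sdiff]
  have c1 : ‖∑ w ∈ Ico a b \ Ico (a + M) (b + M), F w‖ ≤ M := by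
    refine (norm_sum_le_card _ _ fun i _ => hF i).trans ?_
    have : #(Ico a b \ Ico (a + M) (b + M)) ≤ #(Ico a (a + M)) := by
      apply card_le_card; intro x; simp only [mem_sdiff, mem_Ico]; omega
    calc _ ≤ ((#(Ico a (a + M)) : ℕ) : ℝ) := by exact_mod_cast this
      _ = M := by simp
  have c2 : ‖∑ w ∈ Ico (a + M) (b + M) \ Ico a b, F w‖ ≤ M := by
    refine (norm_sum_le_card _ _ fun i _ => hF i).trans ?_
    have : #(Ico (a + M) (b + M) \ Ico a b) ≤ #(Ico b (b + M)) := by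
      apply card_le_card; intro x; simp only [mem_sdiff, mem_Ico]; omega
    calc _ ≤ ((#(Ico b (b + M)) : ℕ) : ℝ) := by exact_mod_cast this
      _ = M := by simp
  refine (norm_sub_le _ _).trans ?_
  linarith

theorem count_near (Q : ℕ) [NeZero Q] (ℓ : ℤ) (hℓ : ℓ ≠ 0) (K : ℕ) (hK : 0 < K) (hKQ : |ℓ| * K < Q) :
    (#{η : ZMod Q | K * ‖1 - ch Q η ℓ‖ ≤ 1 / 2} : ℝ) * K ≤ 4 * Q := by
  have hp := parseval_inj (Q := Q) (range K) (fun k => (k : ℤ) * ℓ) (fun _ => 1) ?_ ?_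
  · simp only [norm_one, one_pow, sum_const, card_range, nsmul_eq_mul, mul_one, one_mul] at hp
    have h2 : ∀ η ∈ ({η : ZMod Q | K * ‖1 - ch Q η ℓ‖ ≤ 1 / 2} : Finset _), ((K : ℝ) / 2) ^ 2 ≤ ‖∑ k ∈ range K, ch Q η (k * ℓ)‖ ^ 2 := by
      intro η hη
      have hη := (mem_filter.1 hη).2
      gcongr
      have : ‖∑ k ∈ range K, (1 - ch Q η (k * ℓ))‖ ≤ K * (1 / 2) := by
        calc _ ≤ ∑ k ∈ range K, ‖1 - ch Q η (k * ℓ)‖ := norm_sum_le _ _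
          _ ≤ ∑ k ∈ range K, (1 / 2 : ℝ) := by
              refine sum_le_sum fun k hk => ?_
              rw [ch_nsmul]
              refine (one_sub_pow_le _ (ch_norm η ℓ) k).trans (le_trans ?_ hη)
              have : (k : ℝ) ≤ K := by exact_mod_cast (mem_range.1 hk).le
              gcongr
          _ = _ := by simp
      rw [sum_sub_distrib] at this
      simp only [sum_const, card_range, nsmul_eq_mul, mul_one] at this
      have h3 := norm_sub_norm_le (K : ℂ) (∑ k ∈ range K, ch Q η (k * ℓ))
      rw [Complex.norm_natCast] at h3
      linarith
    have h3 := sum_le_sum h2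
    rw [sum_const, nsmul_eq_mul] at h3
    have h4 : ∑ η ∈ ({η : ZMod Q | K * ‖1 - ch Q η ℓ‖ ≤ 1 / 2} : Finset _), ‖∑ k ∈ range K, ch Q η (k * ℓ)‖ ^ 2 ≤ Q * K := by
      rw [← hp]
      exact sum_le_sum_of_subset_of_nonneg (filter_subset _ _) fun _ _ _ => by positivity
    nlinarith
  · intro p hp p' hp'
    rw [← sub_mul, abs_mul]
    have h1 : |(p : ℤ) - p'| ≤ K := by
      rw [mem_range] at hp hp'
      rw [abs_le]; omega
    calc _ ≤ (K : ℤ) * |ℓ| := by gcongr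
      _ < Q := by rw [mul_comm]; exact hKQ
  · intro p _ p' _ h
    have := mul_right_cancel₀ hℓ h
    exact_mod_cast this

theorem quad_sum {Q : ℕ} [NeZero Q] {ι κ : Type*} (s : Finset ι) (t : Finset κ) (a : ι → ℂ) (b : κ → ℂ) (π₁ : ι → ℤ) (π₂ : κ → ℤ)
    (h : ∀ q ∈ s, ∀ q' ∈ t, |π₁ q + π₂ q'| < Q) :
    ∑ η : ZMod Q, (∑ q ∈ s, a q * ch Q η (π₁ q)) * (∑ q ∈ t, b q * ch Q η (π₂ q)) =
      Q * ∑ q ∈ s, ∑ q' ∈ t, if π₁ q + π₂ q' = 0 then a q * b q' else 0 := by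
  simp_rw [sum_mul_sum]
  rw [sum_comm, mul_sum]
  refine sum_congr rfl fun q hq => ?_
  rw [sum_comm, mul_sum]
  refine sum_congr rfl fun q' hq' => ?_
  calc ∑ η : ZMod Q, a q * ch Q η (π₁ q) * (b q' * ch Q η (π₂ q'))
      = a q * b q' * ∑ η : ZMod Q, ch Q η (π₁ q + π₂ q') := by
        rw [mul_sum]; refine sum_congr rfl fun η _ => ?_
        rw [ch_add]; ring
    _ = _ := by
        rw [ch_orth _ (h q hq q' hq')]
        split_ifs <;> ring

theorem class_sq {Q : ℕ} [NeZero Q] (s : Finset ℤ) (A : ℤ → ℂ) (r π : ℤ → ℤ) (M : ℕ) (hr : ∀ u, r u ∈ Ico (0:ℤ) M) (η : ZMod Q) :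
    ((∑ c ∈ Ico (0:ℤ) M, ‖∑ u ∈ s with r u = c, A u * ch Q η (π u)‖ ^ 2 : ℝ) : ℂ) =
      ∑ q ∈ s ×ˢ s, (if r q.1 = r q.2 then A q.1 * conj (A q.2) else 0) * ch Q η (π q.1 - π q.2) := by
  rw [fiber_pairs s r _ _ fun u _ => hr u, sum_product]
  refine sum_congr rfl fun u _ => sum_congr rfl fun v _ => ?_
  rw [ch_sub, map_mul]
  split_ifs <;> ring

theorem sq_pairs {Q : ℕ} [NeZero Q] (s : Finset ℤ) (A : ℤ → ℂ) (η : ZMod Q) :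
    ((‖∑ u ∈ s, A u * ch Q η u‖ ^ 2 : ℝ) : ℂ) =
      ∑ q ∈ s ×ˢ s, (A q.1 * conj (A q.2)) * ch Q η (q.1 - q.2) := by
  rw [sqnorm_expand, sum_product]
  refine sum_congr rfl fun u _ => sum_congr rfl fun v _ => ?_
  rw [ch_sub, map_mul]
  ring

theorem ite_r1 (p q r : Prop) [Decidable p] [Decidable q] [Decidable r] (x y : ℂ) (h : ¬ (q ∧ r ∧ p)) :
    (if p then (if q then x else 0) * (if r then y else 0) else 0) = 0 := by
  by_cases hp : p <;> by_cases hq : q <;> by_cases hr : r <;> simp_all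

theorem ite_r2 (p q : Prop) [Decidable p] [Decidable q] (x y : ℂ) (h : ¬ (q ∧ p)) :
    (if p then x * (if q then y else 0) else 0) = 0 := by
  by_cases hp : p <;> by_cases hq : q <;> simp_all

theorem arith_equiv (N R I : ℕ) (hN : 0 < N) (hI : 0 < I) (hc : Nat.Coprime N R) (u v u' v' κ : ℤ) :
    (u % I = v % I ∧ (u' - κ) % I = (v' - κ) % I ∧ -(N : ℤ) * u - -(N : ℤ) * v + (R * u' - R * v') = 0) ↔
    (u' % (N * I : ℕ) = v' % (N * I : ℕ) ∧ (u - v) + (-(R * I : ℤ) * (u' / (N * I : ℕ)) - -(R * I : ℤ) * (v' / (N * I : ℕ))) = 0) := by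
  have hM : ((N * I : ℕ) : ℤ) ≠ 0 := by positivity
  have hcZ : IsCoprime (N : ℤ) (R : ℤ) := Nat.isCoprime_iff_coprime.2 hc
  constructor
  · rintro ⟨h1, h2, h3⟩
    have d1 : (I : ℤ) ∣ u - v := Int.ModEq.dvd (Eq.symm h1)
    have d2 : (I : ℤ) ∣ u' - v' := by
      have : (I : ℤ) ∣ (u' - κ) - (v' - κ) := Int.ModEq.dvd (Eq.symm h2)
      simpa using this
    have e1 : (N : ℤ) * (u - v) = R * (u' - v') := by linarith
    have d3 : (N : ℤ) ∣ u' - v' := by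
      apply hcZ.dvd_of_dvd_mul_left
      exact ⟨u - v, e1.symm⟩
    obtain ⟨l, hl⟩ := d3
    have e2 : u - v = R * l := by
      have : (N : ℤ) * (u - v) = N * (R * l) := by rw [e1, hl]; ring
      exact mul_left_cancel₀ (by positivity) this
    have d4 : (I : ℤ) ∣ l := by
      obtain ⟨x, y, hxy⟩ := hcZ
      have : l = x * (u' - v') + y * (u - v) := by
        rw [hl, e2]; linear_combination (-l) * hxy
      rw [this]
      exact dvd_add (dvd_mul_of_dvd_right d2 _) (dvd_mul_of_dvd_right d1 _)
    obtain ⟨l', rfl⟩ := d4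
    have e3 : u' = v' + (N * I : ℕ) * l' := by push_cast; linarith
    constructor
    · rw [e3, Int.add_mul_emod_self_left]
    · rw [e3, Int.add_mul_ediv_left _ _ hM, e2]; ring
  · rintro ⟨h1, h2⟩
    have e1 := Int.emod_add_mul_ediv u' (N * I : ℕ)
    have e2 := Int.emod_add_mul_ediv v' (N * I : ℕ)
    set a := u' / (N * I : ℕ)
    set b := v' / (N * I : ℕ)
    have e3 : u' = v' + N * I * (a - b) := by push_cast at e1 e2 h1; linarith
    have e4 : u = v + R * I * (a - b) := by linarith
    refine ⟨?_, ?_, ?_⟩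
    · rw [e4, show v + R * I * (a - b) = v + I * (R * (a - b)) by ring, Int.add_mul_emod_self_left]
    · rw [e3, show v' + N * I * (a - b) - κ = (v' - κ) + I * (N * (a - b)) by ring, Int.add_mul_emod_self_left]
    · rw [e3, e4]; ring

set_option maxHeartbeats 800000 in
theorem bilin {Q : ℕ} [NeZero Q] (A B : ℤ → ℂ) (U N R I : ℕ) (hN : 0 < N) (hI : 0 < I) (hc : Nat.Coprime N R)
    (hR : R ≤ 2 * N) (hQ : 3 * U < Q) (κ : ℤ) (J : Finset ℤ) (E : ℤ → ℂ) (hE : ∀ x, ‖E x‖ ≤ 1)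
    (hJ : ∀ x, x ∉ J → E x = 0) :
    ‖∑ p ∈ Ico (0:ℤ) U ×ˢ Ico (0:ℤ) U with (I : ℤ) ∣ p.2 - p.1 - κ, E (R * p.2 - N * p.1) * (A p.1 * B p.2)‖ ^ 2 ≤
      #J * ((1 / Q) * ∑ η : ZMod Q, ‖∑ u ∈ Ico (0:ℤ) U, A u * ch Q η u‖ ^ 2 *
        ∑ ρ ∈ Ico (0:ℤ) (N * I : ℕ), ‖∑ u ∈ Ico (0:ℤ) U with u % (N * I : ℕ) = ρ, B u * ch Q η (-(R * I : ℤ) * (u / (N * I : ℕ)))‖ ^ 2) := by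
  set s := Ico (0:ℤ) U with hs
  set P := {p ∈ s ×ˢ s | (I : ℤ) ∣ p.2 - p.1 - κ} with hP
  refine (fiberCS P (fun p => R * p.2 - N * p.1) J E hE hJ (fun p => A p.1 * B p.2)).trans ?_
  refine mul_le_mul_of_nonneg_left ?_ (by positivity)
  set Q1 : ℕ := 4 * (R + N) * U + 1 with hQ1
  have hQ1pos : (0:ℝ) < Q1 := by positivity
  have hQpos : (0:ℝ) < Q := by have := NeZero.pos Q; exact_mod_cast this
  have hsb : ∀ u ∈ s, ∀ v ∈ s, |u - v| < U := by
    intro u hu v hv; rw [hs, mem_Ico] at hu hv; rw [abs_lt]; omega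
  have hlin : ∀ u ∈ s, ∀ v ∈ s, ∀ u' ∈ s, ∀ v' ∈ s, |-(N : ℤ) * u - -(N : ℤ) * v + (R * u' - R * v')| < Q1 := by
    intro u hu v hv u' hu' v' hv'
    have h1 := (hsb u hu v hv).le
    have h2 := (hsb u' hu' v' hv').le
    have : -(N : ℤ) * u - -(N : ℤ) * v + (R * u' - R * v') = N * (v - u) + R * (u' - v') := by ring
    rw [this]
    calc |(N:ℤ) * (v - u) + R * (u' - v')| ≤ |(N:ℤ) * (v - u)| + |R * (u' - v')| := abs_add_le _ _
      _ = N * |u - v| + R * |u' - v'| := by rw [abs_mul, abs_mul, abs_sub_comm]; simp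
      _ ≤ N * U + R * U := by gcongr
      _ < Q1 := by rw [hQ1]; push_cast; nlinarith [Int.natCast_nonneg N, Int.natCast_nonneg R, Int.natCast_nonneg U, mul_nonneg (Int.natCast_nonneg N) (Int.natCast_nonneg U), mul_nonneg (Int.natCast_nonneg R) (Int.natCast_nonneg U)]
  have hpars := parseval_fiber (Q := Q1) P (fun p => R * p.2 - N * p.1) (fun p => A p.1 * B p.2) (by
    intro p hp p' hp'
    rw [hP, mem_filter, mem_product] at hp hp'
    have := hlin p.1 hp.1.1 p'.1 hp'.1.1 p.2 hp.1.2 p'.2 hp'.1.2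
    convert this using 2; ring)
  have hlhs : ∑ x ∈ P.image (fun p => (R:ℤ) * p.2 - N * p.1), ‖∑ p ∈ P with (R:ℤ) * p.2 - N * p.1 = x, A p.1 * B p.2‖ ^ 2
    = (1 / Q1) * ∑ η : ZMod Q1, ‖∑ p ∈ P, A p.1 * B p.2 * ch Q1 η (R * p.2 - N * p.1)‖ ^ 2 := by
    rw [hpars]; field_simp
  rw [hlhs]
  have hImod : ∀ u : ℤ, u % I ∈ Ico (0:ℤ) I := fun u => by
    rw [mem_Ico]; exact ⟨Int.emod_nonneg _ (by positivity), Int.emod_lt_of_pos _ (by positivity)⟩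
  have hMmod : ∀ u : ℤ, u % (N * I : ℕ) ∈ Ico (0:ℤ) (N * I : ℕ) := fun u => by
    rw [mem_Ico]; exact ⟨Int.emod_nonneg _ (by positivity), Int.emod_lt_of_pos _ (by positivity)⟩
  have hc1 : ∀ η : ZMod Q1, ‖∑ p ∈ P, A p.1 * B p.2 * ch Q1 η (R * p.2 - N * p.1)‖ ^ 2 ≤
      (∑ c ∈ Ico (0:ℤ) I, ‖∑ u ∈ s with u % I = c, A u * ch Q1 η (-(N:ℤ) * u)‖ ^ 2) *
      (∑ c ∈ Ico (0:ℤ) I, ‖∑ u ∈ s with (u - κ) % I = c, B u * ch Q1 η (R * u)‖ ^ 2) := by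
    intro η
    refine le_trans (le_of_eq ?_) (cs_sum (Ico (0:ℤ) I) (fun c => ∑ u ∈ s with u % I = c, A u * ch Q1 η (-(N:ℤ) * u)) (fun c => ∑ u ∈ s with (u - κ) % I = c, B u * ch Q1 η (R * u)))
    congr 2
    rw [← sum_fiberwise_of_maps_to (s := P) (t := Ico (0:ℤ) I) (g := fun p => p.1 % I) (fun p _ => hImod _)]
    refine sum_congr rfl fun c _ => ?_
    rw [sum_mul_sum, ← sum_product']
    have : {p ∈ P | p.1 % (I:ℤ) = c} = {u ∈ s | u % (I:ℤ) = c} ×ˢ {u ∈ s | (u - κ) % (I:ℤ) = c} := by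
      ext ⟨u, u'⟩
      simp only [hP, mem_filter, mem_product]
      have key : (I:ℤ) ∣ u' - u - κ ↔ (u' - κ) % I = u % I := by
        rw [show u' - u - κ = (u' - κ) - u by ring]
        rw [Int.emod_eq_emod_iff_emod_sub_eq_zero]; exact Int.dvd_iff_emod_eq_zero
      rw [key]
      constructor
      · rintro ⟨⟨⟨h1, h2⟩, h3⟩, h4⟩; exact ⟨⟨h1, h4⟩, h2, h3.trans h4⟩
      · rintro ⟨⟨h1, h4⟩, h2, h3⟩; exact ⟨⟨⟨h1, h2⟩, h3.trans h4.symm⟩, h4⟩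
    rw [this]
    refine sum_congr rfl fun p _ => ?_
    rw [show (R:ℤ) * p.2 - N * p.1 = -(N:ℤ) * p.1 + R * p.2 by ring, ch_add]; ring
  have hstep : (1 / (Q1:ℝ)) * ∑ η : ZMod Q1, ‖∑ p ∈ P, A p.1 * B p.2 * ch Q1 η (R * p.2 - N * p.1)‖ ^ 2 ≤
     (1 / (Q1:ℝ)) * ∑ η : ZMod Q1, (∑ c ∈ Ico (0:ℤ) I, ‖∑ u ∈ s with u % I = c, A u * ch Q1 η (-(N:ℤ) * u)‖ ^ 2) *
      (∑ c ∈ Ico (0:ℤ) I, ‖∑ u ∈ s with (u - κ) % I = c, B u * ch Q1 η (R * u)‖ ^ 2) := by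
    gcongr with η
    exact hc1 η
  refine hstep.trans (le_of_eq ?_)
  apply Complex.ofReal_injective
  have hQ1c : (Q1 : ℂ) ≠ 0 := by exact_mod_cast hQ1pos.ne'
  have hQc : (Q : ℂ) ≠ 0 := by exact_mod_cast hQpos.ne'
  have L : ((∑ η : ZMod Q1, (∑ c ∈ Ico (0:ℤ) I, ‖∑ u ∈ s with u % I = c, A u * ch Q1 η (-(N:ℤ) * u)‖ ^ 2) *
      (∑ c ∈ Ico (0:ℤ) I, ‖∑ u ∈ s with (u - κ) % I = c, B u * ch Q1 η (R * u)‖ ^ 2) : ℝ) : ℂ) =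
      Q1 * ∑ q ∈ s ×ˢ s, ∑ q' ∈ s ×ˢ s, if (-(N:ℤ) * q.1 - -(N:ℤ) * q.2) + (R * q'.1 - R * q'.2) = 0 then
        (if q.1 % (I:ℤ) = q.2 % (I:ℤ) then A q.1 * conj (A q.2) else 0) *
        (if (q'.1 - κ) % (I:ℤ) = (q'.2 - κ) % (I:ℤ) then B q'.1 * conj (B q'.2) else 0) else 0 := by
    rw [← quad_sum (Q := Q1) (s ×ˢ s) (s ×ˢ s) (fun q => if q.1 % (I:ℤ) = q.2 % (I:ℤ) then A q.1 * conj (A q.2) else 0)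
      (fun q' => if (q'.1 - κ) % (I:ℤ) = (q'.2 - κ) % (I:ℤ) then B q'.1 * conj (B q'.2) else 0)
      (fun q => -(N:ℤ) * q.1 - -(N:ℤ) * q.2) (fun q' => R * q'.1 - R * q'.2) ?_]
    · rw [Complex.ofReal_sum]
      refine sum_congr rfl fun η _ => ?_
      rw [Complex.ofReal_mul, class_sq s A (fun u => u % I) (fun u => -(N:ℤ) * u) I hImod η,
        class_sq s B (fun u => (u - κ) % I) (fun u => R * u) I (fun u => hImod _) η]
    · intro q hq q' hq'
      rw [mem_product] at hq hq'
      exact hlin _ hq.1 _ hq.2 _ hq'.1 _ hq'.2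
  have Rr : ((∑ η : ZMod Q, ‖∑ u ∈ s, A u * ch Q η u‖ ^ 2 *
        ∑ ρ ∈ Ico (0:ℤ) (N * I : ℕ), ‖∑ u ∈ s with u % (N * I : ℕ) = ρ, B u * ch Q η (-(R * I : ℤ) * (u / (N * I : ℕ)))‖ ^ 2 : ℝ) : ℂ) =
      Q * ∑ q ∈ s ×ˢ s, ∑ q' ∈ s ×ˢ s, if (q.1 - q.2) + (-(R * I : ℤ) * (q'.1 / (N * I : ℕ)) - -(R * I : ℤ) * (q'.2 / (N * I : ℕ))) = 0 then
        (A q.1 * conj (A q.2)) *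
        (if q'.1 % (N * I : ℕ) = q'.2 % (N * I : ℕ) then B q'.1 * conj (B q'.2) else 0) else 0 := by
    have hbd : ∀ q ∈ s ×ˢ s, ∀ q' ∈ {q' ∈ s ×ˢ s | q'.1 % ((N * I : ℕ) : ℤ) = q'.2 % ((N * I : ℕ) : ℤ)},
        |(q.1 - q.2) + (-(R * I : ℤ) * (q'.1 / (N * I : ℕ)) - -(R * I : ℤ) * (q'.2 / (N * I : ℕ)))| < Q := by
      intro q hq q' hq'
      rw [mem_filter, mem_product] at hq'
      rw [mem_product] at hq
      have h1 := hsb _ hq.1 _ hq.2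
      have h2 := hsb _ hq'.1.1 _ hq'.1.2
      have e1 := Int.emod_add_mul_ediv q'.1 (N * I : ℕ)
      have e2 := Int.emod_add_mul_ediv q'.2 (N * I : ℕ)
      set a := q'.1 / ((N * I : ℕ) : ℤ)
      set b := q'.2 / ((N * I : ℕ) : ℤ)
      have e3 : q'.1 - q'.2 = N * (I * (a - b)) := by have := hq'.2; push_cast at e1 e2 this; linarith
      have h3 : (N : ℤ) * |I * (a - b)| < U := by
        rw [e3, abs_mul] at h2; simpa using h2
      have h4 : (R : ℤ) * |I * (a - b)| ≤ 2 * U := by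
        calc (R : ℤ) * |I * (a - b)| ≤ (2 * N) * |I * (a - b)| := by gcongr; exact_mod_cast hR
          _ ≤ 2 * U := by linarith
      calc |(q.1 - q.2) + (-(R * I : ℤ) * a - -(R * I : ℤ) * b)| = |(q.1 - q.2) - R * (I * (a - b))| := by congr 1; ring
        _ ≤ |q.1 - q.2| + |R * (I * (a - b))| := abs_sub _ _
        _ = |q.1 - q.2| + R * |I * (a - b)| := by rw [abs_mul (R:ℤ)]; simp
        _ < Q := by
          have : ((3 * U : ℕ) : ℤ) < Q := by exact_mod_cast hQ
          push_cast at this; linarith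
    have h5 := quad_sum (Q := Q) (s ×ˢ s) {q' ∈ s ×ˢ s | q'.1 % ((N * I : ℕ) : ℤ) = q'.2 % ((N * I : ℕ) : ℤ)} (fun q => A q.1 * conj (A q.2))
      (fun q' => if q'.1 % ((N * I : ℕ) : ℤ) = q'.2 % ((N * I : ℕ) : ℤ) then B q'.1 * conj (B q'.2) else 0)
      (fun q => q.1 - q.2) (fun q' => -(R * I : ℤ) * (q'.1 / (N * I : ℕ)) - -(R * I : ℤ) * (q'.2 / (N * I : ℕ))) hbd
    have h6 : ∀ q ∈ s ×ˢ s, (∑ q' ∈ s ×ˢ s, if (q.1 - q.2) + (-(R * I : ℤ) * (q'.1 / (N * I : ℕ)) - -(R * I : ℤ) * (q'.2 / (N * I : ℕ))) = 0 then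
        (A q.1 * conj (A q.2)) *
        (if q'.1 % ((N * I : ℕ) : ℤ) = q'.2 % ((N * I : ℕ) : ℤ) then B q'.1 * conj (B q'.2) else 0) else 0) =
        ∑ q' ∈ s ×ˢ s with q'.1 % ((N * I : ℕ) : ℤ) = q'.2 % ((N * I : ℕ) : ℤ), if (q.1 - q.2) + (-(R * I : ℤ) * (q'.1 / (N * I : ℕ)) - -(R * I : ℤ) * (q'.2 / (N * I : ℕ))) = 0 then
        (A q.1 * conj (A q.2)) *
        (if q'.1 % ((N * I : ℕ) : ℤ) = q'.2 % ((N * I : ℕ) : ℤ) then B q'.1 * conj (B q'.2) else 0) else 0 := by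
      intro q _
      rw [sum_filter]
      refine sum_congr rfl fun q' _ => ?_
      split_ifs <;> simp
    rw [sum_congr rfl h6, ← h5, Complex.ofReal_sum]
    refine sum_congr rfl fun η _ => ?_
    rw [Complex.ofReal_mul, sq_pairs s A η,
        class_sq s B (fun u => u % (N * I : ℕ)) (fun u => -(R * I : ℤ) * (u / (N * I : ℕ))) (N * I) hMmod η]
    congr 1
    rw [sum_filter]
    refine sum_congr rfl fun q' _ => ?_
    split_ifs <;> simp
  rw [Complex.ofReal_mul, L, Complex.ofReal_mul, Rr]
  push_cast
  rw [← mul_assoc, ← mul_assoc, one_div_mul_cancel hQ1c, one_div_mul_cancel hQc, one_mul, one_mul]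
  refine sum_congr rfl fun q _ => sum_congr rfl fun q' _ => ?_
  have := arith_equiv N R I hN hI hc q.1 q.2 q'.1 q'.2 κ
  push_cast at this
  by_cases hh : (q'.1 % (N * I : ℤ) = q'.2 % (N * I : ℤ) ∧ (q.1 - q.2) + (-(R * I : ℤ) * (q'.1 / (N * I : ℤ)) - -(R * I : ℤ) * (q'.2 / (N * I : ℤ))) = 0)
  · have h2 := this.2 hh
    rw [if_pos h2.2.2, if_pos h2.1, if_pos h2.2.1, if_pos hh.2, if_pos hh.1]
  · have h2 := fun h => hh (this.1 h)
    rw [ite_r1 _ _ _ _ _ h2, ite_r2 _ _ _ _ hh]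

theorem phase_exists (z : ℂ) : ∃ θ : ℂ, ‖θ‖ ≤ 1 ∧ θ * z = (‖z‖ : ℂ) := by
  by_cases h : z = 0
  · exact ⟨0, by simp, by simp [h]⟩
  · refine ⟨conj z / ‖z‖, ?_, ?_⟩
    · rw [norm_div, RCLike.norm_conj, Complex.norm_real, norm_norm, div_self (by simpa using h)]
    · have : (‖z‖ : ℂ) ≠ 0 := by simpa using h
      rw [div_mul_eq_mul_div, div_eq_iff this, Complex.conj_mul']; ring

theorem class_card (U M : ℕ) (hM : 0 < M) (ρ : ℤ) :
    (#{u ∈ Ico (0:ℤ) U | u % (M : ℤ) = ρ} : ℝ) ≤ U / M + 1 := by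
  have h1 : #{u ∈ Ico (0:ℤ) U | u % (M : ℤ) = ρ} ≤ #(Ico (0:ℤ) ((U / M : ℕ) + 1)) := by
    apply card_le_card_of_injOn (fun u : ℤ => u / (M:ℤ))
    · intro u hu
      rw [mem_coe, mem_filter, mem_Ico] at hu
      rw [mem_coe, mem_Ico]
      refine ⟨Int.ediv_nonneg hu.1.1 (by positivity), ?_⟩
      have : u / (M : ℤ) ≤ U / M := Int.ediv_le_ediv (by positivity) hu.1.2.le
      push_cast; linarith
    · intro u hu v hv h
      rw [mem_coe, mem_filter] at hu hv
      have e1 := Int.emod_add_mul_ediv u M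
      have e2 := Int.emod_add_mul_ediv v M
      simp only at h
      rw [← e1, ← e2, h, hu.2, hv.2]
  have h2 : #(Ico (0:ℤ) ((U / M : ℕ) + 1)) = U / M + 1 := by
    rw [Int.card_Ico, sub_zero]; exact_mod_cast Int.toNat_natCast (U / M + 1)
  rw [h2] at h1
  calc _ ≤ ((U / M + 1 : ℕ) : ℝ) := by exact_mod_cast h1
    _ ≤ _ := by push_cast; gcongr; exact Nat.cast_div_le

theorem class_lin {Q : ℕ} [NeZero Q] (B : ℤ → ℂ) (hB : ∀ u, ‖B u‖ ≤ 1) (U M : ℕ) (hM : 0 < M) (η : ZMod Q) (r : ℤ) :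
    ∃ y : ℤ → ℂ, (∀ w, ‖y w‖ ≤ 1) ∧ (∀ w, y (w + M) = ch Q η r * y w) ∧
      ∑ ρ ∈ Ico (0:ℤ) M, ‖∑ u ∈ Ico (0:ℤ) U with u % M = ρ, B u * ch Q η (r * (u / M))‖ ^ 2 ≤
        ((U : ℝ) / M + 1) * ‖∑ u ∈ Ico (0:ℤ) U, B u * y u‖ := by
  choose θ hθ1 hθ2 using fun ρ : ℤ => phase_exists (∑ u ∈ Ico (0:ℤ) U with u % M = ρ, B u * ch Q η (r * (u / M)))
  have hM0 : (M : ℤ) ≠ 0 := by positivity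
  refine ⟨fun w => ch Q η (r * (w / M)) * θ (w % M), ?_, ?_, ?_⟩
  · intro w; simp only; rw [norm_mul, ch_norm, one_mul]; exact hθ1 _
  · intro w
    simp only
    rw [Int.add_emod_right, Int.add_ediv_of_dvd_right dvd_rfl, Int.ediv_self hM0, mul_add, ch_add, mul_one]; ring
  · have h1 : ∑ u ∈ Ico (0:ℤ) U, B u * (ch Q η (r * (u / M)) * θ (u % M)) =
        ((∑ ρ ∈ Ico (0:ℤ) M, ‖∑ u ∈ Ico (0:ℤ) U with u % M = ρ, B u * ch Q η (r * (u / M))‖ : ℝ) : ℂ) := by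
      rw [Complex.ofReal_sum, ← sum_fiberwise_of_maps_to (s := Ico (0:ℤ) U) (t := Ico (0:ℤ) M) (g := fun u => u % M)
        (fun u _ => by rw [mem_Ico]; exact ⟨Int.emod_nonneg _ hM0, Int.emod_lt_of_pos _ (by positivity)⟩)]
      refine sum_congr rfl fun ρ _ => ?_
      rw [← hθ2, mul_sum]
      refine sum_congr rfl fun u hu => ?_
      rw [(mem_filter.1 hu).2]; ring
    rw [h1, Complex.norm_real, Real.norm_of_nonneg (sum_nonneg fun _ _ => norm_nonneg _), mul_sum]
    refine sum_le_sum fun ρ _ => ?_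
    rw [sq]
    gcongr
    refine (norm_sum_le_card _ _ fun u _ => ?_).trans (class_card U M hM ρ)
    rw [norm_mul, ch_norm, mul_one]; exact hB u

theorem Xsum (U T M : ℕ) (hT : 0 < T) (hM : 0 < M) (g : ℤ → ℂ) (hg : ∀ w, ‖g w‖ ≤ 1) (hgs : ∀ w, w ∉ Ico (0:ℤ) U → g w = 0)
    (𝒯 : Finset ℤ) (h𝒯 : 𝒯 ⊆ Ico (0:ℤ) T) (y : ℤ → ℤ → ℂ) (hy : ∀ t w, ‖y t w‖ ≤ 1) (ζ : ℤ → ℂ)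
    (hyM : ∀ t ∈ 𝒯, ∀ w, y t (w + M) = ζ t * y t w) (r0 ρ : ℤ)
    (hbad : ∀ δ : ℤ, δ ≠ 0 → ∀ s ∈ 𝒯, s + δ ∈ 𝒯 →
      #{t ∈ 𝒯 | t + δ ∈ 𝒯 ∧ ‖1 - ζ (t + δ) * conj (ζ t) * conj (ζ (s + δ) * conj (ζ s))‖ * U < 2 * M * T} ≤ 4) :
    (∑ t ∈ 𝒯, ‖∑ w ∈ Ico (0:ℤ) U, conj (g w) * (g (w + (r0 + ρ * t)) * y t w)‖) ^ 4 ≤ 22 * U ^ 4 * T ^ 3 := by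
  set s := Ico (0:ℤ) U with hs
  have hscard : #s = U := by simp [hs]
  have hTcard : (#𝒯 : ℝ) ≤ T := by
    have := card_le_card h𝒯; simp at this; exact_mod_cast this
  have hT' : (0:ℝ) < T := by exact_mod_cast hT
  set D : ℤ → ℤ → ℂ := fun t t' => ∑ w ∈ s, (g (w + (r0 + ρ * t)) * y t w) * conj (g (w + (r0 + ρ * t')) * y t' w) with hD
  have h1 : (∑ t ∈ 𝒯, ‖∑ w ∈ s, conj (g w) * (g (w + (r0 + ρ * t)) * y t w)‖) ^ 2 ≤
      U * ∑ t ∈ 𝒯, ∑ t' ∈ 𝒯, ‖D t t'‖ := by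
    have := cs_weight s 𝒯 (fun w => conj (g w)) (fun w _ => by rw [RCLike.norm_conj]; exact hg w)
      (fun t w => g (w + (r0 + ρ * t)) * y t w)
    rwa [hscard] at this
  set E : ℤ → ℝ := fun δ => ∑ t' ∈ 𝒯 with t' + δ ∈ 𝒯, ‖D (t' + δ) t'‖ with hE
  have h2 : ∑ t ∈ 𝒯, ∑ t' ∈ 𝒯, ‖D t t'‖ = ∑ δ ∈ Ioo (-(T:ℤ)) T, E δ := by
    rw [sum_comm, ← sum_product', ← sum_fiberwise_of_maps_to (s := 𝒯 ×ˢ 𝒯) (t := Ioo (-(T:ℤ)) T) (g := fun p => p.2 - p.1)]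
    · refine sum_congr rfl fun δ _ => ?_
      rw [hE]
      refine sum_nbij' (fun p => p.1) (fun t' => (t', t' + δ)) ?_ ?_ ?_ ?_ ?_
      · rintro ⟨a, b⟩ h
        simp only [mem_filter, mem_product] at h ⊢
        refine ⟨h.1.1, ?_⟩
        have : a + δ = b := by linarith
        rw [this]; exact h.1.2
      · intro a h
        simp only [mem_filter, mem_product] at h ⊢
        exact ⟨h, by ring⟩
      · rintro ⟨a, b⟩ h
        simp only [mem_filter, mem_product] at h ⊢
        ext
        · rfl
        · simp only; linarith
      · intro a _; rfl
      · rintro ⟨a, b⟩ h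
        simp only [mem_filter, mem_product] at h ⊢
        have : a + δ = b := by linarith
        rw [this]
    · rintro ⟨a, b⟩ h
      simp only [mem_product] at h
      have ha := mem_Ico.1 (h𝒯 h.1)
      have hb := mem_Ico.1 (h𝒯 h.2)
      rw [mem_Ioo]; simp only; omega
  have hEn : ∀ δ, 0 ≤ E δ := fun δ => sum_nonneg fun _ _ => norm_nonneg _
  have hE0 : E 0 ≤ T * U := by
    rw [hE]
    calc ∑ t' ∈ 𝒯 with t' + 0 ∈ 𝒯, ‖D (t' + 0) t'‖ ≤ ∑ t' ∈ 𝒯 with t' + 0 ∈ 𝒯, (U : ℝ) := by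
          refine sum_le_sum fun t' _ => ?_
          rw [hD, ← hscard]
          refine norm_sum_le_card _ _ fun w _ => ?_
          rw [norm_mul, norm_mul, RCLike.norm_conj, norm_mul]
          exact mul_le_one₀ (mul_le_one₀ (hg _) (norm_nonneg _) (hy _ _)) (by positivity) (mul_le_one₀ (hg _) (norm_nonneg _) (hy _ _))
      _ ≤ _ := by
          rw [sum_const, nsmul_eq_mul]
          gcongr
          exact_mod_cast le_trans (card_le_card (filter_subset _ _)) (by exact_mod_cast hTcard)
  have hEd : ∀ δ, δ ≠ 0 → E δ ^ 2 ≤ 5 * T * U ^ 2 := by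
    intro δ hδ
    set 𝒮 := {t' ∈ 𝒯 | t' + δ ∈ 𝒯} with h𝒮
    set F : ℤ → ℤ → ℂ := fun t x => if x - (r0 + ρ * t) ∈ s then y (t + δ) (x - (r0 + ρ * t)) * conj (y t (x - (r0 + ρ * t))) else 0 with hF
    have hDF : ∀ t, D (t + δ) t = ∑ x ∈ s, (g (x + ρ * δ) * conj (g x)) * F t x := by
      intro t
      have e1 : ∑ x ∈ s, (g (x + ρ * δ) * conj (g x)) * F t x =
          ∑ x ∈ Ico (r0 + ρ * t) (U + (r0 + ρ * t)), (g (x + ρ * δ) * conj (g x)) * (y (t + δ) (x - (r0 + ρ * t)) * conj (y t (x - (r0 + ρ * t)))) := by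
        have e2 : ∑ x ∈ s, (g (x + ρ * δ) * conj (g x)) * F t x = ∑ x ∈ s with x - (r0 + ρ * t) ∈ s, (g (x + ρ * δ) * conj (g x)) * (y (t + δ) (x - (r0 + ρ * t)) * conj (y t (x - (r0 + ρ * t)))) := by
          rw [sum_filter]; refine sum_congr rfl fun x _ => ?_
          simp only [hF]; split_ifs <;> simp
        rw [e2]
        refine sum_subset ?_ ?_
        · intro x hx
          simp only [hs, mem_filter, mem_Ico] at hx ⊢; omega
        · intro x hx hx'
          have : x ∉ Ico (0:ℤ) U := by
            intro h; apply hx'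
            simp only [hs, mem_filter, mem_Ico] at hx h ⊢; omega
          rw [hgs x this]; simp
      rw [e1]
      have e3 : Ico (r0 + ρ * t) (U + (r0 + ρ * t)) = s.map (addRightEmbedding (r0 + ρ * t)) := by
        rw [hs, map_add_right_Ico, zero_add]
      rw [e3, sum_map, hD]
      refine sum_congr rfl fun w _ => ?_
      simp only [addRightEmbedding_apply, add_sub_cancel_right, map_mul]
      rw [show w + (r0 + ρ * (t + δ)) = w + (r0 + ρ * t) + ρ * δ by ring]; ring
    have h3 := cs_weight s 𝒮 (fun x => g (x + ρ * δ) * conj (g x)) (fun x _ => by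
      rw [norm_mul, RCLike.norm_conj]; exact mul_le_one₀ (hg _) (norm_nonneg _) (hg _)) F
    rw [hscard] at h3
    have h4 : E δ = ∑ t ∈ 𝒮, ‖∑ x ∈ s, (g (x + ρ * δ) * conj (g x)) * F t x‖ := by
      rw [hE]; refine sum_congr rfl fun t _ => by rw [hDF]
    rw [h4]
    refine h3.trans ?_
    have hF1 : ∀ t x, ‖F t x‖ ≤ 1 := by
      intro t x; simp only [hF]; split_ifs
      · rw [norm_mul, RCLike.norm_conj]; exact mul_le_one₀ (hy _ _) (norm_nonneg _) (hy _ _)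
      · simp
    have hin : ∀ b ∈ 𝒮, ∑ t ∈ 𝒮, ‖∑ x ∈ s, F t x * conj (F b x)‖ ≤ 5 * U := by
      intro b hb
      set z : ℤ → ℂ := fun t => ζ (t + δ) * conj (ζ t) * conj (ζ (b + δ) * conj (ζ b)) with hz
      have hb' := mem_filter.1 hb
      have bad := hbad δ hδ b hb'.1 hb'.2
      have htriv : ∀ t, ‖∑ x ∈ s, F t x * conj (F b x)‖ ≤ U := by
        intro t; rw [← hscard]
        refine norm_sum_le_card _ _ fun x _ => ?_
        rw [norm_mul, RCLike.norm_conj]; exact mul_le_one₀ (hF1 _ _) (norm_nonneg _) (hF1 _ _)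
      have hgood : ∀ t ∈ 𝒮, 2 * M * T ≤ ‖1 - z t‖ * U → ‖∑ x ∈ s, F t x * conj (F b x)‖ ≤ U / T := by
        intro t ht hh
        have ht' := mem_filter.1 ht
        set G : ℤ → ℂ := fun x => y (t + δ) (x - (r0 + ρ * t)) * conj (y t (x - (r0 + ρ * t))) * conj (y (b + δ) (x - (r0 + ρ * b)) * conj (y b (x - (r0 + ρ * b)))) with hG
        have e1 : ∑ x ∈ s, F t x * conj (F b x) = ∑ x ∈ Ico (max 0 (max (r0 + ρ * t) (r0 + ρ * b))) (min U (min (U + (r0 + ρ * t)) (U + (r0 + ρ * b)))), G x := by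
          have : Ico (max 0 (max (r0 + ρ * t) (r0 + ρ * b))) (min (U:ℤ) (min (U + (r0 + ρ * t)) (U + (r0 + ρ * b)))) =
             {x ∈ s | x - (r0 + ρ * t) ∈ s ∧ x - (r0 + ρ * b) ∈ s} := by
            ext x; simp only [hs, mem_filter, mem_Ico]; omega
          rw [this, sum_filter]
          refine sum_congr rfl fun x _ => ?_
          simp only [hF, hG]
          by_cases c1 : x - (r0 + ρ * t) ∈ s <;> by_cases c2 : x - (r0 + ρ * b) ∈ s <;> simp [c1, c2]
        have q := quasi_sum G (by
            intro w
            simp only [hG, norm_mul, RCLike.norm_conj]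
            exact mul_le_one₀ (mul_le_one₀ (hy _ _) (norm_nonneg _) (hy _ _)) (by positivity) (mul_le_one₀ (hy _ _) (norm_nonneg _) (hy _ _))) M (z t) (by
            intro w
            simp only [hG, hz]
            rw [show w + (M:ℤ) - (r0 + ρ * t) = (w - (r0 + ρ * t)) + M by ring, show w + (M:ℤ) - (r0 + ρ * b) = (w - (r0 + ρ * b)) + M by ring,
              hyM _ ht'.1, hyM _ ht'.2, hyM _ hb'.1, hyM _ hb'.2]
            simp only [map_mul]; ring) (max 0 (max (r0 + ρ * t) (r0 + ρ * b))) (min U (min (U + (r0 + ρ * t)) (U + (r0 + ρ * b))))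
        rw [← e1] at q
        rw [le_div_iff₀ hT']
        by_cases hz0 : ‖1 - z t‖ = 0
        · rw [hz0, zero_mul] at hh
          have : (0:ℝ) < 2 * M * T := by positivity
          linarith
        · have hzp : 0 < ‖1 - z t‖ := lt_of_le_of_ne (norm_nonneg _) (Ne.symm hz0)
          nlinarith
      calc ∑ t ∈ 𝒮, ‖∑ x ∈ s, F t x * conj (F b x)‖ ≤ ∑ t ∈ 𝒮, ((if ‖1 - z t‖ * U < 2 * M * T then (U:ℝ) else 0) + U / T) := by
            refine sum_le_sum fun t ht => ?_
            split_ifs with hh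
            · have := htriv t; have : (0:ℝ) ≤ U / T := by positivity
              linarith [htriv t]
            · rw [zero_add]; exact hgood t ht (not_lt.1 hh)
        _ ≤ 4 * U + U := by
            rw [sum_add_distrib]
            gcongr
            · rw [← sum_filter, sum_const, nsmul_eq_mul]
              gcongr
              have e : #{t ∈ 𝒮 | ‖1 - z t‖ * U < 2 * M * T} ≤ 4 := by
                refine le_trans (le_of_eq ?_) bad
                rw [h𝒮, filter_filter]
              exact_mod_cast e
            · rw [sum_const, nsmul_eq_mul]
              have : (#𝒮 : ℝ) ≤ T := le_trans (by exact_mod_cast card_le_card (filter_subset _ _)) hTcard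
              calc (#𝒮 : ℝ) * (U / T) ≤ T * (U / T) := by gcongr
                _ = U := by field_simp
        _ = 5 * U := by ring
    have hS : (#𝒮 : ℝ) ≤ T := le_trans (by exact_mod_cast card_le_card (filter_subset _ _)) hTcard
    calc (U:ℝ) * ∑ j ∈ 𝒮, ∑ j' ∈ 𝒮, ‖∑ i ∈ s, F j i * conj (F j' i)‖ ≤ U * ∑ j' ∈ 𝒮, (5 * U : ℝ) := by
          rw [sum_comm]; gcongr with b hb; exact hin b hb
      _ = U * (#𝒮 * (5 * U)) := by rw [sum_const, nsmul_eq_mul]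
      _ ≤ U * (T * (5 * U)) := by gcongr
      _ = _ := by ring
  have h5 : (∑ δ ∈ Ioo (-(T:ℤ)) T, E δ) ^ 2 ≤ 22 * T ^ 3 * U ^ 2 := by
    have hc : #(Ioo (-(T:ℤ)) T) ≤ 2 * T := by rw [Int.card_Ioo]; omega
    have c1 := sq_sum_le_card_mul_sum_sq (s := Ioo (-(T:ℤ)) T) (f := E)
    refine c1.trans ?_
    have c2 : ∑ δ ∈ Ioo (-(T:ℤ)) T, E δ ^ 2 ≤ ∑ δ ∈ Ioo (-(T:ℤ)) T, ((if δ = 0 then (T * U : ℝ) ^ 2 else 0) + 5 * T * U ^ 2) := by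
      refine sum_le_sum fun δ _ => ?_
      split_ifs with h
      · subst h
        have := pow_le_pow_left₀ (hEn 0) hE0 2
        have : (0:ℝ) ≤ 5 * T * U ^ 2 := by positivity
        linarith
      · rw [zero_add]; exact hEd δ h
    have c3 : ∑ δ ∈ Ioo (-(T:ℤ)) T, ((if δ = 0 then (T * U : ℝ) ^ 2 else 0) + 5 * T * U ^ 2) ≤ (T * U : ℝ) ^ 2 + (2 * T) * (5 * T * U ^ 2) := by
      rw [sum_add_distrib, sum_const, nsmul_eq_mul, sum_ite_eq']
      gcongr
      · split_ifs
        · rfl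
        · positivity
      · exact_mod_cast hc
    calc (#(Ioo (-(T:ℤ)) T) : ℝ) * ∑ δ ∈ Ioo (-(T:ℤ)) T, E δ ^ 2 ≤ (2 * T) * ((T * U) ^ 2 + (2 * T) * (5 * T * U ^ 2)) := by
          gcongr
          · exact_mod_cast hc
          · exact c2.trans c3
      _ = _ := by ring
  rw [h2] at h1
  have h6 := pow_le_pow_left₀ (by positivity) h1 2
  calc _ = ((∑ t ∈ 𝒯, ‖∑ w ∈ s, conj (g w) * (g (w + (r0 + ρ * t)) * y t w)‖) ^ 2) ^ 2 := by ring
    _ ≤ _ := h6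
    _ = U ^ 2 * (∑ δ ∈ Ioo (-(T:ℤ)) T, E δ) ^ 2 := by ring
    _ ≤ U ^ 2 * (22 * T ^ 3 * U ^ 2) := by gcongr
    _ = _ := by ring

end

section
open Finset Polynomial
open scoped ComplexConjugate

theorem poly_count (A B d C : ℝ) (hA : A * d ≠ 0) (S : Finset ℝ)
    (hS : ∀ x ∈ S, (A * (x + d) - B) * (x ^ 2 - B) - (A * x - B) * ((x + d) ^ 2 - B) - C * ((x ^ 2 - B) * ((x + d) ^ 2 - B)) = 0) :
    #S ≤ 4 := by
  classical
  set p : ℝ[X] := (Polynomial.C A * (X + Polynomial.C d) - Polynomial.C B) * (X ^ 2 - Polynomial.C B) - (Polynomial.C A * X - Polynomial.C B) * ((X + Polynomial.C d) ^ 2 - Polynomial.C B) - Polynomial.C C * ((X ^ 2 - Polynomial.C B) * ((X + Polynomial.C d) ^ 2 - Polynomial.C B)) with hp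
  have hev : ∀ x, p.eval x = (A * (x + d) - B) * (x ^ 2 - B) - (A * x - B) * ((x + d) ^ 2 - B) - C * ((x ^ 2 - B) * ((x + d) ^ 2 - B)) := by
    intro x; simp [hp]
  have hp2 : p = Polynomial.C (-C) * X ^ 4 + Polynomial.C (-2 * C * d) * X ^ 3 + Polynomial.C (-A * d - C * (d ^ 2 - 2 * B)) * X ^ 2
      + Polynomial.C (-A*d^2 + 2 * B * d + 2 * C * B * d) * X + Polynomial.C (-A * d * B + B * d ^ 2 - C * B * (B - d ^ 2)) := by
    apply Polynomial.funext
    intro x; rw [hev]; simp; ring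
  have hdeg : p.natDegree ≤ 4 := by
    rw [hp2]; compute_degree
  have hne : p ≠ 0 := by
    intro h0
    have c4 : p.coeff 4 = -C := by
      rw [hp2]; simp only [coeff_add, coeff_C_mul, coeff_X_pow, coeff_X, coeff_C]; norm_num
    have c2 : p.coeff 2 = (-A * d - C * (d ^ 2 - 2 * B)) := by
      rw [hp2]; simp only [coeff_add, coeff_C_mul, coeff_X_pow, coeff_X, coeff_C]; norm_num
    rw [h0, coeff_zero] at c4 c2
    apply hA
    have : C = 0 := by linarith
    rw [this] at c2; linarith
  calc #S ≤ #p.roots.toFinset := by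
        apply card_le_card
        intro x hx
        rw [Multiset.mem_toFinset, mem_roots hne, IsRoot, hev, hS x hx]
    _ ≤ Multiset.card p.roots := Multiset.toFinset_card_le _
    _ ≤ p.natDegree := card_roots' p
    _ ≤ 4 := hdeg

theorem major {Q : ℕ} [NeZero Q] (U : ℕ) (hQ : 3 * U < Q) (g : ℤ → ℂ) (hg : ∀ w, ‖g w‖ ≤ 1) (hgs : ∀ w, w ∉ Ico (0:ℤ) U → g w = 0)
    (c : ℝ) (hc : ∀ ξ : ZMod Q, ‖∑ u ∈ Ico (0:ℤ) U, g u * ch Q ξ u‖ ≤ c) (η : ZMod Q)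
    (H : Finset ℤ) (N : ℤ) (hN : N ≠ 0) (hH : ∀ h ∈ H, |N * h| < U) :
    ∑ h ∈ H, ‖∑ u ∈ Ico (0:ℤ) U, (g u * conj (g (u + N * h))) * ch Q η u‖ ^ 2 ≤ c ^ 2 * U := by
  set s := Ico (0:ℤ) U with hs
  have hscard : #s = U := by simp [hs]
  have hQpos : (0:ℝ) < Q := by have := NeZero.pos Q; exact_mod_cast this
  set b : ZMod Q → ℂ := fun ξ => (∑ u ∈ s, (g u * ch Q η u) * ch Q ξ u) * conj (∑ u ∈ s, g u * ch Q ξ u) with hb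
  have h1 : ∀ τ : ℤ, |τ| < U → (Q : ℂ) * ∑ u ∈ s, (g u * conj (g (u + τ))) * ch Q η u = ∑ ξ : ZMod Q, b ξ * ch Q ξ τ := by
    intro τ hτ
    have q := quad_sum (Q := Q) s s (fun u => g u * ch Q η u) (fun v => conj (g v)) (fun u => u) (fun v => -v + τ) (by
      intro u hu v hv
      rw [hs, mem_Ico] at hu hv
      rw [abs_lt] at hτ ⊢
      omega)
    have e1 : ∑ ξ : ZMod Q, b ξ * ch Q ξ τ = ∑ ξ : ZMod Q, (∑ u ∈ s, g u * ch Q η u * ch Q ξ u) * ∑ v ∈ s, conj (g v) * ch Q ξ (-v + τ) := by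
      refine sum_congr rfl fun ξ _ => ?_
      simp only [hb]; rw [map_sum (starRingEnd ℂ), mul_assoc]
      congr 1
      rw [sum_mul]
      refine sum_congr rfl fun v _ => ?_
      rw [ch_add, ch_neg, map_mul]; ring
    rw [e1, q]
    congr 1
    refine sum_congr rfl fun u hu => ?_
    by_cases hm : u + τ ∈ s
    · rw [sum_eq_single (u + τ)]
      · rw [if_pos (by ring)]; ring
      · intro v _ hv; rw [if_neg]; intro h; apply hv; linarith
      · intro h; exact absurd hm h
    · rw [hgs _ hm, sum_eq_zero]
      · simp
      · intro v hv; rw [if_neg]; intro h; apply hm; rw [show u + τ = v by linarith]; exact hv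
  have h2 : ∑ τ ∈ Ioo (-(U:ℤ)) U, ‖∑ ξ : ZMod Q, b ξ * ch Q ξ τ‖ ^ 2 ≤ Q * ∑ ξ, ‖b ξ‖ ^ 2 := by
    have inj : ∑ τ ∈ Ioo (-(U:ℤ)) U, ‖∑ ξ : ZMod Q, b ξ * ch Q ξ τ‖ ^ 2 ≤ ∑ x : ZMod Q, ‖∑ ξ : ZMod Q, b ξ * ZMod.stdAddChar (ξ * x)‖ ^ 2 := by
      have : ∑ τ ∈ Ioo (-(U:ℤ)) U, ‖∑ ξ : ZMod Q, b ξ * ch Q ξ τ‖ ^ 2 = ∑ x ∈ (Ioo (-(U:ℤ)) U).image (fun τ : ℤ => (τ : ZMod Q)), ‖∑ ξ : ZMod Q, b ξ * ZMod.stdAddChar (ξ * x)‖ ^ 2 := by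
        rw [sum_image]
        · rfl
        · intro x hx y hy h
          simp only [coe_Ioo, Set.mem_Ioo] at hx hy
          rw [← sub_eq_zero]
          have : ((x - y : ℤ) : ZMod Q) = 0 := by push_cast; simp only at h; rw [h, sub_self]
          rw [ZMod.intCast_zmod_eq_zero_iff_dvd] at this
          apply Int.eq_zero_of_abs_lt_dvd this
          rw [abs_lt]; omega
      rw [this]
      exact sum_le_sum_of_subset_of_nonneg (subset_univ _) fun _ _ _ => by positivity
    refine inj.trans (le_of_eq ?_)
    apply Complex.ofReal_injective
    rw [Complex.ofReal_sum]
    simp_rw [sqnorm_expand]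
    rw [sum_comm]
    push_cast
    rw [mul_sum]
    refine sum_congr rfl fun ξ _ => ?_
    rw [sum_comm]
    have : ∀ ξ' : ZMod Q, ∑ x : ZMod Q, b ξ * ZMod.stdAddChar (ξ * x) * conj (b ξ' * ZMod.stdAddChar (ξ' * x)) = if ξ' = ξ then Q * (b ξ * conj (b ξ)) else 0 := by
      intro ξ'
      have e : ∀ x : ZMod Q, b ξ * ZMod.stdAddChar (ξ * x) * conj (b ξ' * ZMod.stdAddChar (ξ' * x)) = b ξ * conj (b ξ') * ZMod.stdAddChar (x * (ξ - ξ')) := by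
        intro x
        rw [map_mul (starRingEnd ℂ), ← AddChar.map_neg_eq_conj, show x * (ξ - ξ') = ξ * x + -(ξ' * x) by ring, AddChar.map_add_eq_mul]; ring
      simp_rw [e]
      rw [← mul_sum, AddChar.sum_mulShift _ (ZMod.isPrimitive_stdAddChar Q)]
      simp only [sub_eq_zero, ZMod.card]
      by_cases h : ξ = ξ'
      · subst h; simp; ring
      · rw [if_neg h, if_neg (Ne.symm h)]; simp
    simp_rw [this]
    rw [sum_ite_eq', if_pos (mem_univ _), Complex.mul_conj']
  have h3 : ∑ ξ, ‖b ξ‖ ^ 2 ≤ c ^ 2 * (Q * U) := by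
    have e : ∀ ξ, ‖b ξ‖ ^ 2 ≤ c ^ 2 * ‖∑ u ∈ s, (g u * ch Q η u) * ch Q ξ u‖ ^ 2 := by
      intro ξ
      rw [hb]; simp only; rw [norm_mul, mul_pow, RCLike.norm_conj, mul_comm]
      have := hc ξ
      gcongr
    refine (sum_le_sum fun ξ _ => e ξ).trans ?_
    rw [← mul_sum, parseval_inj s (fun u => u) _ _ (fun _ _ _ _ h => h)]
    · gcongr
      calc ∑ p ∈ s, ‖g p * ch Q η p‖ ^ 2 ≤ ∑ p ∈ s, (1:ℝ) := by
            refine sum_le_sum fun u _ => ?_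
            rw [norm_mul, ch_norm, mul_one]; exact pow_le_one₀ (norm_nonneg _) (hg u)
        _ = U := by rw [sum_const, hscard]; simp
    · intro u hu v hv
      rw [hs, mem_Ico] at hu hv; rw [abs_lt]; omega
  have h4 : (Q:ℝ) ^ 2 * ∑ h ∈ H, ‖∑ u ∈ s, (g u * conj (g (u + N * h))) * ch Q η u‖ ^ 2 ≤ Q ^ 2 * (c ^ 2 * U) := by
    calc (Q:ℝ) ^ 2 * ∑ h ∈ H, ‖∑ u ∈ s, (g u * conj (g (u + N * h))) * ch Q η u‖ ^ 2
        = ∑ h ∈ H, ‖∑ ξ : ZMod Q, b ξ * ch Q ξ (N * h)‖ ^ 2 := by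
          rw [mul_sum]; refine sum_congr rfl fun h hh => ?_
          rw [← h1 _ (hH h hh), norm_mul, mul_pow, Complex.norm_natCast]
      _ = ∑ τ ∈ H.image (fun h => N * h), ‖∑ ξ : ZMod Q, b ξ * ch Q ξ τ‖ ^ 2 := by
          rw [sum_image]; intro x _ y _ h; exact mul_left_cancel₀ hN h
      _ ≤ ∑ τ ∈ Ioo (-(U:ℤ)) U, ‖∑ ξ : ZMod Q, b ξ * ch Q ξ τ‖ ^ 2 := by
          refine sum_le_sum_of_subset_of_nonneg ?_ fun _ _ _ => by positivity
          intro τ hτ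
          obtain ⟨h, hh, rfl⟩ := mem_image.1 hτ
          rw [mem_Ioo]; exact abs_lt.1 (hH h hh)
      _ ≤ _ := h2
      _ ≤ Q * (c ^ 2 * (Q * U)) := by gcongr
      _ = _ := by ring
  exact le_of_mul_le_mul_left h4 (by positivity)

end

section
open Finset
open scoped ComplexConjugate

noncomputable def PP (U I : ℕ) (κ : ℤ) : Finset (ℤ × ℤ) := {p ∈ Ico (0:ℤ) U ×ˢ Ico (0:ℤ) U | (I : ℤ) ∣ p.2 - p.1 - κ}

noncomputable def HH (U N : ℕ) : Finset ℤ := {h ∈ Ioo (-(U:ℤ)) U | |(N:ℤ) * h| < U}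

theorem mem_HH {U N : ℕ} (hN : 0 < N) {h : ℤ} : h ∈ HH U N ↔ |(N:ℤ) * h| < U := by
  unfold HH
  rw [mem_filter]
  refine ⟨fun h => h.2, fun hh => ⟨?_, hh⟩⟩
  rw [mem_Ioo, ← abs_lt]
  refine lt_of_le_of_lt ?_ hh
  rw [abs_mul]
  have : (1:ℤ) ≤ |(N:ℤ)| := by rw [Nat.abs_cast]; exact_mod_cast hN
  nlinarith [abs_nonneg h]

theorem card_HH {U N : ℕ} (hN : 0 < N) (hU : N ≤ U) : (#(HH U N) : ℝ) ≤ 3 * U / N := by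
  have h1 : HH U N ⊆ Icc (-((U / N : ℕ) : ℤ)) ((U / N : ℕ) : ℤ) := by
    intro h hh
    rw [mem_HH hN, abs_mul, Nat.abs_cast] at hh
    rw [mem_Icc, ← abs_le]
    push_cast
    rw [Int.le_ediv_iff_mul_le (by positivity)]
    linarith
  have h2 := card_le_card h1
  rw [Int.card_Icc] at h2
  have h3 : #(HH U N) ≤ 2 * (U / N) + 1 := by
    refine h2.trans ?_; have := Nat.zero_le (U/N); omega
  have h4 : ((U / N : ℕ) : ℝ) ≤ U / N := Nat.cast_div_le
  have h5 : (1:ℝ) ≤ U / N := by rw [le_div_iff₀ (by positivity)]; rw [one_mul]; exact_mod_cast hU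
  calc (#(HH U N) : ℝ) ≤ ((2 * (U / N) + 1 : ℕ) : ℝ) := by exact_mod_cast h3
    _ ≤ 2 * (U / N) + U / N := by push_cast at h4 ⊢; linarith
    _ = _ := by ring

theorem far_step1 (g : ℤ → ℂ) (U N0 N1 R I : ℕ)
    (hgs : ∀ w, w ∉ Ico (0:ℤ) U → g w = 0) (hN0 : 0 < N0) (hc0 : Nat.Coprime N0 R) (hdiv : (I : ℤ) ∣ R - N0)
    (κ : ℤ) (Φ0 Φ1 : ℤ → ℂ) (hΦ0 : ∀ x, ‖Φ0 x‖ ≤ 1) (J0 : Finset ℤ)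
    (hJ0 : ∀ x, x ∉ J0 → Φ0 x = 0) :
    ‖∑ p ∈ PP U I κ, Φ0 (N0 * p.2 - R * p.1) * (Φ1 (R * p.2 - N1 * p.1) * (g p.1 * conj (g p.2)))‖ ^ 2 ≤
      #J0 * ∑ h ∈ HH U N0, ‖∑ p ∈ PP U I κ, (Φ1 (R * p.2 - N1 * p.1) * conj (Φ1 (R * p.2 - N1 * p.1 + h * (R * R - N1 * N0)))) *
        ((g p.1 * conj (g (p.1 + N0 * h))) * (conj (g p.2) * g (p.2 + R * h)))‖ := by
  set P := PP U I κ with hP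
  set w : ℤ × ℤ → ℂ := fun p => Φ1 (R * p.2 - N1 * p.1) * (g p.1 * conj (g p.2)) with hw
  set π : ℤ × ℤ → ℤ := fun p => N0 * p.2 - R * p.1 with hπ
  have h1 := fiberCS P π J0 Φ0 hΦ0 hJ0 w
  refine h1.trans (mul_le_mul_of_nonneg_left ?_ (by positivity))
  have hcZ : IsCoprime (N0 : ℤ) (R : ℤ) := Nat.isCoprime_iff_coprime.2 hc0
  have h2 : ((∑ x ∈ P.image π, ‖∑ p ∈ P with π p = x, w p‖ ^ 2 : ℝ) : ℂ) =
      ∑ h ∈ HH U N0, ∑ p ∈ P, w p * conj (w (p.1 + N0 * h, p.2 + R * h)) := by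
    rw [fiber_pairs P π w (P.image π) fun p hp => mem_image_of_mem _ hp, sum_comm (s := HH U N0)]
    refine sum_congr rfl fun p hp => ?_
    rw [hP, PP, mem_filter, mem_product, mem_Ico, mem_Ico] at hp
    rw [← sum_filter, ← sum_filter_ne_zero (s := HH U N0)]
    rw [← sum_filter_ne_zero (s := {a ∈ P | π p = π a})]
    symm
    refine sum_nbij (fun h => (p.1 + N0 * h, p.2 + R * h)) ?_ ?_ ?_ ?_
    · intro h hh
      rw [mem_filter] at hh ⊢
      refine ⟨?_, hh.2⟩
      rw [mem_filter]
      have hne : w (p.1 + N0 * h, p.2 + R * h) ≠ 0 := by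
        intro h0; apply hh.2; rw [h0]; simp
      have m1 : p.1 + N0 * h ∈ Ico (0:ℤ) U := by
        by_contra hcon; apply hne; simp only [hw]; rw [hgs _ hcon]; simp
      have m2 : p.2 + R * h ∈ Ico (0:ℤ) U := by
        by_contra hcon; apply hne; simp only [hw]; rw [hgs _ hcon]; simp
      refine ⟨?_, ?_⟩
      · rw [hP, PP, mem_filter, mem_product]
        refine ⟨⟨m1, m2⟩, ?_⟩
        simp only
        rw [show p.2 + R * h - (p.1 + N0 * h) - κ = (p.2 - p.1 - κ) + (R - N0) * h by ring]
        exact dvd_add hp.2 (dvd_mul_of_dvd_left hdiv _)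
      · simp only [hπ]; ring
    · intro h _ h' _ heq
      simp only [Prod.mk.injEq] at heq
      have : (N0 : ℤ) * h = N0 * h' := by linarith [heq.1]
      exact mul_left_cancel₀ (by positivity) this
    · intro q hq
      simp only [coe_filter, Set.mem_ofPred_eq, mem_filter] at hq
      obtain ⟨⟨hqP, hqπ⟩, hq0⟩ := hq
      rw [hP, PP, mem_filter, mem_product, mem_Ico, mem_Ico] at hqP
      simp only [hπ] at hqπ
      have e1 : (N0 : ℤ) * (q.2 - p.2) = R * (q.1 - p.1) := by linarith
      have d1 : (N0 : ℤ) ∣ q.1 - p.1 := hcZ.dvd_of_dvd_mul_left ⟨_, e1.symm⟩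
      obtain ⟨h, hh⟩ := d1
      have e2 : q.2 - p.2 = R * h := by
        have : (N0:ℤ) * (q.2 - p.2) = N0 * (R * h) := by rw [e1, hh]; ring
        exact mul_left_cancel₀ (by positivity) this
      have hqe : (p.1 + N0 * h, p.2 + R * h) = q := by
        ext
        · simp only; linarith
        · simp only; linarith
      refine ⟨h, ?_, hqe⟩
      simp only [coe_filter, Set.mem_ofPred_eq]
      refine ⟨?_, ?_⟩
      · rw [mem_HH hN0, ← hh, abs_lt]; constructor <;> linarith [hp.1.1.1, hp.1.1.2, hqP.1.1.1, hqP.1.1.2]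
      · rw [hqe]; exact hq0
    · intro h _; rfl
  have h3 : (∑ x ∈ P.image π, ‖∑ p ∈ P with π p = x, w p‖ ^ 2 : ℝ) = ‖((∑ x ∈ P.image π, ‖∑ p ∈ P with π p = x, w p‖ ^ 2 : ℝ) : ℂ)‖ := by
    rw [Complex.norm_real, Real.norm_of_nonneg (sum_nonneg fun _ _ => by positivity)]
  rw [h3, h2]
  refine (norm_sum_le _ _).trans (sum_le_sum fun h _ => le_of_eq ?_)
  congr 1
  refine sum_congr rfl fun p _ => ?_
  simp only [hw, map_mul, Complex.conj_conj]
  rw [show (R:ℤ) * (p.2 + R * h) - N1 * (p.1 + N0 * h) = R * p.2 - N1 * p.1 + h * (R * R - N1 * N0) by ring]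
  ring

theorem far_one {Q : ℕ} [NeZero Q] (g : ℤ → ℂ) (hg : ∀ w, ‖g w‖ ≤ 1) (U N0 N1 R I : ℕ)
    (hgs : ∀ w, w ∉ Ico (0:ℤ) U → g w = 0) (hN0 : 0 < N0) (hN1 : 0 < N1) (hI : 0 < I)
    (hc0 : Nat.Coprime N0 R) (hc1 : Nat.Coprime N1 R) (hdiv : (I : ℤ) ∣ R - N0) (hR : R ≤ 2 * N1) (hQ : 3 * U < Q)
    (κ : ℤ) (Φ0 Φ1 : ℤ → ℂ) (hΦ0 : ∀ x, ‖Φ0 x‖ ≤ 1) (hΦ1 : ∀ x, ‖Φ1 x‖ ≤ 1) (J0 J1 : Finset ℤ)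
    (hJ0 : ∀ x, x ∉ J0 → Φ0 x = 0) (hJ1 : ∀ x, x ∉ J1 → Φ1 x = 0) (V : ℝ) (hV0 : #J0 ≤ V) (hV1 : #J1 ≤ V) :
    ∃ y : ℤ → ZMod Q → ℤ → ℂ, (∀ h η w, ‖y h η w‖ ≤ 1) ∧
      (∀ h η w, y h η (w + (N1 * I : ℕ)) = ch Q η (-(R * I : ℤ)) * y h η w) ∧
      ‖∑ p ∈ PP U I κ, Φ0 (N0 * p.2 - R * p.1) * (Φ1 (R * p.2 - N1 * p.1) * (g p.1 * conj (g p.2)))‖ ^ 4 ≤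
        V ^ 3 * #(HH U N0) * ((U : ℝ) / (N1 * I : ℕ) + 1) * ((1 / Q) * ∑ h ∈ HH U N0, ∑ η : ZMod Q,
          ‖∑ u ∈ Ico (0:ℤ) U, (g u * conj (g (u + N0 * h))) * ch Q η u‖ ^ 2 *
          ‖∑ w ∈ Ico (0:ℤ) U, conj (g w) * (g (w + R * h) * y h η w)‖) := by
  have hM : 0 < N1 * I := Nat.mul_pos hN1 hI
  have hB : ∀ h u, ‖conj (g u) * g (u + R * h)‖ ≤ 1 := by
    intro h u; rw [norm_mul, RCLike.norm_conj]; exact mul_le_one₀ (hg _) (norm_nonneg _) (hg _)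
  choose y hy1 hy2 hy3 using fun (h : ℤ) (η : ZMod Q) => class_lin (fun u => conj (g u) * g (u + R * h)) (hB h) U (N1 * I) hM η (-(R * I : ℤ))
  refine ⟨y, hy1, hy2, ?_⟩
  have hV : 0 ≤ V := le_trans (by positivity) hV0
  set Θ : ℤ → ℂ := fun h => ∑ p ∈ PP U I κ, (Φ1 (R * p.2 - N1 * p.1) * conj (Φ1 (R * p.2 - N1 * p.1 + h * (R * R - N1 * N0)))) *
        ((g p.1 * conj (g (p.1 + N0 * h))) * (conj (g p.2) * g (p.2 + R * h))) with hΘ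
  have s1 : ‖∑ p ∈ PP U I κ, Φ0 (N0 * p.2 - R * p.1) * (Φ1 (R * p.2 - N1 * p.1) * (g p.1 * conj (g p.2)))‖ ^ 2 ≤ V * ∑ h ∈ HH U N0, ‖Θ h‖ := by
    refine (far_step1 g U N0 N1 R I hgs hN0 hc0 hdiv κ Φ0 Φ1 hΦ0 J0 hJ0).trans ?_
    gcongr
  have s2 : ∀ h, ‖Θ h‖ ^ 2 ≤ V * ((1 / Q) * ∑ η : ZMod Q, ‖∑ u ∈ Ico (0:ℤ) U, (g u * conj (g (u + N0 * h))) * ch Q η u‖ ^ 2 *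
      (((U : ℝ) / (N1 * I : ℕ) + 1) * ‖∑ w ∈ Ico (0:ℤ) U, conj (g w) * (g (w + R * h) * y h η w)‖)) := by
    intro h
    have b := bilin (Q := Q) (fun u => g u * conj (g (u + N0 * h))) (fun u => conj (g u) * g (u + R * h)) U N1 R I hN1 hI hc1 hR hQ κ J1
      (fun x => Φ1 x * conj (Φ1 (x + h * (R * R - N1 * N0)))) (fun x => by
        rw [norm_mul, RCLike.norm_conj]; exact mul_le_one₀ (hΦ1 _) (norm_nonneg _) (hΦ1 _)) (fun x hx => by simp only [hJ1 x hx, zero_mul])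
    refine b.trans ?_
    gcongr with η
    refine (hy3 h η).trans (le_of_eq ?_)
    congr 2
    refine sum_congr rfl fun u _ => by ring
  have s3 : (∑ h ∈ HH U N0, ‖Θ h‖) ^ 2 ≤ #(HH U N0) * ∑ h ∈ HH U N0, ‖Θ h‖ ^ 2 := sq_sum_le_card_mul_sum_sq
  calc _ = (‖∑ p ∈ PP U I κ, Φ0 (N0 * p.2 - R * p.1) * (Φ1 (R * p.2 - N1 * p.1) * (g p.1 * conj (g p.2)))‖ ^ 2) ^ 2 := by ring
    _ ≤ (V * ∑ h ∈ HH U N0, ‖Θ h‖) ^ 2 := by gcongr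
    _ = V ^ 2 * (∑ h ∈ HH U N0, ‖Θ h‖) ^ 2 := by ring
    _ ≤ V ^ 2 * (#(HH U N0) * ∑ h ∈ HH U N0, (V * ((1 / Q) * ∑ η : ZMod Q, ‖∑ u ∈ Ico (0:ℤ) U, (g u * conj (g (u + N0 * h))) * ch Q η u‖ ^ 2 *
      (((U : ℝ) / (N1 * I : ℕ) + 1) * ‖∑ w ∈ Ico (0:ℤ) U, conj (g w) * (g (w + R * h) * y h η w)‖)))) := by
        gcongr
        refine s3.trans ?_
        gcongr with h
        exact s2 h
    _ = _ := by
        simp only [mul_sum]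
        refine sum_congr rfl fun h _ => sum_congr rfl fun η _ => ?_
        ring

theorem badset (P : ℤ → ℤ) (𝒯 : Finset ℤ) (D : ℕ) : ∃ C : ℕ, 0 < C ∧ ∀ U : ℕ, C ≤ U → ∀ (Q : ℕ) [NeZero Q], 3 * U < Q →
    ∃ 𝔐 : Finset (ZMod Q), (#𝔐 : ℝ) * U ≤ C * Q ∧ ∀ η ∉ 𝔐, ∀ t1 ∈ 𝒯, ∀ t2 ∈ 𝒯, ∀ t3 ∈ 𝒯, ∀ t4 ∈ 𝒯,
      ‖1 - ch Q η (P t1 - P t2 - P t3 + P t4)‖ * U < D → P t1 - P t2 - P t3 + P t4 = 0 := by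
  classical
  set Z := (𝒯 ×ˢ 𝒯) ×ˢ (𝒯 ×ˢ 𝒯) with hZ
  set L : (ℤ × ℤ) × (ℤ × ℤ) → ℤ := fun x => P x.1.1 - P x.1.2 - P x.2.1 + P x.2.2 with hL
  set C0 : ℕ := 2 * D + 1 + ∑ x ∈ Z, (L x).natAbs with hC0
  have hC0p : 0 < C0 := by omega
  refine ⟨C0 * (8 * #Z + 1), by positivity, fun U hU Q _ hQ => ?_⟩
  have hUC : C0 ≤ U := le_trans (by nlinarith) hU
  set K := U / C0 with hK
  have hKp : 0 < K := Nat.div_pos hUC hC0p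
  have hK1 : K * C0 ≤ U := Nat.div_mul_le_self _ _
  have hK2 : U < 2 * (K * C0) := by
    have := Nat.lt_div_mul_add (a := U) hC0p; nlinarith
  refine ⟨(Z.filter fun x => L x ≠ 0).biUnion fun x => {η : ZMod Q | K * ‖1 - ch Q η (L x)‖ ≤ 1 / 2}, ?_, ?_⟩
  · have h1 : ∀ x ∈ Z.filter (fun x => L x ≠ 0), (#{η : ZMod Q | K * ‖1 - ch Q η (L x)‖ ≤ 1 / 2} : ℝ) ≤ 4 * Q / K := by
      intro x hx
      rw [mem_filter] at hx
      rw [le_div_iff₀ (by positivity)]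
      refine count_near Q (L x) hx.2 K hKp ?_
      have h2 : (L x).natAbs ≤ C0 := by
        have := single_le_sum (f := fun x => (L x).natAbs) (fun i _ => Nat.zero_le _) hx.1
        omega
      rw [Int.abs_eq_natAbs]
      have : (L x).natAbs * K < Q := by nlinarith
      exact_mod_cast this
    have h3 : (#((Z.filter fun x => L x ≠ 0).biUnion fun x => {η : ZMod Q | K * ‖1 - ch Q η (L x)‖ ≤ 1 / 2}) : ℝ) ≤ #Z * (4 * Q / K) := by
      refine le_trans (Nat.cast_le.2 card_biUnion_le) ?_
      rw [Nat.cast_sum]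
      refine (sum_le_sum h1).trans ?_
      rw [sum_const, nsmul_eq_mul]
      exact mul_le_mul_of_nonneg_right (Nat.cast_le.2 (card_filter_le _ _)) (by positivity)
    have hK2' : (U:ℝ) ≤ 2 * (K * C0) := by exact_mod_cast hK2.le
    have e1 : (#Z : ℝ) * (4 * Q / K) * (2 * (K * C0)) = C0 * (8 * #Z) * Q := by field_simp; ring
    refine (mul_le_mul h3 hK2' (by positivity) (by positivity)).trans (e1.le.trans ?_)
    push_cast; gcongr; linarith
  · intro η hη t1 h1 t2 h2 t3 h3 t4 h4 hlt
    by_contra hne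
    refine hη (mem_biUnion.2 ⟨((t1, t2), (t3, t4)), ?_, ?_⟩)
    · simp only [hZ, hL, mem_filter, mem_product]; exact ⟨⟨⟨h1, h2⟩, h3, h4⟩, hne⟩
    · rw [mem_filter]
      refine ⟨mem_univ _, ?_⟩
      simp only [hL]
      set n := ‖1 - ch Q η (P t1 - P t2 - P t3 + P t4)‖
      have hn : 0 ≤ n := norm_nonneg _
      have hC : (2 * D : ℝ) ≤ C0 := by
        have : 2 * D ≤ C0 := by omega
        exact_mod_cast this
      have hC' : (0:ℝ) < C0 := by exact_mod_cast hC0p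
      have hK1' : (K:ℝ) * C0 ≤ U := by exact_mod_cast hK1
      have : (K * n) * C0 ≤ 1 / 2 * C0 := by nlinarith
      exact le_of_mul_le_mul_right this hC'

theorem far_sum (α0 β B a1 : ℤ) (ha1 : a1 ≠ 0) (hβ : β ≠ 0) (T : ℕ) (hT : 0 < T) (𝒯 : Finset ℤ) (h𝒯 : 𝒯 ⊆ Ico (0:ℤ) T)
    (N R I : ℤ → ℕ) (N0 : ℕ) (hN : ∀ t ∈ 𝒯, (N t : ℤ) = (α0 + β * t) ^ 2 - B) (hR : ∀ t ∈ 𝒯, (R t : ℤ) = a1 * (α0 + β * t) - B)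
    (hNp : ∀ t ∈ 𝒯, 0 < N t) (hN0 : 0 < N0) (hIp : ∀ t ∈ 𝒯, 0 < I t)
    (hc0 : ∀ t ∈ 𝒯, Nat.Coprime N0 (R t)) (hc1 : ∀ t ∈ 𝒯, Nat.Coprime (N t) (R t)) (hdiv : ∀ t ∈ 𝒯, (I t : ℤ) ∣ R t - N0)
    (hRN : ∀ t ∈ 𝒯, R t ≤ 2 * N t) (ρ : ℝ) (hρ0 : 0 ≤ ρ) (hρ : 22 * (T:ℝ) ^ 3 ≤ ρ ^ 4) :
    ∃ C : ℕ, 0 < C ∧ ∀ U : ℕ, C ≤ U → ∀ (g : ℤ → ℂ) (c : ℝ), (∀ w, ‖g w‖ ≤ 1) → (∀ w, w ∉ Ico (0:ℤ) U → g w = 0) →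
      (∀ z : ℂ, ‖z‖ = 1 → ‖∑ u ∈ Ico (0:ℤ) U, g u * z ^ u‖ ≤ c * U) →
      ∀ (κ : ℤ → ℤ) (Φ0 Φ1 : ℤ → ℤ → ℂ) (J0 J1 : ℤ → Finset ℤ) (V μ : ℝ), (∀ t x, ‖Φ0 t x‖ ≤ 1) → (∀ t x, ‖Φ1 t x‖ ≤ 1) →
      (∀ t x, x ∉ J0 t → Φ0 t x = 0) → (∀ t x, x ∉ J1 t → Φ1 t x = 0) → (∀ t ∈ 𝒯, #(J0 t) ≤ V) → (∀ t ∈ 𝒯, #(J1 t) ≤ V) →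
      (∀ t ∈ 𝒯, (U:ℝ) / (N t * I t : ℕ) + 1 ≤ μ) → 0 ≤ V → 0 ≤ μ →
      ∑ t ∈ 𝒯, ‖∑ p ∈ PP U (I t) (κ t), Φ0 t (N0 * p.2 - R t * p.1) * (Φ1 t (R t * p.2 - N t * p.1) * (g p.1 * conj (g p.2)))‖ ^ 4 ≤
        V ^ 3 * #(HH U N0) * μ * (#(HH U N0) * U ^ 2 * ρ + C * c ^ 2 * U ^ 3) := by
  classical
  set E : ℤ → ℕ := fun t => ∏ t' ∈ 𝒯.erase t, N t' * I t' with hE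
  set M : ℕ := ∏ t ∈ 𝒯, N t * I t with hM
  have hEM : ∀ t ∈ 𝒯, (N t * I t) * E t = M := fun t ht => mul_prod_erase 𝒯 (fun t => N t * I t) ht
  have hMp : 0 < M := prod_pos fun t ht => Nat.mul_pos (hNp t ht) (hIp t ht)
  set P : ℤ → ℤ := fun t => R t * I t * E t with hP
  obtain ⟨C, hCp, hC⟩ := badset (fun t => -P t) 𝒯 (2 * M * T)
  refine ⟨C * T, by positivity, fun U hU g c hg hgs hgc κ Φ0 Φ1 J0 J1 V μ hΦ0 hΦ1 hJ0 hJ1 hV0 hV1 hμ hVp hμ0 => ?_⟩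
  set Q := 3 * U + 1 with hQ
  have hQU : 3 * U < Q := by omega
  obtain ⟨𝔐, h𝔐, hgood⟩ := hC U (le_trans (Nat.le_mul_of_pos_right _ hT) hU) Q hQU
  have hex := fun t (ht : t ∈ 𝒯) => far_one (Q := Q) g hg U N0 (N t) (R t) (I t) hgs hN0 (hNp t ht) (hIp t ht) (hc0 t ht) (hc1 t ht) (hdiv t ht) (hRN t ht)
    hQU (κ t) (Φ0 t) (Φ1 t) (hΦ0 t) (hΦ1 t) (J0 t) (J1 t) (hJ0 t) (hJ1 t) V (hV0 t ht) (hV1 t ht)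
  choose! y hy1 hy2 hy3 using hex
  set H := HH U N0 with hH
  have hU0 : (0:ℝ) < U := by
    have : 0 < U := lt_of_lt_of_le (by positivity) hU
    exact_mod_cast this
  have hQ0 : (0:ℝ) < Q := by rw [hQ]; positivity
  set A : ℤ → ZMod Q → ℝ := fun h η => ‖∑ u ∈ Ico (0:ℤ) U, (g u * conj (g (u + N0 * h))) * ch Q η u‖ ^ 2 with hA
  set X : ℤ → ℤ → ZMod Q → ℝ := fun t h η => ‖∑ w ∈ Ico (0:ℤ) U, conj (g w) * (g (w + R t * h) * y t h η w)‖ with hX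
  have hA0 : ∀ h η, 0 ≤ A h η := fun h η => sq_nonneg _
  have hgg : ∀ u v, ‖g u * conj (g v)‖ ≤ 1 := by
    intro u v; rw [norm_mul, RCLike.norm_conj]; exact mul_le_one₀ (hg _) (norm_nonneg _) (hg _)
  have hXtriv : ∀ h η, ∑ t ∈ 𝒯, X t h η ≤ T * U := by
    intro h η
    have h1 : ∀ t ∈ 𝒯, X t h η ≤ U := by
      intro t ht
      refine (norm_sum_le_card _ _ fun w _ => ?_).trans (by simp)
      rw [norm_mul, norm_mul, RCLike.norm_conj]
      exact mul_le_one₀ (hg _) (by positivity) (mul_le_one₀ (hg _) (norm_nonneg _) (hy1 t ht _ _ _))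
    refine (sum_le_sum h1).trans ?_
    rw [sum_const, nsmul_eq_mul]
    have := card_le_card h𝒯
    simp at this
    gcongr
  have hXgood : ∀ h, ∀ η ∉ 𝔐, ∑ t ∈ 𝒯, X t h η ≤ U * ρ := by
    intro h η hη
    refine le_of_pow_le_pow_left₀ (n := 4) (by norm_num) (by positivity) ?_
    have hx := Xsum U T M hT hMp g hg hgs 𝒯 h𝒯 (fun t w => if t ∈ 𝒯 then y t h η w else 0)
      (fun t w => by split_ifs with ht; exacts [hy1 t ht _ _ _, by simp]) (fun t => ch Q η (-P t)) ?_ ((a1 * α0 - B) * h) (a1 * β * h) ?_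
    · refine le_trans (le_of_eq ?_) (hx.trans ?_)
      · congr 1
        refine sum_congr rfl fun t ht => ?_
        simp only [hX, if_pos ht]
        congr 1
        refine sum_congr rfl fun w _ => ?_
        rw [hR t ht]; congr 4; ring
      · rw [mul_pow]; nlinarith [pow_pos hU0 4]
    · intro t ht w
      simp only [if_pos ht]
      have key : ∀ k : ℕ, y t h η (w + (N t * I t * k : ℕ)) = ch Q η (k * -(R t * I t)) * y t h η w := by
        intro k
        rw [ch_nsmul]
        induction k with
        | zero => simp
        | succ k ih =>
          rw [show w + ((N t * I t * (k + 1) : ℕ) : ℤ) = (w + (N t * I t * k : ℕ)) + (N t * I t : ℕ) by push_cast; ring, hy2 t ht, ih, pow_succ]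
          ring
      have := key (E t)
      rw [hEM t ht] at this
      rw [this]; congr 2; simp only [hP]; ring
    · intro δ hδ s hs hsδ
      set K0 : ℝ := ((P (s + δ) - P s : ℤ) : ℝ) / M with hK0
      set S := {t ∈ 𝒯 | t + δ ∈ 𝒯 ∧ ‖1 - ch Q η (-P (t + δ)) * conj (ch Q η (-P t)) * conj (ch Q η (-P (s + δ)) * conj (ch Q η (-P s)))‖ * U < 2 * M * T} with hS
      have hM0 : (M:ℝ) ≠ 0 := by exact_mod_cast hMp.ne'
      have hβ' : (β:ℝ) ≠ 0 := by exact_mod_cast hβ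
      have hinj : Function.Injective (fun t : ℤ => (α0:ℝ) + β * t) := by
        intro t t' hh
        have : (β:ℝ) * t = β * t' := by simpa using hh
        exact_mod_cast mul_left_cancel₀ hβ' this
      have hcd : #(S.image fun t : ℤ => (α0:ℝ) + β * t) ≤ 4 := by
        refine poly_count a1 B (β * δ) K0 ?_ _ ?_
        · have : (δ:ℝ) ≠ 0 := by exact_mod_cast hδ
          positivity
        · intro x hx
          obtain ⟨t, ht, rfl⟩ := mem_image.1 hx
          obtain ⟨ht, htδ, hlt⟩ := mem_filter.1 ht
          have h0 := hgood η hη (t + δ) htδ t ht (s + δ) hsδ s hs (by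
            rw [show -P (t + δ) - -P t - -P (s + δ) + -P s = (-P (t + δ) - -P t) - (-P (s + δ) - -P s) by ring, ch_sub, ch_sub, ch_sub]
            push_cast; exact hlt)
          have hP' : ∀ t ∈ 𝒯, (P t : ℝ) * N t = R t * M := by
            intro t ht; rw [← hEM t ht]; simp only [hP]; push_cast; ring
          have hNr : ∀ t ∈ 𝒯, (N t : ℝ) = (α0 + β * t) ^ 2 - B := fun t ht => by exact_mod_cast congrArg (Int.cast : ℤ → ℝ) (hN t ht)
          have hRr : ∀ t ∈ 𝒯, (R t : ℝ) = a1 * (α0 + β * t) - B := fun t ht => by exact_mod_cast congrArg (Int.cast : ℤ → ℝ) (hR t ht)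
          have e0 : P (s + δ) - P s = P (t + δ) - P t := by linarith
          have e1 := hP' t ht
          have e2 := hP' _ htδ
          have e3 : K0 * M = P (t + δ) - P t := by rw [hK0, e0]; push_cast; field_simp
          have e4 := hNr t ht
          have e5 := hNr _ htδ
          have e6 := hRr t ht
          have e7 := hRr _ htδ
          push_cast at e5 e7
          rw [show (α0:ℝ) + β * t + β * δ = α0 + β * (t + δ) by ring, ← e4, ← e5, ← e6, ← e7]
          refine mul_right_cancel₀ hM0 ?_
          linear_combination (-(N t : ℝ)) * e2 + N (t + δ) * e1 - (N t * N (t+δ)) * e3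
      rwa [card_image_of_injective _ hinj] at hcd
  have hpars : ∀ h, ∑ η, A h η ≤ Q * U := by
    intro h
    simp only [hA]
    rw [parseval_inj (Ico (0:ℤ) U) (fun u => u) _ _ (fun _ _ _ _ h => h)]
    · gcongr
      refine (sum_le_sum fun u _ => pow_le_one₀ (norm_nonneg _) (hgg _ _)).trans (by simp)
    · intro p hp p' hp'
      rw [mem_Ico] at hp hp'
      rw [abs_lt]; constructor <;> omega
  have hmaj : ∀ η, ∑ h ∈ H, A h η ≤ (c * U) ^ 2 * U := by
    intro η
    refine major U hQU g hg hgs (c * U) ?_ η H N0 (by exact_mod_cast hN0.ne') (fun h hh => (mem_HH hN0).1 hh)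
    intro ξ
    have := hgc (ch Q ξ 1) (ch_norm _ _)
    refine le_trans (le_of_eq ?_) this
    congr 1
    refine sum_congr rfl fun u hu => ?_
    rw [mem_Ico] at hu
    congr 1
    obtain ⟨k, rfl⟩ := Int.eq_ofNat_of_zero_le hu.1
    have := ch_nsmul ξ k 1
    rw [mul_one] at this
    exact this
  have hmain : ∑ h ∈ H, ∑ η, A h η * ∑ t ∈ 𝒯, X t h η ≤ Q * (#H * U ^ 2 * ρ + (C * T : ℕ) * c ^ 2 * U ^ 3) := by
    have h1 : ∀ h η, A h η * ∑ t ∈ 𝒯, X t h η ≤ A h η * (U * ρ) + if η ∈ 𝔐 then A h η * (T * U) else 0 := by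
      intro h η
      split_ifs with hη
      · refine (mul_le_mul_of_nonneg_left (hXtriv h η) (hA0 h η)).trans ?_
        have := mul_nonneg (hA0 h η) (mul_nonneg hU0.le hρ0); linarith
      · rw [add_zero]; exact mul_le_mul_of_nonneg_left (hXgood h η hη) (hA0 h η)
    calc _ ≤ ∑ h ∈ H, ∑ η, (A h η * (U * ρ) + if η ∈ 𝔐 then A h η * (T * U) else 0) :=
          sum_le_sum fun h _ => sum_le_sum fun η _ => h1 h η
      _ = ∑ h ∈ H, (∑ η, A h η) * (U * ρ) + ∑ η ∈ 𝔐, (∑ h ∈ H, A h η) * (T * U) := by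
          simp only [sum_add_distrib, sum_mul]
          congr 1
          rw [sum_comm]
          rw [← sum_filter_add_sum_filter_not univ (fun η => η ∈ 𝔐)]
          rw [sum_eq_zero (s := univ.filter fun η => ¬ η ∈ 𝔐), add_zero]
          · have : (univ.filter fun η => η ∈ 𝔐) = 𝔐 := by ext; simp
            rw [this]
            refine sum_congr rfl fun η hη => ?_
            simp only [if_pos hη]
          · intro η hη
            simp only [if_neg (mem_filter.1 hη).2, sum_const_zero]
      _ ≤ ∑ h ∈ H, (Q * U) * (U * ρ) + ∑ η ∈ 𝔐, ((c * U) ^ 2 * U) * (T * U) := by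
          gcongr with h hh η hη
          · exact hpars h
          · exact hmaj η
      _ = Q * (#H * U ^ 2 * ρ) + (#𝔐 * U) * (T * c ^ 2 * U ^ 3) := by
          simp only [sum_const, nsmul_eq_mul]; ring
      _ ≤ Q * (#H * U ^ 2 * ρ) + (C * Q) * (T * c ^ 2 * U ^ 3) := by gcongr
      _ = _ := by push_cast; ring
  calc _ ≤ ∑ t ∈ 𝒯, V ^ 3 * #H * μ * ((1 / Q) * ∑ h ∈ H, ∑ η, A h η * X t h η) := by
        refine sum_le_sum fun t ht => (hy3 t ht).trans ?_
        gcongr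
        exact hμ t ht
    _ = V ^ 3 * #H * μ * ((1 / Q) * ∑ h ∈ H, ∑ η, A h η * ∑ t ∈ 𝒯, X t h η) := by
        rw [← mul_sum, ← mul_sum]
        congr 2
        rw [sum_comm]
        refine sum_congr rfl fun h _ => ?_
        rw [sum_comm]
        simp only [mul_sum]
    _ ≤ V ^ 3 * #H * μ * ((1 / Q) * (Q * (#H * U ^ 2 * ρ + (C * T : ℕ) * c ^ 2 * U ^ 3))) := by gcongr
    _ = _ := by rw [← mul_assoc (1 / (Q:ℝ)), one_div_mul_cancel hQ0.ne', one_mul]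

noncomputable def rs (Δ s : ℤ) (Φ : ℤ → ℂ) (x : ℤ) : ℂ := if Δ ∣ x - s then Φ ((x - s) / Δ) else 0

theorem rs_val {Δ : ℤ} (hΔ : Δ ≠ 0) (s : ℤ) (Φ : ℤ → ℂ) (x j : ℤ) (h : x = Δ * j + s) : rs Δ s Φ x = Φ j := by
  subst h
  simp [rs, hΔ]

theorem rs_le (Δ s : ℤ) (Φ : ℤ → ℂ) (h : ∀ x, ‖Φ x‖ ≤ 1) (x : ℤ) : ‖rs Δ s Φ x‖ ≤ 1 := by
  unfold rs; split_ifs; exacts [h _, by simp]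

theorem rs_supp {Δ : ℤ} (s : ℤ) (Φ : ℤ → ℂ) (J : Finset ℤ) (h : ∀ x, x ∉ J → Φ x = 0) (x : ℤ)
    (hx : x ∉ J.image fun j => Δ * j + s) : rs Δ s Φ x = 0 := by
  unfold rs
  split_ifs with hd
  · refine h _ fun hJ => hx (mem_image.2 ⟨_, hJ, ?_⟩)
    rw [Int.mul_ediv_cancel' hd]; ring
  · rfl

theorem count_y (N : ℕ) (hN : 0 < N) (c : ℤ) (L : ℕ) (S : Finset ℤ) (hS : ∀ y ∈ S, c ≤ N * y ∧ N * y < c + L) :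
    #S ≤ L / N + 1 := by
  have h1 : S ⊆ Icc (-((-c) / N)) (-((-c) / N) + (L / N : ℕ)) := by
    intro y hy
    obtain ⟨h1, h2⟩ := hS y hy
    have hN' : (0:ℤ) < N := by exact_mod_cast hN
    have h3 := Int.mul_ediv_self_le (x := -c) (k := N) hN'.ne'
    have h4 : -c < N * ((-c) / N) + N := Int.lt_mul_ediv_self_add hN'
    set q := (-c) / (N:ℤ)
    rw [mem_Icc]
    constructor
    · by_contra hlt
      push Not at hlt
      nlinarith
    · have : y + q ≤ (L / N : ℕ) := by
        push_cast
        rw [Int.le_ediv_iff_mul_le hN']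
        linarith
      linarith
  have := card_le_card h1
  rw [Int.card_Icc] at this
  generalize L / N = m at *
  omega

theorem Tarith (U L Nb Ω T t1 K ρ ε : ℝ) (hU : 0 < U) (hL : 0 < L) (hN : 0 < Nb) (hΩ : 0 < Ω) (hT : 0 < T) (ht : 0 < t1) (hρ : 0 < ρ)
    (h1 : U * Nb ≤ K * Ω * T * L) (h2 : 24 * K * ρ ≤ ε ^ 4 * t1) :
    L ^ 3 * (3 * U / Nb) * (2 * U / (Nb * (Ω * t1))) * ((3 * U / Nb) * U ^ 2 * ρ + (ρ / Nb) * U ^ 3) ≤ ε ^ 4 * T * (U * L / Nb) ^ 4 := by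
  calc _ = (U * Nb) * (24 * ρ * L ^ 3 * U ^ 4 / (Nb ^ 4 * (Ω * t1))) := by field_simp; ring
    _ ≤ (K * Ω * T * L) * (24 * ρ * L ^ 3 * U ^ 4 / (Nb ^ 4 * (Ω * t1))) := by gcongr
    _ = (24 * K * ρ) * (T * (U * L / Nb) ^ 4 / t1) := by field_simp
    _ ≤ (ε ^ 4 * t1) * (T * (U * L / Nb) ^ 4 / t1) := by gcongr
    _ = _ := by field_simp

set_option maxHeartbeats 1000000 in
theorem Tlemma (α0 v B : ℤ) (Ω T Nb t1 : ℕ) (ε K ρ : ℝ) (N : ℤ → ℕ) (R : ℤ → ℤ → ℕ) (hv : v ≠ 0) (hΩ : 0 < Ω) (hT : 0 < T) (hNb : 0 < Nb)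
    (hα : ∀ t ∈ Ico (0:ℤ) T, α0 + v * Ω * t ≠ 0)
    (hN : ∀ t ∈ Ico (0:ℤ) T, (N t : ℤ) = (α0 + v * Ω * t) ^ 2 - B)
    (hR : ∀ t ∈ Ico (0:ℤ) T, ∀ t' ∈ Ico (0:ℤ) T, (R t t' : ℤ) = (α0 + v * Ω * t) * (α0 + v * Ω * t') - B)
    (hN1 : ∀ t ∈ Ico (0:ℤ) T, Nb ≤ N t) (hRN : ∀ t ∈ Ico (0:ℤ) T, ∀ t' ∈ Ico (0:ℤ) T, R t t' ≤ 2 * N t')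
    (hcop : ∀ t ∈ Ico (0:ℤ) T, ∀ t' ∈ Ico (0:ℤ) T, t ≠ t' → Nat.Coprime (N t) (R t t'))
    (hK : 0 < K) (ht1 : 0 < t1) (hε : 0 < ε) (h4 : 4 * t1 ≤ ε * T) (hρ0 : 0 < ρ) (hρ : 22 * (T:ℝ) ^ 3 ≤ ρ ^ 4) (hρt : 24 * K * ρ ≤ ε ^ 4 * t1) :
    ∃ (c : ℝ) (U0 : ℕ), 0 < c ∧ ∀ U : ℕ, U0 ≤ U → ∀ g : ℤ → ℂ, (∀ w, ‖g w‖ ≤ 1) → (∀ w, w ∉ Ico (0:ℤ) U → g w = 0) →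
      (∀ z : ℂ, ‖z‖ = 1 → ‖∑ u ∈ Ico (0:ℤ) U, g u * z ^ u‖ ≤ c * U) →
      ∀ (κ a : ℤ → ℤ) (L : ℕ) (Φ : ℤ → ℤ → ℂ), (∀ t x, ‖Φ t x‖ ≤ 1) → (∀ t x, x ∉ Ico (a t) (a t + L) → Φ t x = 0) →
      (U * Nb : ℝ) ≤ K * Ω * T * L →
      ∀ (Bx : Finset (ℤ × ℤ)) (d : ℤ × ℤ → ℂ), (∀ p, ‖d p‖ ≤ 1) →
      (∑ t ∈ Ico (0:ℤ) T, ‖∑ p ∈ Bx, d p * (Φ t (N t * p.1 - (α0 + v * Ω * t) * v * (p.2 + Ω * t * p.1 + κ t)) * g (p.2 + Ω * t * p.1 + κ t))‖) ^ 2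
        ≤ #Bx * (2 * ε * T ^ 2 * (U * L / Nb)) := by
  classical
  have hΩ' : (Ω:ℤ) ≠ 0 := by exact_mod_cast hΩ.ne'
  have hRs : ∀ t ∈ Ico (0:ℤ) T, ∀ t' ∈ Ico (0:ℤ) T, R t t' = R t' t := fun t ht t' ht' => by
    have h1 := hR t ht t' ht'; have h2 := hR t' ht' t ht; zify; rw [h1, h2]; ring
  set 𝒯 : ℤ → Finset ℤ := fun t0 => {t ∈ Ico (0:ℤ) T | t1 ≤ (t - t0).natAbs} with h𝒯
  have h𝒯s : ∀ t0, 𝒯 t0 ⊆ Ico (0:ℤ) T := fun t0 => filter_subset _ _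
  set I : ℤ → ℤ → ℕ := fun t0 t => (Ω * (t - t0)).natAbs with hI
  have hIp : ∀ t0, ∀ t ∈ 𝒯 t0, Ω * t1 ≤ I t0 t := by
    intro t0 t ht
    simp only [hI, Int.natAbs_mul, Int.natAbs_natCast]
    exact Nat.mul_le_mul_left _ (mem_filter.1 ht).2
  have hne : ∀ t0, ∀ t ∈ 𝒯 t0, t0 ≠ t := by
    rintro t0 t ht rfl
    have := (mem_filter.1 ht).2; simp at this; omega
  have hRdiff : ∀ t0 ∈ Ico (0:ℤ) T, ∀ t ∈ Ico (0:ℤ) T, (R t0 t : ℤ) - N t0 = (α0 + v * Ω * t0) * v * (Ω * (t - t0)) := by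
    intro t0 ht0 t ht; rw [hR _ ht0 _ ht, hN _ ht0]; ring
  have hNp : ∀ t ∈ Ico (0:ℤ) T, 0 < N t := fun t ht => lt_of_lt_of_le hNb (hN1 t ht)
  have far := fun t0 (ht0 : t0 ∈ Ico (0:ℤ) T) => far_sum α0 (v * Ω) B (α0 + v * Ω * t0) (hα t0 ht0) (mul_ne_zero hv hΩ') T hT (𝒯 t0) (h𝒯s t0)
    N (R t0) (I t0) (N t0) (fun t ht => hN t (h𝒯s _ ht)) (fun t ht => hR _ ht0 _ (h𝒯s _ ht)) (fun t ht => hNp t (h𝒯s _ ht)) (hNp t0 ht0)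
    (fun t ht => lt_of_lt_of_le (by positivity) (hIp t0 t ht)) (fun t ht => hcop _ ht0 _ (h𝒯s _ ht) (hne _ _ ht))
    (fun t ht => by rw [hRs _ ht0 _ (h𝒯s _ ht)]; exact hcop _ (h𝒯s _ ht) _ ht0 (hne _ _ ht).symm)
    (fun t ht => by
      rw [hRdiff _ ht0 _ (h𝒯s _ ht)]
      exact (Int.natAbs_dvd.2 dvd_rfl).trans (dvd_mul_left _ _)) (fun t ht => hRN _ ht0 _ (h𝒯s _ ht)) ρ hρ0.le hρ
  choose! C hCp hC using far
  set C1 : ℕ := ∑ t ∈ Ico (0:ℤ) T, C t with hC1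
  have hCle : ∀ t ∈ Ico (0:ℤ) T, C t ≤ C1 := fun t ht => single_le_sum (f := C) (fun _ _ => Nat.zero_le _) ht
  have hNb' : (0:ℝ) < Nb := by exact_mod_cast hNb
  have hT' : (0:ℝ) < T := by exact_mod_cast hT
  have hΩr : (0:ℝ) < Ω := by exact_mod_cast hΩ
  have ht1' : (0:ℝ) < t1 := by exact_mod_cast ht1
  refine ⟨√(ρ / (Nb * (C1 + 1))), 1 + C1 + ⌈K * Ω * T⌉₊ + ∑ t ∈ Ico (0:ℤ) T, N t + ∑ t0 ∈ Ico (0:ℤ) T, ∑ t ∈ Ico (0:ℤ) T, N t * I t0 t, by positivity,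
    fun U hU g hg hgs hgc κ a L Φ hΦ hΦs hUL Bx d hd => ?_⟩
  set c := √(ρ / (Nb * (C1 + 1))) with hc
  have hc2 : C1 * c ^ 2 ≤ ρ / Nb := by
    rw [hc, Real.sq_sqrt (by positivity), div_mul_eq_div_div, ← mul_div_assoc, div_le_iff₀ (by positivity), mul_comm]
    gcongr; linarith
  have hU1 : (0:ℝ) < U := by
    have : 0 < U := by omega
    exact_mod_cast this
  have hLN : (Nb:ℝ) ≤ L := by
    have h1 : K * Ω * T ≤ U := (Nat.le_ceil _).trans (by exact_mod_cast (by omega : ⌈K * Ω * T⌉₊ ≤ U))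
    have h2 : K * Ω * T * Nb ≤ K * Ω * T * L := le_trans (by gcongr) hUL
    exact le_of_mul_le_mul_left h2 (by positivity)
  have hL0 : (0:ℝ) < L := lt_of_lt_of_le hNb' hLN
  have hUN : ∀ t ∈ Ico (0:ℤ) T, N t ≤ U := fun t ht => by
    have := single_le_sum (f := N) (fun _ _ => Nat.zero_le _) ht
    omega
  have hUI : ∀ t0 ∈ Ico (0:ℤ) T, ∀ t ∈ Ico (0:ℤ) T, N t * I t0 t ≤ U := fun t0 ht0 t ht => by
    have h1 := single_le_sum (f := fun t => N t * I t0 t) (fun _ _ => Nat.zero_le _) ht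
    have h2 := single_le_sum (f := fun t0 => ∑ t ∈ Ico (0:ℤ) T, N t * I t0 t) (fun _ _ => Nat.zero_le _) ht0
    omega
  set k : ℤ → ℤ × ℤ → ℤ := fun t p => p.2 + Ω * t * p.1 + κ t with hk
  set j : ℤ → ℤ × ℤ → ℤ := fun t p => N t * p.1 - (α0 + v * Ω * t) * v * k t p with hj
  set F : ℤ → ℤ × ℤ → ℂ := fun t p => Φ t (j t p) * g (k t p) with hF
  set φ : ℤ → ℤ → ℤ × ℤ → ℤ × ℤ := fun t0 t p => (k t0 p, k t p) with hφ
  have hφi : ∀ t0 t, t0 ≠ t → Function.Injective (φ t0 t) := by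
    intro t0 t hne p p' h
    simp only [hφ, hk, Prod.mk.injEq] at h
    have h1 : (Ω * (t - t0) : ℤ) * p.1 = Ω * (t - t0) * p'.1 := by linarith [h.1, h.2]
    have h2 := mul_left_cancel₀ (mul_ne_zero hΩ' (sub_ne_zero.2 hne.symm)) h1
    refine Prod.ext h2 ?_
    have := h.1; rw [h2] at this; linarith
  have hφs : ∀ t0 t, ∀ q, (I t0 t : ℤ) ∣ q.2 - q.1 - (κ t - κ t0) → ∃ p, φ t0 t p = q := by
    intro t0 t q hq
    obtain ⟨y, hy⟩ := Int.natAbs_dvd.1 hq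
    refine ⟨(y, q.1 - Ω * t0 * y - κ t0), ?_⟩
    simp only [hφ, hk]
    ext <;> simp <;> linarith
  set B' : Finset (ℤ × ℤ) := Bx ∪ (Ico (0:ℤ) T).biUnion fun t0 => (Ico (0:ℤ) T).biUnion fun t =>
    if h : t0 = t then ∅ else (PP U (I t0 t) (κ t - κ t0)).preimage (φ t0 t) (hφi t0 t h).injOn with hB'
  refine (cs_weight' Bx B' subset_union_left (Ico (0:ℤ) T) d (fun p _ => hd p) F).trans ?_
  refine mul_le_mul_of_nonneg_left ?_ (by positivity)
  have hFle : ∀ t, ∀ p, ‖F t p‖ ≤ 1 := fun t p => by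
    simp only [hF, norm_mul]; exact mul_le_one₀ (hΦ _ _) (norm_nonneg _) (hg _)
  have htriv1 : ∀ t ∈ Ico (0:ℤ) T, ∑ p ∈ B', ‖F t p‖ ^ 2 ≤ 2 * (U * L / Nb) := by
    intro t ht
    set S := {p ∈ B' | k t p ∈ Ico (0:ℤ) U ∧ j t p ∈ Ico (a t) (a t + L)} with hS
    have h1 : ∑ p ∈ B', ‖F t p‖ ^ 2 ≤ #S := by
      rw [card_eq_sum_ones, hS, sum_filter]
      push_cast
      refine sum_le_sum fun p _ => ?_
      split_ifs with h
      · simpa using hFle t p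
      · rw [not_and_or] at h
        have : F t p = 0 := by
          simp only [hF]
          rcases h with h | h
          · rw [hgs _ h, mul_zero]
          · rw [hΦs _ _ h, zero_mul]
        rw [this]; simp
    have h2 : #S ≤ (L / N t + 1) * #(Ico (0:ℤ) U) := by
      refine card_le_mul_card_image_of_maps_to (f := k t) (fun p hp => (mem_filter.1 hp).2.1) _ fun b _ => ?_
      rw [← card_image_of_injOn (f := Prod.fst)]
      · refine count_y (N t) (hNp t ht) (a t + (α0 + v * Ω * t) * v * b) L _ fun y hy => ?_
        obtain ⟨p, hp, rfl⟩ := mem_image.1 hy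
        obtain ⟨hp1, hpb⟩ := mem_filter.1 hp
        have := mem_Ico.1 (mem_filter.1 hp1).2.2
        rw [← hpb]
        simp only [hj] at this
        constructor <;> linarith [this.1, this.2]
      · intro p hp p' hp' h
        have e1 := (mem_filter.1 hp).2
        have e2 := (mem_filter.1 hp').2
        simp only [hk] at e1 e2
        refine Prod.ext h ?_
        rw [h] at e1; linarith
    refine h1.trans ((Nat.cast_le.2 h2).trans ?_)
    simp only [Int.card_Ico, sub_zero, Int.toNat_natCast]
    push_cast
    have h3 : ((L / N t : ℕ) : ℝ) ≤ L / Nb := Nat.cast_div_le.trans (by gcongr; exact_mod_cast hN1 t ht)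
    have h4 : (1:ℝ) ≤ L / Nb := by rw [le_div_iff₀ hNb']; linarith
    calc ((L / N t : ℕ) + 1 : ℝ) * U ≤ (L / Nb + L / Nb) * U := by gcongr
      _ = _ := by ring
  have htriv : ∀ t ∈ Ico (0:ℤ) T, ∀ t' ∈ Ico (0:ℤ) T, ‖∑ p ∈ B', F t p * conj (F t' p)‖ ≤ 2 * (U * L / Nb) := by
    intro t ht t' ht'
    have h1 := htriv1 t ht
    have h2 := htriv1 t' ht'
    calc _ ≤ ∑ p ∈ B', (‖F t p‖ ^ 2 + ‖F t' p‖ ^ 2) / 2 := by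
          refine norm_sum_le_of_le _ fun p _ => ?_
          rw [norm_mul, RCLike.norm_conj]; linarith [sq_nonneg (‖F t p‖ - ‖F t' p‖)]
      _ ≤ _ := by rw [← sum_div, sum_add_distrib]; linarith
  have hpair : ∀ t0 ∈ Ico (0:ℤ) T, ∀ t ∈ Ico (0:ℤ) T, t0 ≠ t → ∑ p ∈ B', F t0 p * conj (F t p) =
      ∑ q ∈ PP U (I t0 t) (κ t - κ t0), rs (Ω * (t - t0)) (N t0 * (κ t - κ t0)) (Φ t0) (N t0 * q.2 - R t0 t * q.1) *
        (rs (Ω * (t - t0)) (N t * (κ t - κ t0)) (fun x => conj (Φ t x)) (R t0 t * q.2 - N t * q.1) * (g q.1 * conj (g q.2))) := by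
    intro t0 ht0 t ht hne
    have hΔ : (Ω * (t - t0) : ℤ) ≠ 0 := mul_ne_zero hΩ' (sub_ne_zero.2 hne.symm)
    have e1 := hR _ ht0 _ ht
    have e2 := hN _ ht0
    have e3 := hN _ ht
    symm
    rw [sum_subset (s₁ := PP U (I t0 t) (κ t - κ t0)) (s₂ := B'.image (φ t0 t)) , sum_image (fun _ _ _ _ h => hφi t0 t hne h)]
    · refine sum_congr rfl fun p _ => ?_
      simp only [hφ]
      rw [rs_val hΔ _ _ _ (j t0 p), rs_val hΔ _ _ _ (j t p)]
      · simp only [hF]; rw [map_mul (starRingEnd ℂ)]; ring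
      · simp only [hj, hk, e1, e3]; ring
      · simp only [hj, hk, e1, e2]; ring
    · intro q hq
      obtain ⟨p, rfl⟩ := hφs t0 t q (mem_filter.1 hq).2
      refine mem_image_of_mem _ ?_
      rw [hB']
      refine mem_union_right _ (mem_biUnion.2 ⟨t0, ht0, mem_biUnion.2 ⟨t, ht, ?_⟩⟩)
      rw [dif_neg hne, mem_preimage]; exact hq
    · intro q hq hq'
      obtain ⟨p, _, rfl⟩ := mem_image.1 hq
      have : k t0 p ∉ Ico (0:ℤ) U ∨ k t p ∉ Ico (0:ℤ) U := by
        rw [← not_and_or]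
        rintro ⟨h1, h2⟩
        refine hq' (mem_filter.2 ⟨mem_product.2 ⟨h1, h2⟩, Int.natAbs_dvd.2 ⟨p.1, ?_⟩⟩)
        simp only [hφ, hk]; ring
      simp only [hφ]
      rcases this with h | h <;> rw [hgs _ h] <;> simp
  have hfar : ∀ t0 ∈ Ico (0:ℤ) T, ∑ t ∈ 𝒯 t0, ‖∑ p ∈ B', F t0 p * conj (F t p)‖ ≤ ε * T * (U * L / Nb) := by
    intro t0 ht0
    have h1 := hC t0 ht0 U (le_trans (hCle t0 ht0) (by omega)) g c hg hgs hgc (fun t => κ t - κ t0)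
      (fun t => if t0 = t then 0 else rs (Ω * (t - t0)) (N t0 * (κ t - κ t0)) (Φ t0))
      (fun t => if t0 = t then 0 else rs (Ω * (t - t0)) (N t * (κ t - κ t0)) (fun x => conj (Φ t x)))
      (fun t => (Ico (a t0) (a t0 + L)).image fun x => (Ω * (t - t0)) * x + (N t0 * (κ t - κ t0)))
      (fun t => (Ico (a t) (a t + L)).image fun x => (Ω * (t - t0)) * x + (N t * (κ t - κ t0))) L (2 * U / (Nb * (Ω * t1)))
      (fun t x => by split_ifs; exacts [by simp, rs_le _ _ _ (hΦ t0) _])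
      (fun t x => by split_ifs; exacts [by simp, rs_le _ _ _ (fun x => by rw [RCLike.norm_conj]; exact hΦ t x) _])
      (fun t x hx => by
        split_ifs with h
        · rfl
        · exact rs_supp _ _ _ (hΦs t0) _ hx)
      (fun t x hx => by
        split_ifs with h
        · rfl
        · exact rs_supp _ _ _ (fun x hx => by rw [hΦs t x hx, map_zero]) _ hx)
      (fun t _ => by exact_mod_cast card_image_le.trans (by simp)) (fun t _ => by exact_mod_cast card_image_le.trans (by simp))
      (fun t ht => by
        have e1 : (Nb * (Ω * t1) : ℝ) ≤ (N t * I t0 t : ℕ) := by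
          exact_mod_cast Nat.mul_le_mul (hN1 t (h𝒯s _ ht)) (hIp t0 t ht)
        have e2 : ((N t * I t0 t : ℕ) : ℝ) ≤ U := by exact_mod_cast hUI t0 ht0 t (h𝒯s _ ht)
        have e4 : (1:ℝ) ≤ U / (Nb * (Ω * t1)) := by rw [le_div_iff₀ (by positivity)]; linarith
        calc _ ≤ (U:ℝ) / (Nb * (Ω * t1)) + U / (Nb * (Ω * t1)) := by gcongr
          _ = _ := by ring) hL0.le (by positivity)
    have hH : (#(HH U (N t0)) : ℝ) ≤ 3 * U / Nb :=
      (card_HH (hNp t0 ht0) (hUN t0 ht0)).trans (by gcongr; exact_mod_cast hN1 t0 ht0)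
    have hCc : (C t0 : ℝ) * c ^ 2 ≤ ρ / Nb := le_trans (by gcongr; exact hCle t0 ht0) hc2
    have h2 : ∑ t ∈ 𝒯 t0, ‖∑ p ∈ B', F t0 p * conj (F t p)‖ ^ 4 ≤ ε ^ 4 * T * (U * L / Nb) ^ 4 := by
      refine le_trans (le_of_eq (sum_congr rfl fun t ht => ?_)) (h1.trans ?_)
      · rw [hpair t0 ht0 t (h𝒯s _ ht) (hne _ _ ht)]
        simp only [if_neg (hne _ _ ht)]
      · refine le_trans ?_ (Tarith U L Nb Ω T t1 K ρ ε hU1 hL0 hNb' hΩr hT' ht1' hρ0 hUL hρt)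
        gcongr
    have h4 : (∑ t ∈ 𝒯 t0, ‖∑ p ∈ B', F t0 p * conj (F t p)‖) ^ 4 ≤ (#(𝒯 t0) : ℝ) ^ 3 * ∑ t ∈ 𝒯 t0, ‖∑ p ∈ B', F t0 p * conj (F t p)‖ ^ 4 :=
      pow_sum_le_card_mul_sum_pow (fun _ _ => norm_nonneg _) 3
    have h5 : (#(𝒯 t0) : ℝ) ≤ T := by
      have := card_le_card (h𝒯s t0); simp at this; exact_mod_cast this
    refine le_of_pow_le_pow_left₀ (n := 4) (by norm_num) (by positivity) (h4.trans ?_)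
    calc _ ≤ (T:ℝ) ^ 3 * (ε ^ 4 * T * (U * L / Nb) ^ 4) := by gcongr
      _ = _ := by ring
  have hrow : ∀ t0 ∈ Ico (0:ℤ) T, ∑ t ∈ Ico (0:ℤ) T, ‖∑ p ∈ B', F t0 p * conj (F t p)‖ ≤ 2 * ε * T * (U * L / Nb) := by
    intro t0 ht0
    rw [← sum_filter_add_sum_filter_not (Ico (0:ℤ) T) (fun t => t1 ≤ (t - t0).natAbs)]
    have hnear : ∑ t ∈ Ico (0:ℤ) T with ¬ t1 ≤ (t - t0).natAbs, ‖∑ p ∈ B', F t0 p * conj (F t p)‖ ≤ (2 * t1 : ℕ) * (2 * (U * L / Nb)) := by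
      refine (sum_le_sum fun t ht => htriv t0 ht0 t (mem_filter.1 ht).1).trans ?_
      rw [sum_const, nsmul_eq_mul]
      refine mul_le_mul_of_nonneg_right (Nat.cast_le.2 ?_) (by positivity)
      have : (Ico (0:ℤ) T).filter (fun t => ¬ t1 ≤ (t - t0).natAbs) ⊆ Ioo (t0 - t1) (t0 + t1) := by
        intro t ht
        have := (mem_filter.1 ht).2
        rw [mem_Ioo]; omega
      have := card_le_card this
      rw [Int.card_Ioo] at this
      omega
    have := hfar t0 ht0
    push_cast at hnear
    have h5 : (2 * t1 * (2 * (U * L / Nb)) : ℝ) ≤ ε * T * (U * L / Nb) := by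
      have : (0:ℝ) ≤ U * L / Nb := by positivity
      nlinarith
    simp only [h𝒯] at this
    linarith
  refine (sum_le_sum hrow).trans (le_of_eq ?_)
  simp; ring

section
structure Cfg (e : ℤ) (a b s Ds W Ω Δ T : ℕ) : Prop where
  he : e = 1 ∨ e = -1
  hb : 0 < b
  hs : 0 < s
  hW : 0 < W
  hΩ : 0 < Ω
  hΔ : 0 < Δ
  hT : 0 < T
  hsD : s * Ds = Ω
  hab : (b:ℤ) ∣ a - 1
  hbW : b ∣ W
  hΩb : Ω ∣ b
  hpow : ∃ k : ℕ, s * W * Ω * T.factorial ∣ b ^ k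
  hbig : 100 * (b + s * W * (Ω * T * Δ + 1 + Ω * T)) ≤ a

def u0 (Ω Δ T : ℕ) : ℕ := Ω * T * Δ + 1
def qq (Ω Δ T : ℕ) (t : ℤ) : ℤ := u0 Ω Δ T + Ω * t
def al (a s W Ω Δ T : ℕ) (t : ℤ) : ℤ := a + s * W * qq Ω Δ T t
def pp (e : ℤ) (a b s W Ω Δ T : ℕ) (t : ℤ) : ℤ := a * al a s W Ω Δ T t - e * b ^ 2

theorem cop_b {b N D : ℤ} (h : b ∣ N - 1) (k : ℕ) (hD : D ∣ b ^ k) : IsCoprime N D := by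
  obtain ⟨z, hz⟩ := h
  exact IsCoprime.of_isCoprime_of_dvd_right (IsCoprime.pow_right ⟨1, -z, by linear_combination hz⟩) hD

theorem cop_al {e b α x : ℤ} (he : e = 1 ∨ e = -1) (h : b ∣ α - 1) : IsCoprime (x * α - e * b ^ 2) α := by
  have h1 : IsCoprime (b ^ 2) α := (cop_b h 2 dvd_rfl).symm
  have h2 : IsCoprime (-e * b ^ 2) α := by
    refine IsCoprime.mul_left ?_ h1
    rcases he with rfl | rfl
    · exact ⟨-1, 0, by ring⟩
    · exact ⟨1, 0, by ring⟩
  have := h2.add_mul_right_left x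
  rwa [show -e * b ^ 2 + x * α = x * α - e * b ^ 2 by ring] at this

theorem bnd {e a b δ δ' C : ℤ} (he : e = 1 ∨ e = -1) (hb : 0 ≤ b) (hδ : 0 ≤ δ) (hδ' : 0 ≤ δ') (h1 : δ ≤ C) (h2 : δ' ≤ C)
    (hC : 100 * (b + C) ≤ a) : 9 * a ^ 2 ≤ 10 * ((a + δ) * (a + δ') - e * b ^ 2) ∧ 10 * ((a + δ) * (a + δ') - e * b ^ 2) ≤ 11 * a ^ 2 := by
  have hbb : 100 * b ^ 2 ≤ a ^ 2 := by nlinarith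
  have hC0 : 0 ≤ C := by linarith
  have hCa : 100 * C ≤ a := by linarith
  have ha : 0 ≤ a := by linarith
  have e1 : δ * δ' ≤ C * C := mul_le_mul h1 h2 hδ' hC0
  have e2 : a * δ ≤ a * C := mul_le_mul_of_nonneg_left h1 ha
  have e3 : a * δ' ≤ a * C := mul_le_mul_of_nonneg_left h2 ha
  have e4 : a * (100 * C) ≤ a * a := mul_le_mul_of_nonneg_left hCa ha
  have e5 : 100 * (C * C) ≤ a * C := by nlinarith
  have e6 : 0 ≤ a * δ := mul_nonneg ha hδ
  have e7 : 0 ≤ a * δ' := mul_nonneg ha hδ'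
  have e8 : 0 ≤ δ * δ' := mul_nonneg hδ hδ'
  rcases he with rfl | rfl <;> constructor <;> nlinarith

variable {e : ℤ} {a b s Ds W Ω Δ T : ℕ}
local notation "CF" => Cfg e a b s Ds W Ω Δ T
local notation "uT" => u0 Ω Δ T
local notation "qT" => qq Ω Δ T
local notation "aT" => al a s W Ω Δ T
local notation "pT" => pp e a b s W Ω Δ T

theorem Cfg.qb (h : CF) {t : ℤ} (ht : t ∈ Ico (0:ℤ) T) :
    (uT : ℤ) ≤ qT t ∧ qT t ≤ 2 * uT ∧ qT t ≤ uT + Ω * T ∧ Ω * T * Δ ≤ uT := by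
  obtain ⟨h0, h1⟩ := mem_Ico.1 ht
  have e1 : (Ω:ℤ) * t ≤ Ω * T := mul_le_mul_of_nonneg_left h1.le (by positivity)
  have e2 : (0:ℤ) ≤ Ω * t := by positivity
  have e3 : (Ω:ℤ) * T * 1 ≤ Ω * T * Δ := mul_le_mul_of_nonneg_left (by exact_mod_cast h.hΔ) (by positivity)
  unfold qq u0
  push_cast
  refine ⟨by linarith, by linarith, by linarith, by omega⟩

theorem Cfg.alb (h : CF) {t : ℤ} (ht : t ∈ Ico (0:ℤ) T) :
    0 ≤ (s:ℤ) * W * qT t ∧ (s:ℤ) * W * qT t ≤ s * W * (uT + Ω * T) ∧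
      100 * ((b:ℤ) + s * W * (uT + Ω * T)) ≤ a ∧ (a:ℤ) ≤ aT t ∧ 100 * aT t ≤ 101 * a := by
  obtain ⟨h1, h2, h3, h4⟩ := h.qb ht
  have h5 : 0 ≤ (s:ℤ) * W * qT t := mul_nonneg (by positivity) (by omega)
  have h6 : (s:ℤ) * W * qT t ≤ s * W * (uT + Ω * T) := mul_le_mul_of_nonneg_left h3 (by positivity)
  have h7 : 100 * ((b:ℤ) + s * W * (uT + Ω * T)) ≤ a := by have := h.hbig; unfold u0; exact_mod_cast this
  unfold al
  refine ⟨h5, h6, h7, by linarith, by linarith⟩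

theorem Cfg.Nb (h : CF) {t t' : ℤ} (ht : t ∈ Ico (0:ℤ) T) (ht' : t' ∈ Ico (0:ℤ) T) :
    9 * (a:ℤ) ^ 2 ≤ 10 * (aT t * aT t' - e * b ^ 2) ∧ 10 * (aT t * aT t' - e * b ^ 2) ≤ 11 * a ^ 2 :=
  bnd h.he (by positivity) (h.alb ht).1 (h.alb ht').1 (h.alb ht).2.1 (h.alb ht').2.1 (h.alb ht).2.2.1

theorem Cfg.pb (h : CF) {t : ℤ} (ht : t ∈ Ico (0:ℤ) T) :
    9 * (a:ℤ) ^ 2 ≤ 10 * pT t ∧ 10 * pT t ≤ 11 * a ^ 2 := by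
  have := bnd h.he (b := b) (by positivity) le_rfl (h.alb ht).1 ((h.alb ht).1.trans (h.alb ht).2.1) (h.alb ht).2.1 (h.alb ht).2.2.1
  simpa [pp, al] using this

theorem Cfg.a_pos (h : CF) : 0 < a := by
  have := h.hbig; have := h.hb; omega

theorem Cfg.al_dvd (h : CF) (t : ℤ) : (b:ℤ) ∣ aT t - 1 := by
  have h1 : (b:ℤ) ∣ s * W * qT t := ((Int.natCast_dvd_natCast.2 h.hbW).mul_left _).mul_right _
  have := dvd_add h.hab h1
  unfold al
  rwa [show (a:ℤ) - 1 + s * W * qT t = a + s * W * qT t - 1 by ring] at this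

theorem mul_dvd_one {b x y e : ℤ} (h1 : b ∣ x - 1) (h2 : b ∣ y - 1) : b ∣ x * y - e * b ^ 2 - 1 := by
  obtain ⟨u, hu⟩ := h1
  obtain ⟨v, hv⟩ := h2
  exact ⟨u * y + v - e * b, by linear_combination y * hu + hv⟩

theorem Cfg.copR (h : CF) {t t' : ℤ} (ht : t ∈ Ico (0:ℤ) T) (ht' : t' ∈ Ico (0:ℤ) T) (hne : t ≠ t') :
    IsCoprime (aT t ^ 2 - e * b ^ 2) (aT t * aT t' - e * b ^ 2) := by
  obtain ⟨k, hk⟩ := h.hpow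
  have h1 : IsCoprime (aT t ^ 2 - e * b ^ 2) (aT t) := by
    rw [sq]; exact cop_al h.he (h.al_dvd t)
  have hd : (t' - t) ∣ (T.factorial : ℤ) := by
    rw [← Int.natAbs_dvd_natAbs, Int.natAbs_natCast]
    rw [mem_Ico] at ht ht'
    exact Nat.dvd_factorial (by omega) (by omega)
  have h2 : (s:ℤ) * W * Ω * (t' - t) ∣ (b:ℤ) ^ k := (mul_dvd_mul_left _ hd).trans (by exact_mod_cast hk)
  have h3 : IsCoprime (aT t ^ 2 - e * b ^ 2) _ := cop_b (by rw [sq]; exact mul_dvd_one (e := e) (h.al_dvd t) (h.al_dvd t)) k h2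
  have h4 := (h1.mul_right h3).add_mul_left_right 1
  have h5 : aT t * aT t' - e * b ^ 2 = aT t * (s * W * Ω * (t' - t)) + (aT t ^ 2 - e * b ^ 2) * 1 := by
    unfold al qq; ring
  rw [h5]; exact h4

theorem Cfg.copp (h : CF) (t : ℤ) :
    IsCoprime (pT t) (aT t * (W * Ω)) := by
  obtain ⟨k, hk⟩ := h.hpow
  refine (cop_al h.he (h.al_dvd t)).mul_right (cop_b (mul_dvd_one h.hab (h.al_dvd t)) k ?_)
  have : W * Ω ∣ b ^ k := Dvd.dvd.trans ⟨s * T.factorial, by ring⟩ hk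
  exact_mod_cast this

theorem Cfg.copq (h : CF) (t : ℤ) : IsCoprime (qT t) (Ds:ℤ) := by
  refine cop_b (b := (Ω:ℤ)) ⟨T * Δ + t, ?_⟩ 1 ⟨s, by rw [pow_one, ← h.hsD]; push_cast; ring⟩
  unfold qq u0; push_cast; ring

def mm (e : ℤ) (a b s W Ω Δ T : ℕ) (t x y : ℤ) : ℤ := pp e a b s W Ω Δ T t * y - al a s W Ω Δ T t * (W * Ω) * x
def nn (Ds Ω Δ T : ℕ) (t x y : ℤ) : ℤ := qq Ω Δ T t * y + Ds * x

noncomputable def BX (Ω Δ T Z : ℕ) : Finset (ℤ × ℤ) := Ico (0:ℤ) (u0 Ω Δ T * Z : ℕ) ×ˢ Ico ((Ω * Δ * Z : ℕ):ℤ) (2 * (Ω * Δ * Z : ℕ))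

local notation "mT" => mm e a b s W Ω Δ T
local notation "nT" => nn Ds Ω Δ T
local notation "bX" => BX Ω Δ T

theorem Cfg.DX (h : CF) {Z : ℕ} {x y : ℤ} (hz : (x, y) ∈ bX Z) :
    0 ≤ (Ω:ℤ) * Δ * x ∧ (Ω:ℤ) * Δ * x ≤ uT * y ∧ 0 ≤ y ∧ y ≤ 2 * (Ω * Δ * Z : ℕ) ∧ 0 ≤ x ∧ (Ω * Δ * Z : ℕ) ≤ y ∧ (Ω:ℤ) * x ≤ uT * y := by
  simp only [BX, mem_product, mem_Ico] at hz
  obtain ⟨⟨h1, h2⟩, h3, h4⟩ := hz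
  have e0 : (0:ℤ) ≤ (Ω * Δ * Z : ℕ) := by positivity
  have e1 : (Ω:ℤ) * Δ * x ≤ Ω * Δ * (uT * Z : ℕ) := mul_le_mul_of_nonneg_left h2.le (by positivity)
  have e2 : (uT:ℤ) * (Ω * Δ * Z : ℕ) ≤ uT * y := mul_le_mul_of_nonneg_left h3 (by positivity)
  have e3 : (Ω:ℤ) * x * 1 ≤ Ω * x * Δ := mul_le_mul_of_nonneg_left (by exact_mod_cast h.hΔ) (by positivity)
  push_cast at *
  refine ⟨by positivity, by linarith, by linarith, by linarith, h1, h3, by linarith⟩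

theorem Cfg.nb (h : CF) {Z : ℕ} (hZ : 0 < Z) {t x y : ℤ} (ht : t ∈ Ico (0:ℤ) T) (hz : (x, y) ∈ bX Z) :
    0 < nT t x y ∧ nT t x y < 5 * (uT * (Ω * Δ * Z)) := by
  obtain ⟨h1, h2, h3, h4, h5, h6, h7⟩ := h.DX hz
  obtain ⟨q1, q2, q3, q4⟩ := h.qb ht
  simp only [BX, mem_product, mem_Ico] at hz
  have hΩ := h.hΩ
  have hΔ := h.hΔ
  have hu : (0:ℤ) < uT := by unfold u0; positivity
  have hY : (0:ℤ) < (Ω * Δ * Z : ℕ) := by positivity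
  have hy0 : 0 < y := hY.trans_le h6
  have hs : (1:ℤ) ≤ s := by exact_mod_cast h.hs
  have hD : (s:ℤ) * Ds = Ω := by exact_mod_cast h.hsD
  have e1 : (Ds:ℤ) * x ≤ s * (Ds * x) := le_mul_of_one_le_left (by positivity) hs
  have e2 : (uT:ℤ) * y ≤ qT t * y := mul_le_mul_of_nonneg_right q1 h3
  have e3 : qT t * y ≤ 2 * uT * y := mul_le_mul_of_nonneg_right q2 h3
  have e4 : (0:ℤ) < uT * y := by positivity
  have e5 : (uT:ℤ) * (y + 1) ≤ uT * (2 * (Ω * Δ * Z : ℕ)) := mul_le_mul_of_nonneg_left (by linarith [hz.2.2]) hu.le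
  have e6 : (0:ℤ) ≤ Ds * x := by positivity
  have e7 : (Ω:ℤ) * x ≤ uT * (Ω * Δ * Z : ℕ) := by
    have a1 : (Ω:ℤ) * x * 1 ≤ Ω * x * Δ := mul_le_mul_of_nonneg_left (by exact_mod_cast h.hΔ) (by positivity)
    have a2 : (Ω:ℤ) * Δ * x ≤ Ω * Δ * (uT * Z : ℕ) := mul_le_mul_of_nonneg_left hz.1.2.le (by positivity)
    push_cast at *
    linarith
  have e8 : (s:ℤ) * (Ds * x) = Ω * x := by rw [← hD]; ring
  unfold nn
  push_cast at *
  constructor <;> linarith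

theorem Cfg.mb (h : CF) {Z : ℕ} (hZ : 0 < Z) {t x y : ℤ} (ht : t ∈ Ico (0:ℤ) T) (hz : (x, y) ∈ bX Z) :
    0 < mT t x y ∧ mT t x y < 4 * (a ^ 2 * (Ω * Δ * Z)) ∧
     50 * (aT t * (W * Ω) * x) ≤ a ^ 2 * y := by
  obtain ⟨h1, h2, h3, h4, h5, h6, h7⟩ := h.DX hz
  obtain ⟨q1, q2, q3, q4, q5⟩ := h.alb ht
  obtain ⟨p1, p2⟩ := h.pb ht
  have hΩ := h.hΩ
  have hΔ := h.hΔ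
  have ha : (0:ℤ) < a := by exact_mod_cast h.a_pos
  have hY : (0:ℤ) < (Ω * Δ * Z : ℕ) := by positivity
  have hy0 : 0 < y := hY.trans_le h6
  have hs : (1:ℤ) ≤ s := by exact_mod_cast h.hs
  have hC : 100 * ((W:ℤ) * uT) ≤ a := by
    have a1 : (0:ℤ) ≤ b + s * W * (Ω * T) := by positivity
    have a2 : (W:ℤ) * uT ≤ s * (W * uT) := le_mul_of_one_le_left (by positivity) hs
    linarith
  have e1 : (W:ℤ) * (Ω * x) ≤ W * (uT * y) := mul_le_mul_of_nonneg_left h7 (by positivity)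
  have e2 : 100 * ((W:ℤ) * uT) * y ≤ a * y := mul_le_mul_of_nonneg_right hC h3
  have e3 : 100 * aT t * (W * (Ω * x)) ≤ 101 * a * (W * (Ω * x)) := mul_le_mul_of_nonneg_right q5 (by positivity)
  have e4 : (a:ℤ) * (100 * (W * (Ω * x))) ≤ a * (a * y) := mul_le_mul_of_nonneg_left (by linarith) ha.le
  have e5 : 9 * (a:ℤ) ^ 2 * y ≤ 10 * pT t * y := mul_le_mul_of_nonneg_right p1 h3
  have e6 : 10 * pT t * y ≤ 11 * (a:ℤ) ^ 2 * y := mul_le_mul_of_nonneg_right p2 h3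
  have e7 : 0 < (a:ℤ) ^ 2 * y := by positivity
  have e8 : (a:ℤ) ^ 2 * y ≤ a ^ 2 * (2 * (Ω * Δ * Z : ℕ)) := mul_le_mul_of_nonneg_left h4 (by positivity)
  have e9 : (0:ℤ) ≤ aT t * (W * Ω) * x := mul_nonneg (mul_nonneg (by linarith) (by positivity)) h5
  have e10 : 50 * (aT t * (W * Ω) * x) ≤ a ^ 2 * y := by
    linarith
  unfold mm
  push_cast at *
  refine ⟨by linarith, by linarith, e10⟩

theorem sum_Ico_int {M : Type*} [AddCommMonoid M] (T : ℕ) (F : ℤ → M) : ∑ t ∈ Ico (0:ℤ) T, F t = ∑ k ∈ range T, F k := by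
  symm
  refine sum_nbij' (fun k : ℕ => (k:ℤ)) Int.toNat ?_ ?_ ?_ ?_ ?_ <;> simp <;> omega

theorem boxsplit (X Y1 Ds : ℤ) (hD : 0 < Ds) (u : ℤ) (G : ℤ × ℤ → ℂ) :
    ∑ z ∈ Ico 0 X ×ˢ Ico (Ds * Y1) (2 * (Ds * Y1)), G z =
      ∑ y0 ∈ Ico 0 Ds, ∑ p ∈ (Ico 0 X ×ˢ Ico Y1 (2 * Y1)).image (fun z => (z.2, z.1 + u * z.2)), G (p.2 - u * p.1, y0 + Ds * p.1) := by
  have h1 : ∀ y0 ∈ Ico 0 Ds, ∑ p ∈ (Ico 0 X ×ˢ Ico Y1 (2 * Y1)).image (fun z => (z.2, z.1 + u * z.2)), G (p.2 - u * p.1, y0 + Ds * p.1)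
      = ∑ z ∈ Ico 0 X ×ˢ Ico Y1 (2 * Y1), G (z.1, y0 + Ds * z.2) := by
    intro y0 _
    rw [sum_image]
    · refine sum_congr rfl fun z _ => ?_
      simp
    · rintro ⟨x, y⟩ _ ⟨x', y'⟩ _ hh
      simp only [Prod.mk.injEq] at hh ⊢
      obtain ⟨rfl, h2⟩ := hh
      exact ⟨by linarith, rfl⟩
  rw [sum_congr rfl h1, ← sum_product']
  symm
  refine sum_nbij' (fun w => (w.2.1, w.1 + Ds * w.2.2)) (fun z => (z.2 % Ds, z.1, z.2 / Ds)) ?_ ?_ ?_ ?_ ?_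
  · rintro ⟨y0, x, y⟩ hw
    simp only [mem_product, mem_Ico] at hw ⊢
    obtain ⟨⟨h0, h1⟩, ⟨h2, h3⟩, h4, h5⟩ := hw
    refine ⟨⟨h2, h3⟩, by nlinarith, ?_⟩
    nlinarith
  · rintro ⟨x, y⟩ hw
    simp only [mem_product, mem_Ico] at hw ⊢
    obtain ⟨⟨h2, h3⟩, h4, h5⟩ := hw
    refine ⟨⟨Int.emod_nonneg _ hD.ne', Int.emod_lt_of_pos _ hD⟩, ⟨h2, h3⟩, ?_, ?_⟩
    · exact (Int.le_ediv_iff_mul_le hD).2 (by linarith)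
    · exact Int.ediv_lt_of_lt_mul hD (by linarith)
  · rintro ⟨y0, x, y⟩ hw
    simp only [mem_product, mem_Ico] at hw
    obtain ⟨⟨h0, h1⟩, -⟩ := hw
    simp only [Prod.mk.injEq, true_and]
    refine ⟨by rw [Int.add_mul_emod_self_left, Int.emod_eq_of_lt h0 h1], ?_⟩
    rw [Int.add_mul_ediv_left _ _ hD.ne', Int.ediv_eq_zero_of_lt h0 h1, zero_add]
  · rintro ⟨x, y⟩ _
    simp only [Prod.mk.injEq, true_and]
    exact Int.emod_add_mul_ediv y Ds
  · rintro ⟨y0, x, y⟩ _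
    rfl

theorem sq_le_imp {x E A : ℝ} (hE : 0 ≤ E) (hA : 0 ≤ A) (h : x ^ 2 ≤ (E * A) ^ 2) : x ≤ E * A :=
  le_of_sq_le_sq h (mul_nonneg hE hA)

set_option maxHeartbeats 1600000 in
theorem Tslot (h : CF) (t1 : ℕ) (ρ ε E : ℝ) (ht1 : 0 < t1) (hε : 0 < ε)
    (h4 : 4 * t1 ≤ ε * T) (hρ0 : 0 < ρ) (hρ : 22 * (T:ℝ) ^ 3 ≤ ρ ^ 4) (hρt : 24 * (2 * Δ) * ρ ≤ ε ^ 4 * t1)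
    (hE0 : 0 ≤ E) (hE : 160 * ε * s * Δ ≤ E ^ 2) :
    ∃ (c : ℝ) (Z0 : ℕ), 0 < c ∧ ∀ Z : ℕ, Z0 ≤ Z → ∀ M : ℕ, 16 * (uT * (Ω * Δ * Z)) ≤ M → M ≤ 32 * (uT * (Ω * Δ * Z)) →
      ∀ F : ℤ → ℂ, (∀ x, ‖F x‖ ≤ 1) → ∀ g : ℕ → ℂ, (∀ x, ‖g x‖ ≤ 2) → FU g c M → ∀ d : ℤ × ℤ → ℂ, (∀ p, ‖d p‖ ≤ 1) →
      ∑ t ∈ Ico (0:ℤ) T, ‖∑ z ∈ bX Z, d z * (F (mT t z.1 z.2) * g (nT t z.1 z.2).toNat)‖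
        ≤ 2 * E * T * ((uT * Z) * (Ω * Δ * Z)) := by
  have ha := h.a_pos
  have hs := h.hs
  have hΩ := h.hΩ
  have hΔ := h.hΔ
  have hT := h.hT
  have hsD := h.hsD
  have hDs : 0 < Ds := by by_contra hh; have : Ds = 0 := by omega
                          subst this; omega
  have ha100 : 100 ≤ a := by have := h.hbig; have := h.hb; omega
  have ha2 : 100 ≤ a ^ 2 := ha100.trans (Nat.le_self_pow two_ne_zero a)
  have hu : 0 < uT := by unfold u0; positivity
  have hal : ∀ t : ℤ, (a + s * W * uT : ℤ) + (s * W : ℤ) * Ω * t = aT t := fun t => by unfold al qq; ring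
  have hNpos : ∀ t ∈ Ico (0:ℤ) T, ∀ t' ∈ Ico (0:ℤ) T, ((aT t * aT t' - e * b ^ 2).toNat : ℤ) = aT t * aT t' - e * b ^ 2 :=
    fun t ht t' ht' => Int.toNat_of_nonneg (by have := (h.Nb ht ht').1; linarith)
  obtain ⟨c, U0, hc, hmain⟩ := Tlemma (a + s * W * uT) (s * W) (e * b ^ 2) Ω T (a ^ 2 / 2) t1 ε (2 * Δ) ρ
    (fun t => (aT t * aT t - e * b ^ 2).toNat) (fun t t' => (aT t * aT t' - e * b ^ 2).toNat)
    (by have := h.hW; positivity) hΩ hT (by omega)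
    (fun t ht => by rw [hal]; have := (h.alb ht).2.2.2.1; omega)
    (fun t ht => by rw [hal, hNpos t ht t ht]; ring)
    (fun t ht t' ht' => by rw [hal, hal, hNpos t ht t' ht'])
    (fun t ht => by have := hNpos t ht t ht; have := (h.Nb ht ht).1; zify; omega)
    (fun t ht t' ht' => by
      have := hNpos t ht t' ht'; have := (h.Nb ht ht').2; have := hNpos t' ht' t' ht'; have := (h.Nb ht' ht').1; zify; linarith)
    (fun t ht t' ht' hne => by
      rw [← Nat.isCoprime_iff_coprime, hNpos t ht t ht, hNpos t ht t' ht', ← sq]; exact h.copR ht ht' hne)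
    (by positivity) ht1 hε h4 hρ0 hρ hρt
  refine ⟨c / (4 * Ds), U0 + 1, by positivity, fun Z hZ M hM1 hM2 F hF g hg hFU d hd => ?_⟩
  have hZ0 : 0 < Z := by omega
  set Y1 : ℕ := s * Δ * Z with hY1
  have hY1p : 0 < Y1 := by positivity
  have hYD : Ω * Δ * Z = Ds * Y1 := by rw [hY1, ← hsD]; ring
  set U : ℕ := 5 * uT * Y1 with hU
  set L : ℕ := 4 * a ^ 2 * Y1 with hL
  set u := uT with hudef
  have hUZ : U0 ≤ U := by
    have : Z ≤ U := by
      rw [hU, hY1]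
      calc Z = 1 * Z := (one_mul Z).symm
        _ ≤ (5 * u * (s * Δ)) * Z := Nat.mul_le_mul_right _ (Nat.one_le_iff_ne_zero.2 (by positivity))
        _ = _ := by ring
    omega
  have hDR : (0:ℝ) < Ds := by exact_mod_cast hDs
  have hKL : ((U:ℝ) * (a ^ 2 / 2 : ℕ)) ≤ 2 * Δ * Ω * T * L := by
    have e1 : ((a ^ 2 / 2 : ℕ) : ℝ) ≤ a ^ 2 / 2 := by exact_mod_cast Nat.cast_div_le (α := ℝ) (m := a ^ 2) (n := 2)
    have e2 : (u:ℝ) ≤ 2 * (Ω * T * Δ) := by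
      rw [hudef, u0]; push_cast
      have : (1:ℝ) ≤ Ω * T * Δ := by exact_mod_cast Nat.one_le_iff_ne_zero.2 (by positivity)
      linarith
    have e3 : (0:ℝ) ≤ a ^ 2 * Y1 := by positivity
    rw [hU, hL]; push_cast
    calc (5 * u * Y1 : ℝ) * (a ^ 2 / 2 : ℕ) ≤ (5 * u * Y1 : ℝ) * (a ^ 2 / 2) := by gcongr
      _ = 5 / 2 * u * (a ^ 2 * Y1) := by ring
      _ ≤ 5 / 2 * (2 * (Ω * T * Δ)) * (a ^ 2 * Y1) := by gcongr
      _ ≤ 8 * (Ω * T * Δ) * (a ^ 2 * Y1) := by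
        refine mul_le_mul_of_nonneg_right ?_ e3
        have : (0:ℝ) ≤ Ω * T * Δ := by positivity
        linarith
      _ = _ := by ring
  have key : ∀ y0 ∈ Ico (0:ℤ) Ds, ∑ t ∈ Ico (0:ℤ) T, ‖∑ p ∈ (Ico 0 ((u * Z : ℕ):ℤ) ×ˢ Ico (Y1:ℤ) (2 * Y1)).image (fun z : ℤ × ℤ => (z.2, z.1 + (u:ℤ) * z.2)),
      d (p.2 - u * p.1, y0 + Ds * p.1) * (F (mT t (p.2 - u * p.1) (y0 + Ds * p.1)) * g (nT t (p.2 - u * p.1) (y0 + Ds * p.1)).toNat)‖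
      ≤ 2 * E * T * ((u * Z) * Y1) := by
    intro y0 hy0
    set Bx := (Ico 0 ((u * Z : ℕ):ℤ) ×ˢ Ico (Y1:ℤ) (2 * Y1)).image (fun z : ℤ × ℤ => (z.2, z.1 + (u:ℤ) * z.2)) with hBx
    have hcard : (#Bx : ℝ) ≤ (u * Z) * Y1 := by
      have : #Bx ≤ (u * Z) * Y1 := by
        refine card_image_le.trans ?_
        rw [card_product, Int.card_Ico, Int.card_Ico]
        refine le_of_eq ?_
        congr 1 <;> omega
      exact_mod_cast this
    set cst : ℤ → ℤ := fun t => (aT t * aT t - e * b ^ 2) * y0 - aT t * (s * W) * (u * y0) with hcst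
    have hy := mem_Ico.1 hy0
    have hm := hmain U hUZ (fun k => if k ∈ Ico (0:ℤ) U then g (u * y0 + Ds * k).toNat / 2 else 0)
      (fun w => by
        split_ifs
        · rw [norm_div]; have := hg (u * y0 + Ds * w).toNat; simp only [Complex.norm_ofNat]; linarith
        · simp)
      (fun w hw => if_neg hw)
      (fun z hz => by
        rw [sum_congr rfl fun k hk => by rw [if_pos hk], sum_Ico_int]
        have h0 := FU_AP hFU Ds (u * y0.toNat) hDs z hz 0 U (by
          have : y0.toNat ≤ Ds := by omega
          have e1 : u * y0.toNat ≤ u * (Ds * Y1) := Nat.mul_le_mul_left _ (this.trans (Nat.le_mul_of_pos_right _ hY1p))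
          have e2 : Ds * U = 5 * (u * (Ds * Y1)) := by rw [hU]; ring
          rw [hYD] at hM1
          omega)
        have e3 : ∑ k ∈ range U, g (u * y0 + Ds * (k:ℤ)).toNat / 2 * z ^ (k:ℤ) = (1 / 2) * ∑ k ∈ Ico 0 U, g (u * y0.toNat + Ds * k) * z ^ k := by
          rw [mul_sum, range_eq_Ico]
          refine sum_congr rfl fun k _ => ?_
          have : (u * y0 + Ds * (k:ℤ)).toNat = u * y0.toNat + Ds * k := by
            zify; rw [Int.toNat_of_nonneg (by have := hy.1; positivity), Int.toNat_of_nonneg hy.1]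
          rw [this, zpow_natCast]; ring
        rw [e3, norm_mul]
        have e4 : (M:ℝ) ≤ 32 * (u * (Ds * Y1)) := by rw [hYD] at hM2; exact_mod_cast hM2
        have e5 : c / (4 * Ds) * M ≤ c / (4 * Ds) * (32 * (u * (Ds * Y1))) := by gcongr
        have e6 : c / (4 * Ds) * (32 * (u * (Ds * Y1))) = c * (8 * u * Y1) := by field_simp; ring
        have e7 : (0:ℝ) ≤ c * (u * Y1) := by positivity
        have e8 : ‖(1 / 2 : ℂ)‖ = 1 / 2 := by simp
        rw [e8, hU]; push_cast
        linarith)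
      (fun t => s * t * y0) (fun t => -(cst t / Ds)) L
      (fun t j => if 0 ≤ Ds * j + cst t ∧ Ds * j + cst t < Ds * L then F (Ds * j + cst t) else 0)
      (fun t x => by split_ifs; exacts [hF _, by simp])
      (fun t x hx => by
        refine if_neg fun hh => hx ?_
        have e1 := Int.emod_add_mul_ediv (cst t) Ds
        have e2 := Int.emod_nonneg (cst t) (by positivity : (Ds:ℤ) ≠ 0)
        have e3 := Int.emod_lt_of_pos (cst t) (by exact_mod_cast hDs : (0:ℤ) < Ds)
        have hD0 : (0:ℤ) < Ds := by exact_mod_cast hDs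
        rw [mem_Ico]
        constructor
        · by_contra hlt
          have : x + cst t / Ds ≤ -1 := by omega
          linarith [hh.1, mul_le_mul_of_nonneg_left this hD0.le]
        · by_contra hlt
          have : (L:ℤ) ≤ x + cst t / Ds := by omega
          linarith [hh.2, mul_le_mul_of_nonneg_left this hD0.le])
      hKL Bx (fun p => d (p.2 - u * p.1, y0 + Ds * p.1)) (fun p => hd _)
    have hrew : ∀ t ∈ Ico (0:ℤ) T, ‖∑ p ∈ Bx, d (p.2 - u * p.1, y0 + Ds * p.1) * (F (mT t (p.2 - u * p.1) (y0 + Ds * p.1)) * g (nT t (p.2 - u * p.1) (y0 + Ds * p.1)).toNat)‖ =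
       2 * ‖∑ p ∈ Bx, d (p.2 - u * p.1, y0 + Ds * p.1) * ((if 0 ≤ Ds * (((aT t * aT t - e * b ^ 2).toNat : ℤ) * p.1 - ((a + s * W * u : ℤ) + (s * W : ℤ) * Ω * t) * (s * W) * (p.2 + Ω * t * p.1 + s * t * y0)) + cst t ∧ Ds * (((aT t * aT t - e * b ^ 2).toNat : ℤ) * p.1 - ((a + s * W * u : ℤ) + (s * W : ℤ) * Ω * t) * (s * W) * (p.2 + Ω * t * p.1 + s * t * y0)) + cst t < Ds * L then F (Ds * (((aT t * aT t - e * b ^ 2).toNat : ℤ) * p.1 - ((a + s * W * u : ℤ) + (s * W : ℤ) * Ω * t) * (s * W) * (p.2 + Ω * t * p.1 + s * t * y0)) + cst t) else 0)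
         * (if (p.2 + Ω * t * p.1 + s * t * y0) ∈ Ico (0:ℤ) U then g (u * y0 + Ds * (p.2 + Ω * t * p.1 + s * t * y0)).toNat / 2 else 0))‖ := by
      intro t ht
      rw [← Complex.norm_two, ← norm_mul, mul_sum]
      refine congrArg _ (sum_congr rfl fun p hp => ?_)
      rw [hNpos t ht t ht, hal]
      have hsDz : (s:ℤ) * Ds = Ω := by exact_mod_cast hsD
      have em : Ds * ((aT t * aT t - e * b ^ 2) * p.1 - aT t * (s * W) * (p.2 + Ω * t * p.1 + s * t * y0)) + cst t
          = mT t (p.2 - u * p.1) (y0 + Ds * p.1) := by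
        rw [hcst, ← hsDz]; unfold mm pp; dsimp only
        have : (a:ℤ) = aT t - s * W * (u + s * Ds * t) := by unfold al qq; rw [hsDz, hudef]; ring
        rw [this, hsDz]; rw [← hsDz]; ring
      have en : u * y0 + Ds * (p.2 + Ω * t * p.1 + s * t * y0) = nT t (p.2 - u * p.1) (y0 + Ds * p.1) := by
        unfold nn qq; rw [← hsDz, hudef]; ring
      rw [em, en]
      have hmem : (p.2 - u * p.1, y0 + Ds * p.1) ∈ bX Z := by
        rw [hBx, mem_image] at hp
        obtain ⟨z, hz, rfl⟩ := hp
        rw [mem_product, mem_Ico, mem_Ico] at hz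
        obtain ⟨⟨z1, z2⟩, z3, z4⟩ := hz
        have hD0 : (0:ℤ) < Ds := by exact_mod_cast hDs
        have f1 := mul_le_mul_of_nonneg_left z3 hD0.le
        have f2 := mul_le_mul_of_nonneg_left (Int.add_one_le_iff.2 z4) hD0.le
        simp only [BX, mem_product, mem_Ico, hYD]
        push_cast at z2 ⊢
        refine ⟨⟨by linarith, by linarith⟩, by linarith [hy.1], by linarith [hy.2]⟩
      obtain ⟨m1, m2, -⟩ := h.mb hZ0 ht hmem
      obtain ⟨n1, n2⟩ := h.nb hZ0 ht hmem
      rw [if_pos, if_pos]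
      · ring
      · rw [mem_Ico]
        have hD0 : (0:ℤ) < Ds := by exact_mod_cast hDs
        have hYDz : (Ω:ℤ) * Δ * Z = Ds * Y1 := by exact_mod_cast hYD
        rw [← en, hYDz] at n2
        rw [hBx, mem_image] at hp
        obtain ⟨z, hz, rfl⟩ := hp
        rw [mem_product, mem_Ico, mem_Ico] at hz
        obtain ⟨⟨z1, z2⟩, z3, z4⟩ := hz
        have ht0 := (mem_Ico.1 ht).1
        have hz2 : 0 ≤ z.2 := by omega
        have hy00 := hy.1
        refine ⟨by positivity, ?_⟩
        have hu0 : 0 ≤ (u:ℤ) * y0 := by positivity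
        refine lt_of_mul_lt_mul_left (a := (Ds:ℤ)) ?_ hD0.le
        rw [hU]; push_cast
        linarith
      · have hYDz : (Ω:ℤ) * Δ * Z = Ds * Y1 := by exact_mod_cast hYD
        refine ⟨m1.le, ?_⟩
        rw [hYDz] at m2
        rw [hL]; push_cast; linarith
    rw [sum_congr rfl hrew, ← mul_sum]
    have hfin : (#Bx : ℝ) * (2 * ε * T ^ 2 * (U * L / (a ^ 2 / 2 : ℕ))) ≤ (E * (T * ((u * Z) * Y1))) ^ 2 := by
      have e1 : (a:ℝ) ^ 2 / 4 ≤ ((a ^ 2 / 2 : ℕ) : ℝ) := by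
        have : a ^ 2 ≤ 4 * (a ^ 2 / 2) := by omega
        have : (a:ℝ) ^ 2 ≤ 4 * ((a ^ 2 / 2 : ℕ) : ℝ) := by exact_mod_cast this
        linarith
      have ha0 : (0:ℝ) < a := by exact_mod_cast ha
      have e2 : (U * L : ℝ) / (a ^ 2 / 2 : ℕ) ≤ U * L / (a ^ 2 / 4) := by gcongr
      have e3 : (U * L : ℝ) / (a ^ 2 / 4) = 80 * (s * Δ) * ((u * Z) * Y1) := by
        rw [hU, hL, hY1]; push_cast; field_simp; ring
      calc (#Bx : ℝ) * (2 * ε * T ^ 2 * (U * L / (a ^ 2 / 2 : ℕ))) ≤ ((u * Z) * Y1) * (2 * ε * T ^ 2 * (80 * (s * Δ) * ((u * Z) * Y1))) := by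
            rw [e3] at e2; gcongr
        _ = (160 * ε * s * Δ) * (T * ((u * Z) * Y1)) ^ 2 := by ring
        _ ≤ E ^ 2 * (T * ((u * Z) * Y1)) ^ 2 := by gcongr
        _ = _ := by ring
    have := sq_le_imp hE0 (by positivity) (hm.trans hfin)
    linarith
  have hBXs : ∀ G : ℤ × ℤ → ℂ, ∑ z ∈ bX Z, G z = ∑ y0 ∈ Ico (0:ℤ) Ds, ∑ p ∈ (Ico 0 ((u * Z : ℕ):ℤ) ×ˢ Ico (Y1:ℤ) (2 * Y1)).image (fun z : ℤ × ℤ => (z.2, z.1 + (u:ℤ) * z.2)), G (p.2 - u * p.1, y0 + Ds * p.1) := by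
    intro G
    rw [← boxsplit _ _ _ (by exact_mod_cast hDs), BX, hYD]
    push_cast; rfl
  calc _ ≤ ∑ t ∈ Ico (0:ℤ) T, ∑ y0 ∈ Ico (0:ℤ) Ds, ‖∑ p ∈ (Ico 0 ((u * Z : ℕ):ℤ) ×ˢ Ico (Y1:ℤ) (2 * Y1)).image (fun z : ℤ × ℤ => (z.2, z.1 + (u:ℤ) * z.2)),
      d (p.2 - u * p.1, y0 + Ds * p.1) * (F (mT t (p.2 - u * p.1) (y0 + Ds * p.1)) * g (nT t (p.2 - u * p.1) (y0 + Ds * p.1)).toNat)‖ := by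
        refine sum_le_sum fun t _ => ?_
        rw [hBXs]
        exact norm_sum_le _ _
    _ ≤ ∑ y0 ∈ Ico (0:ℤ) Ds, 2 * E * T * ((u * Z) * Y1) := by
        rw [sum_comm]; exact sum_le_sum key
    _ = _ := by
        have : (Ω:ℝ) * Δ * Z = Ds * Y1 := by exact_mod_cast hYD
        rw [sum_const, Int.card_Ico, this, nsmul_eq_mul]
        simp; ring

theorem l2slot {ι : Type*} (B : Finset ι) (M : ℕ) [NeZero M] (ν : ι → ℤ) (hν : ∀ i ∈ B, 0 ≤ ν i ∧ ν i < M) (μ C : ℝ)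
    (hμ : ∀ n, (#{i ∈ B | ν i = n} : ℝ) ≤ μ) (hC : 0 ≤ C) (Ψ : ZMod M → ℂ) (hB : #B * (μ * M) ≤ (8 * C) ^ 2) :
    ∑ i ∈ B, ‖Ψ (ν i)‖ ≤ C * (8 * √((1 / M) * ∑ x, ‖Ψ x‖ ^ 2)) := by
  have hM : (0:ℝ) < M := by exact_mod_cast Nat.pos_of_ne_zero (NeZero.ne M)
  have h1 : (∑ i ∈ B, ‖Ψ (ν i)‖) ^ 2 ≤ #B * ∑ i ∈ B, ‖Ψ (ν i)‖ ^ 2 := sq_sum_le_card_mul_sum_sq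
  have h2 : ∑ i ∈ B, ‖Ψ (ν i)‖ ^ 2 ≤ ∑ x, μ * ‖Ψ x‖ ^ 2 := by
    rw [← sum_fiberwise_of_maps_to (t := univ) (g := fun i => (ν i : ZMod M)) (fun _ _ => mem_univ _)]
    refine sum_le_sum fun x _ => ?_
    rw [sum_congr rfl (g := fun _ => ‖Ψ x‖ ^ 2) fun i hi => by rw [(mem_filter.1 hi).2], sum_const, nsmul_eq_mul]
    refine mul_le_mul_of_nonneg_right (le_trans (Nat.cast_le.2 (card_le_card fun i hi => ?_)) (hμ (x.val))) (by positivity)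
    rw [mem_filter] at hi ⊢
    refine ⟨hi.1, ?_⟩
    obtain ⟨h3, h4⟩ := hν i hi.1
    rw [← hi.2, ZMod.val_intCast, Int.emod_eq_of_lt h3 h4]
  refine le_of_sq_le_sq (h1.trans ?_) (by positivity)
  rw [mul_pow, mul_pow, Real.sq_sqrt (by positivity)]
  rw [← mul_sum] at h2
  have h3 : (0:ℝ) ≤ (1 / M) * ∑ x, ‖Ψ x‖ ^ 2 := by positivity
  calc (#B : ℝ) * ∑ i ∈ B, ‖Ψ (ν i)‖ ^ 2 ≤ #B * (μ * ∑ x, ‖Ψ x‖ ^ 2) := by gcongr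
    _ = (#B * (μ * M)) * ((1 / M) * ∑ x, ‖Ψ x‖ ^ 2) := by field_simp
    _ ≤ (8 * C) ^ 2 * ((1 / M) * ∑ x, ‖Ψ x‖ ^ 2) := by gcongr
    _ = _ := by ring

theorem lin_mult (p q n : ℤ) (hp : 0 < p) (hc : IsCoprime p q) (X : ℕ) (I : Finset ℤ) :
    (#{z ∈ Ico (0:ℤ) X ×ˢ I | p * z.2 + q * z.1 = n} : ℝ) ≤ X / p + 1 := by
  have h1 : #{z ∈ Ico (0:ℤ) X ×ˢ I | p * z.2 + q * z.1 = n} ≤ #(Icc (0:ℤ) (X / p)) := by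
    refine card_le_card_of_injOn (fun z => z.1 / p) ?_ ?_
    · intro z hz
      simp only [coe_filter, mem_product, mem_Ico, Set.mem_setOf_eq] at hz
      simp only [coe_Icc, Set.mem_Icc]
      exact ⟨Int.ediv_nonneg hz.1.1.1 hp.le, Int.ediv_le_ediv hp hz.1.1.2.le⟩
    · rintro ⟨x, y⟩ hz ⟨x', y'⟩ hz' he
      simp only [coe_filter, mem_product, mem_Ico, Set.mem_setOf_eq] at hz hz' he
      have h2 : p ∣ q * (x - x') := ⟨y' - y, by linarith [hz.2, hz'.2]⟩
      have h3 : p ∣ x - x' := hc.dvd_of_dvd_mul_left h2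
      have h4 : x = x' := by
        have e1 := Int.emod_add_mul_ediv x p
        have e2 := Int.emod_add_mul_ediv x' p
        have e3 : x % p = x' % p := Int.emod_eq_emod_iff_emod_sub_eq_zero.2 (Int.emod_eq_zero_of_dvd h3)
        rw [he] at e1; linarith
      subst h4
      have h5 : p * (y - y') = 0 := by linarith [hz.2, hz'.2]
      rcases mul_eq_zero.1 h5 with h | h
      · omega
      · simp; omega
  have h6 : (0:ℤ) ≤ X / p := Int.ediv_nonneg (by positivity) hp.le
  rw [Int.card_Icc] at h1
  have hpR : (0:ℝ) < p := by exact_mod_cast hp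
  calc (#{z ∈ Ico (0:ℤ) X ×ˢ I | p * z.2 + q * z.1 = n} : ℝ) ≤ ((X / p + 1 - 0 : ℤ).toNat : ℝ) := Nat.cast_le.2 h1
    _ = (((X / p + 1 - 0 : ℤ).toNat : ℤ) : ℝ) := by norm_cast
    _ = ((X / p + 1 : ℤ) : ℝ) := by rw [Int.toNat_of_nonneg (by omega), sub_zero]
    _ ≤ _ := by
      push_cast
      have : ((X / p : ℤ) : ℝ) * p ≤ X := by exact_mod_cast Int.ediv_mul_le (X:ℤ) hp.ne'
      have : ((X / p : ℤ) : ℝ) ≤ X / p := by rwa [le_div_iff₀ hpR]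
      linarith

theorem BX_card (Ω Δ T Z : ℕ) : (#(BX Ω Δ T Z) : ℝ) = (u0 Ω Δ T * Z) * (Ω * Δ * Z) := by
  have : #(BX Ω Δ T Z) = (u0 Ω Δ T * Z) * (Ω * Δ * Z) := by
    rw [BX, card_product, Int.card_Ico, Int.card_Ico]
    congr 1 <;> omega
  rw [this]; push_cast; ring

theorem Cfg.l2n (h : CF) {Z : ℕ} (hZ : 0 < Z) {t : ℤ} (ht : t ∈ Ico (0:ℤ) T)
    (M : ℕ) [NeZero M] (hM1 : 16 * (uT * (Ω * Δ * Z)) ≤ M) (hM2 : M ≤ 32 * (uT * (Ω * Δ * Z))) (Ψ : ZMod M → ℂ) :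
    ∑ z ∈ bX Z, ‖Ψ (nT t z.1 z.2 : ℤ)‖ ≤ ((uT * Z) * (Ω * Δ * Z)) * (8 * √((1 / M) * ∑ x, ‖Ψ x‖ ^ 2)) := by
  have hq := (h.qb ht).1
  have hu : 0 < uT := by unfold u0; positivity
  have hqp : 0 < qT t := by omega
  refine l2slot (bX Z) M (fun z => nT t z.1 z.2) (fun z hz => ?_) (2 * Z) _ (fun n => ?_) (by positivity) Ψ ?_
  · obtain ⟨h1, h2⟩ := h.nb hZ ht hz
    refine ⟨h1.le, h2.trans_le ?_⟩
    have : 5 * (uT * (Ω * Δ * Z)) ≤ M := le_trans (Nat.mul_le_mul_right _ (by norm_num)) hM1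
    exact_mod_cast this
  · refine (lin_mult _ _ n hqp (h.copq t) (uT * Z) _).trans ?_
    have hqR : (uT : ℝ) ≤ qT t := by exact_mod_cast hq
    have huR : (0:ℝ) < uT := by exact_mod_cast hu
    have hZR : (1:ℝ) ≤ Z := by exact_mod_cast hZ
    have : ((uT * Z : ℕ) : ℝ) / qT t ≤ Z := by
      rw [div_le_iff₀ (by linarith)]; push_cast; nlinarith
    linarith
  · rw [BX_card]
    have : (M:ℝ) ≤ 32 * (uT * (Ω * Δ * Z)) := by exact_mod_cast hM2
    calc ((uT * Z : ℝ) * (Ω * Δ * Z)) * (2 * Z * M) ≤ ((uT * Z : ℝ) * (Ω * Δ * Z)) * (2 * Z * (32 * (uT * (Ω * Δ * Z)))) := by gcongr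
      _ = _ := by ring

theorem Cfg.l2m (h : CF) {Z : ℕ} (hZ : 2 * a ^ 2 ≤ Z) {t : ℤ} (ht : t ∈ Ico (0:ℤ) T)
    (M : ℕ) [NeZero M] (hM1 : 16 * (a ^ 2 * (Ω * Δ * Z)) ≤ M) (hM2 : M ≤ 32 * (a ^ 2 * (Ω * Δ * Z))) (Ψ : ZMod M → ℂ) :
    ∑ z ∈ bX Z, ‖Ψ (mT t z.1 z.2 : ℤ)‖ ≤ ((uT * Z) * (Ω * Δ * Z)) * (8 * √((1 / M) * ∑ x, ‖Ψ x‖ ^ 2)) := by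
  have ha := h.a_pos
  have hZ0 : 0 < Z := lt_of_lt_of_le (by positivity) hZ
  have hp := (h.pb ht).1
  have hu : 0 < uT := by unfold u0; positivity
  have ha2 : (0:ℤ) < (a:ℤ) ^ 2 := by positivity
  have hpp : 0 < pT t := by omega
  have haR : (0:ℝ) < a ^ 2 := by positivity
  refine l2slot (bX Z) M (fun z => mT t z.1 z.2) (fun z hz => ?_) (2 * (uT * Z) / a ^ 2) _ (fun n => ?_) (by positivity) Ψ ?_
  · obtain ⟨h1, h2, -⟩ := h.mb hZ0 ht hz
    refine ⟨h1.le, h2.trans_le ?_⟩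
    have : 4 * (a ^ 2 * (Ω * Δ * Z)) ≤ M := le_trans (Nat.mul_le_mul_right _ (by norm_num)) hM1
    exact_mod_cast this
  · have hmul := lin_mult (pT t) (-(aT t * (W * Ω))) n hpp (h.copp t).neg_right (uT * Z)
      (Ico ((Ω * Δ * Z : ℕ):ℤ) (2 * (Ω * Δ * Z : ℕ)))
    have : #{z ∈ bX Z | mT t z.1 z.2 = n} = #{z ∈ Ico (0:ℤ) (uT * Z : ℕ) ×ˢ Ico ((Ω * Δ * Z : ℕ):ℤ) (2 * (Ω * Δ * Z : ℕ)) | pT t * z.2 + -(aT t * (W * Ω)) * z.1 = n} := by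
      unfold mm BX; simp only [neg_mul, ← sub_eq_add_neg]
    rw [this]
    refine hmul.trans ?_
    have hpR : (9:ℝ) * a ^ 2 ≤ 10 * pT t := by exact_mod_cast hp
    have hXR : (2:ℝ) * a ^ 2 ≤ uT * Z := by
      have : 2 * a ^ 2 ≤ uT * Z := hZ.trans (Nat.le_mul_of_pos_left _ hu)
      exact_mod_cast this
    have e1 : ((uT * Z : ℕ) : ℝ) / pT t ≤ (uT * Z) / (9 / 10 * a ^ 2) := by
      push_cast; gcongr; linarith
    have e2 : (1:ℝ) ≤ 1 / 2 * (uT * Z) / a ^ 2 := by rw [le_div_iff₀ haR]; linarith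
    have e3 : (uT * Z : ℝ) / (9 / 10 * a ^ 2) = 10 / 9 * ((uT * Z) / a ^ 2) := by field_simp
    have e4 : (0:ℝ) ≤ (uT * Z) / a ^ 2 := by positivity
    rw [e3] at e1
    rw [mul_div_assoc] at e2 ⊢
    linarith
  · rw [BX_card]
    have : (M:ℝ) ≤ 32 * (a ^ 2 * (Ω * Δ * Z)) := by exact_mod_cast hM2
    calc ((uT * Z : ℝ) * (Ω * Δ * Z)) * (2 * (uT * Z) / a ^ 2 * M) ≤ ((uT * Z : ℝ) * (Ω * Δ * Z)) * (2 * (uT * Z) / a ^ 2 * (32 * (a ^ 2 * (Ω * Δ * Z)))) := by gcongr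
      _ = _ := by field_simp; ring

theorem Cfg.mslot (h : CF) (ε : ℝ) (hε : 0 < ε) (hT : 8 ≤ ε ^ 2 * T) :
    ∃ (c : ℝ) (Z0 : ℕ), 0 < c ∧ ∀ Z : ℕ, Z0 ≤ Z → ∀ M : ℕ, 16 * (a ^ 2 * (Ω * Δ * Z)) ≤ M → M ≤ 32 * (a ^ 2 * (Ω * Δ * Z)) →
      ∀ g : ℤ → ℂ, (∀ x, ‖g x‖ ≤ 2) → FU (fun n : ℕ => g n) c M → ∀ d : ℤ × ℤ → ℂ, (∀ p, ‖d p‖ ≤ 1) →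
      ∑ t ∈ Ico (0:ℤ) T, ‖∑ z ∈ bX Z, d z * g (mT t z.1 z.2)‖
        ≤ ε * T * ((uT * Z) * (Ω * Δ * Z)) := by
  have ha := h.a_pos
  have hT0 := h.hT
  have hΩ := h.hΩ
  have hΔ := h.hΔ
  have hW := h.hW
  have hs := h.hs
  have hb := h.hb
  have hu : 0 < uT := by unfold u0; positivity
  set Q : ℕ := 2 * a ^ 2 * (Ω * Δ) + 2 * a * (W * Ω) * uT + 4 * a ^ 3 * (W * Ω) with hQ
  have hQ0 : 0 < Q := by positivity
  refine ⟨ε ^ 2 / (128 * Q * a ^ 2), 1 + 4 * (4 * a ^ 3 * (W * Ω)), by positivity, fun Z hZ M hM1 hM2 g hg hFU d hd => ?_⟩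
  have hZ0 : 0 < Z := by omega
  rw [sum_Ico_int]
  have hmem : ∀ t < T, ((t:ℕ):ℤ) ∈ Ico (0:ℤ) T := fun t ht => by simp [ht]
  have hp1 : ∀ t < T, 0 < pT t ∧ pT t ≤ 2 * a ^ 2 := fun t ht => by
    have := h.pb (hmem t ht)
    have ha2 : (0:ℤ) < (a:ℤ) ^ 2 := by positivity
    constructor <;> omega
  have ha1 : ∀ t < T, 0 < aT t ∧ aT t ≤ 2 * a := fun t ht => by
    have := h.alb (hmem t ht)
    constructor <;> omega
  have hq1 : ∀ t < T, 0 < aT t * (W * Ω) ∧ aT t * (W * Ω) ≤ 2 * a * (W * Ω) := fun t ht => by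
    obtain ⟨h1, h2⟩ := ha1 t ht
    exact ⟨by positivity, mul_le_mul_of_nonneg_right h2 (by positivity)⟩
  have hqp : ∀ t < T, ∀ t' < T, aT t * (W * Ω) * pT t' ≤ 4 * a ^ 3 * (W * Ω) := fun t ht t' ht' => by
    have := mul_le_mul (hq1 t ht).2 (hp1 t' ht').2 (hp1 t' ht').1.le (by positivity)
    linarith
  have hMbig : (4:ℤ) * (4 * a ^ 3 * (W * Ω)) ≤ M := by
    have : 4 * (4 * a ^ 3 * (W * Ω)) ≤ M := by
      have : Z ≤ 16 * (a ^ 2 * (Ω * Δ * Z)) := by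
        calc Z = 1 * Z := (one_mul _).symm
          _ ≤ (16 * a ^ 2 * (Ω * Δ)) * Z := Nat.mul_le_mul_right _ (Nat.one_le_iff_ne_zero.2 (by positivity))
          _ = _ := by ring
      omega
    exact_mod_cast this
  have hm := _root_.mslot hFU hg T (uT * Z : ℕ) (Ω * Δ * Z : ℕ) (fun t => pT t) (fun t => aT t * (W * Ω)) (Q * Z)
    (by positivity) (by positivity) (fun t ht => (hp1 t ht).1) (fun t ht => (hq1 t ht).1) (fun t ht t' ht' hne => by
      have : pT t' * (aT t * (W * Ω)) - aT t' * (W * Ω) * pT t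
        = (W * Ω) * (e * b ^ 2) * (s * W * Ω) * (t' - t) := by unfold pp al qq; ring
      rw [this]
      have e1 : e ≠ 0 := by rcases h.he with rfl | rfl <;> norm_num
      have e2 : (t':ℤ) - t ≠ 0 := by omega
      positivity) (fun t ht t' ht' => by
      have e1 := hqp t ht t' ht'
      have e2 := hqp t' ht' t ht
      have e3 := mul_pos (hq1 t ht).1 (hp1 t' ht').1
      have e4 := mul_pos (hq1 t' ht').1 (hp1 t ht).1
      refine le_trans ?_ hMbig
      refine mul_le_mul_of_nonneg_left ?_ (by norm_num)
      rw [abs_le]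
      constructor <;> linarith) (fun t ht => by
      have e1 : pT t * (Ω * Δ * Z) ≤ 2 * a ^ 2 * (Ω * Δ * Z) := mul_le_mul_of_nonneg_right (hp1 t ht).2 (by positivity)
      have e2 : aT t * (W * Ω) * (uT * Z) ≤ 2 * a * (W * Ω) * (uT * Z) := mul_le_mul_of_nonneg_right (hq1 t ht).2 (by positivity)
      have e3 := hqp t ht t ht
      have e4 : (4 * a ^ 3 * (W * Ω) : ℤ) * 1 ≤ 4 * a ^ 3 * (W * Ω) * Z := mul_le_mul_of_nonneg_left (by exact_mod_cast hZ0) (by positivity)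
      have e5 : pT t * (Ω * Δ * Z : ℕ) + aT t * (W * Ω) * (uT * Z : ℕ) + aT t * (W * Ω) * pT t ≤ (Q * Z : ℤ) := by
        rw [hQ]; push_cast; linarith
      exact_mod_cast e5) (fun t ht x y hx hx' hy hy' => by
      obtain ⟨h1, h2, -⟩ := h.mb (x := x) (y := y) hZ0 (hmem t ht) (by simp only [BX, mem_product, mem_Ico]; exact ⟨⟨hx, hx'⟩, hy, hy'⟩)
      unfold mm at h1 h2
      refine ⟨h1.le, ?_⟩
      have : (16 * (a ^ 2 * (Ω * Δ * Z)) : ℤ) ≤ M := by exact_mod_cast hM1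
      linarith) d hd
  refine le_of_sq_le_sq (hm.trans ?_) (by positivity)
  have hMR : (M:ℝ) ≤ 32 * (a ^ 2 * (Ω * Δ * Z)) := by exact_mod_cast hM2
  have huR : (1:ℝ) ≤ uT := by exact_mod_cast hu
  have hQR : (0:ℝ) < Q := by exact_mod_cast hQ0
  have haR : (0:ℝ) < a := by exact_mod_cast ha
  have e1 : (Q * Z : ℝ) * (2 * (ε ^ 2 / (128 * Q * a ^ 2) * M)) ≤ ε ^ 2 / 2 * ((uT * Z) * (Ω * Δ * Z)) := by
    calc (Q * Z : ℝ) * (2 * (ε ^ 2 / (128 * Q * a ^ 2) * M)) ≤ (Q * Z : ℝ) * (2 * (ε ^ 2 / (128 * Q * a ^ 2) * (32 * (a ^ 2 * (Ω * Δ * Z))))) := by gcongr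
      _ = ε ^ 2 / 2 * ((1 * Z) * (Ω * Δ * Z)) := by field_simp; ring
      _ ≤ _ := by gcongr
  set P : ℝ := (uT * Z) * (Ω * Δ * Z) with hP
  have hP0 : 0 ≤ P := by positivity
  have hTR : (0:ℝ) < T := by exact_mod_cast hT0
  have e2 : 4 * T ≤ ε ^ 2 / 2 * (T:ℝ) ^ 2 := by nlinarith
  have e3 : (((uT * Z : ℕ) : ℤ) : ℝ) * (((Ω * Δ * Z : ℕ) : ℤ) : ℝ) = P := by rw [hP]; push_cast; ring
  rw [e3]
  calc P * (4 * T * P + T ^ 2 * ((Q * Z : ℝ) * (2 * (ε ^ 2 / (128 * Q * a ^ 2) * M)))) ≤ P * ((ε ^ 2 / 2 * (T:ℝ) ^ 2) * P + T ^ 2 * (ε ^ 2 / 2 * P)) := by gcongr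
    _ = _ := by ring

def Tok (ε : ℝ) (S Δ T : ℕ) : Prop := ∃ (t1 : ℕ) (ρ ε1 : ℝ), 0 < t1 ∧ 0 < ε1 ∧ 4 * t1 ≤ ε1 * T ∧ 0 < ρ ∧ 22 * (T:ℝ) ^ 3 ≤ ρ ^ 4 ∧
  24 * (2 * Δ) * ρ ≤ ε1 ^ 4 * t1 ∧ 160 * ε1 * S * Δ ≤ (ε / 2) ^ 2 ∧ 8 ≤ ε ^ 2 * T

theorem Tok_ex (ε : ℝ) (hε : 0 < ε) (S Δ : ℕ) (hS : 0 < S) (hΔ : 0 < Δ) : ∃ T0 : ℕ, ∀ T, T0 ≤ T → Tok ε S Δ T := by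
  obtain ⟨ε1, h1, h2⟩ : ∃ ε1 : ℝ, 0 < ε1 ∧ 160 * ε1 * S * Δ ≤ (ε / 2) ^ 2 := by
    refine ⟨ε ^ 2 / (640 * S * Δ), by positivity, le_of_eq ?_⟩
    field_simp; norm_num
  set θ := ε1 ^ 5 / (384 * Δ) with hθ
  have hθ0 : 0 < θ := by positivity
  refine ⟨⌈8 / ε1⌉₊ + ⌈22 / θ ^ 4⌉₊ + ⌈8 / ε ^ 2⌉₊ + 1, fun T hT => ?_⟩
  have hT' : ((⌈8 / ε1⌉₊ + ⌈22 / θ ^ 4⌉₊ + ⌈8 / ε ^ 2⌉₊ + 1 : ℕ) : ℝ) ≤ T := Nat.cast_le.2 hT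
  push_cast at hT'
  have e1 := Nat.le_ceil (8 / ε1)
  have e2 := Nat.le_ceil (22 / θ ^ 4)
  have e3 := Nat.le_ceil (8 / ε ^ 2)
  have p1 : 0 < 8 / ε1 := by positivity
  have p2 : 0 < 22 / θ ^ 4 := by positivity
  have p3 : 0 < 8 / ε ^ 2 := by positivity
  have hT0 : (0:ℝ) < T := by linarith
  have f1 : 8 ≤ T * ε1 := by rw [← div_le_iff₀ h1]; linarith
  have f2 : 22 ≤ T * θ ^ 4 := by rw [← div_le_iff₀ (by positivity)]; linarith
  have f3 : 8 ≤ T * ε ^ 2 := by rw [← div_le_iff₀ (by positivity)]; linarith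
  have g1 : (⌊ε1 * T / 4⌋₊ : ℝ) ≤ ε1 * T / 4 := Nat.floor_le (by positivity)
  have g2 : ε1 * T / 4 < ⌊ε1 * T / 4⌋₊ + 1 := Nat.lt_floor_add_one _
  have g3 : ε1 * T / 8 ≤ (⌊ε1 * T / 4⌋₊ : ℝ) := by linarith
  refine ⟨⌊ε1 * T / 4⌋₊, θ * T, ε1, ?_, h1, by linarith, by positivity, ?_, ?_, h2, by linarith⟩
  · exact Nat.floor_pos.2 (by linarith)
  · have : (θ * T) ^ 4 = T * θ ^ 4 * T ^ 3 := by ring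
    rw [this]; gcongr
  · have : 24 * (2 * Δ) * (θ * T) = ε1 ^ 4 * (ε1 * T / 8) := by rw [hθ]; field_simp; norm_num
    rw [this]; gcongr

theorem FU.mono {g : ℕ → ℂ} {c c' : ℝ} {N : ℕ} (h : FU g c N) (hc : c ≤ c') : FU g c' N :=
  fun z hz A B hB => (h z hz A B hB).trans (by gcongr)

theorem chain_id {p f a h h' g b k k' : ℂ} (d : ℂ) (hfp : p = f) :
    d * (p * g - k' * h') = d * (f * (g - b)) + d * f * (b - h) + d * f * (h - h') + (d * h') * (p - a) + d * h' * (a - k) + d * h' * (k - k') := by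
  subst hfp; ring

theorem core (h : CF) (ε σ : ℝ) (hε : 0 < ε) (hσ : 0 < σ) (Wc S : ℕ) (hWc : Wc ∣ Ds) (hsS : s ≤ S)
    (hTok : Tok ε S Δ T) (hΔσ : 1 ≤ ε * σ * Δ) (hCa : (b + s * W * (uT + Ω * T) : ℝ) ≤ ε * σ * a) :
    ∃ (c : ℝ) (Z0 : ℕ), 0 < c ∧ ∀ Z : ℕ, Z0 ≤ Z → ∀ (M1 M2 : ℕ) [NeZero M1] [NeZero M2],
      16 * (a ^ 2 * (Ω * Δ * Z)) ≤ M1 → M1 ≤ 32 * (a ^ 2 * (Ω * Δ * Z)) →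
      16 * (uT * (Ω * Δ * Z)) ≤ M2 → M2 ≤ 32 * (uT * (Ω * Δ * Z)) →
      ∀ (φ1 a1 h1 : ZMod M1 → ℂ) (φ2 a2 h2 : ZMod M2 → ℂ), (∀ x, ‖φ1 x‖ ≤ 1) → (∀ x, ‖a1 x‖ ≤ 1) → (∀ x, ‖φ2 x‖ ≤ 1) →
      (∀ x, ‖a2 x‖ ≤ 1) → (∀ x, ‖h2 x‖ ≤ 1) → FU (fun n : ℕ => φ1 n - a1 n) c M1 → FU (fun n : ℕ => φ2 n - a2 n) c M2 →
      (∀ x y : ℤ, (Wc:ℤ) ∣ y - x → ‖h1 y - h1 x‖ ≤ 4 * |(y:ℝ) - x| / (σ * M1)) →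
      (∀ x y : ℤ, (Wc:ℤ) ∣ y - x → ‖h2 y - h2 x‖ ≤ 4 * |(y:ℝ) - x| / (σ * M2)) →
      ∀ d : ℤ × ℤ → ℂ, (∀ p, ‖d p‖ ≤ 1) →
      ∑ t ∈ Ico (0:ℤ) T, ‖∑ z ∈ bX Z, d z * (φ1 (mT t z.1 z.2 : ℤ) * φ2 (nT t z.1 z.2 : ℤ) -
          h1 ((a ^ 2 - e * b ^ 2) * z.2 : ℤ) * h2 (uT * z.2 : ℤ))‖
        ≤ T * (((uT * Z) * (Ω * Δ * Z)) * (4 * ε + 8 * √((1 / M1) * ∑ x, ‖a1 x - h1 x‖ ^ 2) + 8 * √((1 / M2) * ∑ x, ‖a2 x - h2 x‖ ^ 2))) := by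
  obtain ⟨t1, ρ, ε1, q1, q2, q3, q4, q5, q6, q7, q8⟩ := hTok
  have q7' : 160 * ε1 * s * Δ ≤ (ε / 2) ^ 2 := by
    refine le_trans ?_ q7
    have : (s:ℝ) ≤ S := by exact_mod_cast hsS
    gcongr
  obtain ⟨c1, Z1, hc1, H1⟩ := Tslot h t1 ρ ε1 (ε / 2) q1 q2 q3 q4 q5 q6 (by positivity) q7'
  obtain ⟨c2, Z2, hc2, H2⟩ := h.mslot ε hε q8
  refine ⟨min c1 c2, Z1 + Z2 + 2 * a ^ 2 + 1, lt_min hc1 hc2, fun Z hZ M1 M2 _ _ r1 r2 r3 r4 φ1 a1 h1 φ2 a2 h2 hφ1 ha1 hφ2 ha2 hh2 F1 F2 L1 L2 d hd => ?_⟩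
  have hZ0 : 0 < Z := by omega
  have hΩ := h.hΩ
  have hΔ := h.hΔ
  have ha := h.a_pos
  have hu : 0 < uT := by unfold u0; positivity
  have hM1 : (0:ℝ) < M1 := by exact_mod_cast Nat.pos_of_ne_zero (NeZero.ne M1)
  have hM2 : (0:ℝ) < M2 := by exact_mod_cast Nat.pos_of_ne_zero (NeZero.ne M2)
  set P : ℝ := (uT * Z) * (Ω * Δ * Z) with hP
  set D1 := √((1 / M1) * ∑ x, ‖a1 x - h1 x‖ ^ 2)
  set D2 := √((1 / M2) * ∑ x, ‖a2 x - h2 x‖ ^ 2)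
  have S1 := H1 Z (by omega) M2 r3 r4 (fun x => φ1 (x : ℤ)) (fun x => hφ1 _) (fun n => φ2 n - a2 n)
    (fun x => (norm_sub_le _ _).trans (by linarith [hφ2 x, ha2 x])) (F2.mono (min_le_left _ _)) d hd
  have S4 := H2 Z (by omega) M1 r1 r2 (fun x => φ1 (x:ℤ) - a1 (x:ℤ))
    (fun x => (norm_sub_le _ _).trans (by linarith [hφ1 x, ha1 x]))
    (by simpa using F1.mono (min_le_right c1 c2)) (fun z => d z * h2 (uT * z.2 : ℤ))
    (fun z => by rw [norm_mul]; exact mul_le_one₀ (hd _) (norm_nonneg _) (hh2 _))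
  have hcardP : ∀ κ : ℝ, ∑ z ∈ bX Z, κ = P * κ := fun κ => by rw [sum_const, nsmul_eq_mul, BX_card]
  have hWΩ : (Wc:ℤ) ∣ Ω := by
    rw [← h.hsD]; push_cast; exact (Int.natCast_dvd_natCast.2 hWc).mul_left _
  have hWW : (Wc:ℤ) ∣ W := hWΩ.trans ((Int.natCast_dvd_natCast.2 h.hΩb).trans (Int.natCast_dvd_natCast.2 h.hbW))
  have S3 : ∀ t ∈ Ico (0:ℤ) T, ∀ z ∈ bX Z, ‖h2 (nT t z.1 z.2 : ℤ) - h2 (uT * z.2 : ℤ)‖ ≤ ε := by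
    rintro t ht ⟨x, y⟩ hz
    obtain ⟨k1, k2, k3, k4, k5, k6, k7⟩ := h.DX hz
    obtain ⟨q1, q2, q3, q4⟩ := h.qb ht
    have ht' := mem_Ico.1 ht
    have hid : nT t x y - uT * y = Ω * t * y + Ds * x := by unfold nn qq; ring
    have hdvd : (Wc:ℤ) ∣ nT t x y - uT * y := by
      rw [hid]; exact dvd_add ((hWΩ.mul_right _).mul_right _) ((Int.natCast_dvd_natCast.2 hWc).mul_right _)
    refine (L2 _ _ hdvd).trans ?_
    have b0 : 0 ≤ nT t x y - uT * y := by rw [hid]; have := ht'.1; positivity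
    have b1 : Δ * (nT t x y - uT * y) ≤ 2 * (uT * y) := by
      rw [hid]
      have e1 : (Δ:ℤ) * (Ω * t) ≤ uT := by
        have : (Δ * Ω : ℤ) * t ≤ Δ * Ω * T := mul_le_mul_of_nonneg_left ht'.2.le (by positivity)
        have q4' : (Ω * T * Δ : ℤ) ≤ uT := by exact_mod_cast q4
        linarith
      have e2 : (Δ:ℤ) * (Ω * t) * y ≤ uT * y := mul_le_mul_of_nonneg_right e1 k3
      have e3 : (1:ℤ) ≤ s := by exact_mod_cast h.hs
      have e4 : Δ * ((Ds:ℤ) * x) ≤ s * (Δ * (Ds * x)) := le_mul_of_one_le_left (by positivity) e3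
      have e5 : (s:ℤ) * Ds = Ω := by exact_mod_cast h.hsD
      have e6 : (s:ℤ) * (Δ * (Ds * x)) = Ω * Δ * x := by rw [← e5]; ring
      linarith
    have b2 : (uT : ℤ) * y ≤ uT * (2 * (Ω * Δ * Z : ℕ)) := mul_le_mul_of_nonneg_left k4 (by positivity)
    have b3 : (16 * (uT * (Ω * Δ * Z)) : ℤ) ≤ M2 := by exact_mod_cast r3
    have b4 : 4 * (Δ * (nT t x y - uT * y)) ≤ (M2:ℤ) := by push_cast at b2; linarith
    have b5 : 4 * (Δ * ((nT t x y : ℝ) - (uT * y : ℤ))) ≤ (M2:ℝ) := by exact_mod_cast b4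
    have b6 : (0:ℝ) ≤ (nT t x y : ℝ) - (uT * y : ℤ) := by exact_mod_cast b0
    rw [abs_of_nonneg b6, div_le_iff₀ (by positivity)]
    calc 4 * ((nT t x y : ℝ) - (uT * y : ℤ)) = 1 * (4 * ((nT t x y : ℝ) - (uT * y : ℤ))) := (one_mul _).symm
      _ ≤ (ε * σ * Δ) * (4 * ((nT t x y : ℝ) - (uT * y : ℤ))) := by gcongr
      _ = ε * σ * (4 * (Δ * ((nT t x y : ℝ) - (uT * y : ℤ)))) := by ring
      _ ≤ ε * σ * M2 := by gcongr
      _ = _ := by ring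
  have S6 : ∀ t ∈ Ico (0:ℤ) T, ∀ z ∈ bX Z, ‖h1 (mT t z.1 z.2 : ℤ) - h1 ((a ^ 2 - e * b ^ 2) * z.2 : ℤ)‖ ≤ ε := by
    rintro t ht ⟨x, y⟩ hz
    obtain ⟨k1, k2, k3, k4, k5, k6, k7⟩ := h.DX hz
    obtain ⟨q1, q2, q3, q4, q5⟩ := h.alb ht
    set C : ℤ := b + s * W * (uT + Ω * T) with hC
    have hid : mT t x y - (a ^ 2 - e * b ^ 2) * y = a * (s * W * qT t) * y - aT t * (W * Ω) * x := by
      unfold mm pp al; ring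
    have hdvd : (Wc:ℤ) ∣ mT t x y - (a ^ 2 - e * b ^ 2) * y := by
      rw [hid]
      exact dvd_sub ((((hWW.mul_left _).mul_right _).mul_left _).mul_right _) (((hWW.mul_right _).mul_left _).mul_right _)
    refine (L1 _ _ hdvd).trans ?_
    have hC0 : (0:ℤ) ≤ b := by positivity
    have b1 : a * (s * W * qT t) * y ≤ a * C * y := by
      refine mul_le_mul_of_nonneg_right (mul_le_mul_of_nonneg_left (by linarith) (by positivity)) k3
    have b1' : 0 ≤ a * (s * W * qT t) * y := by positivity
    have b2 : aT t * (W * Ω) * x ≤ 2 * (a * C * y) := by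
      have e1 : (W:ℤ) * (Ω * x) ≤ W * (uT * y) := mul_le_mul_of_nonneg_left k7 (by positivity)
      have e2 : (W:ℤ) * uT ≤ C := by
        have : (W * uT : ℤ) ≤ s * (W * uT) := le_mul_of_one_le_left (by positivity) (by exact_mod_cast h.hs)
        have : (0:ℤ) ≤ s * W * (Ω * T) := by positivity
        linarith
      have e3 : (W:ℤ) * uT * y ≤ C * y := mul_le_mul_of_nonneg_right e2 k3
      have e4 : aT t * (W * (Ω * x)) ≤ (2 * a) * (C * y) :=
        mul_le_mul (by linarith) (by linarith) (by positivity) (by positivity)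
      linarith
    have b2' : 0 ≤ aT t * (W * Ω) * x := mul_nonneg (mul_nonneg (by linarith) (by positivity)) k5
    have b3 : |mT t x y - (a ^ 2 - e * b ^ 2) * y| ≤ 2 * (a * C * y) := by
      rw [hid, abs_le]; constructor <;> linarith
    have b4 : (a * C : ℤ) * y ≤ a * C * (2 * (Ω * Δ * Z : ℕ)) := mul_le_mul_of_nonneg_left k4 (mul_nonneg (by positivity) (by linarith))
    have b5 : |mT t x y - (a ^ 2 - e * b ^ 2) * y| ≤ 4 * (a * C * (Ω * Δ * Z : ℕ)) := by linarith
    have b6 : |(mT t x y : ℝ) - ((a ^ 2 - e * b ^ 2) * y : ℤ)| ≤ 4 * (a * (b + s * W * (uT + Ω * T)) * (Ω * Δ * Z)) := by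
      rw [hC] at b5; exact_mod_cast b5
    have b7 : (16 * (a ^ 2 * (Ω * Δ * Z)) : ℝ) ≤ M1 := by exact_mod_cast r1
    rw [div_le_iff₀ (by positivity)]
    calc 4 * |(mT t x y : ℝ) - ((a ^ 2 - e * b ^ 2) * y : ℤ)| ≤ 4 * (4 * (a * (b + s * W * (uT + Ω * T)) * (Ω * Δ * Z))) := by gcongr
      _ ≤ 4 * (4 * (a * (ε * σ * a) * (Ω * Δ * Z))) := by gcongr
      _ = ε * σ * (16 * (a ^ 2 * (Ω * Δ * Z))) := by ring
      _ ≤ ε * σ * M1 := by gcongr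
      _ = _ := by ring
  have hmain : ∀ t ∈ Ico (0:ℤ) T, ‖∑ z ∈ bX Z, d z * (φ1 (mT t z.1 z.2 : ℤ) * φ2 (nT t z.1 z.2 : ℤ) -
          h1 ((a ^ 2 - e * b ^ 2) * z.2 : ℤ) * h2 (uT * z.2 : ℤ))‖
      ≤ ‖∑ z ∈ bX Z, d z * (φ1 (mT t z.1 z.2 : ℤ) * (φ2 ((nT t z.1 z.2).toNat : ℕ) - a2 ((nT t z.1 z.2).toNat : ℕ)))‖
        + ‖∑ z ∈ bX Z, d z * h2 (uT * z.2 : ℤ) * (φ1 (mT t z.1 z.2 : ℤ) - a1 (mT t z.1 z.2 : ℤ))‖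
        + P * (2 * ε + 8 * D1 + 8 * D2) := by
    intro t ht
    have hb1 : ∀ z, ‖d z * φ1 (mT t z.1 z.2 : ℤ)‖ ≤ 1 := fun z => by rw [norm_mul]; exact mul_le_one₀ (hd _) (norm_nonneg _) (hφ1 _)
    have hb2 : ∀ z, ‖d z * h2 (uT * z.2 : ℤ)‖ ≤ 1 := fun z => by rw [norm_mul]; exact mul_le_one₀ (hd _) (norm_nonneg _) (hh2 _)
    have hS1 : ∑ z ∈ bX Z, d z * (φ1 (mT t z.1 z.2 : ℤ) * (φ2 ((nT t z.1 z.2).toNat : ℕ) - a2 ((nT t z.1 z.2).toNat : ℕ)))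
        = ∑ z ∈ bX Z, d z * (φ1 (mT t z.1 z.2 : ℤ) * (φ2 (nT t z.1 z.2 : ℤ) - a2 (nT t z.1 z.2 : ℤ))) := by
      refine sum_congr rfl fun z hz => ?_
      have : ((nT t z.1 z.2 : ℤ) : ZMod M2) = (((nT t z.1 z.2).toNat : ℕ) : ZMod M2) := by
        conv_lhs => rw [← Int.toNat_of_nonneg (h.nb hZ0 ht (x := z.1) (y := z.2) hz).1.le]
        exact Int.cast_natCast _
      rw [this]
    rw [hS1]
    rw [sum_congr rfl fun z hz => chain_id (d z) (f := φ1 (mT t z.1 z.2 : ℤ)) (a := a1 (mT t z.1 z.2 : ℤ)) (b := a2 (nT t z.1 z.2 : ℤ))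
      (h := h2 (nT t z.1 z.2 : ℤ)) (k := h1 (mT t z.1 z.2 : ℤ)) rfl]
    simp only [sum_add_distrib]
    have w2 := h.l2n hZ0 ht M2 r3 r4 (fun x => a2 x - h2 x)
    have w5 := h.l2m (by omega) ht M1 r1 r2 (fun x => a1 x - h1 x)
    have bnd : ∀ (u v : ℤ × ℤ → ℂ), (∀ z, ‖u z‖ ≤ 1) → ‖∑ z ∈ bX Z, u z * v z‖ ≤ ∑ z ∈ bX Z, ‖v z‖ := fun u v huv =>
      (norm_sum_le _ _).trans (sum_le_sum fun z _ => by rw [norm_mul]; exact mul_le_of_le_one_left (norm_nonneg _) (huv z))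
    have v2 := (bnd _ (fun z => a2 (nT t z.1 z.2 : ℤ) - h2 (nT t z.1 z.2 : ℤ)) hb1).trans w2
    have v3 := (bnd _ (fun z => h2 (nT t z.1 z.2 : ℤ) - h2 (uT * z.2 : ℤ)) hb1).trans ((sum_le_sum (S3 t ht)).trans_eq (hcardP ε))
    have v5 := (bnd _ (fun z => a1 (mT t z.1 z.2 : ℤ) - h1 (mT t z.1 z.2 : ℤ)) hb2).trans w5
    have v6 := (bnd _ (fun z => h1 (mT t z.1 z.2 : ℤ) - h1 ((a ^ 2 - e * b ^ 2) * z.2 : ℤ)) hb2).trans ((sum_le_sum (S6 t ht)).trans_eq (hcardP ε))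
    refine (norm_add_le _ _).trans ?_
    refine (add_le_add_left ((norm_add_le _ _).trans (add_le_add_left ((norm_add_le _ _).trans (add_le_add_left ((norm_add_le _ _).trans (add_le_add_left (norm_add_le _ _) _)) _)) _)) _).trans ?_
    linarith
  refine (sum_le_sum hmain).trans ?_
  rw [sum_add_distrib, sum_add_distrib, sum_const, Int.card_Ico, nsmul_eq_mul]
  simp only [sub_zero, Int.toNat_natCast]
  linarith

noncomputable def ph (f : ℕ →*₀ ℂ) (M : ℕ) (x : ZMod M) : ℂ := f x.val
noncomputable def LL (σ : ℝ) (M W : ℕ) : ℕ := ⌊σ * M / W⌋₊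
noncomputable def aa (f : ℕ →*₀ ℂ) (M W : ℕ) (σ : ℝ) : ZMod M → ℂ := av (W : ZMod M) (LL σ M W) (ph f M)
noncomputable def hh (f : ℕ →*₀ ℂ) (M W : ℕ) (σ : ℝ) : ZMod M → ℂ := Hm (W : ZMod M) (LL σ M W) (ph f M)
noncomputable def DD (f : ℕ →*₀ ℂ) (M : ℕ) [NeZero M] (Wf : ℕ) (σf : ℝ) (Wc : ℕ) (σc : ℝ) : ℝ :=
  (1 / M) * ∑ x, ‖aa f M Wf σf x - hh f M Wc σc x‖ ^ 2
noncomputable def cj (f : ℕ →*₀ ℂ) : ℕ →*₀ ℂ := (RingHom.toMonoidWithZeroHom (starRingEnd ℂ)).comp f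
theorem cj_apply (f : ℕ →*₀ ℂ) (n : ℕ) : cj f n = conj (f n) := rfl
theorem cj_CM {f : ℕ →*₀ ℂ} (h : CM f) : CM (cj f) := fun n hn => by rw [cj_apply, Complex.norm_conj, h n hn]

theorem ph_le {f : ℕ →*₀ ℂ} (h : CM f) (M : ℕ) (x : ZMod M) : ‖ph f M x‖ ≤ 1 := h.le _

theorem LL_ge {σ : ℝ} {M W : ℕ} (hW : 0 < W) (hM : 2 * W ≤ σ * M) : σ * M / (2 * W) ≤ LL σ M W ∧ 0 < LL σ M W := by
  have hWR : (0:ℝ) < W := by exact_mod_cast hW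
  have h1 : 2 ≤ σ * M / W := by rw [le_div_iff₀ hWR]; exact hM
  have h2 := Nat.lt_floor_add_one (σ * M / W)
  have h3 : σ * M / (2 * W) = (σ * M / W) / 2 := by field_simp
  have h4 : σ * M / (2 * W) ≤ LL σ M W := by rw [h3]; unfold LL; linarith
  exact ⟨h4, by have : (0:ℝ) < LL σ M W := by linarith
                exact_mod_cast this⟩

theorem LL_le {σ : ℝ} {M W : ℕ} (hσ : 0 ≤ σ) : (LL σ M W : ℝ) ≤ σ * M / W := Nat.floor_le (by positivity)

theorem hh_lip {f : ℕ →*₀ ℂ} (h : CM f) (M W : ℕ) [NeZero M] (σ : ℝ) (hσ : 0 < σ) (hW : 0 < W) (hM : 2 * W ≤ σ * M) (x y : ℤ) (hd : (W:ℤ) ∣ y - x) :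
    ‖hh f M W σ y - hh f M W σ x‖ ≤ 4 * |(y:ℝ) - x| / (σ * M) := by
  obtain ⟨k, hk⟩ := hd
  obtain ⟨h1, h2⟩ := LL_ge hW hM
  have hM0 : (0:ℝ) < M := by exact_mod_cast Nat.pos_of_ne_zero (NeZero.ne M)
  have hy : y = x + k * W := by linarith
  have h3 := Hm_lip_int (W : ZMod M) (LL σ M W) h2 (ph f M) (ph_le h M) (x : ZMod M) (y : ZMod M) k (by rw [hy]; push_cast; simp)
  refine h3.trans ?_
  have hk' : (y:ℝ) - x = k * W := by rw [hy]; push_cast; ring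
  rw [hk', abs_mul, Nat.abs_cast]
  calc 2 * (|k| : ℝ) / LL σ M W ≤ 2 * |(k:ℝ)| / (σ * M / (2 * W)) := by gcongr
    _ = _ := by field_simp; ring

theorem FU_aa {f : ℕ →*₀ ℂ} (M W : ℕ) [NeZero M] (σ c : ℝ) (hσ : 0 < σ) (hσ2 : σ ≤ 1 / 2) (hW : 0 < W)
    (h : FU (fun n => f n - (1 / (⌊σ * M / W⌋₊ : ℂ)) * ∑ k ∈ range ⌊σ * M / W⌋₊, f (n + W * k)) c M) :
    FU (fun n : ℕ => ph f M n - aa f M W σ n) c M := by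
  intro z hz A B hB
  rw [← sum_congr rfl (s₁ := Ico A B) fun n hn => ?_]
  · exact h z hz A B hB
  have hn2 := (mem_Ico.1 hn).2
  have hWR : (0:ℝ) < W := by exact_mod_cast hW
  have e1 : ph f M (n : ZMod M) = f n := by unfold ph; rw [ZMod.val_natCast, Nat.mod_eq_of_lt (by omega)]
  have e2 : aa f M W σ n = (1 / (⌊σ * M / W⌋₊ : ℂ)) * ∑ k ∈ range ⌊σ * M / W⌋₊, f (n + W * k) := by
    unfold aa av LL
    congr 1
    refine sum_congr rfl fun k hk => ?_
    unfold ph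
    have h1 : (n : ZMod M) + k • (W : ZMod M) = ((n + W * k : ℕ) : ZMod M) := by push_cast; rw [nsmul_eq_mul]; ring
    have h2 : (k:ℝ) + 1 ≤ σ * M / W := by
      have h3 : (k + 1 : ℕ) ≤ ⌊σ * M / W⌋₊ := mem_range.1 hk
      have := (Nat.le_floor_iff (by positivity)).1 h3
      exact_mod_cast this
    have h4 : n + W * k < M := by
      have h5 : ((k:ℝ) + 1) * W ≤ σ * M := by rwa [le_div_iff₀ hWR] at h2
      have h6 : (2:ℝ) * n ≤ M := by exact_mod_cast (show 2 * n ≤ M by omega)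
      have h7 : σ * M ≤ 1 / 2 * M := by gcongr
      have : (n:ℝ) + W * k < M := by linarith
      exact_mod_cast this
    rw [h1, ZMod.val_natCast, Nat.mod_eq_of_lt h4]
  show _ = (ph f M n - aa f M W σ n) * z ^ n
  rw [e1, e2]

def IsAv (P : Set (ℕ × ℕ)) (ν : (ℕ →*₀ ℂ) → ℂ) : Prop :=
  ∃ (I : Finset (ℕ × ℕ)) (c : ℕ × ℕ → ℝ), (∀ p ∈ I, p ∈ P) ∧ ∑ p ∈ I, c p = 1 ∧ ∀ f, ν f = ∑ p ∈ I, (c p : ℂ) * (f p.1 * conj (f p.2))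

theorem IsAv.single {P : Set (ℕ × ℕ)} {p : ℕ × ℕ} (hp : p ∈ P) : IsAv P (fun f => f p.1 * conj (f p.2)) :=
  ⟨{p}, fun _ => 1, by simpa using hp, by simp, by simp⟩

theorem IsAv.sum {P : Set (ℕ × ℕ)} {ι : Type*} (s : Finset ι) (w : ι → ℝ) (hw : ∑ i ∈ s, w i = 1) (ν : ι → (ℕ →*₀ ℂ) → ℂ) (h : ∀ i ∈ s, IsAv P (ν i)) :
    IsAv P (fun f => ∑ i ∈ s, (w i : ℂ) * ν i f) := by
  classical
  choose! I c h1 h2 h3 using h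
  have hext : ∀ i ∈ s, ∀ (φ : ℕ × ℕ → ℂ), ∑ p ∈ s.biUnion I, ((if p ∈ I i then c i p else 0 : ℝ) : ℂ) * φ p = ∑ p ∈ I i, (c i p : ℂ) * φ p := by
    intro i hi φ
    rw [← sum_subset (subset_biUnion_of_mem I hi)]
    · exact sum_congr rfl fun p hp => by rw [if_pos hp]
    · intro p _ hp; rw [if_neg hp]; simp
  refine ⟨s.biUnion I, fun p => ∑ i ∈ s, w i * (if p ∈ I i then c i p else 0), ?_, ?_, fun f => ?_⟩
  · intro p hp
    obtain ⟨i, hi, hpi⟩ := mem_biUnion.1 hp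
    exact h1 i hi p hpi
  · rw [sum_comm, ← hw]
    refine sum_congr rfl fun i hi => ?_
    rw [← mul_sum]
    have := hext i hi (fun _ => 1)
    simp only [mul_one] at this
    have h4 : ∑ p ∈ s.biUnion I, (if p ∈ I i then c i p else 0 : ℝ) = ∑ p ∈ I i, c i p := by exact_mod_cast this
    rw [h4, h2 i hi, mul_one]
  · push_cast
    simp only [sum_mul]
    rw [sum_comm]
    refine sum_congr rfl fun i hi => ?_
    rw [h3 i hi f, ← hext i hi, mul_sum]
    refine sum_congr rfl fun p _ => ?_
    split_ifs <;> push_cast <;> ring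

theorem IsAv.avg {P : Set (ℕ × ℕ)} {ι : Type*} (s : Finset ι) (hs : s.Nonempty) (ν : ι → (ℕ →*₀ ℂ) → ℂ) (h : ∀ i ∈ s, IsAv P (ν i)) :
    IsAv P (fun f => (1 / (#s : ℂ)) * ∑ i ∈ s, ν i f) := by
  have := IsAv.sum s (fun _ => 1 / (#s : ℝ)) (by rw [sum_const, nsmul_eq_mul]; field_simp) ν h
  simpa [mul_sum] using this

theorem unif_c {ι : Type*} (I : Finset ι) (Q : ι → ℝ → ℕ → Prop) (mono : ∀ i c c' Z Z', 0 < c' → c' ≤ c → Z ≤ Z' → Q i c Z → Q i c' Z')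
    (h : ∀ i ∈ I, ∃ c Z, 0 < c ∧ Q i c Z) : ∃ c Z, 0 < c ∧ ∀ i ∈ I, Q i c Z := by
  classical
  induction I using Finset.induction_on with
  | empty => exact ⟨1, 0, one_pos, by simp⟩
  | insert i I hi ih =>
    obtain ⟨c, Z, hc, h1⟩ := ih fun j hj => h j (mem_insert_of_mem hj)
    obtain ⟨c', Z', hc', h2⟩ := h i (mem_insert_self _ _)
    refine ⟨min c c', max Z Z', lt_min hc hc', fun j hj => ?_⟩
    rcases mem_insert.1 hj with rfl | hj
    · exact mono _ _ _ _ _ (lt_min hc hc') (min_le_right _ _) (le_max_right _ _) h2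
    · exact mono _ _ _ _ _ (lt_min hc hc') (min_le_left _ _) (le_max_left _ _) (h1 j hj)

noncomputable def xi (f : ℕ →*₀ ℂ) (e : ℤ) (a b W Ω Δ T Z M1 M2 Wc : ℕ) [NeZero M1] [NeZero M2] (σc : ℝ) : ℂ :=
  (1 / (((u0 Ω Δ T * Z) * (Ω * Δ * Z) : ℝ) : ℂ)) * ∑ z ∈ BX Ω Δ T Z, f ((a * z.2 - W * Ω * z.1) ^ 2 - e * (b * z.2) ^ 2 : ℤ).natAbs *
    (hh (cj f) M1 Wc σc ((a ^ 2 - e * b ^ 2) * z.2 : ℤ) * hh (cj f) M2 Wc σc (u0 Ω Δ T * z.2 : ℤ))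

theorem xi_le {f : ℕ →*₀ ℂ} (hf : CM f) (e : ℤ) (a b W Ω Δ T Z M1 M2 Wc : ℕ) [NeZero M1] [NeZero M2] (σc : ℝ) : ‖xi f e a b W Ω Δ T Z M1 M2 Wc σc‖ ≤ 1 := by
  unfold xi
  rw [norm_mul]
  have hP : (0:ℝ) ≤ (u0 Ω Δ T * Z) * (Ω * Δ * Z) := by positivity
  have h1 : ∀ z ∈ BX Ω Δ T Z, ‖f ((a * z.2 - W * Ω * z.1) ^ 2 - e * (b * z.2) ^ 2 : ℤ).natAbs *
    (hh (cj f) M1 Wc σc ((a ^ 2 - e * b ^ 2) * z.2 : ℤ) * hh (cj f) M2 Wc σc (u0 Ω Δ T * z.2 : ℤ))‖ ≤ 1 := fun z _ => by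
    rw [norm_mul, norm_mul]
    exact mul_le_one₀ (hf.le _) (by positivity) (mul_le_one₀ (Hm_le _ _ _ (ph_le (cj_CM hf) _) _) (norm_nonneg _) (Hm_le _ _ _ (ph_le (cj_CM hf) _) _))
  have h2 := norm_sum_le_card _ _ h1
  rw [BX_card] at h2
  rw [norm_div, norm_one, Complex.norm_real, Real.norm_of_nonneg hP, one_div]
  exact inv_mul_le_one_of_le₀ h2 hP

theorem ph_int (f : ℕ →*₀ ℂ) (M : ℕ) {x : ℤ} (h0 : 0 ≤ x) (h1 : x < M) : ph f M (x : ZMod M) = f x.natAbs := by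
  obtain ⟨n, rfl⟩ := Int.eq_ofNat_of_zero_le h0
  unfold ph
  rw [Int.cast_natCast, ZMod.val_natCast, Nat.mod_eq_of_lt (by omega)]; rfl

theorem mn_id (e a b s Ds W Ω Q A x y : ℤ) (hA : A = a + s * W * Q) (hs : s * Ds = Ω) :
    ((a * A - e * b ^ 2) * y - A * (W * Ω) * x) ^ 2 - e * (b * s * W * (Q * y + Ds * x)) ^ 2 =
      (A ^ 2 - e * b ^ 2) * ((a * y - W * Ω * x) ^ 2 - e * (b * y) ^ 2) := by
  subst hA hs; ring

theorem gap_ar (a b l p al W Ω x y u w nn m n : ℤ) (hy : 0 ≤ y) (ha : 0 < a) (hb : 0 < b) (hw : 0 ≤ w) (hl : 0 ≤ l) (h1 : 9 * a ^ 2 ≤ 10 * p)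
    (h2 : 50 * (al * (W * Ω) * x) ≤ a ^ 2 * y) (h3 : nn ≤ 3 * u * y) (h4 : 100 * b ≤ a) (h5 : l * (w * u) ≤ a)
    (hm : m = p * y - al * (W * Ω) * x) (hn : n = b * w * nn) : l * n ≤ m := by
  have e1 : n ≤ b * w * (3 * u * y) := by rw [hn]; gcongr
  have e4 : b * (l * (w * u)) * (3 * y) ≤ b * a * (3 * y) := by gcongr
  have e5 : 100 * b * (a * (3 * y)) ≤ a * (a * (3 * y)) := by gcongr
  nlinarith

def Sc (a Ω Δ T Z M1 M2 : ℕ) : Prop := 16 * (a ^ 2 * (Ω * Δ * Z)) ≤ M1 ∧ M1 ≤ 32 * (a ^ 2 * (Ω * Δ * Z)) ∧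
  16 * (u0 Ω Δ T * (Ω * Δ * Z)) ≤ M2 ∧ M2 ≤ 32 * (u0 Ω Δ T * (Ω * Δ * Z))
noncomputable def gg (f : ℕ →*₀ ℂ) (e : ℤ) (a b s W Ω Δ T : ℕ) : ℂ :=
  (1 / (T:ℂ)) * ∑ t ∈ range T, f ((al a s W Ω Δ T t) ^ 2 - e * b ^ 2).natAbs
noncomputable def CC (f : ℕ →*₀ ℂ) (l l' b W : ℕ) : ℂ := f l * conj (f l') * conj (f (b * W))

theorem Cfg.pair (h : CF) {l l' Z M1 M2 : ℕ} (hZ : 0 < Z) (hS : Sc a Ω Δ T Z M1 M2)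
    (hl : (l' + 1) * (s * W * uT) ≤ a) {t : ℤ} (ht : t ∈ Ico (0:ℤ) T) {z : ℤ × ℤ} (hz : z ∈ bX Z) :
    IsAv (Pset l l' e) (fun f => CC f l l' b W * conj (f s) * (f ((aT t) ^ 2 - e * b ^ 2).natAbs *
      (f ((a * z.2 - W * Ω * z.1) ^ 2 - e * (b * z.2) ^ 2 : ℤ).natAbs * (ph (cj f) M1 (mT t z.1 z.2 : ℤ) * ph (cj f) M2 (nT t z.1 z.2 : ℤ))))) := by
  obtain ⟨x, y⟩ := z
  obtain ⟨n1, n2⟩ := h.nb hZ ht hz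
  obtain ⟨m1, m2, m3⟩ := h.mb hZ ht hz
  obtain ⟨_, _, y0, _, x0, _, xy⟩ := h.DX hz
  obtain ⟨S1, _, S2, _⟩ := hS
  have id := mn_id e a b s Ds W Ω (qT t) (aT t) x y rfl (by exact_mod_cast h.hsD)
  have hnn : nT t x y ≤ 3 * uT * y := by
    have hq : qT t ≤ 2 * uT := by
      have h1 : Ω * T ≤ Ω * T * Δ := Nat.le_mul_of_pos_right _ h.hΔ
      have h2 : Ω * t ≤ Ω * T := by have := (mem_Ico.1 ht).2; gcongr
      unfold qq u0; push_cast
      linarith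
    have hD : (Ds:ℤ) * x ≤ Ω * x := by
      have : Ds ≤ Ω := by rw [← h.hsD]; exact Nat.le_mul_of_pos_left _ h.hs
      gcongr
    have : qT t * y ≤ 2 * uT * y := by gcongr
    unfold nn; linarith
  have hgap := gap_ar a b (l' + 1) _ (aT t) W Ω x y (uT) (s * W) _ _ _ y0 (by exact_mod_cast h.a_pos) (by exact_mod_cast h.hb) (by positivity)
    (by positivity) (h.pb ht).1 m3 hnn (by have := h.hbig; have : 100 * b ≤ a := by linarith [Nat.zero_le (s * W * (Ω * T * Δ + 1 + Ω * T))]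
                                           exact_mod_cast this) (by exact_mod_cast hl) rfl rfl
  set m := mT t x y with hm
  set n := nT t x y with hn
  have hp : (l * (((m.natAbs:ℕ):ℤ) ^ 2 - e * ((b * (s * W) * n.natAbs : ℕ):ℤ) ^ 2).natAbs, l' * (m.natAbs * (b * (s * W) * n.natAbs))) ∈ Pset l l' e := by
    refine ⟨m.natAbs, b * (s * W) * n.natAbs, ?_, ?_, rfl, rfl⟩
    · have := h.hb; have := h.hs; have := h.hW; have : 0 < n.natAbs := by omega
      positivity
    · zify; rw [abs_of_pos n1, abs_of_pos m1]; exact hgap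
  have hs1 := IsAv.single hp
  convert hs1 using 2 with f
  simp only
  rw [ph_int _ _ m1.le (by linarith), ph_int _ _ n1.le (by linarith), cj_apply, cj_apply]
  have e1 : ((m.natAbs:ℕ):ℤ) ^ 2 - e * ((b * (s * W) * n.natAbs : ℕ):ℤ) ^ 2 =
      ((aT t) ^ 2 - e * b ^ 2) * ((a * y - W * Ω * x) ^ 2 - e * (b * y) ^ 2) := by
    rw [← id]; push_cast; rw [abs_of_pos n1, abs_of_pos m1, hm, hn]; unfold mm nn pp; ring
  rw [e1, Int.natAbs_mul]
  simp only [map_mul, CC]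
  ring

theorem avg_key {ι κ : Type*} (I : Finset ι) (J : Finset κ) (T P : ℝ) (hT : 0 < T) (hP : 0 < P) (K : ℂ) (u : ι → ℂ) (d q : κ → ℂ) (τ : ι → κ → ℂ) (B : ℝ)
    (hK : ‖K‖ ≤ 1) (hu : ∀ t, ‖u t‖ ≤ 1) (H : ∑ t ∈ I, ‖∑ z ∈ J, d z * (τ t z - q z)‖ ≤ T * (P * B)) :
    ‖∑ t ∈ I, ∑ z ∈ J, (((1 / (T * P) : ℝ)):ℂ) * (K * (u t * (d z * τ t z))) - K * (1 / (T:ℂ) * ∑ t ∈ I, u t) * (1 / (P:ℂ) * ∑ z ∈ J, d z * q z)‖ ≤ B := by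
  have key : ∑ t ∈ I, ∑ z ∈ J, (((1 / (T * P) : ℝ)):ℂ) * (K * (u t * (d z * τ t z))) - K * (1 / (T:ℂ) * ∑ t ∈ I, u t) * (1 / (P:ℂ) * ∑ z ∈ J, d z * q z) =
      (((1 / (T * P) : ℝ)):ℂ) * (K * ∑ t ∈ I, u t * ∑ z ∈ J, d z * (τ t z - q z)) := by
    have e1 : ∀ t, u t * ∑ z ∈ J, d z * (τ t z - q z) = (∑ z ∈ J, u t * (d z * τ t z)) - u t * ∑ z ∈ J, d z * q z := fun t => by
      rw [← mul_sum, ← mul_sub, ← sum_sub_distrib]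
      simp only [mul_sub]
    simp only [e1, sum_sub_distrib, ← mul_sum, ← sum_mul]
    push_cast
    ring
  rw [key, norm_mul, norm_mul, Complex.norm_real, Real.norm_of_nonneg (by positivity)]
  calc _ ≤ 1 / (T * P) * (1 * (T * (P * B))) := by
        gcongr
        refine (norm_sum_le _ _).trans (le_trans (sum_le_sum fun t _ => ?_) H)
        rw [norm_mul]
        exact mul_le_of_le_one_left (norm_nonneg _) (hu _)
    _ = B := by field_simp

def CoreP (e : ℤ) (l l' a b s W Ω Δ T Wc : ℕ) (ε σ c : ℝ) (Z0 : ℕ) : Prop :=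
      ∀ Z : ℕ, Z0 ≤ Z → ∀ (M1 M2 : ℕ) [NeZero M1] [NeZero M2], Sc a Ω Δ T Z M1 M2 → 2 * Wc ≤ σ * M1 → 2 * Wc ≤ σ * M2 →
      ∃ ν, IsAv (Pset l l' e) ν ∧ ∀ f, CM f → ∀ Wf σf, FU (fun n : ℕ => ph (cj f) M1 n - aa (cj f) M1 Wf σf n) c M1 →
        FU (fun n : ℕ => ph (cj f) M2 n - aa (cj f) M2 Wf σf n) c M2 →
        ‖ν f - CC f l l' b W * conj (f s) * gg f e a b s W Ω Δ T * xi f e a b W Ω Δ T Z M1 M2 Wc σ‖ ≤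
          4 * ε + 8 * √(DD (cj f) M1 Wf σf Wc σ) + 8 * √(DD (cj f) M2 Wf σf Wc σ)

theorem CoreP.mono {e : ℤ} {l l' a b s W Ω Δ T Wc : ℕ} {ε σ c c' : ℝ} {Z Z' : ℕ} (hc : c' ≤ c) (hZ : Z ≤ Z') (h : CoreP e l l' a b s W Ω Δ T Wc ε σ c Z) :
    CoreP e l l' a b s W Ω Δ T Wc ε σ c' Z' := fun Y hY M1 M2 _ _ hS k1 k2 => by
  obtain ⟨ν, h1, h2⟩ := h Y (hZ.trans hY) M1 M2 hS k1 k2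
  exact ⟨ν, h1, fun f hf Wf σf F1 F2 => h2 f hf Wf σf (F1.mono hc) (F2.mono hc)⟩

theorem coreF (h : CF) (l l' : ℕ) (ε σ : ℝ) (hε : 0 < ε) (hσ : 0 < σ) (Wc S : ℕ) (hWc0 : 0 < Wc) (hWc : Wc ∣ Ds) (hsS : s ≤ S)
    (hTok : Tok ε S Δ T) (hΔσ : 1 ≤ ε * σ * Δ) (hCa : (b + s * W * (uT + Ω * T) : ℝ) ≤ ε * σ * a) (hl : (l' + 1) * (s * W * uT) ≤ a) :
    ∃ (c : ℝ) (Z0 : ℕ), 0 < c ∧ CoreP e l l' a b s W Ω Δ T Wc ε σ c Z0 := by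
  obtain ⟨c, Z0, hc, H⟩ := core h ε σ hε hσ Wc S hWc hsS hTok hΔσ hCa
  refine ⟨c, Z0 + 1, hc, fun Z hZ M1 M2 _ _ hS k1 k2 => ?_⟩
  have hZ0 : 0 < Z := by omega
  have hT := h.hT
  have hΩ := h.hΩ
  have hΔ := h.hΔ
  have hu : 0 < uT := by unfold u0; positivity
  set P : ℝ := (uT * Z) * (Ω * Δ * Z) with hP
  have hP0 : 0 < P := by positivity
  have hTR : (0:ℝ) < T := by positivity
  have hav := IsAv.sum (Ico (0:ℤ) T ×ˢ bX Z) (fun _ => 1 / (T * P)) (by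
    rw [sum_const, card_product, nsmul_eq_mul, Nat.cast_mul, BX_card, ← hP, Int.card_Ico]; simp; field_simp) _
    (fun p hp => h.pair (l := l) hZ0 hS hl (mem_product.1 hp).1 (mem_product.1 hp).2)
  refine ⟨_, hav, fun f hf Wf σf F1 F2 => ?_⟩
  have hf' := cj_CM hf
  have hd : ∀ z : ℤ × ℤ, ‖f ((a * z.2 - W * Ω * z.1) ^ 2 - e * (b * z.2) ^ 2 : ℤ).natAbs‖ ≤ 1 := fun z => hf.le _
  have HH := H Z (by omega) M1 M2 hS.1 hS.2.1 hS.2.2.1 hS.2.2.2 (ph (cj f) M1) (aa (cj f) M1 Wf σf) (hh (cj f) M1 Wc σ) (ph (cj f) M2) (aa (cj f) M2 Wf σf) (hh (cj f) M2 Wc σ)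
    (ph_le hf' _) (av_le _ _ _ (ph_le hf' _)) (ph_le hf' _) (av_le _ _ _ (ph_le hf' _)) (Hm_le _ _ _ (ph_le hf' _)) F1 F2
    (hh_lip hf' M1 Wc σ hσ hWc0 k1) (hh_lip hf' M2 Wc σ hσ hWc0 k2) _ hd
  change _ ≤ T * (P * (4 * ε + 8 * √(DD (cj f) M1 Wf σf Wc σ) + 8 * √(DD (cj f) M2 Wf σf Wc σ))) at HH
  set B := 4 * ε + 8 * √(DD (cj f) M1 Wf σf Wc σ) + 8 * √(DD (cj f) M2 Wf σf Wc σ)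
  have hK : ‖CC f l l' b W * conj (f s)‖ ≤ 1 := by
    unfold CC
    simp only [norm_mul, Complex.norm_conj]
    have := hf.le;
    exact mul_le_one₀ (mul_le_one₀ (mul_le_one₀ (this _) (by positivity) (this _)) (by positivity) (this _)) (by positivity) (this _)
  unfold gg xi
  rw [← sum_Ico_int T (fun t => f ((aT t) ^ 2 - e * b ^ 2).natAbs), sum_product]
  set K := CC f l l' b W * conj (f s)
  exact avg_key (Ico (0:ℤ) T) (bX Z) T P hTR hP0 K (fun t => f ((aT t) ^ 2 - e * b ^ 2).natAbs)
    (fun z => f ((a * z.2 - W * Ω * z.1) ^ 2 - e * (b * z.2) ^ 2 : ℤ).natAbs) _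
    (fun t z => ph (cj f) M1 (mT t z.1 z.2 : ℤ) * ph (cj f) M2 (nT t z.1 z.2 : ℤ)) B hK (fun t => hf.le _) HH

end

theorem en_le {Q : ℕ} [NeZero Q] (b : ZMod Q) (L : ℕ) (φ : ZMod Q → ℂ) (hφ : ∀ x, ‖φ x‖ ≤ 1) : ∑ x, ‖av b L φ x‖ ^ 2 ≤ Q := by
  calc _ ≤ ∑ _x : ZMod Q, (1:ℝ) := sum_le_sum fun x _ => pow_le_one₀ (norm_nonneg _) (av_le _ _ _ hφ _)
    _ = Q := by simp [ZMod.card]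

theorem inner_ar (S Ω Δ Λ ε s u T : ℝ) (hS : 1 ≤ S) (hΩ : 1 ≤ Ω) (hΔ : 1 ≤ Δ) (hT : 1 ≤ T) (hΛ : 16 * (S * Ω * (Δ + 2)) ≤ ε ^ 2 * Λ) (hΛ0 : 0 < Λ)
    (hs : s ≤ S) (hu : u = Ω * T * Δ + 1) : 4 * (s * u + s * Ω * T) / (Λ * T) ≤ ε ^ 2 / 4 ∧ 4 * S / Λ ≤ ε ^ 2 / 4 := by
  constructor
  · rw [div_le_iff₀ (by positivity)]
    have h1 : s * u + s * Ω * T ≤ S * (Ω * (Δ + 2)) * T := by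
      have : s * (u + Ω * T) ≤ S * (u + Ω * T) := by rw [hu]; gcongr
      have h3 : 1 * 1 ≤ Ω * T := by gcongr
      have h4 : u + Ω * T ≤ Ω * (Δ + 2) * T := by rw [hu]; linarith
      have h5 : S * (u + Ω * T) ≤ S * (Ω * (Δ + 2) * T) := by gcongr
      linarith
    have := mul_le_mul_of_nonneg_right hΛ (by positivity : 0 ≤ T)
    linarith
  · rw [div_le_iff₀ hΛ0]
    have : S * 1 * (1 + 2) ≤ S * Ω * (Δ + 2) := by gcongr
    linarith

theorem inner (ε : ℝ) (hε : 0 < ε) (S Ω Δ Tb : ℕ) (hS : 0 < S) (hΩ : 0 < Ω) (hΔ : 0 < Δ) (hTb : 0 < Tb) : ∃ (J : ℕ) (T : ℕ → ℕ), 0 < J ∧ (∀ j, Tb ≤ T j ∧ T j ≤ T 0) ∧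
    ∀ (Q : ℕ) [NeZero Q] (φ : ZMod Q → ℂ), (∀ x, ‖φ x‖ ≤ 1) → ∃ G : ℕ → ZMod Q → ℂ, (∀ j x, ‖G j x‖ ≤ 1) ∧ ∀ s, 0 < s → s ∣ S →
      ∑ j ∈ range J, ∑ x, ‖av ((s * Ω * (S * Ω) ^ j : ℕ) : ZMod Q) (T j) φ (x + (s * u0 Ω Δ (T j) * (S * Ω) ^ j : ℕ)) - G j x‖ ^ 2 ≤ J * ε ^ 2 * Q := by
  obtain ⟨J, hJ⟩ := exists_nat_ge (2 / ε ^ 2)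
  obtain ⟨Λ, hΛ⟩ := exists_nat_ge (16 * (S * Ω * (Δ + 2)) / ε ^ 2)
  rw [div_le_iff₀ (by positivity)] at hJ hΛ
  have hJ0 : 0 < J := Nat.pos_of_ne_zero fun h => by subst h; norm_num at hJ
  have hΛ0 : 0 < Λ := Nat.pos_of_ne_zero fun h => by
    subst h; have : (0:ℝ) < 16 * (S * Ω * (Δ + 2)) := by positivity
    norm_num at hΛ; linarith
  refine ⟨J, fun j => Tb * Λ ^ (2 * (J - j)), hJ0, fun j => ⟨Nat.le_mul_of_pos_right _ (by positivity), Nat.mul_le_mul_left _ (Nat.pow_le_pow_right hΛ0 (by omega))⟩, fun Q _ φ hφ => ?_⟩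
  set T : ℕ → ℕ := fun j => Tb * Λ ^ (2 * (J - j)) with hT
  have hT0 : ∀ j, 0 < T j := fun j => by positivity
  set w : ℕ → ℕ := fun j => (S * Ω) ^ j with hw
  refine ⟨fun j => Hm (w j : ZMod Q) (Λ * T j) φ, fun j x => Hm_le _ _ _ hφ _, fun s hs hsS => ?_⟩
  set E : ℕ → ℝ := fun j => ∑ x, ‖av (w j : ZMod Q) (Λ * T j) φ x‖ ^ 2 with hE
  have step : ∀ j ∈ range J, ∑ x, ‖av ((s * Ω * w j : ℕ) : ZMod Q) (T j) φ (x + (s * u0 Ω Δ (T j) * w j : ℕ)) - Hm (w j : ZMod Q) (Λ * T j) φ x‖ ^ 2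
      ≤ E (j + 1) - E j + ε ^ 2 / 2 * Q := by
    intro j hj
    obtain ⟨d, hd⟩ := hsS
    have h1 := energy_i (w j : ZMod Q) ((s * Ω * w j : ℕ) : ZMod Q) ((s * u0 Ω Δ (T j) * w j : ℕ) : ZMod Q) (Λ * T j) (T j) (by have := hT0 j; positivity) (hT0 j) φ hφ
      (s * u0 Ω Δ (T j)) (s * Ω) (by simp [nsmul_eq_mul]) (by simp [nsmul_eq_mul])
    have h2 := energy_ii ((s * Ω * w j : ℕ) : ZMod Q) (Λ * T (j + 1)) (T j) d (hT0 j) (by have := hT0 (j + 1); positivity) φ hφ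
    have e1 : d • ((s * Ω * w j : ℕ) : ZMod Q) = (w (j + 1) : ZMod Q) := by
      rw [nsmul_eq_mul, ← Nat.cast_mul]; congr 1; simp only [hw]; rw [hd, pow_succ]; ring
    rw [e1] at h2
    have e2 : T j = Λ * (Λ * T (j + 1)) := by
      have : J - j = J - (j + 1) + 1 := by have := mem_range.1 hj; omega
      simp only [hT]; rw [this]; ring
    have hsS' : (s:ℝ) ≤ S := by exact_mod_cast Nat.le_of_dvd hS ⟨d, hd⟩
    have hdS : (d:ℝ) ≤ S := by exact_mod_cast Nat.le_of_dvd hS ⟨s, by rw [hd, mul_comm]⟩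
    obtain ⟨b1, b2⟩ := inner_ar S Ω Δ Λ ε s (u0 Ω Δ (T j)) (T j) (by exact_mod_cast hS) (by exact_mod_cast hΩ) (by exact_mod_cast hΔ) (by exact_mod_cast hT0 j)
      (by linarith) (by exact_mod_cast hΛ0) hsS' (by unfold u0; push_cast; ring)
    have hT1 : (0:ℝ) < T (j + 1) := by exact_mod_cast hT0 (j + 1)
    have b3 : 4 * ((d:ℝ) * ((Λ * T (j + 1) : ℕ):ℝ)) / (T j : ℝ) ≤ ε ^ 2 / 4 := by
      rw [e2]; push_cast
      calc _ = 4 * (d:ℝ) / Λ := by field_simp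
        _ ≤ 4 * S / Λ := by gcongr
        _ ≤ _ := b2
    rw [ZMod.card] at h1 h2
    push_cast at h1 h2 b3 b1 ⊢
    have c1 := mul_le_mul_of_nonneg_right b1 (by positivity : (0:ℝ) ≤ Q)
    have c3 := mul_le_mul_of_nonneg_right b3 (by positivity : (0:ℝ) ≤ Q)
    simp only [hE]
    push_cast
    linarith
  refine (sum_le_sum step).trans ?_
  rw [sum_add_distrib, sum_range_sub, sum_const, card_range, nsmul_eq_mul]
  have g1 : E J ≤ Q := en_le _ _ _ hφ
  have g2 : 0 ≤ E 0 := by positivity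
  have g3 : 2 * (Q:ℝ) ≤ J * ε ^ 2 * Q := by gcongr
  linarith

noncomputable def fi (f : ℕ →*₀ ℂ) (e : ℤ) (W0 Q : ℕ) (x : ZMod Q) : ℂ := f (((1 + W0 * x.val : ℕ) : ℤ) ^ 2 - e * W0 ^ 2).natAbs

theorem gg_av (f : ℕ →*₀ ℂ) (e : ℤ) (W0 Q s w r Ω Δ T : ℕ) (hr : r + s * w * (u0 Ω Δ T + Ω * T) < Q) :
    gg f e (1 + W0 * r) W0 s (W0 * w) Ω Δ T = av ((s * Ω * w : ℕ) : ZMod Q) T (fi f e W0 Q) (r + (s * u0 Ω Δ T * w : ℕ)) := by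
  unfold gg av
  congr 1
  refine sum_congr rfl fun t ht => ?_
  have ht' := (mem_range.1 ht).le
  have h1 : (r : ZMod Q) + (s * u0 Ω Δ T * w : ℕ) + t • ((s * Ω * w : ℕ) : ZMod Q) = ((r + s * w * (u0 Ω Δ T + Ω * t) : ℕ) : ZMod Q) := by
    rw [nsmul_eq_mul]; push_cast; ring
  have h2 : r + s * w * (u0 Ω Δ T + Ω * t) < Q := lt_of_le_of_lt (by gcongr) hr
  rw [h1]; unfold fi
  rw [ZMod.val_natCast, Nat.mod_eq_of_lt h2]
  congr 4
  unfold al qq; push_cast; ring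

theorem cfg_ex (e : ℤ) (he : e = 1 ∨ e = -1) (l' S Wc Δ J : ℕ) (hS : 0 < S) (hWc : 0 < Wc) (hΔ : 0 < Δ) (T : ℕ → ℕ) (hT : ∀ j, 0 < T j ∧ T j ≤ T 0) (κ : ℝ) (hκ : 0 < κ) :
    ∃ W0 R : ℕ, 0 < W0 ∧ 0 < R ∧ ∀ j < J, ∀ s, 0 < s → s ∣ S → s * (S * (S * Wc)) ^ j * (u0 (S * Wc) Δ (T j) + (S * Wc) * T j) ≤ 2 * R ∧ ∀ r, R ≤ r →
      ∃ Ds, Cfg e (1 + W0 * r) W0 s Ds (W0 * (S * (S * Wc)) ^ j) (S * Wc) Δ (T j) ∧ Wc ∣ Ds ∧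
      (W0 + s * (W0 * (S * (S * Wc)) ^ j : ℕ) * (u0 (S * Wc) Δ (T j) + (S * Wc : ℕ) * T j) : ℝ) ≤ κ * (1 + W0 * r : ℕ) ∧
      (l' + 1) * (s * (W0 * (S * (S * Wc)) ^ j) * u0 (S * Wc) Δ (T j)) ≤ 1 + W0 * r := by
  set Ω := S * Wc with hΩ
  have hΩ0 : 0 < Ω := by positivity
  set W0 := S * Ω * (T 0).factorial with hW0
  have hW : 0 < W0 := by have := (T 0).factorial_pos; positivity
  set V := ∑ j ∈ range J, S * (S * Ω) ^ j * (u0 Ω Δ (T j) + Ω * T j)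
  obtain ⟨R1, hR1⟩ := exists_nat_ge ((1 + V) / κ)
  rw [div_le_iff₀ hκ] at hR1
  refine ⟨W0, R1 + (100 * (1 + V) + (l' + 1) * V), hW, by positivity, fun j hj s hs hsS => ?_⟩
  set v := s * (S * Ω) ^ j * (u0 Ω Δ (T j) + Ω * T j) with hv
  have hvV : v ≤ V := by
    refine le_trans ?_ (single_le_sum (f := fun j => S * (S * Ω) ^ j * (u0 Ω Δ (T j) + Ω * T j)) (fun _ _ => Nat.zero_le _) (mem_range.2 hj))
    have := Nat.le_of_dvd hS hsS
    simp only [hv]; gcongr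
  refine ⟨by linarith [Nat.zero_le ((l' + 1) * V)], fun r hr => ?_⟩
  obtain ⟨d, hd⟩ := hsS
  have hr1 : 100 * (1 + v) ≤ r := by linarith [Nat.zero_le ((l' + 1) * V)]
  refine ⟨d * Wc, ⟨he, hW, hs, by positivity, hΩ0, hΔ, (hT j).1, by rw [hΩ, hd]; ring, ⟨r, by push_cast; ring⟩, ⟨_, rfl⟩, ⟨S * (T 0).factorial, by rw [hW0]; ring⟩, ⟨j + 4, ?_⟩, ?_⟩, ⟨d, by ring⟩, ?_, ?_⟩
  · have d1 : s ∣ W0 := ⟨d * Ω * (T 0).factorial, by rw [hW0, hd]; ring⟩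
    have d2 : Ω ∣ W0 := ⟨S * (T 0).factorial, by rw [hW0]; ring⟩
    have d3 : (T j).factorial ∣ W0 := (Nat.factorial_dvd_factorial (hT j).2).trans ⟨S * Ω, by rw [hW0]; ring⟩
    have d4 : (S * Ω) ^ j ∣ W0 ^ j := pow_dvd_pow_of_dvd ⟨(T 0).factorial, hW0⟩ _
    have := mul_dvd_mul (mul_dvd_mul (mul_dvd_mul d1 (mul_dvd_mul (dvd_refl W0) d4)) d2) d3
    refine this.trans (dvd_of_eq ?_); ring
  · have e1 : 100 * (W0 + s * (W0 * (S * Ω) ^ j) * (Ω * T j * Δ + 1 + Ω * T j)) = W0 * (100 * (1 + v)) := by rw [hv]; unfold u0; ring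
    rw [e1]; linarith [Nat.mul_le_mul_left W0 hr1]
  · have e1 : (W0 + s * (W0 * (S * Ω) ^ j : ℕ) * (u0 Ω Δ (T j) + Ω * T j) : ℝ) = W0 * (1 + v) := by rw [hv]; push_cast; ring
    rw [e1]
    have a1 : (v:ℝ) ≤ V := by exact_mod_cast hvV
    have a2 : (R1:ℝ) ≤ r := by exact_mod_cast (show R1 ≤ r by omega)
    have a3 : (R1:ℝ) * κ ≤ r * κ := by gcongr
    have a4 : (W0:ℝ) * (1 + v) ≤ W0 * (r * κ) := by gcongr; linarith
    push_cast; linarith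
  · have e1 : (l' + 1) * (s * (W0 * (S * Ω) ^ j) * u0 Ω Δ (T j)) ≤ W0 * ((l' + 1) * v) := by
      have : s * (S * Ω) ^ j * u0 Ω Δ (T j) ≤ v := by rw [hv]; gcongr; omega
      calc _ = W0 * ((l' + 1) * (s * (S * Ω) ^ j * u0 Ω Δ (T j))) := by ring
        _ ≤ _ := by gcongr
    have e2 : (l' + 1) * v ≤ r := le_trans (Nat.mul_le_mul_left _ hvV) (by omega)
    linarith [Nat.mul_le_mul_left W0 e2]

theorem cell_bd (Φ : Finset ℕ) (ω : ℕ → ℝ) (hω : ∀ s, 0 ≤ ω s) (h1 : ∑ s ∈ Φ, ω s = 1) (f : ℕ →*₀ ℂ) (hf : CM f) (ν g : ℕ → ℂ) (C ξ G : ℂ) (B : ℝ) (hC : ‖C‖ ≤ 1) (hξ : ‖ξ‖ ≤ 1) (hG : ‖G‖ ≤ 1)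
    (h : ∀ s ∈ Φ, ‖ν s - C * conj (f s) * g s * ξ‖ ≤ B) : ‖∑ s ∈ Φ, (ω s : ℂ) * ν s‖ ≤ ‖∑ s ∈ Φ, (ω s : ℂ) * f s‖ + ∑ s ∈ Φ, ω s * ‖g s - G‖ + B := by
  have e : ∑ s ∈ Φ, (ω s : ℂ) * ν s = C * ξ * G * conj (∑ s ∈ Φ, (ω s : ℂ) * f s) + ∑ s ∈ Φ, (ω s : ℂ) * (C * ξ * conj (f s) * (g s - G)) + ∑ s ∈ Φ, (ω s : ℂ) * (ν s - C * conj (f s) * g s * ξ) := by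
    rw [map_sum, mul_sum, ← sum_add_distrib, ← sum_add_distrib]
    refine sum_congr rfl fun s _ => ?_
    rw [map_mul, Complex.conj_ofReal]; ring
  have hCξ : ‖C * ξ‖ ≤ 1 := by rw [norm_mul]; exact mul_le_one₀ hC (norm_nonneg _) hξ
  have hn : ∀ s, ‖(ω s : ℂ)‖ = ω s := fun s => by rw [Complex.norm_real, Real.norm_of_nonneg (hω s)]
  rw [e]
  refine (norm_add₃_le).trans (add_le_add_three ?_ ?_ ?_)
  · rw [norm_mul, norm_mul, Complex.norm_conj]
    exact mul_le_of_le_one_left (norm_nonneg _) (mul_le_one₀ hCξ (norm_nonneg _) hG)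
  · refine (norm_sum_le _ _).trans (sum_le_sum fun s _ => ?_)
    rw [norm_mul, hn, norm_mul, norm_mul (C * ξ), Complex.norm_conj]
    exact mul_le_mul_of_nonneg_left (mul_le_of_le_one_left (norm_nonneg _) (mul_le_one₀ hCξ (norm_nonneg _) (hf.le _))) (hω s)
  · refine (norm_sum_le _ _).trans ?_
    calc _ ≤ ∑ s ∈ Φ, ω s * B := sum_le_sum fun s hs => by rw [norm_mul, hn]; exact mul_le_mul_of_nonneg_left (h s hs) (hω s)
      _ = B := by rw [← sum_mul, h1, one_mul]

theorem sum_ZMod_le (Q A B : ℕ) [NeZero Q] (hB : B ≤ Q) (F : ZMod Q → ℝ) (hF : ∀ x, 0 ≤ F x) : ∑ r ∈ Ico A B, F r ≤ ∑ x, F x := by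
  rw [← sum_image (s := Ico A B) (g := fun r : ℕ => (r : ZMod Q)) (f := F)]
  · exact sum_le_sum_of_subset_of_nonneg (subset_univ _) fun x _ _ => hF x
  · intro a ha b hb hab
    have ha' := (mem_Ico.1 (mem_coe.1 ha)).2
    have hb' := (mem_Ico.1 (mem_coe.1 hb)).2
    have := congrArg ZMod.val hab
    simp only [ZMod.val_natCast] at this
    rwa [Nat.mod_eq_of_lt (by omega), Nat.mod_eq_of_lt (by omega)] at this

theorem l1_l2 {ι : Type*} (s : Finset ι) (F : ι → ℝ) (B : ℝ) (hB : 0 ≤ B) (h : #s * ∑ i ∈ s, F i ^ 2 ≤ B ^ 2) : ∑ i ∈ s, F i ≤ B :=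
  le_of_sq_le_sq (sq_sum_le_card_mul_sum_sq.trans h) hB

theorem X_bd (J R Q : ℕ) [NeZero Q] (hQ : Q = 4 * R) (Φ : Finset ℕ) (ω : ℕ → ℝ) (hω : ∀ s, 0 ≤ ω s) (h1 : ∑ s ∈ Φ, ω s = 1) (ε : ℝ) (hε : 0 < ε) (F : ℕ → ℕ → ZMod Q → ℝ)
    (h : ∀ s ∈ Φ, ∑ j ∈ range J, ∑ x, F s j x ^ 2 ≤ J * ε ^ 2 * Q) :
    ∑ j ∈ range J, ∑ r ∈ Ico R (2 * R), ∑ s ∈ Φ, ω s * F s j r ≤ J * R * (2 * ε) := by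
  have hs : ∀ s ∈ Φ, ∑ p ∈ range J ×ˢ Ico R (2 * R), F s p.1 p.2 ≤ J * R * (2 * ε) := fun s hs => by
    refine l1_l2 _ _ _ (by positivity) ?_
    rw [card_product, card_range, Nat.card_Ico, sum_product]
    have : ∑ j ∈ range J, ∑ r ∈ Ico R (2 * R), F s j (r : ZMod Q) ^ 2 ≤ J * ε ^ 2 * Q :=
      (sum_le_sum fun j _ => sum_ZMod_le Q R (2 * R) (by omega) (fun x => F s j x ^ 2) fun x => sq_nonneg _).trans (h s hs)
    have e2 : 2 * R - R = R := by omega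
    rw [e2]
    calc _ ≤ ((J * R : ℕ) : ℝ) * (J * ε ^ 2 * Q) := by gcongr
      _ = _ := by rw [hQ]; push_cast; ring
  rw [← sum_product', sum_comm]
  calc _ ≤ ∑ s ∈ Φ, ω s * (J * R * (2 * ε)) := sum_le_sum fun s hs' => by rw [← mul_sum]; exact mul_le_mul_of_nonneg_left (hs s hs') (hω s)
    _ = _ := by rw [← sum_mul, h1, one_mul]

theorem sqrt_avg (E : ℕ → ℝ) (hE : ∀ n, 0 ≤ E n) (K H h K0 : ℕ) (hK : 0 < K) (hh : h ≤ H) :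
    ∑ κ ∈ range K, √(E (K0 + κ + h)) ≤ K * √((1 / K) * ∑ κ ∈ range (K + H), E (K0 + κ)) := by
  have hN : 0 ≤ ∑ κ ∈ range (K + H), E (K0 + κ) := sum_nonneg fun _ _ => hE _
  refine l1_l2 _ _ _ (by positivity) ?_
  rw [card_range, mul_pow, Real.sq_sqrt (by positivity)]
  simp only [Real.sq_sqrt (hE _)]
  have : ∑ κ ∈ range K, E (K0 + κ + h) ≤ ∑ κ ∈ range (K + H), E (K0 + κ) := by
    rw [sum_congr rfl fun κ _ => (by rw [add_assoc, add_comm κ] : E (K0 + κ + h) = E (K0 + (h + κ))), ← sum_range_add_sum_Ico _ (by omega : h + K ≤ K + H),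
      sum_range_add]
    have a1 : 0 ≤ ∑ x ∈ range h, E (K0 + x) := sum_nonneg fun _ _ => hE _
    have a2 : 0 ≤ ∑ x ∈ Ico (h + K) (K + H), E (K0 + x) := sum_nonneg fun _ _ => hE _
    linarith
  calc _ ≤ (K:ℝ) * ∑ κ ∈ range (K + H), E (K0 + κ) := by gcongr
    _ = _ := by field_simp

theorem avg_bd (J R K H K0 : ℕ) (hJ : 0 < J) (hR : 0 < R) (hK : 0 < K) (A ε : ℝ) (E : ℕ → ℝ) (hE : ∀ n, 0 ≤ E n) (X : ℕ → ℕ → ℝ) (h1 h2 : ℕ → ℕ → ℕ)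
    (hh : ∀ j ∈ range J, ∀ r ∈ Ico R (2 * R), h1 j r ≤ H ∧ h2 j r ≤ H) (hX : ∑ j ∈ range J, ∑ r ∈ Ico R (2 * R), X j r ≤ J * R * (2 * ε)) (v : ℕ × ℕ × ℕ → ℂ)
    (hv : ∀ j ∈ range J, ∀ r ∈ Ico R (2 * R), ∀ κ ∈ range K, ‖v (j, r, κ)‖ ≤ A + X j r + (4 * ε + 8 * √(E (K0 + κ + h1 j r)) + 8 * √(E (K0 + κ + h2 j r)))) :
    ‖(1 / (#(range J ×ˢ Ico R (2 * R) ×ˢ range K) : ℂ)) * ∑ p ∈ range J ×ˢ Ico R (2 * R) ×ˢ range K, v p‖ ≤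
      A + 6 * ε + 16 * √((1 / K) * ∑ κ ∈ range (K + H), E (K0 + κ)) := by
  set B := √((1 / K) * ∑ κ ∈ range (K + H), E (K0 + κ))
  have hc : #(range J ×ˢ Ico R (2 * R) ×ˢ range K) = J * (R * K) := by simp [card_product]; left; omega
  have b1 : ∀ j ∈ range J, ∀ r ∈ Ico R (2 * R), ∑ κ ∈ range K, ‖v (j, r, κ)‖ ≤ K * (A + 4 * ε + 16 * B) + K * X j r := fun j hj r hr => by
    refine (sum_le_sum (hv j hj r hr)).trans ?_
    have s1 := sqrt_avg E hE K H (h1 j r) K0 hK (hh j hj r hr).1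
    have s2 := sqrt_avg E hE K H (h2 j r) K0 hK (hh j hj r hr).2
    simp only [sum_add_distrib, sum_const, card_range, nsmul_eq_mul, ← mul_sum]
    linarith
  have b2 : ∑ p ∈ range J ×ˢ Ico R (2 * R) ×ˢ range K, ‖v p‖ ≤ J * (R * (K * (A + 6 * ε + 16 * B))) := by
    rw [sum_product]
    simp only [sum_product]
    refine (sum_le_sum fun j hj => sum_le_sum fun r hr => b1 j hj r hr).trans ?_
    have e2 : 2 * R - R = R := by omega
    simp only [sum_add_distrib, sum_const, card_range, Nat.card_Ico, nsmul_eq_mul, ← mul_sum, e2]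
    have := mul_le_mul_of_nonneg_left hX (by positivity : (0:ℝ) ≤ K)
    linarith
  rw [norm_mul, hc, norm_div, norm_one, Complex.norm_natCast]
  calc _ ≤ 1 / ((J * (R * K) : ℕ) : ℝ) * (J * (R * (K * (A + 6 * ε + 16 * B)))) := by
        gcongr; exact (norm_sum_le _ _).trans b2
    _ = _ := by push_cast; field_simp

theorem clog_bd (x : ℕ) (hx : 0 < x) : 16 * x ≤ 2 ^ Nat.clog 2 (16 * x) ∧ 2 ^ Nat.clog 2 (16 * x) ≤ 32 * x := by
  refine ⟨Nat.le_pow_clog one_lt_two _, ?_⟩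
  have h1 : 0 < Nat.clog 2 (16 * x) := Nat.clog_pos one_lt_two (by omega)
  have h2 := Nat.pow_pred_clog_lt_self one_lt_two (show 1 < 16 * x by omega)
  obtain ⟨k, hk⟩ := Nat.exists_eq_add_of_lt h1
  rw [hk] at h2 ⊢
  simp only [zero_add, Nat.pred_succ] at h2 ⊢
  rw [pow_succ]; omega

theorem Sc_pow (a Ω Δ T κ : ℕ) (ha : 0 < a) (hΩ : 0 < Ω) (hΔ : 0 < Δ) :
    Sc a Ω Δ T (2 ^ κ) (2 ^ (κ + Nat.clog 2 (16 * (a ^ 2 * (Ω * Δ))))) (2 ^ (κ + Nat.clog 2 (16 * (u0 Ω Δ T * (Ω * Δ))))) := by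
  have hu : 0 < u0 Ω Δ T := by unfold u0; positivity
  obtain ⟨p1, p2⟩ := clog_bd (a ^ 2 * (Ω * Δ)) (by positivity)
  obtain ⟨p3, p4⟩ := clog_bd (u0 Ω Δ T * (Ω * Δ)) (by positivity)
  have hm : ∀ {x y : ℕ}, x ≤ y → 2 ^ κ * x ≤ 2 ^ κ * y := fun h => Nat.mul_le_mul_left _ h
  unfold Sc
  rw [pow_add, pow_add]
  refine ⟨le_trans (le_of_eq ?_) (hm p1), (hm p2).trans (le_of_eq ?_), le_trans (le_of_eq ?_) (hm p3), (hm p4).trans (le_of_eq ?_)⟩ <;> ring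

theorem DD_nonneg (f : ℕ →*₀ ℂ) (M : ℕ) [NeZero M] (Wf σf Wc σc) : 0 ≤ DD f M Wf σf Wc σc := by unfold DD; positivity

theorem cellA {e : ℤ} {l l' a b W Ω Δ T Wc : ℕ} {ε σc c : ℝ} {Z0 : ℕ} (Φ : Finset ℕ) (ω : ℕ → ℝ) (hω : ∀ s, 0 ≤ ω s) (hω1 : ∑ s ∈ Φ, ω s = 1)
    (hCP : ∀ s ∈ Φ, CoreP e l l' a b s W Ω Δ T Wc ε σc c Z0) (Z : ℕ) (hZ : Z0 ≤ Z) (M1 M2 : ℕ) [NeZero M1] [NeZero M2] (hSc : Sc a Ω Δ T Z M1 M2) (k1 : 2 * Wc ≤ σc * M1) (k2 : 2 * Wc ≤ σc * M2)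
    (Wf : ℕ) (σf : ℝ) (FUf : ∀ M : ℕ, [NeZero M] → M = M1 ∨ M = M2 → ∀ f, CM f → FU (fun n : ℕ => ph f M n - aa f M Wf σf n) c M) :
    ∃ ν, IsAv (Pset l l' e) ν ∧ ∀ f, CM f → ∀ G : ℂ, ‖G‖ ≤ 1 → ‖ν f‖ ≤ ‖∑ s ∈ Φ, (ω s : ℂ) * f s‖ + ∑ s ∈ Φ, ω s * ‖gg f e a b s W Ω Δ T - G‖ +
      (4 * ε + 8 * √(DD (cj f) M1 Wf σf Wc σc) + 8 * √(DD (cj f) M2 Wf σf Wc σc)) := by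
  have ex : ∀ s ∈ Φ, _ := fun s hs => hCP s hs Z hZ M1 M2 hSc k1 k2
  choose! ν hν1 hν2 using ex
  refine ⟨_, IsAv.sum Φ ω hω1 ν hν1, fun f hf G hG => ?_⟩
  refine cell_bd Φ ω hω hω1 f hf (fun s => ν s f) (fun s => gg f e a b s W Ω Δ T) (CC f l l' b W) (xi f e a b W Ω Δ T Z M1 M2 Wc σc) G _ ?_
    (xi_le hf _ _ _ _ _ _ _ _ _ _ _ _) hG fun s hs => hν2 s hs f hf Wf σf (FUf _ (Or.inl rfl) _ (cj_CM hf)) (FUf _ (Or.inr rfl) _ (cj_CM hf))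
  unfold CC
  rw [norm_mul, norm_mul, Complex.norm_conj, Complex.norm_conj]
  exact mul_le_one₀ (mul_le_one₀ (hf.le _) (norm_nonneg _) (hf.le _)) (norm_nonneg _) (hf.le _)

theorem stepA (e : ℤ) (he : e = 1 ∨ e = -1) (l l' : ℕ) (Φ : Finset ℕ) (ω : ℕ → ℝ) (hΦ : ∀ s ∈ Φ, 0 < s) (hω : ∀ s, 0 ≤ ω s) (hω1 : ∑ s ∈ Φ, ω s = 1) (ε : ℝ) (hε : 0 < ε)
    (Wc : ℕ) (hWc : 0 < Wc) (σc : ℝ) (hσc : 0 < σc) (σm : ℝ) (hσm : 0 < σm) (hσm2 : σm ≤ 1 / 2) :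
    ∃ (Wf : ℕ) (σf : ℝ) (H κ0 : ℕ), 0 < Wf ∧ Wc ∣ Wf ∧ 0 < σf ∧ σf ≤ σm ∧ ∀ K0, κ0 ≤ K0 → ∀ K, 0 < K → ∃ ν, IsAv (Pset l l' e) ν ∧ ∀ f, CM f →
      ‖ν f‖ ≤ ‖∑ s ∈ Φ, (ω s : ℂ) * f s‖ + 6 * ε + 16 * √((1 / K) * ∑ κ ∈ range (K + H), DD (cj f) (2 ^ (K0 + κ)) Wf σf Wc σc) := by
  set S := ∏ s ∈ Φ, s
  have hS : 0 < S := prod_pos hΦ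
  have hsS : ∀ s ∈ Φ, s ∣ S := fun s hs => dvd_prod_of_mem _ hs
  set Ω := S * Wc with hΩ
  have hΩ0 : 0 < Ω := by positivity
  obtain ⟨Δ, hΔ⟩ := exists_nat_ge (1 / (ε * σc))
  rw [div_le_iff₀ (by positivity)] at hΔ
  have hΔ0 : 0 < Δ := Nat.pos_of_ne_zero fun h => by subst h; norm_num at hΔ
  obtain ⟨Tb, hTb⟩ := Tok_ex ε hε S Δ hS hΔ0
  obtain ⟨J, T, hJ, hT, Hin⟩ := inner ε hε S Ω Δ (Tb + 1) hS hΩ0 hΔ0 (by omega)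
  obtain ⟨W0, R, hW0, hR, hC⟩ := cfg_ex e he l' S Wc Δ J hS hWc hΔ0 T (fun j => ⟨by have := (hT j).1; omega, (hT j).2⟩) (ε * σc) (by positivity)
  rw [← hΩ] at hC
  obtain ⟨c, Z0, hc, HC⟩ := unif_c (Φ ×ˢ range J ×ˢ Ico R (2 * R))
    (fun i c Z => CoreP e l l' (1 + W0 * i.2.2) W0 i.1 (W0 * (S * Ω) ^ i.2.1) Ω Δ (T i.2.1) Wc ε σc c Z) (fun i c c' Z Z' _ h1 h2 h => h.mono h1 h2) (fun i hi => by
      obtain ⟨h1, hi2⟩ := mem_product.1 hi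
      obtain ⟨h2, h3⟩ := mem_product.1 hi2
      obtain ⟨Ds, g1, g2, g3, g4⟩ := (hC _ (mem_range.1 h2) _ (hΦ _ h1) (hsS _ h1)).2 _ (mem_Ico.1 h3).1
      exact coreF g1 l l' ε σc hε hσc Wc S hWc g2 (Nat.le_of_dvd hS (hsS _ h1)) (hTb _ (by have := (hT i.2.1).1; omega)) (by linarith) g3 g4)
  obtain ⟨Wf, σf, N0, hWf, hWcf, hσf, hσfm, HU⟩ := unif c σm hc hσm Wc hWc
  obtain ⟨κ1, hκ1⟩ := exists_nat_ge (2 * Wc / σc)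
  rw [div_le_iff₀ hσc] at hκ1
  obtain ⟨h1, h2, hSc⟩ : ∃ h1 h2 : ℕ → ℕ → ℕ, ∀ j r κ, Sc (1 + W0 * r) Ω Δ (T j) (2 ^ κ) (2 ^ (κ + h1 j r)) (2 ^ (κ + h2 j r)) :=
    ⟨fun _ r => Nat.clog 2 (16 * ((1 + W0 * r) ^ 2 * (Ω * Δ))), fun j _ => Nat.clog 2 (16 * (u0 Ω Δ (T j) * (Ω * Δ))), fun j r κ => Sc_pow _ _ _ _ _ (by omega) hΩ0 hΔ0⟩
  obtain ⟨H, hH⟩ := ((range J ×ˢ Ico R (2 * R)).image fun p => h1 p.1 p.2 + h2 p.1 p.2).exists_le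
  refine ⟨Wf, σf, H, N0 + Z0 + κ1, hWf, hWcf, hσf, hσfm, fun K0 hK0 K hK => ?_⟩
  have cell : ∀ j r κ, j ∈ range J → r ∈ Ico R (2 * R) → ∃ ν, IsAv (Pset l l' e) ν ∧ ∀ f, CM f → ∀ G : ℂ, ‖G‖ ≤ 1 → ‖ν f‖ ≤ ‖∑ s ∈ Φ, (ω s : ℂ) * f s‖ +
      ∑ s ∈ Φ, ω s * ‖gg f e (1 + W0 * r) W0 s (W0 * (S * Ω) ^ j) Ω Δ (T j) - G‖ +
      (4 * ε + 8 * √(DD (cj f) (2 ^ (K0 + κ + h1 j r)) Wf σf Wc σc) + 8 * √(DD (cj f) (2 ^ (K0 + κ + h2 j r)) Wf σf Wc σc)) := by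
    intro j r κ hj hr
    have big : ∀ h, N0 + Z0 + κ1 ≤ 2 ^ (K0 + κ + h) := fun h => by
      have : K0 + κ + h < 2 ^ (K0 + κ + h) := Nat.lt_two_pow_self
      omega
    have bW : ∀ h, 2 * Wc ≤ σc * (2 ^ (K0 + κ + h) : ℕ) := fun h => by
      have : (κ1:ℝ) ≤ (2 ^ (K0 + κ + h) : ℕ) := by exact_mod_cast (show κ1 ≤ 2 ^ (K0 + κ + h) by have := big h; omega)
      nlinarith
    have hM : ∀ h, N0 ≤ 2 ^ (K0 + κ + h) := fun h => by have := big h; omega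
    exact cellA Φ ω hω hω1 (fun s hs => HC (s, j, r) (mem_product.2 ⟨hs, mem_product.2 ⟨hj, hr⟩⟩)) (2 ^ (K0 + κ)) (by have := big 0; rw [add_zero] at this; omega)
      (2 ^ (K0 + κ + h1 j r)) (2 ^ (K0 + κ + h2 j r)) (hSc j r _) (bW _) (bW _) Wf σf fun M _ hM12 f hf =>
      FU_aa _ _ _ _ hσf (hσfm.trans hσm2) hWf (HU _ (by rcases hM12 with rfl | rfl <;> exact hM _) _ hf)
  choose! ν hν1 hν2 using cell
  refine ⟨_, IsAv.avg (range J ×ˢ Ico R (2 * R) ×ˢ range K) ?_ (fun p => ν p.1 p.2.1 p.2.2) fun p hp => ?_, fun f hf => ?_⟩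
  · exact ⟨(0, R, 0), by simp [hJ, hR, hK]⟩
  · obtain ⟨h1, hi2⟩ := mem_product.1 hp
    exact hν1 _ _ _ h1 (mem_product.1 hi2).1
  have : NeZero (4 * R) := ⟨by omega⟩
  obtain ⟨G, hG1, hG2⟩ := Hin (4 * R) (fi f e W0 (4 * R)) (fun x => hf.le _)
  have hX := X_bd J R (4 * R) rfl Φ ω hω hω1 ε hε (fun s j x => ‖av ((s * Ω * (S * Ω) ^ j : ℕ) : ZMod (4 * R)) (T j) (fi f e W0 (4 * R)) (x + (s * u0 Ω Δ (T j) * (S * Ω) ^ j : ℕ)) - G j x‖)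
    (fun s hs => hG2 s (hΦ s hs) (hsS s hs))
  refine avg_bd J R K H K0 hJ hR hK _ ε (fun n => DD (cj f) (2 ^ n) Wf σf Wc σc) (fun n => DD_nonneg _ _ _ _ _ _) _ h1 h2 (fun j hj r hr => ?_) hX _ fun j hj r hr κ _ => ?_
  · have := hH _ (mem_image_of_mem _ (mem_product.2 ⟨hj, hr⟩ : (j, r) ∈ range J ×ˢ Ico R (2 * R)))
    simp only at this; omega
  · have := hν2 j r κ hj hr f hf (G j r) (hG1 _ _)
    refine this.trans_eq ?_
    congr 2
    refine sum_congr rfl fun s hs => ?_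
    rw [gg_av f e W0 (4 * R) s ((S * Ω) ^ j) r Ω Δ (T j) (by
      have := (hC j (mem_range.1 hj) s (hΦ s hs) (hsS s hs)).1; have := (mem_Ico.1 hr).2; omega)]

theorem DD_le {f : ℕ →*₀ ℂ} (hf : CM f) (M : ℕ) [NeZero M] (Wc Wf : ℕ) (σc σf δ : ℝ) (hWc : 0 < Wc) (hWf : 0 < Wf) (hσf : 0 < σf) (hσc : 0 < σc) (hd : Wc ∣ Wf) (hδ : σf ≤ δ * σc)
    (k1 : 2 * Wc ≤ σc * M) (k2 : 2 * Wf ≤ σf * M) :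
    DD f M Wf σf Wc σc ≤ (1 / M) * ∑ x, ‖aa f M Wf σf x‖ ^ 2 - (1 / M) * ∑ x, ‖aa f M Wc σc x‖ ^ 2 + 8 * δ := by
  obtain ⟨k, hk⟩ := hd
  obtain ⟨c1, c2⟩ := LL_ge hWc k1
  have c3 := LL_le (σ := σf) (M := M) (W := Wf) hσf.le
  have h := energy_i (Wc : ZMod M) (Wf : ZMod M) 0 (LL σc M Wc) (LL σf M Wf) c2 (LL_ge hWf k2).2 (ph f M) (ph_le hf M) 0 k (by simp) (by rw [hk, nsmul_eq_mul]; push_cast; ring)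
  simp only [add_zero, ZMod.card] at h
  have hM : (0:ℝ) < M := by exact_mod_cast Nat.pos_of_ne_zero (NeZero.ne M)
  have hk0 : (0:ℝ) < k := by
    have : 0 < k := Nat.pos_of_ne_zero fun h => by simp [h] at hk; omega
    exact_mod_cast this
  have hb : 4 * ((0:ℕ) + (k:ℝ) * LL σf M Wf) / LL σc M Wc ≤ 8 * δ := by
    have c2' : (0:ℝ) < LL σc M Wc := by exact_mod_cast c2
    rw [div_le_iff₀ c2']
    have a1 : (k:ℝ) * LL σf M Wf ≤ σf * M / Wc := by
      calc _ ≤ (k:ℝ) * (σf * M / Wf) := by gcongr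
        _ = _ := by rw [hk]; push_cast; field_simp
    have a2 : σf * M / Wc ≤ δ * σc * M / Wc := by gcongr
    have hδ0 : 0 ≤ δ := by by_contra hc; push Not at hc; nlinarith
    have a3 : δ * (σc * M / (2 * Wc)) ≤ δ * LL σc M Wc := by gcongr
    have a4 : δ * σc * M / Wc = 2 * (δ * (σc * M / (2 * Wc))) := by field_simp
    push_cast; linarith
  unfold DD aa hh
  have h' := mul_le_mul_of_nonneg_left h (by positivity : (0:ℝ) ≤ 1 / M)
  have e1 : (1 / M : ℝ) * (4 * ((0:ℕ) + (k:ℝ) * LL σf M Wf) / LL σc M Wc * M) = 4 * ((0:ℕ) + (k:ℝ) * LL σf M Wf) / LL σc M Wc := by field_simp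
  rw [mul_add, mul_sub, e1] at h'
  linarith

theorem seqs (e : ℤ) (he : e = 1 ∨ e = -1) (l l' : ℕ) (Φ : Finset ℕ) (ω : ℕ → ℝ) (hΦ : ∀ s ∈ Φ, 0 < s) (hω : ∀ s, 0 ≤ ω s) (hω1 : ∑ s ∈ Φ, ω s = 1) (ε : ℝ) (hε : 0 < ε) (δ : ℝ) (hδ : 0 < δ) :
    ∃ (W : ℕ → ℕ) (σ : ℕ → ℝ) (H κ0 : ℕ → ℕ), ∀ i, 0 < W i ∧ 0 < σ i ∧ W i ∣ W (i + 1) ∧ σ (i + 1) ≤ δ * σ i ∧ ∀ K0, κ0 i ≤ K0 → ∀ K, 0 < K → ∃ ν, IsAv (Pset l l' e) ν ∧ ∀ f, CM f →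
      ‖ν f‖ ≤ ‖∑ s ∈ Φ, (ω s : ℂ) * f s‖ + 6 * ε + 16 * √((1 / K) * ∑ κ ∈ range (K + H i), DD (cj f) (2 ^ (K0 + κ)) (W (i + 1)) (σ (i + 1)) (W i) (σ i)) := by
  have st : ∀ x : {p : ℕ × ℝ // 0 < p.1 ∧ 0 < p.2}, ∃ (y : {p : ℕ × ℝ // 0 < p.1 ∧ 0 < p.2}) (H κ0 : ℕ), x.1.1 ∣ y.1.1 ∧ y.1.2 ≤ δ * x.1.2 ∧
      ∀ K0, κ0 ≤ K0 → ∀ K, 0 < K → ∃ ν, IsAv (Pset l l' e) ν ∧ ∀ f, CM f →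
      ‖ν f‖ ≤ ‖∑ s ∈ Φ, (ω s : ℂ) * f s‖ + 6 * ε + 16 * √((1 / K) * ∑ κ ∈ range (K + H), DD (cj f) (2 ^ (K0 + κ)) y.1.1 y.1.2 x.1.1 x.1.2) := by
    rintro ⟨⟨Wc, σc⟩, hWc, hσc⟩
    simp only at hWc hσc
    obtain ⟨Wf, σf, H, κ0, h1, h2, h3, h4, h5⟩ := stepA e he l l' Φ ω hΦ hω hω1 ε hε Wc hWc σc hσc (min (1 / 2) (δ * σc)) (by positivity) (min_le_left _ _)
    exact ⟨⟨⟨Wf, σf⟩, h1, h3⟩, H, κ0, h2, h4.trans (min_le_right _ _), h5⟩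
  choose y H κ0 h1 h2 h3 using st
  let x0 : {p : ℕ × ℝ // 0 < p.1 ∧ 0 < p.2} := ⟨(1, 1), by norm_num, by norm_num⟩
  refine ⟨fun i => (y^[i] x0).1.1, fun i => (y^[i] x0).1.2, fun i => H (y^[i] x0), fun i => κ0 (y^[i] x0), fun i => ⟨(y^[i] x0).2.1, (y^[i] x0).2.2, ?_⟩⟩
  simp only [Function.iterate_succ_apply']
  exact ⟨h1 _, h2 _, h3 _⟩

theorem KP_all (e : ℤ) (he : e = 1 ∨ e = -1) (l l' : ℕ) (_ : 0 < l) (_ : 0 < l') : KPset (Pset l l' e) := by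
  intro Φ ω η hΦ hω hω1 hη
  obtain ⟨ε, rfl⟩ : ∃ ε, η = 40 * ε := ⟨η / 40, by ring⟩
  have hε : 0 < ε := by linarith
  obtain ⟨W, σ, H, κ0, hs⟩ := seqs e he l l' Φ ω hΦ hω hω1 ε hε (ε ^ 2 / 8) (by positivity)
  obtain ⟨J, hJ⟩ := exists_nat_ge (1 / ε ^ 2)
  rw [div_le_iff₀ (by positivity)] at hJ
  have hJ0 : 0 < J := Nat.pos_of_ne_zero fun h => by subst h; norm_num at hJ
  set K := 1 + ∑ i ∈ range J, H i with hK
  have hKH : ∀ i ∈ range J, H i ≤ K := fun i hi => (single_le_sum (fun _ _ => Nat.zero_le _) hi).trans (Nat.le_add_left _ _)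
  set K0 := ∑ i ∈ range (J + 1), (κ0 i + ⌈2 * W i / σ i⌉₊)
  have hK0 : ∀ i ∈ range (J + 1), κ0 i + ⌈2 * W i / σ i⌉₊ ≤ K0 := fun i hi => single_le_sum (f := fun i => κ0 i + ⌈2 * W i / σ i⌉₊) (fun _ _ => Nat.zero_le _) hi
  have hK' : 0 < K := by omega
  have hν : ∀ i ∈ range J, _ := fun i hi => (hs i).2.2.2.2 K0 (by have := hK0 i (by simp at hi ⊢; omega); omega) K hK'
  choose! ν hν1 hν2 using hν
  obtain ⟨I, c, p1, p2, p3⟩ := IsAv.avg (range J) ⟨0, by simpa using hJ0⟩ ν hν1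
  refine ⟨I, c, p1, p2, fun f hf => ?_⟩
  rw [← p3 f, card_range, norm_mul, norm_div, norm_one, Complex.norm_natCast]
  set A := ‖∑ s ∈ Φ, (ω s : ℂ) * f s‖
  set D : ℕ → ℕ → ℝ := fun i κ => DD (cj f) (2 ^ (K0 + κ)) (W (i + 1)) (σ (i + 1)) (W i) (σ i) with hD
  have hD0 : ∀ i κ, 0 ≤ D i κ := fun i κ => DD_nonneg _ _ _ _ _ _
  have hJR : (0:ℝ) < J := by exact_mod_cast hJ0
  have sc : ∀ i ∈ range (J + 1), ∀ κ, 2 * (W i : ℝ) ≤ σ i * (2 ^ (K0 + κ) : ℕ) := fun i hi κ => by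
    have h1 := hK0 i hi
    have h2 : K0 + κ < 2 ^ (K0 + κ) := Nat.lt_two_pow_self
    have h3 : (⌈2 * W i / σ i⌉₊ : ℝ) ≤ (2 ^ (K0 + κ) : ℕ) := by exact_mod_cast (show ⌈2 * W i / σ i⌉₊ ≤ 2 ^ (K0 + κ) by omega)
    have h4 := (Nat.le_ceil _).trans h3
    rw [div_le_iff₀ (hs i).2.1] at h4
    linarith
  have per : ∀ κ, ∑ i ∈ range J, D i κ ≤ 1 + J * ε ^ 2 := fun κ => by
    set E : ℕ → ℝ := fun i => (1 / ((2 ^ (K0 + κ) : ℕ) : ℝ)) * ∑ x, ‖aa (cj f) (2 ^ (K0 + κ)) (W i) (σ i) x‖ ^ 2 with hE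
    calc _ ≤ ∑ i ∈ range J, (E (i + 1) - E i + ε ^ 2) := sum_le_sum fun i hi => by
          have := DD_le (cj_CM hf) (2 ^ (K0 + κ)) (W i) (W (i + 1)) (σ i) (σ (i + 1)) (ε ^ 2 / 8) (hs i).1 (hs (i + 1)).1 (hs (i + 1)).2.1 (hs i).2.1 (hs i).2.2.1 (hs i).2.2.2.1
            (sc i (by simp at hi ⊢; omega) κ) (sc (i + 1) (by simpa using hi) κ)
          simp only [hD, hE]; linarith
      _ = E J - E 0 + J * ε ^ 2 := by rw [sum_add_distrib, sum_range_sub, sum_const, card_range, nsmul_eq_mul]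
      _ ≤ _ := by
          have g0 : 0 ≤ E 0 := by positivity
          have g1 : E J ≤ 1 := by
            have := en_le (W J : ZMod (2 ^ (K0 + κ))) (LL (σ J) (2 ^ (K0 + κ)) (W J)) _ (ph_le (cj_CM hf) _)
            simp only [hE, one_div]
            exact inv_mul_le_one_of_le₀ this (by positivity)
          linarith
  have tot : ∑ i ∈ range J, √((1 / K) * ∑ κ ∈ range (K + H i), D i κ) ≤ J * (2 * ε) := by
    refine l1_l2 _ _ _ (by positivity) ?_
    rw [card_range]
    have e1 : ∀ i ∈ range J, √((1 / K) * ∑ κ ∈ range (K + H i), D i κ) ^ 2 ≤ (1 / K) * ∑ κ ∈ range (K + K), D i κ := fun i hi => by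
      rw [Real.sq_sqrt (mul_nonneg (by positivity) (sum_nonneg fun _ _ => hD0 _ _))]
      have := hKH i hi
      exact mul_le_mul_of_nonneg_left (sum_le_sum_of_subset_of_nonneg (range_mono (by omega)) fun _ _ _ => hD0 _ _) (by positivity)
    have e2 : ∑ i ∈ range J, (1 / (K:ℝ)) * ∑ κ ∈ range (K + K), D i κ ≤ 4 * (J * ε ^ 2) := by
      rw [← mul_sum, sum_comm]
      calc _ ≤ (1 / (K:ℝ)) * ∑ κ ∈ range (K + K), (1 + J * ε ^ 2) := by gcongr; exact per _
        _ = 2 * (1 + J * ε ^ 2) := by rw [sum_const, card_range, nsmul_eq_mul]; push_cast; field_simp; ring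
        _ ≤ _ := by linarith
    calc _ ≤ (J:ℝ) * (4 * (J * ε ^ 2)) := mul_le_mul_of_nonneg_left ((sum_le_sum e1).trans e2) hJR.le
      _ = _ := by ring
  calc _ ≤ 1 / (J:ℝ) * ∑ i ∈ range J, (A + 6 * ε + 16 * √((1 / K) * ∑ κ ∈ range (K + H i), D i κ)) := by
        gcongr; exact (norm_sum_le _ _).trans (sum_le_sum fun i hi => hν2 i hi f hf)
    _ ≤ 1 / (J:ℝ) * (J * (A + 6 * ε) + 16 * (J * (2 * ε))) := by
        gcongr
        rw [sum_add_distrib, sum_const, card_range, nsmul_eq_mul, ← mul_sum]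
        linarith
    _ = A + 38 * ε := by field_simp; ring
    _ ≤ _ := by linarith

end

open MeasureTheory

/-- **Theorem 2.1.** Let `(T_n)` be a measure preserving action of `(ℕ, ×)` (by invertible
measure preserving transformations, `T 1 = id`, `T (m n) = T m ∘ T n`) on a probability
space `(X, μ)`, and let `A` be measurable with `μ A > 0`. Then for all `ℓ, ℓ' ∈ ℕ`:
(1) there are `m > n` with `ℓ(m² − n²) ≠ ℓ' m n` and
`μ(T_{ℓ(m²−n²)}⁻¹A ∩ T_{ℓ'mn}⁻¹A) > 0`; (2) there are `m, n` with
`ℓ(m² + n²) ≠ ℓ' m n` and `μ(T_{ℓ(m²+n²)}⁻¹A ∩ T_{ℓ'mn}⁻¹A) > 0`. -/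
theorem multiplicative_recurrence_pythagorean
    {X : Type*} [MeasurableSpace X] (μ : Measure X) [IsProbabilityMeasure μ]
    (T : ℕ → X → X)
    (hmp : ∀ n, 0 < n → MeasurePreserving (T n) μ μ)
    (hbij : ∀ n, 0 < n → Function.Bijective (T n))
    (hid : T 1 = id)
    (hmul : ∀ m n, 0 < m → 0 < n → T (m * n) = T m ∘ T n)
    (ℓ ℓ' : ℕ) (hℓ : 0 < ℓ) (hℓ' : 0 < ℓ')
    (A : Set X) (hA : MeasurableSet A) (hApos : 0 < μ A) :
    (∃ m n : ℕ, 0 < n ∧ n < m ∧ ℓ * (m ^ 2 - n ^ 2) ≠ ℓ' * (m * n) ∧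
      0 < μ (T (ℓ * (m ^ 2 - n ^ 2)) ⁻¹' A ∩ T (ℓ' * (m * n)) ⁻¹' A)) ∧
    (∃ m n : ℕ, 0 < m ∧ 0 < n ∧ ℓ * (m ^ 2 + n ^ 2) ≠ ℓ' * (m * n) ∧
      0 < μ (T (ℓ * (m ^ 2 + n ^ 2)) ⁻¹' A ∩ T (ℓ' * (m * n)) ⁻¹' A)) := by
  exact main_of_KP KP_all μ T hmp hid hmul ℓ ℓ' hℓ hℓ' A hA hApos
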